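/- Let g ≥ 1 and n ≥ 1 be integers and set d_n := n²(2g−2) + 2. Suppose P ∈ ℚ[X] is a polynomial such that for every prime power q with n dividing q−1 there is an element ζ ∈ F_q^× of multiplicative order exactly n for which the number of 2g-tuples (A_1,B_1,…,A_g,B_g) ∈ GL(n,F_q)^{2g} with [A_1,B_1]⋯[A_g,B_g] = ζ·I_n equals (|GL(n,F_q)|/(q−1)) · P(q). Then P has degree d_n, leading coefficient 1, constant coefficient 1, and satisfies the curious Poincaré duality X^{d_n} · P(1/X) = P(X) (i.e. its coefficient sequence is palindromic). -/

import Mathlib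

set_option linter.all false
section modH1
set_option autoImplicit false
open scoped MatrixGroups
open Finset

namespace HRV
noncomputable section

/-! ### Part A: group algebra of a finite group -/

/-- complex group algebra -/
abbrev Al (G : Type) [Group G] := MonoidAlgebra ℂ G

section GA
variable {G : Type} [Group G]

/-- basis element -/
def dl (g : G) : Al G := MonoidAlgebra.single g 1

/-- coefficient at `g` -/
def cf (g : G) : Al G →ₗ[ℂ] ℂ where
  toFun x := x.coeff g
  map_add' x y := rfl
  map_smul' c x := rfl

/-- coefficient of `1` -/
def tau : Al G →ₗ[ℂ] ℂ := cf 1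

lemma dl_mul (g h : G) : dl (g * h) = dl g * dl h := by
  simp [dl, MonoidAlgebra.single_mul_single]

@[simp] lemma dl_one : dl (1 : G) = 1 := rfl

lemma dl_inv_mul (g : G) : dl g⁻¹ * dl g = 1 := by rw [← dl_mul]; simp
lemma dl_mul_inv (g : G) : dl g * dl g⁻¹ = 1 := by rw [← dl_mul]; simp

open Classical in
lemma cf_dl (g h : G) : cf g (dl h) = if h = g then 1 else 0 := by
  change (MonoidAlgebra.single h (1:ℂ)).coeff g = _
  rw [MonoidAlgebra.coeff_single, Finsupp.single_apply]

open Classical in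
lemma tau_dl (h : G) : tau (dl h) = if h = 1 then 1 else 0 := cf_dl 1 h

lemma al_ext {x y : Al G} (h : ∀ g, cf g x = cf g y) : x = y := by
  apply MonoidAlgebra.coeff_injective
  ext g; exact h g

variable [Fintype G]

lemma al_sum (x : Al G) : x = ∑ g, cf g x • dl g := by
  classical
  apply al_ext; intro g
  simp [map_sum, cf_dl]

/-- induction principle via linearity -/
lemma lin_ext {M : Type*} [AddCommMonoid M] [Module ℂ M] {f f' : Al G →ₗ[ℂ] M}
    (h : ∀ g, f (dl g) = f' (dl g)) : f = f' := by
  ext x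
  apply h

lemma lin_ext_apply {M : Type*} [AddCommMonoid M] [Module ℂ M] (f f' : Al G →ₗ[ℂ] M)
    (h : ∀ g, f (dl g) = f' (dl g)) (x : Al G) : f x = f' x := by
  rw [lin_ext h]

lemma tau_mul_comm (x y : Al G) : tau (x * y) = tau (y * x) := by
  classical
  rw [al_sum x, al_sum y]
  simp only [Finset.sum_mul, Finset.mul_sum, map_sum, smul_mul_assoc, mul_smul_comm, map_smul,
    ← dl_mul, tau_dl, Finset.smul_sum]
  rw [Finset.sum_comm]
  refine Finset.sum_congr rfl fun g _ => Finset.sum_congr rfl fun h _ => ?_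
  rw [smul_comm]
  congr 3
  rw [mul_eq_one_iff_eq_inv, mul_eq_one_iff_inv_eq, eq_comm, eq_iff_iff]; exact eq_comm

lemma tau_dl_mul (g : G) (x : Al G) : tau (dl g * x) = cf g⁻¹ x := by
  classical
  rw [al_sum x]
  simp only [Finset.mul_sum, map_sum, mul_smul_comm, map_smul, ← dl_mul, tau_dl, cf_dl]
  refine Finset.sum_congr rfl fun h _ => ?_
  congr 2
  rw [mul_eq_one_iff_inv_eq, eq_iff_iff]; exact eq_comm

lemma tau_mul_dl (g : G) (x : Al G) : tau (x * dl g) = cf g⁻¹ x := by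
  rw [tau_mul_comm, tau_dl_mul]

lemma cf_eq_tau (g : G) (x : Al G) : cf g x = tau (dl g⁻¹ * x) := by
  rw [tau_dl_mul, inv_inv]

lemma sum_tau_dl (a : Al G) : ∑ g, tau (dl g * a) • dl g⁻¹ = a := by
  conv_rhs => rw [al_sum a]
  refine Fintype.sum_equiv (Equiv.inv G) _ _ fun g => ?_
  simp [tau_dl_mul]

lemma tau_nondeg {a : Al G} (h : a ≠ 0) : ∃ g, tau (a * dl g) ≠ 0 := by
  by_contra hc
  push Not at hc
  apply h
  rw [← sum_tau_dl a]
  simp_rw [tau_mul_comm (dl _), hc]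
  simp

/-- Wedderburn -/
lemma wed_exists (G : Type) [Group G] [Fintype G] :
    ∃ (n : ℕ) (d : Fin n → ℕ), (∀ i, NeZero (d i)) ∧
      Nonempty (Al G ≃ₐ[ℂ] Π i, Matrix (Fin (d i)) (Fin (d i)) ℂ) := by
  haveI : NeZero (Nat.card G : ℂ) := ⟨by simp⟩
  exact IsSemisimpleRing.exists_algEquiv_pi_matrix_of_isAlgClosed ℂ (Al G)

variable (G) in
/-- index type of irreps -/
def Irr : Type := Fin (wed_exists G).choose

instance : Fintype (Irr G) := inferInstanceAs (Fintype (Fin _))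
instance : DecidableEq (Irr G) := inferInstanceAs (DecidableEq (Fin _))

/-- dimension -/
def dm (i : Irr G) : ℕ := (wed_exists G).choose_spec.choose i

instance (i : Irr G) : NeZero (dm i) := (wed_exists G).choose_spec.choose_spec.1 i

/-- matrices of the irrep -/
abbrev Mt (i : Irr G) := Matrix (Fin (dm i)) (Fin (dm i)) ℂ

variable (G) in
/-- Wedderburn iso -/
def wed : Al G ≃ₐ[ℂ] Π i : Irr G, Mt i := (wed_exists G).choose_spec.choose_spec.2.some

/-- irreps -/
def rp (i : Irr G) : Al G →ₐ[ℂ] Mt i := (Pi.evalAlgHom ℂ _ i).comp (wed G).toAlgHom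

/-- block inclusion -/
def bl (i : Irr G) (M : Mt i) : Al G := (wed G).symm (Pi.single i M)

/-- character -/
def ch (i : Irr G) : Al G →ₗ[ℂ] ℂ := (Matrix.traceLinearMap _ ℂ ℂ).comp (rp i).toLinearMap

/-- |G|/dim -/
def hk (i : Irr G) : ℂ := Fintype.card G / dm i

/-- central idempotent -/
def ep (i : Irr G) : Al G := bl i 1

lemma ch_apply (i : Irr G) (x : Al G) : ch i x = (rp i x).trace := rfl

lemma rp_ext {x y : Al G} (h : ∀ i, rp i x = rp i y) : x = y := by
  apply (wed G).injective
  funext i; exact h i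

lemma rp_bl_same (i : Irr G) (M : Mt i) : rp i (bl i M) = M := by
  simp [rp, bl]

lemma rp_bl_ne {i j : Irr G} (h : j ≠ i) (M : Mt i) : rp j (bl i M) = 0 := by
  simp [rp, bl, h]

lemma rp_ep_same (i : Irr G) : rp i (ep i) = 1 := rp_bl_same i 1
lemma rp_ep_ne {i j : Irr G} (h : j ≠ i) : rp j (ep i) = 0 := rp_bl_ne h 1

lemma bl_rp (i : Irr G) (x : Al G) : bl i (rp i x) = ep i * x := by
  apply rp_ext; intro j
  by_cases h : j = i
  · subst h; simp [rp_bl_same, rp_ep_same]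
  · simp [rp_bl_ne h, rp_ep_ne h]

lemma ep_comm (i : Irr G) (x : Al G) : ep i * x = x * ep i := by
  apply rp_ext; intro j
  by_cases h : j = i
  · subst h; simp [rp_ep_same]
  · simp [rp_ep_ne h]

lemma rp_surj (i : Irr G) (M : Mt i) : ∃ x, rp i x = M := ⟨_, rp_bl_same i M⟩

lemma sum_ep : ∑ i : Irr G, ep i = 1 := by
  apply rp_ext; intro j
  rw [map_sum, Finset.sum_eq_single j]
  · simp [rp_ep_same]
  · intro i _ h; exact rp_ep_ne h.symm
  · simp

lemma ch_mul_comm (i : Irr G) (x y : Al G) : ch i (x * y) = ch i (y * x) := by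
  rw [ch_apply, ch_apply, map_mul, map_mul, Matrix.trace_mul_comm]

lemma ch_one (i : Irr G) : ch i 1 = dm i := by simp [ch_apply]

lemma dm_ne (i : Irr G) : (dm i : ℂ) ≠ 0 := by
  exact_mod_cast (NeZero.ne (dm i))

lemma card_ne : (Fintype.card G : ℂ) ≠ 0 := by simp

lemma hk_ne (i : Irr G) : hk i ≠ 0 := div_ne_zero card_ne (dm_ne i)

lemma hk_dm (i : Irr G) : hk i * dm i = Fintype.card G := by
  unfold hk; field_simp [dm_ne i]

/-- an element commuting with the group acts by scalars -/
lemma rp_central {i : Irr G} {X : Mt i} (h : ∀ g, rp i (dl g) * X = X * rp i (dl g)) :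
    X = (X.trace / dm i) • (1 : Mt i) := by
  have h2 : ∀ x : Al G, rp i x * X = X * rp i x := by
    intro x
    rw [al_sum x]
    simp [map_sum, Finset.sum_mul, Finset.mul_sum, h]
  have h3 : ∀ M : Mt i, Commute M X := by
    intro M
    obtain ⟨x, rfl⟩ := rp_surj i M
    exact h2 x
  have h4 : X ∈ Set.center (Mt i) := by
    rw [Semigroup.mem_center_iff]
    intro M; exact h3 M
  have h5 : ∃ c : ℂ, X = c • (1 : Mt i) := by
    have := (Matrix.mem_range_scalar_iff_commute_single' (M := X)).mpr
      (fun a b => h3 _)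
    obtain ⟨c, rfl⟩ := this
    exact ⟨c, by simp [Matrix.smul_one_eq_diagonal]⟩
  obtain ⟨c, rfl⟩ := h5
  congr 1
  have := dm_ne i
  simp [Matrix.trace_smul, Matrix.trace_one]

lemma schur (i : Irr G) (M : Mt i) :
    ∑ g, rp i (dl g) * M * rp i (dl g⁻¹) = (hk i * M.trace) • (1 : Mt i) := by
  have key := rp_central (i := i) (X := ∑ g, rp i (dl g) * M * rp i (dl g⁻¹)) ?_
  · rw [key]
    congr 1
    rw [Matrix.trace_sum]
    have : ∀ g : G, (rp i (dl g) * M * rp i (dl g⁻¹)).trace = M.trace := by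
      intro g
      rw [Matrix.trace_mul_comm, ← mul_assoc, ← map_mul, dl_inv_mul]; simp
    simp only [this]
    simp [hk]; ring
  · intro h
    rw [Finset.mul_sum, Finset.sum_mul]
    refine Fintype.sum_equiv (Equiv.mulLeft h) _ _ fun g => ?_
    simp only [Equiv.coe_mulLeft, mul_inv_rev, dl_mul, map_mul, mul_assoc]
    rw [← map_mul (rp i) (dl h⁻¹), dl_inv_mul]; simp

lemma schur_el (i : Irr G) (x : Al G) :
    rp i (∑ g, dl g * x * dl g⁻¹) = (hk i * ch i x) • (1 : Mt i) := by
  rw [ch_apply, ← schur]; simp [map_sum]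

lemma schur_entry (i : Irr G) (l j k m : Fin (dm i)) :
    ∑ g, rp i (dl g) l j * rp i (dl g⁻¹) k m = if j = k ∧ l = m then hk i else 0 := by
  have h := congrFun (congrFun (schur i (Matrix.single j k 1)) l) m
  rw [Matrix.sum_apply] at h
  have h2 : ∀ g : G, (rp i (dl g) * Matrix.single j k (1:ℂ) * rp i (dl g⁻¹) : Mt i) l m
      = rp i (dl g) l j * rp i (dl g⁻¹) k m := by
    intro g
    simp [Matrix.mul_apply, Matrix.single_apply, ite_and]
  simp_rw [h2] at h
  rw [h]
  simp only [Matrix.trace_single_eq_same, Matrix.smul_apply, Matrix.one_apply]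
  by_cases h1 : j = k
  · subst h1
    by_cases h3 : l = m <;> simp [h3]
  · simp [h1]

/-- trace functionals on a block -/
lemma tau_bl (i : Irr G) (M : Mt i) : tau (bl i M) = M.trace / hk i := by
  have blmul : ∀ M N : Mt i, bl i (M * N) = bl i M * bl i N := by
    intro M N
    apply rp_ext; intro j
    by_cases h : j = i
    · subst h; simp [rp_bl_same]
    · simp [rp_bl_ne h]
  have bladd : ∀ M N : Mt i, bl i (M + N) = bl i M + bl i N := by
    intro M N
    apply rp_ext; intro j
    by_cases h : j = i
    · subst h; simp [rp_bl_same]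
    · simp [rp_bl_ne h]
  have blsmul : ∀ (c : ℂ) (M : Mt i), bl i (c • M) = c • bl i M := by
    intro c M
    apply rp_ext; intro j
    by_cases h : j = i
    · subst h; simp [rp_bl_same]
    · simp [rp_bl_ne h]
  let f : Mt i →ₗ[ℂ] ℂ :=
    { toFun := fun M => tau (bl i M)
      map_add' := fun M N => by rw [bladd, map_add]
      map_smul' := fun c M => by rw [blsmul, map_smul]; rfl }
  have fcomm : ∀ M N, f (M * N) = f (N * M) := by
    intro M N
    change tau (bl i (M * N)) = tau (bl i (N * M))
    rw [blmul, blmul, tau_mul_comm]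
  let o : Fin (dm i) := 0
  have fsingle : ∀ a b, f (Matrix.single a b 1) = if a = b then f (Matrix.single o o 1) else 0 := by
    intro a b
    have e1 : (Matrix.single a b (1:ℂ)) = Matrix.single a o 1 * Matrix.single o b 1 := by simp
    rw [e1, fcomm]
    by_cases h : a = b
    · subst h; simp
    · rw [Matrix.single_mul_single_of_ne _ _ _ _ (Ne.symm h)]; simp [h]
  have ftr : ∀ M : Mt i, f M = f (Matrix.single o o 1) * M.trace := by
    intro M
    conv_lhs => rw [Matrix.matrix_eq_sum_single M]
    simp only [map_sum]
    have : ∀ a b, f (Matrix.single a b (M a b)) = M a b * (if a = b then f (Matrix.single o o 1) else 0) := by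
      intro a b
      rw [← fsingle, ← smul_eq_mul, ← map_smul]; simp
    simp only [this]
    simp [Matrix.trace, Finset.sum_mul, mul_comm]
  have hc : f (Matrix.single o o 1) * hk i = 1 := by
    have h1 := congrArg (fun x => rp i x o o) (sum_tau_dl (bl i (Matrix.single o o 1)))
    simp only [map_sum, map_smul, Matrix.sum_apply, rp_bl_same, Matrix.smul_apply] at h1
    have h2 : ∀ g : G, tau (dl g * bl i (Matrix.single o o 1)) =
        f (Matrix.single o o 1) * rp i (dl g) o o := by
      intro g
      have : dl g * bl i (Matrix.single o o 1) = bl i (rp i (dl g) * Matrix.single o o 1) := by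
        apply rp_ext; intro j
        by_cases h : j = i
        · subst h; simp [rp_bl_same]
        · simp [rp_bl_ne h]
      rw [this]
      change f _ = _
      rw [ftr]
      congr 1
      rw [Matrix.trace_mul_comm]
      simp [Matrix.trace, Matrix.mul_apply, Matrix.single_apply, ite_and]
    simp only [h2, smul_eq_mul, mul_assoc] at h1
    rw [← Finset.mul_sum, schur_entry] at h1
    simpa using h1
  have := ftr M
  change f M = _
  rw [this, eq_div_iff (hk_ne i), mul_right_comm, hc, one_mul]

lemma tau_eq (x : Al G) : tau x = ∑ i : Irr G, ch i x / hk i := by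
  conv_lhs => rw [← one_mul x, ← sum_ep, Finset.sum_mul, map_sum]
  refine Finset.sum_congr rfl fun i _ => ?_
  rw [← bl_rp, tau_bl]; rfl

lemma ch_eq_tau (i : Irr G) (x : Al G) : ch i x = hk i * tau (ep i * x) := by
  rw [← bl_rp, tau_bl, mul_div_cancel₀ _ (hk_ne i)]; rfl

/-- pairing formula -/
lemma pairing (x y : Al G) : ∑ i : Irr G, ch i x * ch i y = ∑ g, tau (dl g * x * dl g⁻¹ * y) := by
  rw [← map_sum, ← Finset.sum_mul, tau_eq]
  refine Finset.sum_congr rfl fun i _ => ?_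
  rw [ch_apply i (_ * y), map_mul, schur_el]
  simp only [smul_mul_assoc, one_mul, Matrix.trace_smul, smul_eq_mul, ← ch_apply]
  field_simp [hk_ne i]

lemma rank_zero_iff {m : ℕ} (M : Matrix (Fin m) (Fin m) ℂ) : M.rank = 0 ↔ M = 0 := by
  constructor
  · intro h
    have h1 : LinearMap.range M.mulVecLin = ⊥ := Submodule.finrank_eq_zero.mp h
    rw [LinearMap.range_eq_bot] at h1
    ext a b
    have := congrFun (LinearMap.congr_fun h1 (Pi.single b 1)) a
    simpa using this
  · rintro rfl; exact Matrix.rank_zero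

/-- rank as a natural number -/
def rk (i : Irr G) (e : Al G) : ℕ := (rp i e).rank

lemma ch_idem (i : Irr G) {e : Al G} (he : e * e = e) : ch i e = rk i e := by
  have h1 : IsIdempotentElem (rp i e) := by
    rw [IsIdempotentElem, ← map_mul, he]
  have h2 : IsIdempotentElem (Matrix.toLin' (rp i e)) := by
    rw [IsIdempotentElem, Module.End.mul_eq_comp, ← Matrix.toLin'_mul, h1]
  have h3 := LinearMap.IsIdempotentElem.isProj_range _ h2
  have h4 := h3.trace
  rw [ch_apply, ← Matrix.trace_toLin'_eq, h4]
  rfl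

lemma rk_eq_zero (i : Irr G) (e : Al G) : rk i e = 0 ↔ rp i e = 0 := rank_zero_iff _

lemma rp_eq_zero_iff (i : Irr G) (e : Al G) : rp i e = 0 ↔ ep i * e = 0 := by
  constructor
  · intro h; rw [← bl_rp, h]; simp [bl]
  · intro h
    have := congrArg (rp i) h
    simpa [rp_ep_same] using this

/-- central character of a central group element -/
def om (i : Irr G) (z : G) : ℂ := ch i (dl z) / dm i

lemma rp_om (i : Irr G) {z : G} (hz : ∀ g, z * g = g * z) : rp i (dl z) = om i z • (1 : Mt i) := by
  apply rp_central
  intro g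
  rw [← map_mul, ← map_mul, ← dl_mul, ← dl_mul, hz]

end GA
end
end HRV
end modH1

section modH2
set_option autoImplicit false
open scoped MatrixGroups
open Finset

namespace HRV
noncomputable section

/-! ### Part B: Frobenius formula, Casimir lemma, subgroup idempotents -/

section Frob
variable {G : Type} [Group G] [Fintype G]

lemma comm_sum_el (i : Irr G) :
    rp i (∑ a : G, ∑ b : G, dl (a * b * a⁻¹ * b⁻¹)) = (hk i) ^ 2 • (1 : Mt i) := by
  rw [Finset.sum_comm, map_sum]
  have h1 : ∀ b : G, rp i (∑ a, dl (a * b * a⁻¹ * b⁻¹)) =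
      (hk i * ch i (dl b)) • rp i (dl b⁻¹) := by
    intro b
    have : ∑ a, dl (a * b * a⁻¹ * b⁻¹) = (∑ a, dl a * dl b * dl a⁻¹) * dl b⁻¹ := by
      rw [Finset.sum_mul]; simp [dl_mul]
    rw [this, map_mul, schur_el, smul_mul_assoc, one_mul]
  simp_rw [h1, mul_smul]
  rw [← Finset.smul_sum, pow_two, mul_smul]
  congr 1
  ext l m
  rw [Matrix.sum_apply]
  simp only [Matrix.smul_apply, smul_eq_mul, ch_apply, Matrix.trace, Matrix.diag_apply,
    Finset.sum_mul]
  rw [Finset.sum_comm]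
  simp_rw [schur_entry]
  by_cases h : l = m
  · subst h; simp
  · simp only [Matrix.one_apply, h, if_false, mul_zero]
    apply Finset.sum_eq_zero
    intro k _
    rw [if_neg]
    rintro ⟨rfl, rfl⟩; exact h rfl

lemma prod_ofFn_sum {R X : Type*} [Semiring R] [Fintype X] (f : X → R) (k : ℕ) :
    (∑ x, f x) ^ k = ∑ v : Fin k → X, (List.ofFn fun i => f (v i)).prod := by
  induction k with
  | zero => simp
  | succ k ih =>
    rw [pow_succ', ih, Finset.sum_mul_sum, ← Finset.sum_product']
    rw [← (Fin.consEquiv (fun _ : Fin (k+1) => X)).sum_comp]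
    refine Finset.sum_congr rfl fun p _ => ?_
    simp [Fin.consEquiv, List.ofFn_succ]

lemma dl_list_prod (l : List G) : dl l.prod = (l.map dl).prod := by
  induction l with
  | nil => simp
  | cons a l ih => simp [dl_mul, ih]

open Classical in
lemma frobenius (g : ℕ) (hg : 1 ≤ g) {z : G} (hz : ∀ x, z * x = x * z) :
    (Nat.card {p : (Fin g → G) × (Fin g → G) //
      (List.ofFn fun i => p.1 i * p.2 i * (p.1 i)⁻¹ * (p.2 i)⁻¹).prod = z} : ℂ)
      = Fintype.card G * ∑ i : Irr G, hk i ^ (2 * g - 2) * om i z⁻¹ := by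
  have hz' : ∀ x, z⁻¹ * x = x * z⁻¹ := fun x => by
    rw [inv_mul_eq_iff_eq_mul, ← mul_assoc, hz, mul_assoc]; simp
  have h1 : (Nat.card {p : (Fin g → G) × (Fin g → G) //
      (List.ofFn fun i => p.1 i * p.2 i * (p.1 i)⁻¹ * (p.2 i)⁻¹).prod = z} : ℂ)
      = tau (dl z⁻¹ * (∑ x : G × G, dl (x.1 * x.2 * x.1⁻¹ * x.2⁻¹)) ^ g) := by
    rw [prod_ofFn_sum, Finset.mul_sum, map_sum, Nat.card_eq_fintype_card, Fintype.card_subtype]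
    rw [Finset.card_filter, Nat.cast_sum]
    rw [← (Equiv.arrowProdEquivProdArrow (Fin g) (fun _ => G) (fun _ => G)).sum_comp]
    refine Finset.sum_congr rfl fun v _ => ?_
    have : (List.ofFn fun i => dl ((v i).1 * (v i).2 * (v i).1⁻¹ * (v i).2⁻¹)).prod
        = dl (List.ofFn fun i => ((v i).1 * (v i).2 * (v i).1⁻¹ * (v i).2⁻¹)).prod := by
      rw [dl_list_prod, List.map_ofFn]; rfl
    rw [this, ← dl_mul, tau_dl]
    have h9 : (List.ofFn fun i => ((v i).1 * (v i).2 * (v i).1⁻¹ * (v i).2⁻¹)).prod = z ↔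
      z⁻¹ * (List.ofFn fun i => ((v i).1 * (v i).2 * (v i).1⁻¹ * (v i).2⁻¹)).prod = 1 := by
      rw [inv_mul_eq_one]; exact eq_comm
    by_cases h8 : (List.ofFn fun i => ((v i).1 * (v i).2 * (v i).1⁻¹ * (v i).2⁻¹)).prod = z
    · rw [if_pos (h9.mp h8)]; exact_mod_cast if_pos h8
    · rw [if_neg (fun h => h8 (h9.mpr h))]; exact_mod_cast if_neg h8
  rw [h1, tau_eq, Finset.mul_sum]
  refine Finset.sum_congr rfl fun i _ => ?_
  rw [ch_apply, map_mul, map_pow, Fintype.sum_prod_type, comm_sum_el, rp_om i hz']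
  rw [smul_pow, one_pow, smul_mul_smul_comm, one_mul, Matrix.trace_smul, Matrix.trace_one]
  rw [← hk_dm i]
  obtain ⟨k, rfl⟩ : ∃ k, g = k + 1 := ⟨g - 1, by omega⟩
  have : 2 * (k + 1) - 2 = 2 * k := by omega
  rw [this]
  have := hk_ne i
  simp only [smul_eq_mul, Fintype.card_fin]
  field_simp
  ring

end Frob

section Casimir
variable {G : Type} [Group G] [Fintype G]

/-- dual bases between `e A f` and `f A e` -/
structure DB (e f : Al G) (X : Type) [Fintype X] where
  T : X → Al G
  S : X → Al G
  t : ℂ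
  he : e * e = e
  hf : f * f = f
  ht : t ≠ 0
  eT : ∀ x, e * T x * f = T x
  eS : ∀ x, f * S x * e = S x
  gram_self : ∀ x, tau (S x * T x) = t
  gram_ne : ∀ x y, x ≠ y → tau (S x * T y) = 0
  span : ∀ g : G, e * dl g * f ∈ Submodule.span ℂ (Set.range T)

variable {e f : Al G} {X : Type} [Fintype X]

lemma DB.span' (D : DB e f X) (a : Al G) : e * a * f ∈ Submodule.span ℂ (Set.range D.T) := by
  rw [al_sum a]
  simp only [Finset.mul_sum, Finset.sum_mul, mul_smul_comm, smul_mul_assoc]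
  exact Submodule.sum_mem _ fun g _ => Submodule.smul_mem _ _ (D.span g)

lemma DB.expand (D : DB e f X) (a : Al G) :
    ∑ x, tau (D.S x * a) • D.T x = D.t • (e * a * f) := by
  have h1 : ∀ b ∈ Submodule.span ℂ (Set.range D.T),
      ∑ x, tau (D.S x * b) • D.T x = D.t • b := by
    intro b hb
    induction hb using Submodule.span_induction with
    | mem b hb =>
      obtain ⟨y, rfl⟩ := hb
      rw [Finset.sum_eq_single y]
      · rw [D.gram_self]
      · intro x _ hx; rw [D.gram_ne x y hx, zero_smul]
      · simp
    | zero => simp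
    | add b c _ _ hb hc => simp only [mul_add, map_add, add_smul, Finset.sum_add_distrib, hb, hc, smul_add]
    | smul c b _ hb =>
      simp only [mul_smul_comm, map_smul, smul_eq_mul, mul_smul, ← Finset.smul_sum, hb]
      rw [smul_comm]
  rw [← h1 _ (D.span' a)]
  refine Finset.sum_congr rfl fun x _ => ?_
  congr 1
  rw [← D.eS x]
  have h2 : f * D.S x * e * (e * a * f) = f * D.S x * e * a * f := by
    simp only [← mul_assoc]; rw [mul_assoc _ e e, D.he]
  rw [h2]
  rw [tau_mul_comm (f * D.S x * e * a) f]
  simp only [← mul_assoc, D.hf]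

lemma DB.count (D : DB e f X) : ∑ i : Irr G, ch i e * ch i f = Fintype.card X := by
  have h1 : ∑ i : Irr G, ch i e * ch i f = ∑ i : Irr G, ch i f * ch i e :=
    Finset.sum_congr rfl fun i _ => mul_comm _ _
  rw [h1, pairing]
  have h2 : ∀ g : G, tau (dl g * f * dl g⁻¹ * e) = ∑ x, D.t⁻¹ * (tau (D.S x * dl g) * tau (dl g⁻¹ * D.T x)) := by
    intro g
    rw [mul_assoc _ _ e, tau_mul_comm]
    have : tau (dl g⁻¹ * e * (dl g * f)) = tau (dl g⁻¹ * (D.t⁻¹ • (D.t • (e * dl g * f)))) := by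
      rw [smul_smul, inv_mul_cancel₀ D.ht, one_smul]; simp only [mul_assoc]
    rw [this, ← D.expand]
    simp only [mul_smul_comm, map_smul, Finset.mul_sum, map_sum, smul_eq_mul]
  simp_rw [h2]
  rw [Finset.sum_comm]
  have h3 : ∀ x, ∑ g, D.t⁻¹ * (tau (D.S x * dl g) * tau (dl g⁻¹ * D.T x)) = 1 := by
    intro x
    rw [← Finset.mul_sum]
    have : ∑ g, (tau (D.S x * dl g) * tau (dl g⁻¹ * D.T x)) = tau ((∑ g, tau (dl g * D.S x) • dl g⁻¹) * D.T x) := by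
      simp only [Finset.sum_mul, map_sum, smul_mul_assoc, map_smul, smul_eq_mul]
      refine Finset.sum_congr rfl fun g _ => ?_
      rw [tau_mul_comm (D.S x)]
    rw [this, sum_tau_dl, D.gram_self, inv_mul_cancel₀ D.ht]
  simp [h3]

/-- Casimir -/
lemma DB.casimir (D : DB e e X) (Y : Al G) : ∑ x, D.T x * Y * D.S x =
    D.t • (e * (∑ g, dl g * (e * Y * e) * dl g⁻¹) * e) := by
  have h1 : ∀ x, D.S x = e * (∑ g, tau (dl g * D.S x) • dl g⁻¹) * e := by
    intro x; rw [sum_tau_dl, D.eS]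
  have h2 : ∀ x, D.T x * Y * D.S x = ∑ g, tau (dl g * D.S x) • (D.T x * Y * (e * dl g⁻¹ * e)) := by
    intro x
    conv_lhs => rw [h1 x]
    simp only [Finset.mul_sum, Finset.sum_mul, mul_smul_comm, smul_mul_assoc]
  simp_rw [h2]
  rw [Finset.sum_comm]
  simp only [Finset.mul_sum, Finset.sum_mul, Finset.smul_sum]
  refine Finset.sum_congr rfl fun g _ => ?_
  have h3 : ∑ x, tau (dl g * D.S x) • (D.T x * Y * (e * dl g⁻¹ * e)) =
      (∑ x, tau (D.S x * dl g) • D.T x) * Y * (e * dl g⁻¹ * e) := by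
    simp only [Finset.sum_mul, smul_mul_assoc]
    refine Finset.sum_congr rfl fun x _ => ?_
    rw [tau_mul_comm]
  rw [h3, D.expand]
  simp only [smul_mul_assoc, mul_assoc]

lemma DB.casimir_rp (D : DB e e X) (Y : Al G) (i : Irr G) : rp i (∑ x, D.T x * Y * D.S x) =
    (D.t * hk i * ch i (e * Y * e)) • rp i e := by
  rw [D.casimir, map_smul, map_mul, map_mul, schur_el]
  simp only [mul_smul_comm, smul_mul_assoc, mul_one, smul_smul, ← map_mul, D.he, mul_assoc]

/-- matrix of left multiplication -/
def DB.L (D : DB e f X) (a : Al G) : Matrix X X ℂ := Matrix.of fun x y => D.t⁻¹ * tau (D.S x * a * D.T y)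

lemma DB.L_mul (D : DB e e X) (a b : Al G) (hb : e * b = b) : D.L (a * b) = D.L a * D.L b := by
  ext z y
  simp only [DB.L, Matrix.mul_apply, Matrix.of_apply]
  have h1 : ∑ x, D.t⁻¹ * tau (D.S z * a * D.T x) * (D.t⁻¹ * tau (D.S x * b * D.T y)) =
      D.t⁻¹ * (D.t⁻¹ * tau (D.S z * a * ∑ x, tau (D.S x * (b * D.T y)) • D.T x)) := by
    simp only [Finset.mul_sum, map_sum, mul_smul_comm, map_smul, smul_eq_mul]
    refine Finset.sum_congr rfl fun x _ => ?_
    simp only [mul_assoc]; ring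
  rw [h1, D.expand]
  have h2 : e * (b * D.T y) * e = b * D.T y := by
    rw [← mul_assoc, hb, mul_assoc, ← D.eT y]
    simp only [mul_assoc, D.he]
  rw [h2, mul_smul_comm, map_smul, smul_eq_mul, ← mul_assoc D.t⁻¹ D.t, inv_mul_cancel₀ D.ht, one_mul]
  simp only [mul_assoc]

lemma DB.L_trace (D : DB e e X) (a : Al G) (ha : a * e = a) :
    (D.L a).trace = ∑ i : Irr G, ch i a * ch i e := by
  simp only [DB.L, Matrix.trace, Matrix.diag_apply, Matrix.of_apply]
  have h1 : ∀ x, D.t⁻¹ * tau (D.S x * a * D.T x) = D.t⁻¹ * tau (a * (D.T x * 1 * D.S x)) := by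
    intro x
    rw [mul_assoc, tau_mul_comm, mul_one, mul_assoc]
  simp_rw [h1]
  rw [← Finset.mul_sum, ← map_sum, ← Finset.mul_sum, tau_eq, Finset.mul_sum]
  refine Finset.sum_congr rfl fun i _ => ?_
  rw [ch_apply i (a * _), map_mul, D.casimir_rp, mul_smul_comm, ← map_mul, ha, Matrix.trace_smul,
    ← ch_apply, mul_one, D.he, smul_eq_mul]
  have := hk_ne i
  have := D.ht
  field_simp

lemma DB.L_add (D : DB e e X) (a b : Al G) : D.L (a + b) = D.L a + D.L b := by
  ext z y
  simp only [DB.L, Matrix.of_apply, mul_add, add_mul, map_add, Matrix.add_apply]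

lemma DB.L_smul (D : DB e e X) (c : ℂ) (b : Al G) : D.L (c • b) = c • D.L b := by
  ext z y
  simp only [DB.L, Matrix.of_apply, mul_smul_comm, smul_mul_assoc, map_smul, Matrix.smul_apply,
    smul_eq_mul]
  ring

lemma DB.L_e [DecidableEq X] (D : DB e e X) : D.L e = 1 := by
  ext z y
  simp only [DB.L, Matrix.of_apply, Matrix.one_apply]
  have : D.S z * e * D.T y = D.S z * D.T y := by
    rw [← D.eS z]; simp only [mul_assoc]; rw [← mul_assoc e e, D.he]
  rw [this]
  split_ifs with h
  · subst h; rw [D.gram_self, inv_mul_cancel₀ D.ht]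
  · rw [D.gram_ne _ _ h, mul_zero]

lemma DB.L_sum {ι : Type} (D : DB e e X) (s : Finset ι) (a : ι → Al G) :
    D.L (∑ k ∈ s, a k) = ∑ k ∈ s, D.L (a k) := by
  ext z y
  rw [Matrix.sum_apply]
  simp only [DB.L, Matrix.of_apply, Finset.mul_sum, Finset.sum_mul, map_sum]

/-- main trace lemma -/
lemma DB.main [DecidableEq X] (D : DB e e X) (g : ℕ) (C C1 : Matrix X X ℂ)
    (hC1 : C1 = ∑ x, D.L (D.T x) * D.L (D.S x))
    (hC : C = ∑ x, ∑ y, D.L (D.T x) * D.L (D.T y) * D.L (D.S x) * D.L (D.S y)) :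
    IsUnit C1.det ∧ (C ^ g * C1⁻¹ * C1⁻¹).trace =
      ∑ i : Irr G, if rk i e = 0 then 0 else (D.t * hk i) ^ (2 * g) * ((D.t * hk i) ^ 2)⁻¹ := by
  have eT' : ∀ x, e * D.T x = D.T x := fun x => by
    rw [← D.eT x]; simp only [← mul_assoc, D.he]
  have eS' : ∀ x, e * D.S x = D.S x := fun x => by
    rw [← D.eS x]; simp only [← mul_assoc, D.he]
  have Se : ∀ x, D.S x * e = D.S x := fun x => by
    rw [← D.eS x]; simp only [mul_assoc, D.he]
  set c1 : Al G := ∑ x, D.T x * 1 * D.S x with hc1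
  set c : Al G := ∑ y, (∑ x, D.T x * D.T y * D.S x) * D.S y with hc
  have hC1' : C1 = D.L c1 := by
    rw [hC1, hc1, D.L_sum]
    refine Finset.sum_congr rfl fun x _ => ?_
    rw [mul_one, D.L_mul _ _ (eS' x)]
  have hC' : C = D.L c := by
    rw [hC, hc, D.L_sum, Finset.sum_comm]
    refine Finset.sum_congr rfl fun y _ => ?_
    rw [Finset.sum_mul, D.L_sum]
    refine Finset.sum_congr rfl fun x _ => ?_
    rw [D.L_mul _ _ (eS' y), D.L_mul _ _ (eS' x), D.L_mul _ _ (eT' y)]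
  have he := D.he
  have rc1 : ∀ i, rp i c1 = (D.t * hk i * rk i e) • rp i e := by
    intro i
    rw [hc1, D.casimir_rp, mul_one, he, ch_idem i he]
  have rc : ∀ i, rp i c = (D.t * hk i) ^ 2 • rp i e := by
    intro i
    have h1 : ∀ y, rp i ((∑ x, D.T x * D.T y * D.S x) * D.S y) =
        (D.t * hk i) • (ch i (D.T y) • rp i (D.S y)) := by
      intro y
      rw [map_mul, D.casimir_rp, D.eT, smul_mul_assoc, ← map_mul, eS', mul_smul]
    rw [hc, map_sum]
    simp_rw [h1]
    rw [← Finset.smul_sum, pow_two, mul_smul (D.t * hk i) (D.t * hk i)]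
    congr 1
    -- dual expansion
    have dual : ∀ b : Al G, ∑ y, tau (D.T y * b) • D.S y = D.t • (e * b * e) := by
      intro b
      have hb : ∀ g' : G, tau (dl g' * ∑ y, tau (D.T y * b) • D.S y) = tau (dl g' * (D.t • (e * b * e))) := by
        intro g'
        have := congrArg (fun u => tau (u * b)) (D.expand (dl g'))
        simp only [Finset.sum_mul, map_sum, smul_mul_assoc, map_smul, smul_eq_mul] at this
        simp only [Finset.mul_sum, map_sum, mul_smul_comm, map_smul, smul_eq_mul]
        rw [tau_mul_comm (dl g') (e * b * e)]
        have h5 : tau (e * b * e * dl g') = tau (e * dl g' * e * b) := by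
          have h6 : e * b * e * dl g' = e * (b * (e * dl g')) := by simp only [mul_assoc]
          have h7 : e * dl g' * e * b = (e * dl g') * (e * b) := by simp only [mul_assoc]
          rw [h6, h7, tau_mul_comm e, tau_mul_comm (e * dl g')]
          have h8 : b * (e * dl g') * e = b * ((e * dl g') * e) := by simp only [mul_assoc]
          have h9 : e * b * (e * dl g') = e * (b * (e * dl g')) := by simp only [mul_assoc]
          rw [h8, h9, tau_mul_comm e]; simp only [mul_assoc]
        rw [h5, ← this]
        refine Finset.sum_congr rfl fun y _ => ?_
        rw [tau_mul_comm (dl g'), mul_comm]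
      apply al_ext
      intro g'
      rw [cf_eq_tau, cf_eq_tau, hb]
    have h2 : ∀ y, ch i (D.T y) = hk i * tau (D.T y * ep i) := by
      intro y; rw [ch_eq_tau, ep_comm]
    have h2' : ∀ y, ch i (D.T y) • rp i (D.S y) = hk i • (tau (D.T y * ep i) • rp i (D.S y)) := by
      intro y; rw [h2, mul_smul]
    rw [Finset.sum_congr rfl (fun y _ => h2' y), ← Finset.smul_sum]
    have h3 := congrArg (rp i) (dual (ep i))
    simp only [map_sum, map_smul, map_mul, rp_ep_same, mul_one] at h3
    rw [h3, ← map_mul, he, smul_smul, mul_comm]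
  -- inverse element
  set c' : Al G := ∑ i : Irr G, (D.t * hk i * rk i e)⁻¹ • (ep i * e) with hc'
  have rc' : ∀ i, rp i c' = (D.t * hk i * rk i e)⁻¹ • rp i e := by
    intro i
    rw [hc', map_sum, Finset.sum_eq_single i]
    · simp [rp_ep_same]
    · intro j _ hj; simp [rp_ep_ne hj.symm]
    · simp
  have ec' : e * c' = c' := by
    apply rp_ext; intro i
    rw [map_mul, rc', mul_smul_comm, ← map_mul, he]
  have c1c' : c1 * c' = e := by
    apply rp_ext; intro i
    rw [map_mul, rc', rc1, smul_mul_smul_comm, ← map_mul, he]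
    by_cases h : rk i e = 0
    · rw [(rk_eq_zero i e).mp h]; simp
    · rw [mul_inv_cancel₀, one_smul]
      exact mul_ne_zero (mul_ne_zero D.ht (hk_ne i)) (by exact_mod_cast h)
  have hLL : C1 * D.L c' = 1 := by
    rw [hC1', ← D.L_mul _ _ ec', c1c', D.L_e]
  have hinv : C1⁻¹ = D.L c' := Matrix.inv_eq_right_inv hLL
  refine ⟨Matrix.isUnit_det_of_right_inverse hLL, ?_⟩
  have ecc : e * c = c := by
    apply rp_ext; intro i
    rw [map_mul, rc, mul_smul_comm, ← map_mul, he]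
  let cp : ℕ → Al G := fun k => Nat.rec e (fun _ x => x * c) k
  have hpow : ∀ k : ℕ, C ^ k = D.L (cp k) := by
    intro k
    induction k with
    | zero => rw [pow_zero]; exact D.L_e.symm
    | succ k ih => rw [pow_succ, ih, hC']; exact (D.L_mul _ _ ecc).symm
  have hfin : C ^ g * C1⁻¹ * C1⁻¹ = D.L (cp g * c' * c') := by
    rw [hinv, hpow, D.L_mul _ _ ec', D.L_mul _ _ ec']
  have hce : c' * e = c' := by
    apply rp_ext; intro i
    rw [map_mul, rc', smul_mul_assoc, ← map_mul, he]
  rw [hfin, D.L_trace _ (by rw [mul_assoc, hce])]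
  refine Finset.sum_congr rfl fun i _ => ?_
  have hpe : ∀ k : ℕ, rp i (cp k) = (D.t * hk i) ^ (2 * k) • rp i e := by
    intro k
    induction k with
    | zero => simp [cp]
    | succ k ih =>
      have : cp (k+1) = cp k * c := rfl
      rw [this, map_mul, ih, rc, smul_mul_smul_comm, ← map_mul, he, ← pow_add]
      congr 1
  have : ch i (cp g * c' * c') = (D.t * hk i) ^ (2 * g) * (D.t * hk i * rk i e)⁻¹ * (D.t * hk i * rk i e)⁻¹ * rk i e := by
    rw [ch_apply, map_mul, map_mul, hpe, rc', smul_mul_smul_comm, ← map_mul, he, smul_mul_smul_comm,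
      ← map_mul, he, Matrix.trace_smul, ← ch_apply, ch_idem i he, smul_eq_mul]
  rw [this, ch_idem i he]
  split_ifs with h
  · simp [h]
  · have h1 := D.ht
    have h2 := hk_ne i
    have h3 : (rk i e : ℂ) ≠ 0 := by exact_mod_cast h
    field_simp

end Casimir
end
end HRV
end modH2

section modH3
set_option autoImplicit false
open scoped MatrixGroups
open Finset

namespace HRV
noncomputable section

/-! ### Part C: subgroup idempotents and tensor products -/

section Av
variable {G : Type} [Group G] [Fintype G]

/-- `lam` is multiplicative on `H` -/
def IsCh (H : Subgroup G) (lam : G → ℂ) : Prop :=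
  lam 1 = 1 ∧ ∀ h ∈ H, ∀ k ∈ H, lam (h * k) = lam h * lam k

lemma isCh_one (H : Subgroup G) : IsCh H (fun _ => 1) := ⟨rfl, fun _ _ _ _ => by simp⟩

open Classical in
/-- average over a subgroup against a character -/
def av (H : Subgroup G) (lam : G → ℂ) : Al G :=
  (Nat.card H : ℂ)⁻¹ • ∑ h : G, if h ∈ H then lam h⁻¹ • dl h else 0

/-- average over subgroup -/
abbrev ev (H : Subgroup G) : Al G := av H (fun _ => 1)

lemma cardH_ne (H : Subgroup G) : (Nat.card H : ℂ) ≠ 0 := by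
  exact_mod_cast Nat.card_pos.ne'

open Classical in
lemma cf_av (H : Subgroup G) (lam : G → ℂ) (g : G) :
    cf g (av H lam) = if g ∈ H then (Nat.card H : ℂ)⁻¹ * lam g⁻¹ else 0 := by
  have : ∀ h : G, cf g (if h ∈ H then lam h⁻¹ • dl h else 0) =
      if h = g then (if g ∈ H then lam g⁻¹ else 0) else 0 := by
    intro h
    by_cases hh : h ∈ H
    · by_cases e : h = g
      · subst e; simp [hh, cf_dl]
      · simp [hh, cf_dl, e]
    · by_cases e : h = g
      · subst e; simp [hh]
      · simp [hh, e]
  rw [av, map_smul, map_sum]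
  simp_rw [this]
  simp

lemma tau_av {H : Subgroup G} {lam : G → ℂ} (hl : IsCh H lam) :
    tau (av H lam) = (Nat.card H : ℂ)⁻¹ := by
  classical
  rw [tau, cf_av]; simp [H.one_mem, hl.1]

lemma ch_inv {H : Subgroup G} {lam : G → ℂ} (hl : IsCh H lam) {h : G} (hh : h ∈ H) :
    lam h * lam h⁻¹ = 1 := by
  rw [← hl.2 h hh _ (H.inv_mem hh)]; simp [hl.1]

lemma av_left {H : Subgroup G} {lam : G → ℂ} (hl : IsCh H lam) {h : G} (hh : h ∈ H) :
    dl h * av H lam = lam h • av H lam := by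
  classical
  unfold av
  rw [mul_smul_comm, smul_comm (lam h), Finset.mul_sum]
  refine congrArg _ ?_
  rw [Finset.smul_sum]
  refine Fintype.sum_equiv (Equiv.mulLeft h) _ _ fun k => ?_
  have h1 : h * k ∈ H ↔ k ∈ H := H.mul_mem_cancel_left hh
  simp only [Equiv.coe_mulLeft, h1]
  split_ifs with hk
  · rw [mul_smul_comm, ← dl_mul, smul_smul, mul_inv_rev, hl.2 _ (H.inv_mem hk) _ (H.inv_mem hh),
      mul_comm (lam k⁻¹), ← mul_assoc, ch_inv hl hh, one_mul]
  · simp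

lemma av_right {H : Subgroup G} {lam : G → ℂ} (hl : IsCh H lam) {h : G} (hh : h ∈ H) :
    av H lam * dl h = lam h • av H lam := by
  classical
  unfold av
  rw [smul_mul_assoc, smul_comm (lam h), Finset.sum_mul]
  refine congrArg _ ?_
  rw [Finset.smul_sum]
  refine Fintype.sum_equiv (Equiv.mulRight h) _ _ fun k => ?_
  have h1 : k * h ∈ H ↔ k ∈ H := H.mul_mem_cancel_right hh
  simp only [Equiv.coe_mulRight, h1]
  split_ifs with hk
  · rw [smul_mul_assoc, ← dl_mul, smul_smul, mul_inv_rev, hl.2 _ (H.inv_mem hh) _ (H.inv_mem hk),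
      ← mul_assoc, ch_inv hl hh, one_mul]
  · simp

/-- if `H` acts on `x` by `lam` then the average fixes `x` -/
lemma av_fix {H : Subgroup G} {lam : G → ℂ} (hl : IsCh H lam) {x : Al G}
    (hx : ∀ h ∈ H, dl h * x = lam h • x) : av H lam * x = x := by
  classical
  unfold av
  rw [smul_mul_assoc, Finset.sum_mul]
  have : ∀ h : G, (if h ∈ H then lam h⁻¹ • dl h else 0) * x = if h ∈ H then x else 0 := by
    intro h
    split_ifs with hh
    · rw [smul_mul_assoc, hx h hh, smul_smul, mul_comm, ch_inv hl hh, one_smul]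
    · simp
  simp_rw [this]
  rw [← Finset.sum_filter, Finset.sum_const, ← Nat.cast_smul_eq_nsmul ℂ, smul_smul]
  have h2 : ((univ.filter fun h => h ∈ H).card : ℂ) = Nat.card H := by
    rw [← Fintype.card_subtype, Nat.card_eq_fintype_card]
  rw [h2, inv_mul_cancel₀ (cardH_ne H), one_smul]

lemma av_fix' {H : Subgroup G} {lam : G → ℂ} (hl : IsCh H lam) {x : Al G}
    (hx : ∀ h ∈ H, x * dl h = lam h • x) : x * av H lam = x := by
  classical
  unfold av
  rw [mul_smul_comm, Finset.mul_sum]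
  have : ∀ h : G, x * (if h ∈ H then lam h⁻¹ • dl h else 0) = if h ∈ H then x else 0 := by
    intro h
    split_ifs with hh
    · rw [mul_smul_comm, hx h hh, smul_smul, mul_comm, ch_inv hl hh, one_smul]
    · simp
  simp_rw [this]
  rw [← Finset.sum_filter, Finset.sum_const, ← Nat.cast_smul_eq_nsmul ℂ, smul_smul]
  have h2 : ((univ.filter fun h => h ∈ H).card : ℂ) = Nat.card H := by
    rw [← Fintype.card_subtype, Nat.card_eq_fintype_card]
  rw [h2, inv_mul_cancel₀ (cardH_ne H), one_smul]

lemma av_idem {H : Subgroup G} {lam : G → ℂ} (hl : IsCh H lam) :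
    av H lam * av H lam = av H lam := av_fix hl fun h hh => av_left hl hh

lemma av_ne_zero {H : Subgroup G} {lam : G → ℂ} (hl : IsCh H lam) : av H lam ≠ 0 := by
  intro h
  have := tau_av hl
  rw [h, map_zero] at this
  exact inv_ne_zero (cardH_ne H) this.symm

lemma av_conj {H H' : Subgroup G} {lam lam' : G → ℂ} (g : G)
    (h1 : ∀ h, h ∈ H ↔ g * h * g⁻¹ ∈ H') (h2 : ∀ h ∈ H, lam h = lam' (g * h * g⁻¹)) :
    dl g * av H lam = av H' lam' * dl g := by
  classical
  unfold av
  have e : H ≃ H' := by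
    refine ⟨fun h => ⟨g * h * g⁻¹, (h1 _).mp h.2⟩, fun h => ⟨g⁻¹ * h * g, (h1 _).mpr ?_⟩, ?_, ?_⟩
    · have := h.2; simpa [mul_assoc] using this
    · intro h; simp [mul_assoc]
    · intro h; simp [mul_assoc]
  rw [Nat.card_congr e, mul_smul_comm, smul_mul_assoc, Finset.mul_sum, Finset.sum_mul]
  congr 1
  refine Fintype.sum_equiv (MulAut.conj g).toEquiv _ _ fun h => ?_
  simp only [MulEquiv.toEquiv_eq_coe, MulEquiv.coe_toEquiv, MulAut.conj_apply, ← h1]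
  split_ifs with hh
  · rw [mul_smul_comm, smul_mul_assoc, ← dl_mul, ← dl_mul, h2 _ (H.inv_mem hh)]
    simp [mul_assoc]
  · simp

lemma av_kill {H H' : Subgroup G} {lam lam' : G → ℂ} (hl : IsCh H lam) (hl' : IsCh H' lam')
    {x : Al G} {h h' : G} (hh : h ∈ H) (hh' : h' ∈ H') (hx : dl h * x = x * dl h')
    (hne : lam h ≠ lam' h') : av H lam * x * av H' lam' = 0 := by
  have h1 : av H lam * (dl h * x) * av H' lam' = av H lam * (x * dl h') * av H' lam' := by rw [hx]
  rw [← mul_assoc, av_right hl hh, mul_assoc, mul_assoc, mul_assoc, av_left hl' hh'] at h1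
  simp only [smul_mul_assoc, mul_smul_comm, ← mul_assoc] at h1
  have h2 : (lam h - lam' h') • (av H lam * x * av H' lam') = 0 := by
    rw [sub_smul, h1, sub_self]
  rcases smul_eq_zero.mp h2 with h3 | h3
  · exact absurd (sub_eq_zero.mp h3) hne
  · exact h3

end Av

section Tens
variable {G : Type} [Group G] [Fintype G] {Λ : Type} [Fintype Λ] [DecidableEq Λ]
  {H : Λ → Type} [∀ a, Group (H a)] [∀ a, Fintype (H a)]

/-- pure tensors pushed into a group algebra -/
def tens (Φ : (Π a, H a) →* G) (x : Π a, Al (H a)) : Al G :=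
  ∑ h : Π a, H a, (∏ a, cf (h a) (x a)) • dl (Φ h)

lemma cf_mul {G : Type} [Group G] [Fintype G] (x y : Al G) (g : G) :
    cf g (x * y) = ∑ h, cf h x * cf (h⁻¹ * g) y := by
  conv_lhs => rw [al_sum x]
  simp only [Finset.sum_mul, map_sum, smul_mul_assoc, map_smul, smul_eq_mul]
  refine Finset.sum_congr rfl fun h _ => ?_
  congr 1
  rw [cf_eq_tau g, ← mul_assoc, ← dl_mul, tau_dl_mul]; simp

lemma tens_mul (Φ : (Π a, H a) →* G) (x y : Π a, Al (H a)) :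
    tens Φ x * tens Φ y = tens Φ (fun a => x a * y a) := by
  unfold tens
  simp only [cf_mul]
  simp_rw [Finset.prod_univ_sum, Fintype.piFinset_univ, Finset.sum_smul]
  rw [Finset.sum_comm, Finset.sum_mul]
  refine Finset.sum_congr rfl fun h _ => ?_
  rw [Finset.mul_sum]
  refine Fintype.sum_equiv (Equiv.mulLeft h) _ _ fun k => ?_
  rw [smul_mul_smul_comm, ← dl_mul, ← map_mul]
  simp [Finset.prod_mul_distrib]

lemma tens_dl (Φ : (Π a, H a) →* G) (h : Π a, H a) : tens Φ (fun a => dl (h a)) = dl (Φ h) := by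
  classical
  unfold tens
  rw [Finset.sum_eq_single h]
  · simp [cf_dl]
  · intro k _ hk
    obtain ⟨a, ha⟩ := Function.ne_iff.mp hk
    rw [Finset.prod_eq_zero (Finset.mem_univ a), zero_smul]
    simp [cf_dl, ha.symm]
  · simp

lemma tens_one (Φ : (Π a, H a) →* G) : tens Φ (fun a => 1) = 1 := by
  have := tens_dl Φ (fun a => 1)
  simpa using (this.trans (by rw [show (fun a => (1 : H a)) = 1 from rfl, map_one, dl_one]))

lemma tens_smul (Φ : (Π a, H a) →* G) (c : Λ → ℂ) (x : Π a, Al (H a)) :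
    tens Φ (fun a => c a • x a) = (∏ a, c a) • tens Φ x := by
  unfold tens
  simp [Finset.prod_mul_distrib, Finset.smul_sum, mul_smul]

lemma tens_zero (Φ : (Π a, H a) →* G) {x : Π a, Al (H a)} {a : Λ} (h : x a = 0) :
    tens Φ x = 0 := by
  unfold tens
  apply Finset.sum_eq_zero
  intro k _
  rw [Finset.prod_eq_zero (Finset.mem_univ a), zero_smul]
  simp [h]

lemma tens_sum (Φ : (Π a, H a) →* G) {K : Λ → Type} [∀ a, Fintype (K a)]
    (x : Π a, K a → Al (H a)) :
    tens Φ (fun a => ∑ k, x a k) = ∑ k : Π a, K a, tens Φ (fun a => x a (k a)) := by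
  unfold tens
  rw [Finset.sum_comm]
  refine Finset.sum_congr rfl fun h _ => ?_
  simp only [map_sum]
  rw [Finset.prod_univ_sum, Fintype.piFinset_univ, Finset.sum_smul]

lemma tau_tens (Φ : (Π a, H a) →* G) (hΦ : Function.Injective Φ) (x : Π a, Al (H a)) :
    tau (tens Φ x) = ∏ a, tau (x a) := by
  classical
  unfold tens
  rw [map_sum, Finset.sum_eq_single 1]
  · have h1 : tau (1 : Al G) = 1 := by rw [← dl_one, tau_dl, if_pos rfl]
    rw [map_smul, map_one, dl_one, h1]; simp; rfl
  · intro k _ hk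
    rw [map_smul, tau_dl, if_neg, smul_zero]
    intro h; exact hk (hΦ (by rw [h, map_one]))
  · simp

/-- conjugation formula for tensors -/
lemma tens_intertwine (Φ : (Π a, H a) →* G) (Φ' : (Π a, H a) →* G) (g : G)
    (hg : ∀ h, g * Φ h = Φ' h * g) (x : Π a, Al (H a)) :
    dl g * tens Φ x = tens Φ' x * dl g := by
  unfold tens
  simp only [Finset.mul_sum, Finset.sum_mul, mul_smul_comm, smul_mul_assoc, ← dl_mul, hg]

/-- commuting elements -/
lemma tens_commute (Φ : (Π a, H a) →* G) (y : Al G) (hy : ∀ h, dl (Φ h) * y = y * dl (Φ h))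
    (x : Π a, Al (H a)) : tens Φ x * y = y * tens Φ x := by
  unfold tens
  simp only [Finset.mul_sum, Finset.sum_mul, mul_smul_comm, smul_mul_assoc, hy]

end Tens
end
end HRV
end modH3

section modH4
set_option autoImplicit false
open scoped MatrixGroups
open Finset

namespace HRV
noncomputable section

/-! ### Part D: pattern subgroups of `GL` -/

section GLn
variable {F : Type} [Field F] [Fintype F] [DecidableEq F]
variable {ι : Type} [Fintype ι] [DecidableEq ι] {Λ : Type} [LinearOrder Λ]

/-- matrix of an element -/
abbrev mx (g : GL ι F) : Matrix ι ι F := (g : Matrix ι ι F)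

lemma gl_ext {g h : GL ι F} (H : ∀ i j, mx g i j = mx h i j) : g = h := by
  apply Units.ext
  ext i j
  exact H i j

lemma mx_mul (g h : GL ι F) (i j : ι) : mx (g * h) i j = ∑ k, mx g i k * mx h k j := by
  simp [mx, Matrix.mul_apply]

lemma mx_one (i j : ι) : mx (1 : GL ι F) i j = (1 : Matrix ι ι F) i j := by simp [mx]

lemma inv_mem_of_pow {G : Type} [Group G] [Finite G] (S : Submonoid G) {g : G} (h : g ∈ S) :
    g⁻¹ ∈ S := by
  have h1 : g⁻¹ = g ^ (orderOf g - 1) := by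
    rw [inv_eq_iff_mul_eq_one, ← pow_succ', Nat.sub_add_cancel (orderOf_pos g), pow_orderOf_eq_one]
  rw [h1]
  exact S.pow_mem h _

/-- unipotent radical of the pattern `b` as a submonoid -/
def UbM (b : ι → Λ) : Submonoid (GL ι F) where
  carrier := {g | ∀ i j, b j ≤ b i → mx g i j = (1 : Matrix ι ι F) i j}
  one_mem' := fun i j _ => mx_one i j
  mul_mem' := by
    intro g h hg hh i j hij
    rw [mx_mul, Finset.sum_eq_single i]
    · rw [hg i i le_rfl, hh i j hij]; simp
    · intro k _ hk
      rcases le_or_gt (b k) (b i) with h1 | h1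
      · rw [hg i k h1, Matrix.one_apply_ne hk.symm, zero_mul]
      · rw [hh k j (hij.trans h1.le), Matrix.one_apply_ne, mul_zero]
        rintro rfl
        exact absurd hij (not_le.mpr h1)
    · simp

/-- unipotent radical of the pattern `b` -/
def Ub (b : ι → Λ) : Subgroup (GL ι F) where
  toSubmonoid := UbM b
  inv_mem' := fun h => inv_mem_of_pow (UbM b) h

lemma mem_Ub {b : ι → Λ} {g : GL ι F} :
    g ∈ Ub b ↔ ∀ i j, b j ≤ b i → mx g i j = (1 : Matrix ι ι F) i j := Iff.rfl

/-- Levi of the pattern -/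
def LbM (b : ι → Λ) : Submonoid (GL ι F) where
  carrier := {g | ∀ i j, b i ≠ b j → mx g i j = 0}
  one_mem' := fun i j h => by rw [mx_one, Matrix.one_apply_ne]; rintro rfl; exact h rfl
  mul_mem' := by
    intro g h hg hh i j hij
    rw [mx_mul]
    refine Finset.sum_eq_zero fun k _ => ?_
    by_cases h1 : b i = b k
    · rw [hh k j (h1 ▸ hij), mul_zero]
    · rw [hg i k h1, zero_mul]

/-- Levi of the pattern -/
def Lb (b : ι → Λ) : Subgroup (GL ι F) where
  toSubmonoid := LbM b
  inv_mem' := fun h => inv_mem_of_pow (LbM b) h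

lemma mem_Lb {b : ι → Λ} {g : GL ι F} :
    g ∈ Lb b ↔ ∀ i j, b i ≠ b j → mx g i j = 0 := Iff.rfl

/-- parabolic -/
def PbM (b : ι → Λ) : Submonoid (GL ι F) where
  carrier := {g | ∀ i j, b j < b i → mx g i j = 0}
  one_mem' := fun i j h => by rw [mx_one, Matrix.one_apply_ne]; rintro rfl; exact absurd h (lt_irrefl _)
  mul_mem' := by
    intro g h hg hh i j hij
    rw [mx_mul]
    refine Finset.sum_eq_zero fun k _ => ?_
    rcases lt_or_ge (b k) (b i) with h1 | h1
    · rw [hg i k h1, zero_mul]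
    · rw [hh k j (hij.trans_le h1), mul_zero]

/-- parabolic -/
def Pb (b : ι → Λ) : Subgroup (GL ι F) where
  toSubmonoid := PbM b
  inv_mem' := fun h => inv_mem_of_pow (PbM b) h

lemma mem_Pb {b : ι → Λ} {g : GL ι F} :
    g ∈ Pb b ↔ ∀ i j, b j < b i → mx g i j = 0 := Iff.rfl

lemma Ub_le_Pb (b : ι → Λ) : (Ub b : Subgroup (GL ι F)) ≤ Pb b := fun g hg i j h => by
  rw [mem_Ub.mp hg i j h.le, Matrix.one_apply_ne]; rintro rfl; exact absurd h (lt_irrefl _)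

lemma Lb_le_Pb (b : ι → Λ) : (Lb b : Subgroup (GL ι F)) ≤ Pb b := fun g hg i j h => hg i j h.ne'

/-- block-diagonal part is multiplicative on the parabolic -/
lemma Pb_diag_mul {b : ι → Λ} {g h : GL ι F} (hg : g ∈ Pb b) (hh : h ∈ Pb b) {i j : ι}
    (hij : b i = b j) : mx (g * h) i j = ∑ k, if b k = b i then mx g i k * mx h k j else 0 := by
  rw [mx_mul]
  refine Finset.sum_congr rfl fun k _ => ?_
  split_ifs with h1
  · rfl
  · rcases lt_or_gt_of_ne h1 with h2 | h2
    · rw [mem_Pb.mp hg i k h2, zero_mul]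
    · rw [mem_Pb.mp hh k j (hij ▸ h2), mul_zero]

/-- The Levi normalises the radical -/
lemma Lb_conj {b : ι → Λ} {l u : GL ι F} (hl : l ∈ Lb b) (hu : u ∈ Ub b) :
    l * u * l⁻¹ ∈ Ub b := by
  have hu' := Ub_le_Pb b hu
  have hP : l * u ∈ Pb b := (Pb b).mul_mem (Lb_le_Pb b hl) hu'
  -- l u = l on diagonal blocks
  have h1 : ∀ i j, b j ≤ b i → mx (l * u) i j = mx l i j := by
    intro i j hij
    rw [mx_mul, Finset.sum_eq_single j]
    · rw [mem_Ub.mp hu j j le_rfl]; simp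
    · intro k _ hk
      by_cases h2 : b i = b k
      · rw [mem_Ub.mp hu k j (h2 ▸ hij), Matrix.one_apply_ne hk, mul_zero]
      · rw [mem_Lb.mp hl i k h2, zero_mul]
    · simp
  intro i j hij
  rw [← mx_one i j, ← mul_inv_cancel l, mx_mul, mx_mul]
  refine Finset.sum_congr rfl fun k _ => ?_
  by_cases h2 : b k = b j
  · rw [h1 i k (h2 ▸ hij)]
  · rw [mem_Lb.mp ((Lb b).inv_mem hl) k j h2, mul_zero, mul_zero]

lemma Lb_conj_iff {b : ι → Λ} {l u : GL ι F} (hl : l ∈ Lb b) :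
    u ∈ Ub b ↔ l * u * l⁻¹ ∈ Ub b := by
  refine ⟨Lb_conj hl, fun h => ?_⟩
  have := Lb_conj ((Lb b).inv_mem hl) h
  simpa [mul_assoc] using this

/-- average over the radical commutes with the Levi -/
lemma ev_Lb {b : ι → Λ} {l : GL ι F} (hl : l ∈ Lb b) :
    dl l * ev (Ub b) = ev (Ub b) * dl l :=
  av_conj l (fun h => Lb_conj_iff hl) fun _ _ => rfl

lemma ev_left {H : Subgroup (GL ι F)} {h : GL ι F} (hh : h ∈ H) : dl h * ev H = ev H := by
  rw [av_left (isCh_one H) hh, one_smul]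

lemma ev_right {H : Subgroup (GL ι F)} {h : GL ι F} (hh : h ∈ H) : ev H * dl h = ev H := by
  rw [av_right (isCh_one H) hh, one_smul]

lemma ev_fix {H : Subgroup (GL ι F)} {x : Al (GL ι F)} (h : ∀ k ∈ H, dl k * x = x) :
    ev H * x = x := av_fix (isCh_one H) fun k hk => by rw [h k hk, one_smul]

lemma ev_fix' {H : Subgroup (GL ι F)} {x : Al (GL ι F)} (h : ∀ k ∈ H, x * dl k = x) :
    x * ev H = x := av_fix' (isCh_one H) fun k hk => by rw [h k hk, one_smul]

lemma ev_sub {H K : Subgroup (GL ι F)} (h : H ≤ K) : ev H * ev K = ev K :=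
  ev_fix fun k hk => ev_left (h hk)

lemma ev_sub' {H K : Subgroup (GL ι F)} (h : H ≤ K) : ev K * ev H = ev K :=
  ev_fix' fun k hk => ev_right (h hk)

lemma ev_idem (H : Subgroup (GL ι F)) : ev H * ev H = ev H := av_idem (isCh_one H)

/-- unipotent element from its off-diagonal part -/
lemma mkU_exists (b : ι → Λ) (N : Matrix ι ι F) (hN : ∀ i j, b j ≤ b i → N i j = 0) :
    ∃ u : GL ι F, u ∈ Ub b ∧ mx u = 1 + N := by
  have hB : Matrix.BlockTriangular (1 + N) b := by
    intro i j h
    rw [Matrix.add_apply, hN i j h.le, Matrix.one_apply_ne, add_zero]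
    rintro rfl; exact absurd h (lt_irrefl _)
  have hd : (1 + N).det = 1 := by
    rw [hB.det]
    refine Finset.prod_eq_one fun a _ => ?_
    have : (1 + N).toSquareBlock b a = 1 := by
      ext i j
      have : b j = b i := by rw [i.2, j.2]
      simp only [Matrix.toSquareBlock_def, Matrix.of_apply, Matrix.add_apply, hN _ _ this.le, add_zero]
      simp [Matrix.one_apply, Subtype.ext_iff]
    rw [this, Matrix.det_one]
  refine ⟨Matrix.GeneralLinearGroup.mkOfDetNeZero (1 + N) (by rw [hd]; exact one_ne_zero), ?_, rfl⟩
  intro i j h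
  change (1 + N) i j = _
  rw [Matrix.add_apply, hN i j h, add_zero]

lemma card_Ub (b : ι → Λ) : Nat.card (Ub b : Subgroup (GL ι F)) =
    Fintype.card F ^ (univ.filter fun p : ι × ι => b p.1 < b p.2).card := by
  classical
  let e : (Ub b : Subgroup (GL ι F)) ≃ ({p : ι × ι // b p.1 < b p.2} → F) := by
    refine Equiv.ofBijective (fun u p => mx u.1 p.1.1 p.1.2) ⟨?_, ?_⟩
    · intro u v h
      apply Subtype.ext
      apply gl_ext
      intro i j
      rcases le_or_gt (b j) (b i) with h1 | h1
      · rw [u.2 i j h1, v.2 i j h1]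
      · exact congrFun h ⟨(i, j), h1⟩
    · intro f
      obtain ⟨u, hu, hu'⟩ := mkU_exists b (Matrix.of fun i j => if h : b i < b j then f ⟨(i, j), h⟩ else 0)
        (fun i j h => by simp [not_lt.mpr h])
      refine ⟨⟨u, hu⟩, ?_⟩
      ext p
      change mx u p.1.1 p.1.2 = f p
      rw [hu', Matrix.add_apply, Matrix.one_apply_ne, zero_add]
      · simp [p.2]
      · intro h; have := p.2; rw [h] at this; exact absurd this (lt_irrefl _)
  rw [Nat.card_congr e, Nat.card_eq_fintype_card, Fintype.card_fun, Fintype.card_subtype]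

/-! monomial elements -/

/-- `n` is monomial with permutation `w` -/
def IsMono (n : GL ι F) (w : Equiv.Perm ι) : Prop := ∀ i j, i ≠ w j → mx n i j = 0

lemma mono_mul_left {n : GL ι F} {w : Equiv.Perm ι} (h : IsMono n w) (g : GL ι F) (i j : ι) :
    mx (n * g) (w i) j = mx n (w i) i * mx g i j := by
  rw [mx_mul, Finset.sum_eq_single i]
  · intro k _ hk
    rw [h, zero_mul]; exact fun h => hk (w.injective h).symm
  · simp

lemma mono_mul_right {n : GL ι F} {w : Equiv.Perm ι} (h : IsMono n w) (g : GL ι F) (i j : ι) :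
    mx (g * n) i j = mx g i (w j) * mx n (w j) j := by
  rw [mx_mul, Finset.sum_eq_single (w j)]
  · intro k _ hk
    rw [h _ _ hk, mul_zero]
  · simp

lemma mono_ne {n : GL ι F} {w : Equiv.Perm ι} (h : IsMono n w) (j : ι) : mx n (w j) j ≠ 0 := by
  intro h0
  have := mono_mul_right h n⁻¹ j j
  rw [h0, mul_zero, inv_mul_cancel, mx_one] at this
  simp at this

lemma mono_inv {n : GL ι F} {w : Equiv.Perm ι} (h : IsMono n w) : IsMono n⁻¹ w⁻¹ := by
  intro i j hij
  obtain ⟨j, rfl⟩ := w.surjective j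
  have hij' : i ≠ j := by simpa using hij
  have h1 := mono_mul_right h n⁻¹ i j
  rw [inv_mul_cancel, mx_one, Matrix.one_apply_ne hij'] at h1
  rcases mul_eq_zero.mp h1.symm with h2 | h2
  · exact h2
  · exact absurd h2 (mono_ne h j)

lemma mono_conj {n : GL ι F} {w : Equiv.Perm ι} (h : IsMono n w) (g : GL ι F) (i j : ι) :
    mx (n * g * n⁻¹) (w i) (w j) = mx n (w i) i * mx g i j * (mx n (w j) j)⁻¹ := by
  have h1 : mx (n * g * n⁻¹ * n) (w i) j = _ := mono_mul_right h (n * g * n⁻¹) (w i) j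
  rw [inv_mul_cancel_right, mono_mul_left h] at h1
  rw [h1, mul_inv_cancel_right₀ (mono_ne h j)]

lemma mono_Ub {n : GL ι F} {w : Equiv.Perm ι} (h : IsMono n w) {b : ι → Λ} {b' : ι → Λ}
    (hb : ∀ i j, b j ≤ b i ↔ b' (w j) ≤ b' (w i)) (u : GL ι F) :
    u ∈ Ub b ↔ n * u * n⁻¹ ∈ Ub b' := by
  have key : ∀ i j, mx u i j = (1 : Matrix ι ι F) i j ↔
      mx (n * u * n⁻¹) (w i) (w j) = (1 : Matrix ι ι F) (w i) (w j) := by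
    intro i j
    rw [mono_conj h]
    by_cases hij : i = j
    · subst hij
      simp only [Matrix.one_apply_eq]
      have := mono_ne h i
      rw [mul_comm, ← mul_assoc, inv_mul_cancel₀ this, one_mul]
    · rw [Matrix.one_apply_ne hij, Matrix.one_apply_ne (fun h => hij (w.injective h))]
      simp [mono_ne h]
  constructor
  · intro hu i j hij
    obtain ⟨i, rfl⟩ := w.surjective i
    obtain ⟨j, rfl⟩ := w.surjective j
    exact (key i j).mp (hu i j ((hb i j).mpr hij))
  · intro hu i j hij
    exact (key i j).mpr (hu _ _ ((hb i j).mp hij))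

lemma ev_mono {n : GL ι F} {w : Equiv.Perm ι} (h : IsMono n w) {b : ι → Λ} {b' : ι → Λ}
    (hb : ∀ i j, b j ≤ b i ↔ b' (w j) ≤ b' (w i)) :
    dl n * ev (Ub b) = ev (Ub b') * dl n := av_conj n (mono_Ub h hb) fun _ _ => rfl

/-- permutation elements -/
def pm (w : Equiv.Perm ι) : GL ι F where
  val := Matrix.of fun i j => if i = w j then 1 else 0
  inv := Matrix.of fun i j => if w i = j then 1 else 0
  val_inv := by
    ext i j
    simp only [Matrix.mul_apply, Matrix.of_apply, Matrix.one_apply]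
    rw [Finset.sum_eq_single (w⁻¹ i)]
    · simp
    · intro k _ hk; rw [if_neg, zero_mul]; rintro rfl; simp at hk
    · simp
  inv_val := by
    ext i j
    simp only [Matrix.mul_apply, Matrix.of_apply, Matrix.one_apply]
    rw [Finset.sum_eq_single (w i)]
    · simp
    · intro k _ hk; rw [if_neg (Ne.symm hk), zero_mul]
    · simp

lemma mx_pm (w : Equiv.Perm ι) (i j : ι) : mx (pm w : GL ι F) i j = if i = w j then 1 else 0 := rfl

lemma pm_mono (w : Equiv.Perm ι) : IsMono (pm w : GL ι F) w := fun i j h => by rw [mx_pm, if_neg h]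

lemma pm_one : (pm 1 : GL ι F) = 1 := gl_ext fun i j => by
  rw [mx_pm, mx_one, Matrix.one_apply]; rfl

lemma pm_mul (w v : Equiv.Perm ι) : (pm (w * v) : GL ι F) = pm w * pm v := gl_ext fun i j => by
  rw [mono_mul_right (pm_mono v), mx_pm, mx_pm, mx_pm, if_pos rfl, mul_one]; rfl

lemma pm_inv (w : Equiv.Perm ι) : (pm w⁻¹ : GL ι F) = (pm w)⁻¹ := by
  rw [eq_inv_iff_mul_eq_one, ← pm_mul]; simp [pm_one]

/-! Bruhat decomposition -/

/-- pivot elimination -/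
lemma pivot_step (r c : ι → ℕ) (g : GL ι F) (i0 j0 : ι) (h0 : mx g i0 j0 ≠ 0)
    (hr : ∀ i, i ≠ i0 → mx g i j0 ≠ 0 → r i < r i0) (hc : ∀ j, j ≠ j0 → mx g i0 j ≠ 0 → c j0 < c j) :
    ∃ u ∈ (Ub r : Subgroup (GL ι F)), ∃ u' ∈ (Ub c : Subgroup (GL ι F)),
      ∀ i j, mx (u * g * u') i j = if i = i0 ∧ j = j0 then mx g i0 j0 else
        mx g i j - mx g i j0 * mx g i0 j / mx g i0 j0 := by
  obtain ⟨u, hu, hu'⟩ := mkU_exists r (Matrix.of fun i k => if k = i0 ∧ i ≠ i0 then - mx g i j0 / mx g i0 j0 else 0)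
    (by
      intro i k hik
      simp only [Matrix.of_apply]
      split_ifs with h
      · by_contra h1
        have := hr i h.2 (by intro h2; simp [h2] at h1)
        rw [h.1] at hik; omega
      · rfl)
  obtain ⟨v, hv, hv'⟩ := mkU_exists c (Matrix.of fun k j => if k = j0 ∧ j ≠ j0 then - mx g i0 j / mx g i0 j0 else 0)
    (by
      intro k j hik
      simp only [Matrix.of_apply]
      split_ifs with h
      · by_contra h1
        have := hc j h.2 (by intro h2; simp [h2] at h1)
        rw [h.1] at hik; omega
      · rfl)
  refine ⟨u, hu, v, hv, ?_⟩
  have e1 : ∀ i j, mx (u * g) i j = mx g i j + if i ≠ i0 then - mx g i j0 / mx g i0 j0 * mx g i0 j else 0 := by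
    intro i j
    rw [mx_mul, hu']
    simp only [Matrix.add_apply, add_mul, Finset.sum_add_distrib, Matrix.of_apply, Matrix.one_apply]
    simp only [ite_mul, one_mul, zero_mul, Finset.sum_ite_eq, Finset.mem_univ, if_true]
    congr 1
    rw [Finset.sum_eq_single i0]
    · simp
    · intro k _ hk; simp [hk]
    · simp
  have e2 : ∀ i j, mx (u * g * v) i j = mx (u * g) i j + if j ≠ j0 then mx (u * g) i j0 * (- mx g i0 j / mx g i0 j0) else 0 := by
    intro i j
    rw [mx_mul, hv']
    simp only [Matrix.add_apply, mul_add, Finset.sum_add_distrib, Matrix.of_apply, Matrix.one_apply]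
    simp only [mul_ite, mul_one, mul_zero, Finset.sum_ite_eq', Finset.mem_univ, if_true]
    congr 1
    rw [Finset.sum_eq_single j0]
    · simp
    · intro k _ hk; simp [hk]
    · simp
  intro i j
  rw [e2, e1, e1]
  by_cases hi : i = i0
  · by_cases hj : j = j0
    · simp [hi, hj]
    · simp [hi, hj]; field_simp; ring
  · by_cases hj : j = j0
    · simp [hi, hj]; field_simp; ring
    · simp [hi, hj]; field_simp; ring

lemma bruhat_aux (r c : ι → ℕ) (hr : Function.Injective r) (hc : Function.Injective c) (g : GL ι F)
    (k : ℕ) : ∃ u ∈ (Ub r : Subgroup (GL ι F)), ∃ u' ∈ (Ub c : Subgroup (GL ι F)),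
      ∀ j, c j < k → ∃ i, mx (u * g * u') i j ≠ 0 ∧ (∀ i', i' ≠ i → mx (u * g * u') i' j = 0) ∧
        (∀ j', j' ≠ j → mx (u * g * u') i j' = 0) := by
  induction k with
  | zero => exact ⟨1, Subgroup.one_mem _, 1, Subgroup.one_mem _, fun j h => absurd h (by omega)⟩
  | succ k ih =>
    obtain ⟨u, hu, v, hv, H⟩ := ih
    by_cases hk : ∃ j0, c j0 = k
    swap
    · refine ⟨u, hu, v, hv, fun j hj => H j ?_⟩
      have : c j ≠ k := fun h => hk ⟨j, h⟩
      omega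
    obtain ⟨j0, hj0⟩ := hk
    set g' := u * g * v with hg'
    -- column nonzero
    have hne : ∃ i, mx g' i j0 ≠ 0 := by
      by_contra h
      push Not at h
      have : mx (g'⁻¹ * g') j0 j0 = 0 := by
        rw [mx_mul]; exact Finset.sum_eq_zero fun k _ => by rw [h, mul_zero]
      rw [inv_mul_cancel, mx_one] at this
      simp at this
    obtain ⟨i0, hi0, hmax⟩ := Finset.exists_max_image (univ.filter fun i => mx g' i j0 ≠ 0) r
      (by obtain ⟨i, hi⟩ := hne; exact ⟨i, by simpa using hi⟩)
    have hp : mx g' i0 j0 ≠ 0 := by simpa using hi0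
    obtain ⟨u1, hu1, v1, hv1, H1⟩ := pivot_step r c g' i0 j0 hp
      (by
        intro i hi h
        have h1 := hmax i (by simpa using h)
        exact lt_of_le_of_ne h1 fun h => hi (hr h))
      (by
        intro j hj h
        by_contra h1
        have h2 : c j < k := by
          have : c j ≠ c j0 := fun h => hj (hc h)
          omega
        obtain ⟨i, a1, a2, a3⟩ := H j h2
        have h3 : i0 = i := by
          by_contra h4; exact h (a2 i0 h4)
        subst h3
        exact hp (a3 j0 (Ne.symm hj)))
    refine ⟨u1 * u, Subgroup.mul_mem _ hu1 hu, v * v1, Subgroup.mul_mem _ hv hv1, ?_⟩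
    have hgg : u1 * u * g * (v * v1) = u1 * g' * v1 := by rw [hg']; group
    rw [hgg]
    intro j hj
    rcases Nat.lt_succ_iff_lt_or_eq.mp hj with h2 | h2
    · obtain ⟨i, a1, a2, a3⟩ := H j h2
      have hjj : j ≠ j0 := by rintro rfl; omega
      have hii : i ≠ i0 := by rintro rfl; exact hp (a3 j0 (Ne.symm hjj))
      have z1 : mx g' i j0 = 0 := a3 j0 (Ne.symm hjj)
      have z2 : mx g' i0 j = 0 := a2 i0 (Ne.symm hii)
      refine ⟨i, ?_, ?_, ?_⟩
      · rw [H1, if_neg (by tauto), z1]; simpa using a1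
      · intro i' hi'
        rw [H1, if_neg (by tauto), z2, a2 i' hi']; simp
      · intro j' hj'
        rw [H1, if_neg (by tauto), z1, a3 j' hj']; simp
    · have : j = j0 := hc (by omega)
      subst this
      refine ⟨i0, ?_, ?_, ?_⟩
      · rw [H1, if_pos ⟨rfl, rfl⟩]; exact hp
      · intro i' hi'
        rw [H1, if_neg (by tauto)]; field_simp; ring
      · intro j' hj'
        rw [H1, if_neg (by tauto)]; field_simp; ring

lemma bruhat (r c : ι → ℕ) (hr : Function.Injective r) (hc : Function.Injective c) (g : GL ι F) :
    ∃ u ∈ (Ub r : Subgroup (GL ι F)), ∃ v ∈ (Ub c : Subgroup (GL ι F)), ∃ n w, IsMono n w ∧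
      g = u * n * v := by
  obtain ⟨u, hu, v, hv, H⟩ := bruhat_aux r c hr hc g ((univ.sup c) + 1)
  have H' := fun j => H j (Nat.lt_succ_of_le (Finset.le_sup (Finset.mem_univ j)))
  choose f h1 h2 h3 using H'
  have hinj : Function.Injective f := by
    intro j j' h
    by_contra hne
    exact h1 j' (h ▸ h3 j j' (Ne.symm hne))
  refine ⟨u⁻¹, Subgroup.inv_mem _ hu, v⁻¹, Subgroup.inv_mem _ hv, u * g * v,
    Equiv.ofBijective f (Finite.injective_iff_bijective.mp hinj), ?_, by group⟩
  intro i j hij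
  exact h2 j i hij

end GLn
end
end HRV
end modH4

section modH5
set_option autoImplicit false
open scoped MatrixGroups
open Finset

namespace HRV
noncomputable section

/-! ### Part E: Levi embeddings and cuspidal idempotents -/

section Levi
variable {F : Type} [Field F] [Fintype F] [DecidableEq F]
variable {ι : Type} [Fintype ι] [DecidableEq ι] {Λ : Type} [LinearOrder Λ] [Fintype Λ]
variable {d : Λ → ℕ}

/-- block function -/
def bE (E : (Σ a, Fin (d a)) ≃ ι) (i : ι) : Λ := (E.symm i).1

@[simp] lemma bE_apply (E : (Σ a, Fin (d a)) ≃ ι) (a : Λ) (k : Fin (d a)) : bE E (E ⟨a, k⟩) = a := by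
  simp [bE]

lemma bE_eq (E : (Σ a, Fin (d a)) ≃ ι) {i : ι} {a : Λ} (h : bE E i = a) : ∃ k, i = E ⟨a, k⟩ := by
  subst h
  exact ⟨(E.symm i).2, by simp [bE]⟩

lemma E_ind (E : (Σ a, Fin (d a)) ≃ ι) (i : ι) : ∃ a k, i = E ⟨a, k⟩ := ⟨_, bE_eq E rfl⟩

/-- Levi embedding -/
def Ph (E : (Σ a, Fin (d a)) ≃ ι) : (Π a, GL (Fin (d a)) F) →* GL ι F :=
  (Units.map (Matrix.reindexAlgEquiv F F E).toMonoidHom).comp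
    ((Units.map (Matrix.blockDiagonal'RingHom (fun a => Fin (d a)) F).toMonoidHom).comp
      MulEquiv.piUnits.symm.toMonoidHom)

lemma Ph_same (E : (Σ a, Fin (d a)) ≃ ι) (h : Π a, GL (Fin (d a)) F) (a : Λ) (k l : Fin (d a)) :
    mx (Ph E h) (E ⟨a, k⟩) (E ⟨a, l⟩) = mx (h a) k l := by
  change Matrix.blockDiagonal' (fun a => (h a : Matrix (Fin (d a)) (Fin (d a)) F)) (E.symm (E ⟨a, k⟩)) (E.symm (E ⟨a, l⟩)) = _
  rw [Equiv.symm_apply_apply, Equiv.symm_apply_apply, Matrix.blockDiagonal'_apply_eq]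

lemma Ph_ne (E : (Σ a, Fin (d a)) ≃ ι) (h : Π a, GL (Fin (d a)) F) {i j : ι} (hij : bE E i ≠ bE E j) :
    mx (Ph E h) i j = 0 := by
  change Matrix.blockDiagonal' (fun a => (h a : Matrix (Fin (d a)) (Fin (d a)) F)) (E.symm i) (E.symm j) = _
  rw [Matrix.blockDiagonal'_apply]
  exact dif_neg hij

lemma Ph_mem (E : (Σ a, Fin (d a)) ≃ ι) (h : Π a, GL (Fin (d a)) F) : Ph E h ∈ Lb (bE E) :=
  fun i j hij => Ph_ne E h hij

lemma Ph_inj (E : (Σ a, Fin (d a)) ≃ ι) : Function.Injective (Ph E : (Π a, GL (Fin (d a)) F) →* GL ι F) := by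
  intro h h' hh
  funext a
  apply gl_ext
  intro k l
  rw [← Ph_same E h, ← Ph_same E h', hh]

lemma sum_block (E : (Σ a, Fin (d a)) ≃ ι) (a : Λ) (f : ι → F) :
    (∑ k, if bE E k = a then f k else 0) = ∑ l : Fin (d a), f (E ⟨a, l⟩) := by
  rw [← E.sum_comp, Fintype.sum_sigma, Finset.sum_eq_single a]
  · simp
  · intro b _ hb; simp [hb]
  · simp

lemma Ph_mul_right (E : (Σ a, Fin (d a)) ≃ ι) (h : Π a, GL (Fin (d a)) F) (g : GL ι F) (a : Λ)
    (k : Fin (d a)) (j : ι) :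
    mx (Ph E h * g) (E ⟨a, k⟩) j = ∑ l, mx (h a) k l * mx g (E ⟨a, l⟩) j := by
  have := sum_block E a (fun x => mx (Ph E h) (E ⟨a, k⟩) x * mx g x j)
  simp only [Ph_same] at this
  rw [mx_mul, ← this]
  refine Finset.sum_congr rfl fun x _ => ?_
  split_ifs with hx
  · rfl
  · rw [Ph_ne, zero_mul]
    rw [bE_apply]; exact fun h => hx h.symm

lemma Pb_block_inv (E : (Σ a, Fin (d a)) ≃ ι) {g : GL ι F} (hg : g ∈ Pb (bE E)) (a : Λ) (k l : Fin (d a)) :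
    ∑ m : Fin (d a), mx g (E ⟨a, k⟩) (E ⟨a, m⟩) * mx g⁻¹ (E ⟨a, m⟩) (E ⟨a, l⟩) =
      (1 : Matrix (Fin (d a)) (Fin (d a)) F) k l := by
  have h1 := Pb_diag_mul hg ((Pb (bE E)).inv_mem hg) (i := E ⟨a, k⟩) (j := E ⟨a, l⟩) (by simp)
  rw [mul_inv_cancel, mx_one, bE_apply, sum_block E a] at h1
  rw [← h1, Matrix.one_apply, Matrix.one_apply]
  simp

/-- block part of an element of the parabolic -/
def blkP (E : (Σ a, Fin (d a)) ≃ ι) (g : GL ι F) (hg : g ∈ Pb (bE E)) (a : Λ) : GL (Fin (d a)) F where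
  val := Matrix.of fun k l => mx g (E ⟨a, k⟩) (E ⟨a, l⟩)
  inv := Matrix.of fun k l => mx g⁻¹ (E ⟨a, k⟩) (E ⟨a, l⟩)
  val_inv := by
    ext k l; rw [Matrix.mul_apply]; exact Pb_block_inv E hg a k l
  inv_val := by
    ext k l; rw [Matrix.mul_apply]
    have := Pb_block_inv E ((Pb (bE E)).inv_mem hg) a k l
    rw [inv_inv] at this
    exact this

lemma Pb_decomp (E : (Σ a, Fin (d a)) ≃ ι) {g : GL ι F} (hg : g ∈ Pb (bE E)) :
    ∃ u ∈ Ub (bE E), g = Ph E (blkP E g hg) * u := by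
  refine ⟨(Ph E (blkP E g hg))⁻¹ * g, ?_, by group⟩
  rw [← map_inv]
  intro i j hij
  obtain ⟨a, k, rfl⟩ := E_ind E i
  rw [Ph_mul_right]
  by_cases h : bE E j = a
  · obtain ⟨l, rfl⟩ := bE_eq E h
    have h1 : ∀ m, mx ((blkP E g hg)⁻¹ a) k m = mx g⁻¹ (E ⟨a, k⟩) (E ⟨a, m⟩) := fun m => rfl
    simp_rw [h1]
    have := Pb_block_inv E ((Pb (bE E)).inv_mem hg) a k l
    rw [inv_inv] at this
    rw [this, Matrix.one_apply, Matrix.one_apply]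
    simp
  · rw [bE_apply] at hij
    have hlt := lt_of_le_of_ne hij h
    rw [Matrix.one_apply_ne]
    · exact Finset.sum_eq_zero fun m _ => by rw [mem_Pb.mp hg _ _ (by simpa using hlt), mul_zero]
    · intro h'; rw [← h'] at h; simp at h

lemma Lb_decomp (E : (Σ a, Fin (d a)) ≃ ι) {g : GL ι F} (hg : g ∈ Lb (bE E)) :
    ∃ h : Π a, GL (Fin (d a)) F, g = Ph E h := by
  refine ⟨blkP E g (Lb_le_Pb _ hg), gl_ext fun i j => ?_⟩
  obtain ⟨a, k, rfl⟩ := E_ind E i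
  by_cases h : bE E j = a
  · obtain ⟨l, rfl⟩ := bE_eq E h
    rw [Ph_same]; rfl
  · rw [hg _ _ (by rw [bE_apply]; exact fun h' => h h'.symm), Ph_ne]
    rw [bE_apply]; exact fun h' => h h'.symm

/-- tensors commute with the radical average -/
lemma tens_ev (E : (Σ a, Fin (d a)) ≃ ι) (x : Π a, Al (GL (Fin (d a)) F)) :
    tens (Ph E) x * ev (Ub (bE E)) = ev (Ub (bE E)) * tens (Ph E) x :=
  tens_commute _ _ (fun h => ev_Lb (Ph_mem E h)) x

end Levi

section Cuspidal
variable {F : Type} [Field F] [Fintype F] [DecidableEq F]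

/-- cuspidal irreps -/
def IsCusp {d : ℕ} (i : Irr (GL (Fin d) F)) : Prop :=
  ∀ β : Fin d → Bool, (∃ k l, β k ≠ β l) → ev (Ub β) * ep i = 0

variable (F) in
/-- cuspidal irreps of all sizes -/
structure Cusp where
  d : ℕ
  hd : 0 < d
  i : Irr (GL (Fin d) F)
  hi : IsCusp i

/-- primitive idempotent -/
def pe (ρ : Cusp F) : Al (GL (Fin ρ.d) F) := bl ρ.i (Matrix.single 0 0 1)

/-- matrix coefficient -/
def lam (ρ : Cusp F) (x : Al (GL (Fin ρ.d) F)) : ℂ := (rp ρ.i x : Mt ρ.i) 0 0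

/-- hook number -/
def hC (ρ : Cusp F) : ℂ := hk ρ.i

/-- central character on scalars -/
def scal {ι : Type} [Fintype ι] [DecidableEq ι] (z : Fˣ) : GL ι F := Units.map (algebraMap F (Matrix ι ι F)).toMonoidHom z

lemma pe_idem (ρ : Cusp F) : pe ρ * pe ρ = pe ρ := by
  apply rp_ext; intro j
  by_cases h : j = ρ.i
  · subst h; simp [pe, rp_bl_same]
  · simp [pe, rp_bl_ne h]

lemma pe_mul (ρ : Cusp F) (x : Al (GL (Fin ρ.d) F)) : pe ρ * x * pe ρ = lam ρ x • pe ρ := by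
  apply rp_ext; intro j
  by_cases h : j = ρ.i
  · subst h
    simp only [pe, map_mul, map_smul, rp_bl_same]
    rw [Matrix.single_mul_mul_single]
    simp [lam]
  · simp [pe, rp_bl_ne h]

lemma pe_ne (ρ : Cusp F) {j : Irr (GL (Fin ρ.d) F)} (h : j ≠ ρ.i) (x : Al (GL (Fin ρ.d) F)) (M : Mt j) :
    pe ρ * x * bl j M = 0 := by
  apply rp_ext; intro k
  by_cases h' : k = ρ.i
  · subst h'; simp [pe, rp_bl_ne h.symm]
  · simp [pe, rp_bl_ne h']

lemma tau_pe (ρ : Cusp F) : tau (pe ρ) = (hC ρ)⁻¹ := by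
  rw [pe, tau_bl, Matrix.trace_single_eq_same, hC, one_div]

lemma pe_ep (ρ : Cusp F) : pe ρ * ep ρ.i = pe ρ := by
  apply rp_ext; intro j
  by_cases h : j = ρ.i
  · subst h; simp [pe, rp_bl_same, rp_ep_same]
  · simp [pe, rp_bl_ne h]

lemma pe_kill (ρ : Cusp F) (x : Al (GL (Fin ρ.d) F)) {β : Fin ρ.d → Bool} (hβ : ∃ k l, β k ≠ β l) :
    pe ρ * x * ev (Ub β) = 0 := by
  rw [← pe_ep, mul_assoc (pe ρ), ep_comm, mul_assoc, mul_assoc, ep_comm, ρ.hi β hβ, mul_zero, mul_zero]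

lemma kill_pe (ρ : Cusp F) (x : Al (GL (Fin ρ.d) F)) {β : Fin ρ.d → Bool} (hβ : ∃ k l, β k ≠ β l) :
    ev (Ub β) * x * pe ρ = 0 := by
  rw [← pe_ep, ← ep_comm, mul_assoc, ← mul_assoc x, ← ep_comm, mul_assoc, ← mul_assoc, ρ.hi β hβ, zero_mul]

lemma sum_lam (ρ : Cusp F) : ∑ g, lam ρ (dl g) * lam ρ (dl g⁻¹) = hC ρ := by
  have := schur_entry ρ.i 0 0 0 0
  simpa [lam, hC] using this

lemma hC_ne (ρ : Cusp F) : hC ρ ≠ 0 := hk_ne _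

lemma lam_one (ρ : Cusp F) : lam ρ 1 = 1 := by simp [lam]

lemma scal_comm {ι : Type} [Fintype ι] [DecidableEq ι] (z : Fˣ) (g : GL ι F) : scal z * g = g * scal z := by
  apply Units.ext
  exact Algebra.commutes (z : F) (g : Matrix ι ι F)

/-- central character -/
def omC (ρ : Cusp F) (z : Fˣ) : ℂ := om ρ.i (scal z)

lemma scal_pe (ρ : Cusp F) (z : Fˣ) : dl (scal z) * pe ρ = omC ρ z • pe ρ := by
  apply rp_ext; intro j
  by_cases h : j = ρ.i
  · subst h; simp [pe, rp_bl_same, rp_om _ (scal_comm z), omC]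
  · simp [pe, rp_bl_ne h]

lemma lam_scal (ρ : Cusp F) (z : Fˣ) (x : Al (GL (Fin ρ.d) F)) : lam ρ (dl (scal z) * x) = omC ρ z * lam ρ x := by
  simp [lam, rp_om _ (scal_comm z), omC]

end Cuspidal
end
end HRV
end modH5

section modH6
set_option autoImplicit false
open scoped MatrixGroups
open Finset

namespace HRV
noncomputable section

/-! ### Part F: cuspidal sequences and the Mackey formula -/

section supp
variable {G : Type} [Group G] [Fintype G]

/-- supported on a subgroup -/
def Sup (P : Subgroup G) (x : Al G) : Prop := ∀ g, g ∉ P → cf g x = 0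

lemma Sup_mul {P : Subgroup G} {x y : Al G} (hx : Sup P x) (hy : Sup P y) : Sup P (x * y) := by
  intro g hg
  rw [cf_mul]
  refine Finset.sum_eq_zero fun h _ => ?_
  by_cases h1 : h ∈ P
  · rw [hy, mul_zero]
    intro h2; apply hg; simpa using P.mul_mem h1 h2
  · rw [hx h h1, zero_mul]

lemma Sup_av {P H : Subgroup G} (h : H ≤ P) : Sup P (ev H) := by
  classical
  intro g hg
  rw [cf_av, if_neg fun h' => hg (h h')]

lemma Sup_tens {Λ : Type} [Fintype Λ] [DecidableEq Λ]
  {H : Λ → Type} [∀ a, Group (H a)] [∀ a, Fintype (H a)] (Φ : (Π a, H a) →* G) {P : Subgroup G}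
    (hP : ∀ h, Φ h ∈ P) (x : Π a, Al (H a)) : Sup P (tens Φ x) := by
  classical
  intro g hg
  unfold tens
  rw [map_sum]
  refine Finset.sum_eq_zero fun h _ => ?_
  rw [map_smul, cf_dl, if_neg, smul_zero]
  rintro rfl; exact hg (hP h)

lemma tau_Sup {P P' : Subgroup G} {x y : Al G} (hx : Sup P x) (hy : Sup P' y) (g h : G)
    (H : ∀ p ∈ P, ∀ p' ∈ P', p * g * p' * h ≠ 1) : tau (x * dl g * y * dl h) = 0 := by
  classical
  rw [al_sum x, al_sum y]
  simp only [Finset.sum_mul, Finset.mul_sum, smul_mul_assoc, mul_smul_comm, map_sum, map_smul, ← dl_mul]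
  refine Finset.sum_eq_zero fun a _ => ?_
  rw [smul_eq_mul, Finset.mul_sum]
  refine Finset.sum_eq_zero fun c _ => ?_
  by_cases h1 : c ∈ P
  · by_cases h2 : a ∈ P'
    · rw [tau_dl, if_neg (by first | exact H _ h1 _ h2 | exact H _ h2 _ h1)]; simp
    · rw [hy _ h2]; simp
  · rw [hx _ h1]; simp
end supp

section levi2
variable {F : Type} [Field F] [Fintype F] [DecidableEq F]
variable {ι : Type} [Fintype ι] [DecidableEq ι]
variable {Λ Λ' : Type} [LinearOrder Λ] [Fintype Λ] [LinearOrder Λ'] [Fintype Λ']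
variable {d : Λ → ℕ} {d' : Λ' → ℕ}

/-- reindexing of a block decomposition -/
def reE (E : (Σ a, Fin (d a)) ≃ ι) (π : Λ' ≃ Λ) : (Σ a, Fin (d (π a))) ≃ ι :=
  (Equiv.sigmaCongrLeft (β := fun a => Fin (d a)) π).trans E

@[simp] lemma reE_apply (E : (Σ a, Fin (d a)) ≃ ι) (π : Λ' ≃ Λ) (a : Λ') (k : Fin (d (π a))) :
    reE E π ⟨a, k⟩ = E ⟨π a, k⟩ := by
  simp [reE, Equiv.sigmaCongrLeft]

lemma bE_reE (E : (Σ a, Fin (d a)) ≃ ι) (π : Λ' ≃ Λ) (i : ι) : π (bE (reE E π) i) = bE E i := by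
  obtain ⟨a, k, rfl⟩ := E_ind (reE E π) i
  rw [bE_apply, reE_apply, bE_apply]

lemma Ph_reE (E : (Σ a, Fin (d a)) ≃ ι) (π : Λ' ≃ Λ) (h : Π a, GL (Fin (d a)) F) :
    Ph (reE E π) (fun a => h (π a)) = Ph E h := by
  apply gl_ext
  intro i j
  obtain ⟨a, k, rfl⟩ := E_ind (reE E π) i
  by_cases hj : bE (reE E π) j = a
  · obtain ⟨l, rfl⟩ := bE_eq _ hj
    rw [Ph_same, reE_apply, reE_apply, Ph_same]
  · rw [Ph_ne, Ph_ne]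
    · rw [← bE_reE E π, ← bE_reE E π, bE_apply]; exact fun h' => hj (π.injective h').symm
    · rw [bE_apply]; exact fun h' => hj h'.symm

lemma tens_reE (E : (Σ a, Fin (d a)) ≃ ι) (π : Λ' ≃ Λ) (x : Π a, Al (GL (Fin (d a)) F)) :
    tens (Ph (reE E π)) (fun a => x (π a)) = tens (Ph E) x := by
  unfold tens
  refine (Fintype.sum_equiv (Equiv.piCongrLeft' (fun a => GL (Fin (d a)) F) π.symm) _ _ fun h => ?_).symm
  have h1 : (Equiv.piCongrLeft' (fun a => GL (Fin (d a)) F) π.symm) h = fun a => h (π a) := rfl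
  rw [h1, Ph_reE, ← π.prod_comp]

/-- permutation matching blocks, same index set -/
def hat0 {d d' : Λ → ℕ} (E : (Σ a, Fin (d a)) ≃ ι) (E' : (Σ a, Fin (d' a)) ≃ ι) (hd : ∀ a, d a = d' a) :
    Equiv.Perm ι := (E'.symm.trans (Equiv.sigmaCongrRight fun a => finCongr (hd a).symm)).trans E

lemma hat0_apply {d d' : Λ → ℕ} (E : (Σ a, Fin (d a)) ≃ ι) (E' : (Σ a, Fin (d' a)) ≃ ι) (hd : ∀ a, d a = d' a)
    (a : Λ) (k : Fin (d' a)) :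
    hat0 E E' hd (E' ⟨a, k⟩) = E ⟨a, Fin.cast (hd a).symm k⟩ := by
  simp [hat0]

lemma bE_hat0 {d d' : Λ → ℕ} (E : (Σ a, Fin (d a)) ≃ ι) (E' : (Σ a, Fin (d' a)) ≃ ι) (hd : ∀ a, d a = d' a)
    (i : ι) : bE E (hat0 E E' hd i) = bE E' i := by
  obtain ⟨a, k, rfl⟩ := E_ind E' i
  rw [hat0_apply, bE_apply, bE_apply]

/-- permutation matching blocks -/
def hat (E : (Σ a, Fin (d a)) ≃ ι) (E' : (Σ a, Fin (d' a)) ≃ ι) (π : Λ' ≃ Λ) (hd : ∀ a, d (π a) = d' a) :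
    Equiv.Perm ι := hat0 (reE E π) E' hd

lemma hat_apply (E : (Σ a, Fin (d a)) ≃ ι) (E' : (Σ a, Fin (d' a)) ≃ ι) (π : Λ' ≃ Λ)
    (hd : ∀ a, d (π a) = d' a) (a : Λ') (k : Fin (d' a)) :
    hat E E' π hd (E' ⟨a, k⟩) = E ⟨π a, Fin.cast (hd a).symm k⟩ := by
  rw [hat, hat0_apply, reE_apply]

lemma bE_hat (E : (Σ a, Fin (d a)) ≃ ι) (E' : (Σ a, Fin (d' a)) ≃ ι) (π : Λ' ≃ Λ)
    (hd : ∀ a, d (π a) = d' a) (i : ι) : bE E (hat E E' π hd i) = π (bE E' i) := by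
  obtain ⟨a, k, rfl⟩ := E_ind E' i
  rw [hat_apply, bE_apply, bE_apply]

lemma pm_hat0_Ph' {d : Λ → ℕ} (E : (Σ a, Fin (d a)) ≃ ι) (E' : (Σ a, Fin (d a)) ≃ ι) (hd : ∀ a, d a = d a)
    (h : Π a, GL (Fin (d a)) F) :
    pm (hat0 E E' hd) * Ph E' h = Ph E h * pm (hat0 E E' hd) := by
  apply gl_ext
  intro i j
  rw [mono_mul_right (pm_mono _)]
  obtain ⟨i, rfl⟩ := (hat0 E E' hd).surjective i
  rw [mono_mul_left (pm_mono _), mx_pm, mx_pm, if_pos rfl, if_pos rfl, one_mul, mul_one]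
  obtain ⟨a, k, rfl⟩ := E_ind E' i
  by_cases hj : bE E' j = a
  · obtain ⟨l, rfl⟩ := bE_eq _ hj
    rw [hat0_apply, hat0_apply, Ph_same]
    exact (Ph_same E h a k l).symm
  · rw [Ph_ne, Ph_ne]
    · rw [bE_hat0, bE_hat0, bE_apply]; exact fun h' => hj h'.symm
    · rw [bE_apply]; exact fun h' => hj h'.symm

lemma pm_hat0_tens' {d : Λ → ℕ} (E : (Σ a, Fin (d a)) ≃ ι) (E' : (Σ a, Fin (d a)) ≃ ι) (hd : ∀ a, d a = d a)
    (x : Π a, Al (GL (Fin (d a)) F)) :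
    dl (pm (hat0 E E' hd)) * tens (Ph E') x = tens (Ph E) x * dl (pm (hat0 E E' hd)) :=
  tens_intertwine _ _ _ (fun h => pm_hat0_Ph' E E' hd h) x

/-- killing by mismatch of one tensor factor -/
lemma hat0_kill {d d' : Λ → ℕ} (h0 : d = d') (hd : ∀ a, d a = d' a) (E : (Σ a, Fin (d a)) ≃ ι) (E' : (Σ a, Fin (d' a)) ≃ ι)
    (x : Π a, Al (GL (Fin (d a)) F)) (y : Π a, Al (GL (Fin (d' a)) F)) (h : Π a, GL (Fin (d a)) F)
    (h' : Π a, GL (Fin (d' a)) F) (a : Λ)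
    (hk : ∀ (g : Al (GL (Fin (d a)) F)) (g' : Al (GL (Fin (d' a)) F)), x a * g * ((hd a).symm ▸ (g' * y a)) = 0) :
    tens (Ph E) x * dl (Ph E h) * dl (pm (hat0 E E' hd)) * dl (Ph E' h') * tens (Ph E') y = 0 := by
  subst h0
  rw [← tens_dl, ← tens_dl, mul_assoc, tens_mul, mul_assoc, tens_mul, pm_hat0_tens' E E' hd,
    ← mul_assoc, tens_mul]
  rw [tens_zero (a := a), zero_mul]
  have := hk (dl (h a)) (dl (h' a))
  exact this

/-- refinement of a block function by an injective function -/
lemma exists_refine (b : ι → Λ) : ∃ r : ι → ℕ, Function.Injective r ∧ ∀ i j, b i < b j → r i < r j := by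
  let N := Fintype.card ι
  let e := Fintype.equivFin ι
  let rk : Λ → ℕ := fun a => (univ.filter fun c => c < a).card
  have hrk : ∀ a c, a < c → rk a < rk c := by
    intro a c h
    apply Finset.card_lt_card
    refine Finset.ssubset_iff_of_subset ?_ |>.mpr ⟨a, by simpa using h, by simp⟩
    intro x hx
    simp only [Finset.mem_filter, Finset.mem_univ, true_and] at hx ⊢
    exact hx.trans h
  refine ⟨fun i => rk (b i) * N + e i, ?_, ?_⟩
  · intro i j h
    have hi := (e i).2
    have hj := (e j).2
    have h1 : ((e i : ℕ)) = e j := by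
      have := congrArg (· % N) h
      simp only [Nat.mul_add_mod_self_right] at this
      rwa [Nat.mod_eq_of_lt hi, Nat.mod_eq_of_lt hj] at this
    exact e.injective (Fin.ext h1)
  · intro i j h
    have hi := (e i).2
    have := hrk _ _ h
    calc rk (b i) * N + e i < rk (b i) * N + N := by omega
      _ = (rk (b i) + 1) * N := by ring
      _ ≤ rk (b j) * N := Nat.mul_le_mul_right _ this
      _ ≤ _ := Nat.le_add_right _ _

lemma Ub_refine {b : ι → Λ} {r : ι → ℕ} (h : ∀ i j, b i < b j → r i < r j) : (Ub r : Subgroup (GL ι F)) ≤ Pb b := by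
  intro u hu i j hij
  rw [mem_Ub.mp hu _ _ (h _ _ hij).le, Matrix.one_apply_ne]
  rintro rfl; exact absurd hij (lt_irrefl _)

lemma equiv_le_eq (π π' : Λ' ≃ Λ) (h : ∀ a, π a ≤ π' a) : π = π' := by
  let rk : Λ → ℕ := fun a => (univ.filter fun c => c < a).card
  have hrk : StrictMono rk := by
    intro a c h
    apply Finset.card_lt_card
    refine Finset.ssubset_iff_of_subset ?_ |>.mpr ⟨a, by simpa using h, by simp⟩
    intro x hx
    simp only [Finset.mem_filter, Finset.mem_univ, true_and] at hx ⊢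
    exact hx.trans h
  have h1 : ∑ a, rk (π a) = ∑ a, rk (π' a) := by rw [π.sum_comp rk, π'.sum_comp rk]
  have h2 := (Finset.sum_eq_sum_iff_of_le (s := univ) fun a _ => hrk.monotone (h a)).mp h1
  ext a
  exact hrk.injective (h2 a (Finset.mem_univ a))

/-- the gram relation: Weyl elements in distinct double cosets -/
lemma hat_coset (E : (Σ a, Fin (d a)) ≃ ι) (E' : (Σ a, Fin (d' a)) ≃ ι) (hd0 : ∀ a, 0 < d' a) (π π' : Λ' ≃ Λ)
    (hd : ∀ a, d (π a) = d' a) (hd' : ∀ a, d (π' a) = d' a) {p' p : GL ι F}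
    (hp' : p' ∈ Pb (bE E')) (hp : p ∈ Pb (bE E))
    (h : p' * (pm (hat E E' π hd))⁻¹ * p * pm (hat E E' π' hd') = 1) : π = π' := by
  apply equiv_le_eq
  intro a
  have h1 : p * pm (hat E E' π' hd') = pm (hat E E' π hd) * p'⁻¹ := by
    rw [mul_assoc, mul_assoc] at h
    have := eq_inv_of_mul_eq_one_right h
    rw [← this]; group
  have h2 := Pb_block_inv E' hp' a ⟨0, hd0 a⟩ ⟨0, hd0 a⟩
  rw [Matrix.one_apply_eq] at h2
  obtain ⟨m, -, hm⟩ := Finset.exists_ne_zero_of_sum_ne_zero (h2.trans_ne one_ne_zero)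
  have h3 : mx (p * pm (hat E E' π' hd')) (hat E E' π hd (E' ⟨a, m⟩)) (E' ⟨a, ⟨0, hd0 a⟩⟩) ≠ 0 := by
    rw [h1, mono_mul_left (pm_mono _), mx_pm, if_pos rfl, one_mul]
    exact right_ne_zero_of_mul hm
  rw [mono_mul_right (pm_mono _)] at h3
  have h4 := left_ne_zero_of_mul h3
  by_contra hlt
  push Not at hlt
  apply h4
  apply hp
  rw [bE_hat, bE_hat, bE_apply, bE_apply]
  exact hlt

/-- Levi part trivial -/
lemma tau_tens_mul (E : (Σ a, Fin (d a)) ≃ ι) (x : Π a, Al (GL (Fin (d a)) F)) (y : Al (GL ι F))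
    (hy : ∀ h : Π a, GL (Fin (d a)) F, h ≠ 1 → cf (Ph E h) y = 0) :
    tau (tens (Ph E) x * y) = (∏ a, tau (x a)) * tau y := by
  classical
  unfold tens
  rw [Finset.sum_mul, map_sum, Finset.sum_eq_single 1]
  · simp [dl_one, tau]
  · intro h _ hh
    rw [smul_mul_assoc, map_smul, tau_dl_mul, ← map_inv, hy _ (inv_ne_one.mpr hh), smul_zero]
  · simp

lemma cf_ev_ev (E : (Σ a, Fin (d a)) ≃ ι) (b' : ι → Λ') (hb : ∀ i j, bE E i = bE E j → b' j ≤ b' i)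
    (h : Π a, GL (Fin (d a)) F) (hh : h ≠ 1) :
    cf (Ph E h) (ev (Ub b') * ev (Ub (bE E))) = 0 := by
  classical
  rw [cf_mul]
  refine Finset.sum_eq_zero fun u _ => ?_
  rw [cf_av, cf_av]
  by_cases h1 : u ∈ Ub b'
  · refine mul_eq_zero_of_right _ (if_neg ?_)
    intro h2
    apply hh
    funext a
    apply gl_ext
    intro k l
    rw [Pi.one_apply, mx_one]
    have h3 := Ph_mul_right E h (u⁻¹ * Ph E h)⁻¹ a k (E ⟨a, l⟩)
    rw [mul_inv_rev, inv_inv, mul_inv_cancel_left] at h3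
    rw [mem_Ub.mp h1 _ _ (hb _ _ (by simp))] at h3
    have h4 := (Ub (bE E)).inv_mem h2
    rw [mul_inv_rev, inv_inv] at h4
    have h5 : ∀ m, mx ((Ph E h)⁻¹ * u) (E ⟨a, m⟩) (E ⟨a, l⟩) = (1 : Matrix (Fin (d a)) (Fin (d a)) F) m l := by
      intro m
      rw [mem_Ub.mp h4 _ _ (by simp), Matrix.one_apply, Matrix.one_apply]; simp
    simp only [h5] at h3
    simp [Matrix.one_apply] at h3
    rw [Matrix.one_apply]
    exact h3.symm
  · rw [if_neg h1, zero_mul]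

lemma card_Ub_inf (b : ι → Λ) (b' : ι → Λ') : Nat.card ((Ub b ⊓ Ub b' : Subgroup (GL ι F))) =
    Fintype.card F ^ (univ.filter fun p : ι × ι => b p.1 < b p.2 ∧ b' p.1 < b' p.2).card := by
  classical
  let e : ((Ub b ⊓ Ub b' : Subgroup (GL ι F))) ≃ ({p : ι × ι // b p.1 < b p.2 ∧ b' p.1 < b' p.2} → F) := by
    refine Equiv.ofBijective (fun u p => mx u.1 p.1.1 p.1.2) ⟨?_, ?_⟩
    · intro u v huv
      apply Subtype.ext
      apply gl_ext
      intro i j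
      by_cases h : b i < b j
      · by_cases h' : b' i < b' j
        · exact congrFun huv ⟨(i, j), h, h'⟩
        · push Not at h'
          rw [mem_Ub.mp u.2.2 i j h', mem_Ub.mp v.2.2 i j h']
      · push Not at h
        rw [mem_Ub.mp u.2.1 i j h, mem_Ub.mp v.2.1 i j h]
    · intro f
      obtain ⟨u, hu, hu'⟩ := mkU_exists (F := F) b
        (Matrix.of fun i j => if h : b i < b j ∧ b' i < b' j then f ⟨(i, j), h⟩ else 0) (by
          intro i j h
          exact dif_neg fun h' => absurd h'.1 (not_lt.mpr h))
      refine ⟨⟨u, hu, ?_⟩, ?_⟩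
      · intro i j h
        rw [hu', Matrix.add_apply, Matrix.of_apply, dif_neg fun h' => absurd h'.2 (not_lt.mpr h), add_zero]
      · funext p
        have hne : p.1.1 ≠ p.1.2 := by
          intro h'; have := p.2.1; rw [h'] at this; exact lt_irrefl _ this
        change mx u p.1.1 p.1.2 = f p
        rw [hu', Matrix.add_apply, Matrix.of_apply, dif_pos p.2, Matrix.one_apply_ne hne, zero_add]
  rw [Nat.card_congr e, Nat.card_eq_fintype_card, Fintype.card_fun, Fintype.card_subtype]

lemma tau_ev_ev {G : Type} [Group G] [Fintype G] (H K : Subgroup G) : tau (ev H * ev K) =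
    (Nat.card (H ⊓ K : Subgroup G) : ℂ) * ((Nat.card H : ℂ)⁻¹ * (Nat.card K : ℂ)⁻¹) := by
  classical
  rw [tau, cf_mul]
  have : ∀ h : G, cf h (ev H) * cf (h⁻¹ * 1) (ev K) = if h ∈ H ⊓ K then (Nat.card H : ℂ)⁻¹ * (Nat.card K : ℂ)⁻¹ else 0 := by
    intro h
    rw [mul_one h⁻¹, cf_av, cf_av, inv_mem_iff, Subgroup.mem_inf]
    by_cases h1 : h ∈ H <;> by_cases h2 : h ∈ K <;> simp [h1, h2]
  rw [Finset.sum_congr rfl fun h _ => this h, ← Finset.sum_filter, Finset.sum_const, nsmul_eq_mul,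
    Nat.card_eq_fintype_card (α := (H ⊓ K : Subgroup G)), Fintype.card_subtype]

end levi2
end
end HRV
end modH6

section modH7
set_option autoImplicit false
open scoped MatrixGroups
open Finset

namespace HRV
noncomputable section

section seq
variable (F : Type) [Field F] [Fintype F] [DecidableEq F]

/-- cuspidal sequences -/
structure Sq (Λ ι : Type) [LinearOrder Λ] [Fintype Λ] [Fintype ι] [DecidableEq ι] where
  ρ : Λ → Cusp F
  E : (Σ a, Fin (ρ a).d) ≃ ι

variable {F} {ι : Type} [Fintype ι] [DecidableEq ι]
variable {Λ Λ' : Type} [LinearOrder Λ] [Fintype Λ] [LinearOrder Λ'] [Fintype Λ']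

/-- block function -/
abbrev Sq.b (σ : Sq F Λ ι) : ι → Λ := bE σ.E

/-- Levi idempotent -/
def Sq.te (σ : Sq F Λ ι) : Al (GL ι F) := tens (Ph σ.E) (fun a => pe (σ.ρ a))

/-- unipotent average -/
abbrev Sq.u (σ : Sq F Λ ι) : Al (GL ι F) := ev (Ub σ.b)

/-- idempotent -/
def Sq.e (σ : Sq F Λ ι) : Al (GL ι F) := σ.te * σ.u

lemma Sq.te_idem (σ : Sq F Λ ι) : σ.te * σ.te = σ.te := by
  rw [Sq.te, tens_mul]; simp only [pe_idem]

lemma Sq.te_u (σ : Sq F Λ ι) : σ.te * σ.u = σ.u * σ.te := tens_ev _ _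

lemma Sq.e_eq (σ : Sq F Λ ι) : σ.e = σ.u * σ.te := σ.te_u

lemma Sq.u_idem (σ : Sq F Λ ι) : σ.u * σ.u = σ.u := ev_idem _

lemma Sq.e_def (σ : Sq F Λ ι) : σ.e = σ.te * σ.u := rfl

lemma Sq.e_idem (σ : Sq F Λ ι) : σ.e * σ.e = σ.e := by
  nth_rewrite 1 [Sq.e_eq]
  rw [Sq.e, ← mul_assoc, mul_assoc σ.u, σ.te_idem, ← σ.te_u, mul_assoc, σ.u_idem]

lemma Sq.e_u (σ : Sq F Λ ι) : σ.e * σ.u = σ.e := by rw [Sq.e, mul_assoc, σ.u_idem]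
lemma Sq.u_e (σ : Sq F Λ ι) : σ.u * σ.e = σ.e := by rw [Sq.e_eq, ← mul_assoc, σ.u_idem]
lemma Sq.e_te (σ : Sq F Λ ι) : σ.e * σ.te = σ.e := by rw [Sq.e_eq, mul_assoc, σ.te_idem]
lemma Sq.te_e (σ : Sq F Λ ι) : σ.te * σ.e = σ.e := by rw [Sq.e, ← mul_assoc, σ.te_idem]

lemma Sq.dl_e (σ : Sq F Λ ι) {u : GL ι F} (hu : u ∈ Ub σ.b) : dl u * σ.e = σ.e := by
  rw [Sq.e_eq, ← mul_assoc, ev_left hu]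

lemma Sq.e_dl (σ : Sq F Λ ι) {u : GL ι F} (hu : u ∈ Ub σ.b) : σ.e * dl u = σ.e := by
  rw [Sq.e, mul_assoc, ev_right hu]

lemma Sq.dl_Ph_u (σ : Sq F Λ ι) (l : Π a, GL (Fin (σ.ρ a).d) F) : dl (Ph σ.E l) * σ.u = σ.u * dl (Ph σ.E l) :=
  ev_Lb (Ph_mem _ _)

lemma Sq.te_tens_te (σ : Sq F Λ ι) (x : Π a, Al (GL (Fin (σ.ρ a).d) F)) :
    σ.te * tens (Ph σ.E) x * σ.te = (∏ a, lam (σ.ρ a) (x a)) • σ.te := by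
  rw [Sq.te, tens_mul, tens_mul]
  simp only [pe_mul]
  rw [tens_smul]

lemma Sq.e_tens_e (σ : Sq F Λ ι) (x : Π a, Al (GL (Fin (σ.ρ a).d) F)) :
    σ.e * tens (Ph σ.E) x * σ.e = (∏ a, lam (σ.ρ a) (x a)) • σ.e := by
  have : σ.e * tens (Ph σ.E) x * σ.e = σ.u * (σ.te * tens (Ph σ.E) x * σ.te) * σ.u := by
    nth_rewrite 1 [Sq.e_eq]
    rw [Sq.e]; simp only [mul_assoc]
  rw [this, σ.te_tens_te, mul_smul_comm, smul_mul_assoc, ← Sq.e_eq, σ.e_u]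

lemma Sq.tau_e (σ : Sq F Λ ι) : tau σ.e = (∏ a, (hC (σ.ρ a))⁻¹) * (Nat.card (Ub σ.b : Subgroup (GL ι F)) : ℂ)⁻¹ := by
  have h0 : σ.u = ev (Ub σ.b) * ev (Ub σ.b) := (ev_idem _).symm
  rw [Sq.e, h0, Sq.te, tau_tens_mul, ev_idem, tau_av (isCh_one _)]
  · simp only [tau_pe]
  · intro h hh
    exact cf_ev_ev σ.E (bE σ.E) (fun i j h => h.symm.le) h hh

lemma Sq.e_ne (σ : Sq F Λ ι) : σ.e ≠ 0 := by
  intro h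
  have := σ.tau_e
  rw [h, map_zero] at this
  have h1 : ∏ a, (hC (σ.ρ a))⁻¹ ≠ 0 := Finset.prod_ne_zero_iff.mpr fun a _ => inv_ne_zero (hC_ne _)
  exact mul_ne_zero h1 (inv_ne_zero (cardH_ne _)) this.symm

lemma Sq.sup_e (σ : Sq F Λ ι) : Sup (Pb σ.b) σ.e :=
  Sup_mul (Sup_tens _ (fun h => Lb_le_Pb _ (Ph_mem _ h)) _) (Sup_av (Ub_le_Pb _))

/-- reindexed sequence -/
def Sq.re (σ : Sq F Λ ι) (π : Λ' ≃ Λ) : Sq F Λ' ι := ⟨fun a => σ.ρ (π a), reE σ.E π⟩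

lemma Sq.te_re (σ : Sq F Λ ι) (π : Λ' ≃ Λ) : (σ.re π).te = σ.te :=
  tens_reE σ.E π (fun a => pe (σ.ρ a))

/-- move the Levi part of a parabolic element next to the idempotent -/
lemma Sq.e_P (σ : Sq F Λ ι) {p : GL ι F} (hp : p ∈ Pb σ.b) : ∃ l, σ.e * dl p = σ.e * dl (Ph σ.E l) := by
  obtain ⟨u, hu, h⟩ := Pb_decomp σ.E hp
  refine ⟨blkP σ.E p hp, ?_⟩
  conv_lhs => rw [h]
  rw [dl_mul, ← mul_assoc, Sq.e, mul_assoc σ.te, ← σ.dl_Ph_u, mul_assoc, mul_assoc, ev_right hu]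

lemma Sq.P_e (σ : Sq F Λ ι) {p : GL ι F} (hp : p ∈ Pb σ.b) : ∃ l, dl p * σ.e = dl (Ph σ.E l) * σ.e := by
  obtain ⟨u, hu, h⟩ := Pb_decomp σ.E hp
  refine ⟨blkP σ.E p hp, ?_⟩
  conv_lhs => rw [h]
  rw [dl_mul, mul_assoc, σ.dl_e hu]

/-- single-block element -/
lemma Ph_single_entry {d : Λ → ℕ} (E : (Σ a, Fin (d a)) ≃ ι) (a : Λ) (v : GL (Fin (d a)) F) (i j : ι)
    (h : ∀ k l, i = E ⟨a, k⟩ → j = E ⟨a, l⟩ → mx v k l = (1 : Matrix (Fin (d a)) (Fin (d a)) F) k l) :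
    mx (Ph E (Pi.mulSingle a v)) i j = (1 : Matrix ι ι F) i j := by
  obtain ⟨c, k, rfl⟩ := E_ind E i
  by_cases hj : bE E j = c
  · obtain ⟨l, rfl⟩ := bE_eq E hj
    rw [Ph_same]
    by_cases hc : c = a
    · subst hc
      rw [Pi.mulSingle_eq_same, h k l rfl rfl, Matrix.one_apply, Matrix.one_apply]; simp
    · rw [Pi.mulSingle_eq_of_ne hc, mx_one, Matrix.one_apply, Matrix.one_apply]; simp
  · rw [Ph_ne _ _ (by rw [bE_apply]; exact fun h' => hj h'.symm), Matrix.one_apply_ne]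
    rintro rfl; exact hj (by simp)

open Classical in
/-- averaging over one block -/
lemma tens_single_eq {d : Λ → ℕ} (E : (Σ a, Fin (d a)) ≃ ι) (a : Λ) (H : Subgroup (GL (Fin (d a)) F)) :
  tens (Ph E) (Function.update (fun c => 1) a (ev H)) =
      (Nat.card H : ℂ)⁻¹ • ∑ v : GL (Fin (d a)) F, if v ∈ H then dl (Ph E (Pi.mulSingle a v)) else 0 := by
    let Φ := (Ph E : (Π a, GL (Fin (d a)) F) →* GL ι F)
    unfold tens
    rw [Finset.smul_sum]
    symm
    have hinj : Function.Injective (fun v : GL (Fin (d a)) F => (Pi.mulSingle a v : Π c, GL (Fin (d c)) F)) :=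
      fun v v' h => by simpa using congrFun h a
    refine Finset.sum_of_injOn (fun v => Pi.mulSingle a v) (hinj.injOn) (fun v _ => by simp) ?_ ?_
    · intro h _ hh
      have : ∃ c, c ≠ a ∧ h c ≠ 1 := by
        by_contra hcon
        push Not at hcon
        apply hh
        refine ⟨h a, by simp, ?_⟩
        funext c
        by_cases hc : c = a
        · subst hc; simp
        · simp [hc, hcon c hc]
      obtain ⟨c, hc, hc'⟩ := this
      rw [Finset.prod_eq_zero (Finset.mem_univ c), zero_smul]
      rw [Function.update_of_ne hc, ← dl_one, cf_dl, if_neg]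
      first | exact fun h => hc' h.symm | exact hc'
    · intro v _
      rw [Finset.prod_eq_single a]
      · rw [Function.update_self, Pi.mulSingle_eq_same, cf_av]
        split_ifs <;> simp
      · intro c _ hc
        rw [Function.update_of_ne hc, Pi.mulSingle_eq_of_ne hc, ← dl_one, cf_dl, if_pos rfl]
      · simp

lemma tens_single_ev {d : Λ → ℕ} (E : (Σ a, Fin (d a)) ≃ ι) (a : Λ) (H : Subgroup (GL (Fin (d a)) F)) (Y : Al (GL ι F))
    (hY : ∀ v ∈ H, dl (Ph E (Pi.mulSingle a v)) * Y = Y) :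
    tens (Ph E) (Function.update (fun c => 1) a (ev H)) * Y = Y := by
  classical
  rw [tens_single_eq, smul_mul_assoc, Finset.sum_mul]
  have h2 : ∀ v : GL (Fin (d a)) F, (if v ∈ H then dl (Ph E (Pi.mulSingle a v)) else 0) * Y = if v ∈ H then Y else 0 := by
    intro v; split_ifs with h
    · exact hY v h
    · simp
  rw [Finset.sum_congr rfl fun v _ => h2 v, ← Finset.sum_filter, Finset.sum_const, ← Nat.cast_smul_eq_nsmul ℂ, smul_smul,
    ← Fintype.card_subtype, ← Nat.card_eq_fintype_card, inv_mul_cancel₀, one_smul]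
  exact cardH_ne H

lemma tens_single_ev' {d : Λ → ℕ} (E : (Σ a, Fin (d a)) ≃ ι) (a : Λ) (H : Subgroup (GL (Fin (d a)) F)) (Y : Al (GL ι F))
    (hY : ∀ v ∈ H, Y * dl (Ph E (Pi.mulSingle a v)) = Y) :
    Y * tens (Ph E) (Function.update (fun c => 1) a (ev H)) = Y := by
  classical
  rw [tens_single_eq, mul_smul_comm, Finset.mul_sum]
  have h2 : ∀ v : GL (Fin (d a)) F, Y * (if v ∈ H then dl (Ph E (Pi.mulSingle a v)) else 0) = if v ∈ H then Y else 0 := by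
    intro v; split_ifs with h
    · exact hY v h
    · simp
  rw [Finset.sum_congr rfl fun v _ => h2 v, ← Finset.sum_filter, Finset.sum_const, ← Nat.cast_smul_eq_nsmul ℂ, smul_smul,
    ← Fintype.card_subtype, ← Nat.card_eq_fintype_card, inv_mul_cancel₀, one_smul]
  exact cardH_ne H


/-- threshold function -/
lemma thresh {m : ℕ} {Λ0 : Type} [LinearOrder Λ0] (f : Fin m → Λ0) {k0 k1 : Fin m} (h : f k0 ≠ f k1) :
    ∃ β : Fin m → Bool, (∃ k l, β k ≠ β l) ∧ ∀ k l, f l ≤ f k → β l ≤ β k := by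
  classical
  refine ⟨fun k => decide (min (f k0) (f k1) < f k), ?_, ?_⟩
  · rcases lt_or_gt_of_ne h with h | h
    · exact ⟨k0, k1, by simp [h, h.le]⟩
    · exact ⟨k0, k1, by simp [h, h.le]⟩
  · intro k l hkl
    simp only [Bool.le_iff_imp, decide_eq_true_eq]
    intro h'; exact lt_of_lt_of_le h' hkl

lemma kill_left (σ : Sq F Λ ι) (σ' : Sq F Λ' ι) {n : GL ι F} {w : Equiv.Perm ι} (hn : IsMono n w)
    (l : Π a, GL (Fin (σ.ρ a).d) F) (l' : Π a, GL (Fin (σ'.ρ a).d) F) (a : Λ) {k0 k1 : Fin (σ.ρ a).d}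
    (h : σ'.b (w.symm (σ.E ⟨a, k0⟩)) ≠ σ'.b (w.symm (σ.E ⟨a, k1⟩))) :
    σ.te * dl (Ph σ.E l) * dl n * dl (Ph σ'.E l') * σ'.u = 0 := by
  obtain ⟨β, hβ, hβ'⟩ := thresh (fun k => σ'.b (w.symm (σ.E ⟨a, k⟩))) h
  set Y := dl n * dl (Ph σ'.E l') * σ'.u with hYdef
  have hY : ∀ v ∈ (Ub β : Subgroup (GL (Fin (σ.ρ a).d) F)), dl (Ph σ.E (Pi.mulSingle a v)) * Y = Y := by
    intro v hv
    have hx : Ph σ.E (Pi.mulSingle a v) ∈ Ub (fun i => σ'.b (w.symm i)) := by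
      intro i j hij
      apply Ph_single_entry
      rintro k l rfl rfl
      exact mem_Ub.mp hv _ _ (hβ' _ _ hij)
    have hx' : n⁻¹ * Ph σ.E (Pi.mulSingle a v) * n ∈ Ub σ'.b := by
      rw [mono_Ub hn (b := σ'.b) (b' := fun i => σ'.b (w.symm i)) (by intro i j; simp)]
      convert hx using 1
      group
    have h1 : Ph σ.E (Pi.mulSingle a v) * n = n * (n⁻¹ * Ph σ.E (Pi.mulSingle a v) * n) := by group
    rw [hYdef, ← mul_assoc, ← mul_assoc, ← dl_mul, h1, dl_mul, mul_assoc, σ'.dl_Ph_u, mul_assoc (dl n), ← mul_assoc (dl (n⁻¹ * _ * _)),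
      ev_left hx', ← σ'.dl_Ph_u, mul_assoc]
  have h2 := tens_single_ev σ.E a (Ub β) Y hY
  have h3 : σ.te * dl (Ph σ.E l) * dl n * dl (Ph σ'.E l') * σ'.u = σ.te * dl (Ph σ.E l) * Y := by
    rw [hYdef]; simp only [mul_assoc]
  rw [h3, ← h2, ← mul_assoc, Sq.te, ← tens_dl, tens_mul, tens_mul, tens_zero (a := a), zero_mul]
  simp only [Function.update_self]
  exact pe_kill _ _ hβ

lemma kill_right (σ : Sq F Λ ι) (σ' : Sq F Λ' ι) {n : GL ι F} {w : Equiv.Perm ι} (hn : IsMono n w)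
    (l : Π a, GL (Fin (σ.ρ a).d) F) (l' : Π a, GL (Fin (σ'.ρ a).d) F) (a : Λ') {k0 k1 : Fin (σ'.ρ a).d}
    (h : σ.b (w (σ'.E ⟨a, k0⟩)) ≠ σ.b (w (σ'.E ⟨a, k1⟩))) :
    σ.u * dl (Ph σ.E l) * dl n * dl (Ph σ'.E l') * σ'.te = 0 := by
  obtain ⟨β, hβ, hβ'⟩ := thresh (fun k => σ.b (w (σ'.E ⟨a, k⟩))) h
  set Y := σ.u * dl (Ph σ.E l) * dl n with hYdef
  have hY : ∀ v ∈ (Ub β : Subgroup (GL (Fin (σ'.ρ a).d) F)), Y * dl (Ph σ'.E (Pi.mulSingle a v)) = Y := by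
    intro v hv
    have hx : Ph σ'.E (Pi.mulSingle a v) ∈ Ub (fun i => σ.b (w i)) := by
      intro i j hij
      apply Ph_single_entry
      rintro k l rfl rfl
      exact mem_Ub.mp hv _ _ (hβ' _ _ hij)
    have hx' : n * Ph σ'.E (Pi.mulSingle a v) * n⁻¹ ∈ Ub σ.b := by
      rwa [← mono_Ub hn (b := fun i => σ.b (w i)) (b' := σ.b) (by intro i j; simp)]
    have h1 : n * Ph σ'.E (Pi.mulSingle a v) = (n * Ph σ'.E (Pi.mulSingle a v) * n⁻¹) * n := by group
    rw [hYdef, mul_assoc, ← dl_mul, h1, dl_mul, ← σ.dl_Ph_u, ← mul_assoc, mul_assoc (dl _), ev_right hx']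
  have h2 := tens_single_ev' σ'.E a (Ub β) Y hY
  rw [← h2, Sq.te, ← tens_dl, mul_assoc, tens_mul, mul_assoc, tens_mul, tens_zero (a := a), mul_zero]
  simp only [Function.update_self]
  rw [← mul_assoc]
  exact kill_pe _ _ hβ

lemma cusp_ne {X Y : Cusp F} (hd : X.d = Y.d) (h : X ≠ Y) (g : Al (GL (Fin X.d) F)) (g' : Al (GL (Fin Y.d) F)) :
    pe X * g * (hd.symm ▸ (g' * pe Y)) = 0 := by
  obtain ⟨d, hd0, i, hi⟩ := X
  obtain ⟨d', hd0', j, hj⟩ := Y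
  simp only at hd
  subst hd
  have hij : j ≠ i := by rintro rfl; exact h rfl
  change pe ⟨d, hd0, i, hi⟩ * g * (g' * pe ⟨d, hd0, j, hj⟩) = 0
  rw [← mul_assoc, mul_assoc _ g]
  exact pe_ne ⟨d, hd0, i, hi⟩ hij _ _

/-- matchings of two sequences -/
abbrev Mtch (σ : Sq F Λ ι) (σ' : Sq F Λ' ι) : Type := {π : Λ' ≃ Λ // ∀ a, σ.ρ (π a) = σ'.ρ a}

/-- Weyl element -/
def wh (σ : Sq F Λ ι) (σ' : Sq F Λ' ι) (π : Mtch σ σ') : Equiv.Perm ι :=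
  hat σ.E σ'.E π.1 (fun a => congrArg Cusp.d (π.2 a))

/-- basis element -/
def tB (σ : Sq F Λ ι) (σ' : Sq F Λ' ι) (π : Mtch σ σ') : Al (GL ι F) := σ.e * dl (pm (wh σ σ' π)) * σ'.e

lemma bE_wh (σ : Sq F Λ ι) (σ' : Sq F Λ' ι) (π : Mtch σ σ') (i : ι) : σ.b (wh σ σ' π i) = π.1 (σ'.b i) :=
  bE_hat _ _ _ _ _

lemma hat0_te (ρ ρ' : Λ → Cusp F) (h : ρ = ρ') (E : (Σ a, Fin (ρ a).d) ≃ ι) (E' : (Σ a, Fin (ρ' a).d) ≃ ι)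
    (hd : ∀ a, (ρ a).d = (ρ' a).d) :
    tens (Ph E) (fun a => pe (ρ a)) * dl (pm (hat0 E E' hd)) = dl (pm (hat0 E E' hd)) * tens (Ph E') (fun a => pe (ρ' a)) := by
  subst h
  exact (pm_hat0_tens' E E' hd _).symm

lemma te_wh (σ : Sq F Λ ι) (σ' : Sq F Λ' ι) (π : Mtch σ σ') :
    σ.te * dl (pm (wh σ σ' π)) = dl (pm (wh σ σ' π)) * σ'.te := by
  rw [← σ.te_re π.1]
  exact hat0_te (σ.re π.1).ρ σ'.ρ (funext π.2) (reE σ.E π.1) σ'.E (fun a => congrArg Cusp.d (π.2 a))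

lemma b_surj (σ : Sq F Λ ι) (a : Λ) : ∃ i, σ.b i = a := ⟨σ.E ⟨a, ⟨0, (σ.ρ a).hd⟩⟩, by simp⟩

lemma span_key (ρ ρ' : Λ' → Cusp F) (h : ρ = ρ') (E : (Σ a, Fin (ρ a).d) ≃ ι) (E' : (Σ a, Fin (ρ' a).d) ≃ ι)
    (hd : ∀ a, (ρ a).d = (ρ' a).d) (l : Π a, GL (Fin (ρ a).d) F) (l' : Π a, GL (Fin (ρ' a).d) F) :
    tens (Ph E) (fun a => pe (ρ a)) * dl (Ph E l) * dl (pm (hat0 E E' hd)) * dl (Ph E' l') * tens (Ph E') (fun a => pe (ρ' a)) ∈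
    Submodule.span ℂ {tens (Ph E) (fun a => pe (ρ a)) * dl (pm (hat0 E E' hd)) * tens (Ph E') (fun a => pe (ρ' a))} := by
  subst h
  have h1 : dl (pm (hat0 E E' hd)) * (dl (Ph E' l') * tens (Ph E') (fun a => pe (ρ a))) =
      tens (Ph E) (fun a => dl (l' a) * pe (ρ a)) * dl (pm (hat0 E E' hd)) := by
    rw [← tens_dl, tens_mul, pm_hat0_tens' E E' hd]
  have h3 : (fun a => pe (ρ a) * dl (l a) * (dl (l' a) * pe (ρ a))) = fun a => lam (ρ a) (dl (l a) * dl (l' a)) • pe (ρ a) :=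
    funext fun a => by rw [← pe_mul]; simp only [mul_assoc]
  have h4 : tens (Ph E) (fun a => pe (ρ a)) * dl (pm (hat0 E E' hd)) * tens (Ph E') (fun a => pe (ρ a)) =
      tens (Ph E) (fun a => pe (ρ a)) * dl (pm (hat0 E E' hd)) := by
    rw [mul_assoc, pm_hat0_tens' E E' hd, ← mul_assoc, tens_mul]
    simp only [pe_idem]
  rw [h4, mul_assoc, mul_assoc, h1, ← mul_assoc, ← tens_dl, tens_mul, tens_mul, h3, tens_smul, smul_mul_assoc]
  exact Submodule.smul_mem _ _ (Submodule.subset_span rfl)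

lemma span_mono (σ : Sq F Λ ι) (σ' : Sq F Λ' ι) {n : GL ι F} {w : Equiv.Perm ι} (hn : IsMono n w)
    (l : Π a, GL (Fin (σ.ρ a).d) F) (l' : Π a, GL (Fin (σ'.ρ a).d) F) :
    σ.e * dl (Ph σ.E l) * dl n * dl (Ph σ'.E l') * σ'.e ∈ Submodule.span ℂ (Set.range (tB σ σ')) := by
  by_cases hL : ∃ a, ∃ k0 k1, σ'.b (w.symm (σ.E ⟨a, k0⟩)) ≠ σ'.b (w.symm (σ.E ⟨a, k1⟩))
  · obtain ⟨a, k0, k1, h⟩ := hL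
    have := kill_left σ σ' hn l l' a h
    rw [Sq.e_eq, Sq.e_eq, ← mul_assoc, mul_assoc σ.u, mul_assoc σ.u, mul_assoc σ.u, mul_assoc σ.u, this]
    simp
  by_cases hR : ∃ a, ∃ k0 k1, σ.b (w (σ'.E ⟨a, k0⟩)) ≠ σ.b (w (σ'.E ⟨a, k1⟩))
  · obtain ⟨a, k0, k1, h⟩ := hR
    have := kill_right σ σ' hn l l' a h
    rw [Sq.e, Sq.e, ← mul_assoc, mul_assoc σ.te, mul_assoc σ.te, mul_assoc σ.te, mul_assoc σ.te, this]
    simp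
  push Not at hL hR
  have hL' : ∀ i j, σ.b i = σ.b j → σ'.b (w.symm i) = σ'.b (w.symm j) := by
    intro i j hij
    obtain ⟨a, k, rfl⟩ := E_ind σ.E i
    obtain ⟨k', rfl⟩ := bE_eq _ (hij.symm.trans (bE_apply _ _ _))
    exact hL _ _ _
  have hR' : ∀ i j, σ'.b i = σ'.b j → σ.b (w i) = σ.b (w j) := by
    intro i j hij
    obtain ⟨a, k, rfl⟩ := E_ind σ'.E i
    obtain ⟨k', rfl⟩ := bE_eq _ (hij.symm.trans (bE_apply _ _ _))
    exact hR _ _ _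
  obtain ⟨s, hs⟩ : ∃ s : Λ → ι, ∀ a, σ.b (s a) = a := ⟨_, fun a => (b_surj σ a).choose_spec⟩
  obtain ⟨s', hs'⟩ : ∃ s : Λ' → ι, ∀ a, σ'.b (s a) = a := ⟨_, fun a => (b_surj σ' a).choose_spec⟩
  let π : Λ' ≃ Λ :=
    { toFun := fun a => σ.b (w (s' a))
      invFun := fun a => σ'.b (w.symm (s a))
      left_inv := fun a => by
        have := hL' (s (σ.b (w (s' a)))) (w (s' a)) (hs _)
        exact this.trans (by simp [hs'])
      right_inv := fun a => by
        have := hR' (s' (σ'.b (w.symm (s a)))) (w.symm (s a)) (hs' _)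
        exact this.trans (by simp [hs]) }
  have hπ : ∀ i, σ.b (w i) = π (σ'.b i) := fun i => (hR' _ _ (hs' _)).symm
  have hd : ∀ a, (σ.ρ (π a)).d = (σ'.ρ a).d := by
    intro a
    have c1 : ∀ a, Fintype.card {i // σ.b i = a} = (σ.ρ a).d := by
      intro a
      rw [← Fintype.card_fin (σ.ρ a).d]
      refine (Fintype.card_congr (Equiv.ofBijective (fun k => ⟨σ.E ⟨a, k⟩, by simp⟩) ⟨?_, ?_⟩)).symm
      · intro k k' h; simpa using h
      · rintro ⟨i, hi⟩
        obtain ⟨k, rfl⟩ := bE_eq _ hi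
        exact ⟨k, rfl⟩
    have c2 : ∀ a, Fintype.card {i // σ'.b i = a} = (σ'.ρ a).d := by
      intro a
      rw [← Fintype.card_fin (σ'.ρ a).d]
      refine (Fintype.card_congr (Equiv.ofBijective (fun k => ⟨σ'.E ⟨a, k⟩, by simp⟩) ⟨?_, ?_⟩)).symm
      · intro k k' h; simpa using h
      · rintro ⟨i, hi⟩
        obtain ⟨k, rfl⟩ := bE_eq _ hi
        exact ⟨k, rfl⟩
    rw [← c1, ← c2]
    refine (Fintype.card_congr (w.subtypeEquiv fun i => ?_)).symm
    rw [hπ]; simp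
  set wt := hat σ.E σ'.E π hd with hwt
  have hLb : n * (pm wt)⁻¹ ∈ Lb (bE (reE σ.E π)) := by
    intro i j hij
    obtain ⟨j, rfl⟩ := wt.surjective j
    rw [← pm_inv, mono_mul_right (pm_mono _)]
    refine mul_eq_zero_of_left (hn _ _ ?_) _
    have hww : wt⁻¹ (wt j) = j := wt.symm_apply_apply j
    rw [hww]
    rintro rfl
    apply hij
    apply π.injective
    rw [bE_reE, bE_reE, bE_hat]
    exact hπ j
  obtain ⟨l2, hl2⟩ := Lb_decomp _ hLb
  have hn2 : n = Ph (reE σ.E π) l2 * pm wt := by rw [← hl2]; group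
  have e1 : σ.e * dl (Ph σ.E l) * dl n * dl (Ph σ'.E l') * σ'.e =
      σ.u * ((σ.re π).te * dl (Ph (reE σ.E π) ((fun a => l (π a)) * l2)) * dl (pm wt) * dl (Ph σ'.E l') * σ'.te) * σ'.u := by
    rw [σ.e_eq, σ'.e_def, hn2, map_mul, Ph_reE, σ.te_re, dl_mul, dl_mul]
    simp only [mul_assoc]
  rw [e1]
  by_cases hρ : ∀ a, σ.ρ (π a) = σ'.ρ a
  · have hm : (σ.re π).te * dl (Ph (reE σ.E π) ((fun a => l (π a)) * l2)) * dl (pm wt) * dl (Ph σ'.E l') * σ'.te ∈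
        Submodule.span ℂ {(σ.re π).te * dl (pm wt) * σ'.te} := by
      clear e1 hl2 hn2 hLb
      exact span_key (σ.re π).ρ σ'.ρ (funext hρ) _ _ _ _ _
    obtain ⟨c, hc⟩ := Submodule.mem_span_singleton.mp hm
    rw [← hc, mul_smul_comm, smul_mul_assoc]
    refine Submodule.smul_mem _ _ (Submodule.subset_span ⟨⟨π, hρ⟩, ?_⟩)
    rw [tB, σ.e_eq, σ'.e_def, σ.te_re]
    simp only [mul_assoc]
    rfl
  · push Not at hρ
    obtain ⟨a, ha⟩ := hρ
    have h0 := hat0_kill (funext hd : (fun a => (σ.ρ (π a)).d) = fun a => (σ'.ρ a).d) hd (reE σ.E π) σ'.E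
      (fun a => pe (σ.ρ (π a))) (fun a => pe (σ'.ρ a)) ((fun a => l (π a)) * l2) l' a
      (fun g g' => cusp_ne (hd a) ha g g')
    have : (σ.re π).te * dl (Ph (reE σ.E π) ((fun a => l (π a)) * l2)) * dl (pm wt) * dl (Ph σ'.E l') * σ'.te = 0 := h0
    rw [this]; simp

lemma span_tB (σ : Sq F Λ ι) (σ' : Sq F Λ' ι) (g : GL ι F) :
    σ.e * dl g * σ'.e ∈ Submodule.span ℂ (Set.range (tB σ σ')) := by
  obtain ⟨r, hr, hr'⟩ := exists_refine σ.b
  obtain ⟨c, hc, hc'⟩ := exists_refine σ'.b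
  obtain ⟨u, hu, v, hv, n, w, hn, rfl⟩ := bruhat r c hr hc g
  obtain ⟨l, hl⟩ := σ.e_P (Ub_refine hr' hu)
  obtain ⟨l', hl'⟩ := σ'.P_e (Ub_refine hc' hv)
  have := span_mono σ σ' hn l l'
  rw [dl_mul, dl_mul, ← mul_assoc, ← mul_assoc, hl, mul_assoc, hl', ← mul_assoc]
  exact this

lemma gram_ne (σ : Sq F Λ ι) (σ' : Sq F Λ' ι) (π π' : Mtch σ σ') (h : π ≠ π') :
    tau (σ'.e * dl (pm (wh σ σ' π))⁻¹ * σ.e * tB σ σ' π') = 0 := by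
  have e1 : tau (σ'.e * dl (pm (wh σ σ' π))⁻¹ * σ.e * tB σ σ' π') =
      tau (σ'.e * dl (pm (wh σ σ' π))⁻¹ * σ.e * dl (pm (wh σ σ' π'))) := by
    rw [tB, ← mul_assoc, tau_mul_comm, ← mul_assoc, ← mul_assoc, ← mul_assoc, ← mul_assoc, σ'.e_idem,
      mul_assoc _ σ.e σ.e, σ.e_idem]
  rw [e1]
  apply tau_Sup σ'.sup_e σ.sup_e
  intro p' hp' p hp h1
  exact h (Subtype.ext (hat_coset σ.E σ'.E (fun a => (σ'.ρ a).hd) π.1 π'.1 _ _ hp' hp h1))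

lemma gram_self (σ : Sq F Λ ι) (σ' : Sq F Λ' ι) (π : Mtch σ σ') :
    tau (σ'.e * dl (pm (wh σ σ' π))⁻¹ * σ.e * tB σ σ' π) =
      (∏ a, (hC (σ'.ρ a))⁻¹) * tau (ev (Ub (fun i => σ.b (wh σ σ' π i)) : Subgroup (GL ι F)) * σ'.u) := by
  have e1 : tau (σ'.e * dl (pm (wh σ σ' π))⁻¹ * σ.e * tB σ σ' π) =
      tau (σ'.e * dl (pm (wh σ σ' π))⁻¹ * (σ.e * dl (pm (wh σ σ' π)))) := by
    rw [tB, ← mul_assoc, tau_mul_comm, ← mul_assoc, ← mul_assoc, ← mul_assoc, ← mul_assoc, σ'.e_idem,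
      mul_assoc _ σ.e σ.e, σ.e_idem, mul_assoc _ σ.e]
  have e2 : σ.e * dl (pm (wh σ σ' π)) = dl (pm (wh σ σ' π)) * (σ'.te * ev (Ub (fun i => σ.b (wh σ σ' π i)))) := by
    have h1 : σ.u * dl (pm (wh σ σ' π)) = dl (pm (wh σ σ' π)) * ev (Ub (fun i => σ.b (wh σ σ' π i))) :=
      (ev_mono (pm_mono _) (fun i j => by simp)).symm
    rw [σ.e_def, mul_assoc, h1, ← mul_assoc, te_wh, ← mul_assoc]
  rw [e1, e2, mul_assoc, ← mul_assoc (dl _), dl_inv_mul, one_mul, tau_mul_comm, σ'.e_eq, ← mul_assoc, tau_mul_comm, mul_assoc σ'.te,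
    ← mul_assoc σ'.te, σ'.te_idem, Sq.te, tau_tens_mul]
  · simp only [tau_pe]
  · intro h hh
    exact cf_ev_ev σ'.E (fun i => σ.b (wh σ σ' π i))
      (fun i j hij => by rw [bE_wh, bE_wh]; exact (congrArg π.1 hij).symm.le) h hh

end seq
end
end HRV
end modH7

section modH8
set_option autoImplicit false
open scoped MatrixGroups
open Finset

namespace HRV
noncomputable section

section mackey
variable {F : Type} [Field F] [Fintype F] [DecidableEq F]
variable {ι : Type} [Fintype ι] [DecidableEq ι]
variable {Λ Λ' : Type} [LinearOrder Λ] [Fintype Λ] [LinearOrder Λ'] [Fintype Λ']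

instance (σ : Sq F Λ ι) (σ' : Sq F Λ' ι) : Fintype (Mtch σ σ') := Fintype.ofFinite _

/-- the Gram value -/
def grv (σ : Sq F Λ ι) (σ' : Sq F Λ' ι) (π : Mtch σ σ') : ℂ :=
  tau (σ'.e * dl (pm (wh σ σ' π))⁻¹ * σ.e * tB σ σ' π)

lemma grv_ne (σ : Sq F Λ ι) (σ' : Sq F Λ' ι) (π : Mtch σ σ') : grv σ σ' π ≠ 0 := by
  rw [grv, gram_self, tau_ev_ev]
  refine mul_ne_zero (Finset.prod_ne_zero_iff.mpr fun a _ => inv_ne_zero (hC_ne _))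
    (mul_ne_zero (cardH_ne _) (mul_ne_zero (inv_ne_zero (cardH_ne _)) (inv_ne_zero (cardH_ne _))))

/-- Mackey dual bases -/
def mackey (σ : Sq F Λ ι) (σ' : Sq F Λ' ι) : DB σ.e σ'.e (Mtch σ σ') where
  T := tB σ σ'
  S := fun π => (grv σ σ' π)⁻¹ • (σ'.e * dl (pm (wh σ σ' π))⁻¹ * σ.e)
  t := 1
  he := σ.e_idem
  hf := σ'.e_idem
  ht := one_ne_zero
  eT := fun π => by
    rw [tB, ← mul_assoc, ← mul_assoc, σ.e_idem, mul_assoc _ σ'.e, σ'.e_idem]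
  eS := fun π => by
    rw [mul_smul_comm, smul_mul_assoc, ← mul_assoc, ← mul_assoc, σ'.e_idem, mul_assoc _ σ.e, σ.e_idem]
  gram_self := fun π => by
    rw [smul_mul_assoc, map_smul, smul_eq_mul]
    exact inv_mul_cancel₀ (grv_ne σ σ' π)
  gram_ne := fun π π' h => by
    rw [smul_mul_assoc, map_smul, gram_ne _ _ _ _ h, smul_zero]
  span := fun g => span_tB σ σ' g

lemma mackey_count (σ : Sq F Λ ι) (σ' : Sq F Λ' ι) :
    ∑ i : Irr (GL ι F), rk i σ.e * rk i σ'.e = Fintype.card (Mtch σ σ') := by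
  have := (mackey σ σ').count
  simp only [ch_idem _ σ.e_idem, ch_idem _ σ'.e_idem] at this
  exact_mod_cast this

lemma mackey_disj (σ : Sq F Λ ι) (σ' : Sq F Λ' ι) (h : IsEmpty (Mtch σ σ')) (i : Irr (GL ι F))
    (h1 : rk i σ.e ≠ 0) : rk i σ'.e = 0 := by
  have := mackey_count σ σ'
  rw [Fintype.card_eq_zero, Finset.sum_eq_zero_iff] at this
  exact (mul_eq_zero.mp (this i (Finset.mem_univ _))).resolve_left h1

lemma mackey_same (σ : Sq F Λ ι) (σ' : Sq F Λ' ι) (π : Mtch σ σ') (i : Irr (GL ι F)) :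
    rk i σ.e = rk i σ'.e := by
  have e1 : Fintype.card (Mtch σ σ) = Fintype.card (Mtch σ σ') := by
    refine Fintype.card_congr ⟨fun κ => ⟨π.1.trans κ.1, fun a => (κ.2 _).trans (π.2 a)⟩,
      fun κ => ⟨π.1.symm.trans κ.1, fun a => (κ.2 _).trans ?_⟩, fun κ => ?_, fun κ => ?_⟩
    · rw [← π.2]; simp
    · apply Subtype.ext; ext; simp
    · apply Subtype.ext; ext; simp
  have e2 : Fintype.card (Mtch σ' σ') = Fintype.card (Mtch σ σ') := by
    refine Fintype.card_congr ⟨fun κ => ⟨κ.1.trans π.1, fun a => (π.2 _).trans (κ.2 a)⟩,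
      fun κ => ⟨κ.1.trans π.1.symm, fun a => ?_⟩, fun κ => ?_, fun κ => ?_⟩
    · have h := π.2 (π.1.symm (κ.1 a))
      rw [Equiv.apply_symm_apply] at h
      exact h.symm.trans (κ.2 a)
    · apply Subtype.ext; ext; simp
    · apply Subtype.ext; ext; simp
  rw [← mackey_count, ← mackey_count] at e1 e2
  have : ∑ i : Irr (GL ι F), ((rk i σ.e : ℤ) - rk i σ'.e) ^ 2 = 0 := by
    have h1 : ∑ i : Irr (GL ι F), ((rk i σ.e : ℤ) * rk i σ.e) = ∑ i : Irr (GL ι F), ((rk i σ.e : ℤ) * rk i σ'.e) := by exact_mod_cast e1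
    have h2 : ∑ i : Irr (GL ι F), ((rk i σ'.e : ℤ) * rk i σ'.e) = ∑ i : Irr (GL ι F), ((rk i σ.e : ℤ) * rk i σ'.e) := by exact_mod_cast e2
    have h3 : ∀ i : Irr (GL ι F), ((rk i σ.e : ℤ) - rk i σ'.e) ^ 2 = rk i σ.e * rk i σ.e + rk i σ'.e * rk i σ'.e -
      (rk i σ.e * rk i σ'.e + rk i σ.e * rk i σ'.e) := fun i => by ring
    simp only [h3, Finset.sum_sub_distrib, Finset.sum_add_distrib, h1, h2]
    ring
  rw [Finset.sum_eq_zero_iff_of_nonneg (fun i _ => sq_nonneg _)] at this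
  have := this i (Finset.mem_univ _)
  have := pow_eq_zero_iff (two_ne_zero) |>.mp this
  omega

lemma scal_apply (z : Fˣ) (i j : ι) : mx (scal z : GL ι F) i j = if i = j then (z : F) else 0 := by
  change (algebraMap F (Matrix ι ι F) z) i j = _
  rw [Matrix.algebraMap_matrix_apply]; rfl

lemma Ph_scal {d : Λ → ℕ} (E : (Σ a, Fin (d a)) ≃ ι) (z : Fˣ) : Ph E (fun a => scal z) = (scal z : GL ι F) := by
  apply gl_ext
  intro i j
  obtain ⟨a, k, rfl⟩ := E_ind E i
  by_cases h : bE E j = a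
  · obtain ⟨l, rfl⟩ := bE_eq E h
    rw [Ph_same, scal_apply, scal_apply]; simp
  · rw [Ph_ne, scal_apply, if_neg]
    · rintro rfl; simp at h
    · rw [bE_apply]; exact Ne.symm h

lemma scal_e (σ : Sq F Λ ι) (z : Fˣ) : dl (scal z) * σ.e = (∏ a, omC (σ.ρ a) z) • σ.e := by
  rw [Sq.e_def, ← mul_assoc, ← Ph_scal σ.E, ← tens_dl, Sq.te, tens_mul]
  simp only [scal_pe]
  rw [tens_smul, smul_mul_assoc]

lemma om_seq (σ : Sq F Λ ι) (i : Irr (GL ι F)) (h : rk i σ.e ≠ 0) (z : Fˣ) :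
    om i (scal z) = ∏ a, omC (σ.ρ a) z := by
  have h1 := congrArg (rp i) (scal_e σ z)
  rw [map_mul, map_smul, rp_om _ (scal_comm z), smul_mul_assoc, one_mul] at h1
  have h2 : rp i σ.e ≠ 0 := fun h2 => h ((rk_eq_zero _ _).mpr h2)
  exact smul_left_injective ℂ h2 h1

end mackey

section comb
variable {F : Type} [Field F] [Fintype F] [DecidableEq F]

/-- lexicographic sigma type -/
def SL {C : Type} (Λ : C → Type) : Type := Σ c, Λ c

/-- constructor -/
def SL.mk {C : Type} {Λ : C → Type} (c : C) (a : Λ c) : SL Λ := Sigma.mk c a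

lemma SL.mk_inj {C : Type} {Λ : C → Type} {c : C} {a b : Λ c} (h : SL.mk c a = SL.mk c b) : a = b :=
  eq_of_heq (Sigma.mk.inj h).2

lemma SL.mk_fst {C : Type} {Λ : C → Type} {c c' : C} {a : Λ c} {b : Λ c'} (h : SL.mk c a = SL.mk c' b) : c = c' :=
  (Sigma.mk.inj h).1

instance {C : Type} [LinearOrder C] (Λ : C → Type) [∀ c, LinearOrder (Λ c)] : LinearOrder (SL Λ) :=
  inferInstanceAs (LinearOrder (Σₗ c, Λ c))
instance {C : Type} [Fintype C] (Λ : C → Type) [∀ c, Fintype (Λ c)] : Fintype (SL Λ) :=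
  inferInstanceAs (Fintype (Σ c, Λ c))

lemma SL_le_same {C : Type} [LinearOrder C] {Λ : C → Type} [∀ c, LinearOrder (Λ c)] {c : C} {a b : Λ c} :
    (SL.mk c a ≤ SL.mk c b) ↔ a ≤ b := by
  change Sigma.Lex (fun x y : C => x < y) (fun c (x y : Λ c) => x ≤ y) ⟨c, a⟩ ⟨c, b⟩ ↔ _
  rw [Sigma.lex_iff]
  simp

lemma SL_le_lt {C : Type} [LinearOrder C] {Λ : C → Type} [∀ c, LinearOrder (Λ c)] {c c' : C} {a : Λ c} {b : Λ c'}
    (h : c < c') : (SL.mk c a ≤ SL.mk c' b) := by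
  change Sigma.Lex (fun x y : C => x < y) (fun c (x y : Λ c) => x ≤ y) ⟨c, a⟩ ⟨c', b⟩
  rw [Sigma.lex_iff]
  exact Or.inl h

lemma SL_fst {C : Type} [LinearOrder C] {Λ : C → Type} [∀ c, LinearOrder (Λ c)] {x y : SL Λ}
    (h : x ≤ y) : x.1 ≤ y.1 := by
  rcases x with ⟨c, a⟩; rcases y with ⟨c', b⟩
  change Sigma.Lex _ _ _ _ at h
  rw [Sigma.lex_iff] at h
  rcases h with h | ⟨h, _⟩
  · exact h.le
  · exact h.le

variable {ι : Type} [Fintype ι] [DecidableEq ι]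
variable {C : Type} [LinearOrder C] [Fintype C] {Λ : C → Type} [∀ c, LinearOrder (Λ c)] [∀ c, Fintype (Λ c)]
  {d : C → ℕ}

/-- combination of sequences -/
def combS (E : (Σ c, Fin (d c)) ≃ ι) (σ : Π c, Sq F (Λ c) (Fin (d c))) : Sq F (SL Λ) ι where
  ρ := fun x => (σ x.1).ρ x.2
  E := ((Equiv.sigmaAssoc fun c (a : Λ c) => Fin ((σ c).ρ a).d).trans (Equiv.sigmaCongrRight fun c => (σ c).E)).trans E

lemma combS_E (E : (Σ c, Fin (d c)) ≃ ι) (σ : Π c, Sq F (Λ c) (Fin (d c))) (c : C) (a : Λ c) (k : Fin ((σ c).ρ a).d) :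
    (combS E σ).E ⟨SL.mk c a, k⟩ = E ⟨c, (σ c).E ⟨a, k⟩⟩ := rfl

lemma combS_b (E : (Σ c, Fin (d c)) ≃ ι) (σ : Π c, Sq F (Λ c) (Fin (d c))) (c : C) (k : Fin (d c)) :
    (combS E σ).b (E ⟨c, k⟩) = SL.mk c ((σ c).b k) := by
  obtain ⟨a, k, rfl⟩ := E_ind (σ c).E k
  rw [← combS_E]
  exact (bE_apply _ _ _).trans (congrArg (SL.mk c) (bE_apply (σ c).E a k).symm)

lemma combS_Ph (E : (Σ c, Fin (d c)) ≃ ι) (σ : Π c, Sq F (Λ c) (Fin (d c)))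
    (h : Π x : SL Λ, GL (Fin ((combS E σ).ρ x).d) F) :
    Ph (combS E σ).E h = Ph E (fun c => Ph (σ c).E (fun a => h (SL.mk c a))) := by
  apply gl_ext
  intro i j
  obtain ⟨c, i, rfl⟩ := E_ind E i
  obtain ⟨c', j, rfl⟩ := E_ind E j
  by_cases hc : c' = c
  · subst hc
    rw [Ph_same]
    obtain ⟨a, i, rfl⟩ := E_ind (σ c').E i
    obtain ⟨a', j, rfl⟩ := E_ind (σ c').E j
    by_cases ha : a' = a
    · subst ha
      exact (Ph_same (combS E σ).E h (SL.mk c' a') i j).trans (Ph_same (σ c').E (fun a => h (SL.mk c' a)) a' i j).symm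
    · refine (Ph_ne (combS E σ).E h ?_).trans (Ph_ne (σ c').E _ ?_).symm
      · have h1 := combS_b E σ c' ((σ c').E ⟨a, i⟩)
        have h2 := combS_b E σ c' ((σ c').E ⟨a', j⟩)
        rw [Sq.b] at h1 h2
        rw [h1, h2]
        intro h
        have := SL.mk_inj h
        simp at this; exact ha this.symm
      · simpa using Ne.symm ha
  · refine (Ph_ne (combS E σ).E h ?_).trans (Ph_ne E _ ?_).symm
    · have h1 := combS_b E σ c i
      have h2 := combS_b E σ c' j
      rw [Sq.b] at h1 h2
      rw [h1, h2]
      intro h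
      exact hc (SL.mk_fst h).symm
    · simpa using Ne.symm hc

lemma combS_te (E : (Σ c, Fin (d c)) ≃ ι) (σ : Π c, Sq F (Λ c) (Fin (d c))) :
    (combS E σ).te = tens (Ph E) (fun c => (σ c).te) := by
  have h1 : (fun c => (σ c).te) = fun c => ∑ k : Π a, GL (Fin ((σ c).ρ a).d) F,
      (∏ a, cf (k a) (pe ((σ c).ρ a))) • dl (Ph (σ c).E k) := rfl
  rw [h1, tens_sum]
  simp only [tens_smul, tens_dl]
  rw [Sq.te, tens]
  refine Fintype.sum_equiv (Equiv.piCurry (fun c a => GL (Fin ((σ c).ρ a).d) F)) _ _ fun h => ?_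
  refine congrArg₂ (· • ·) ?_ (congrArg dl (combS_Ph E σ h))
  exact Fintype.prod_sigma (fun x : (Σ c, Λ c) => cf (h x) (pe ((σ x.1).ρ x.2)))

lemma combS_fix (E : (Σ c, Fin (d c)) ≃ ι) (σ : Π c, Sq F (Λ c) (Fin (d c))) :
    (combS E σ).e * (tens (Ph E) (fun c => (σ c).e) * ev (Ub (bE E))) = tens (Ph E) (fun c => (σ c).e) * ev (Ub (bE E)) := by
  rw [Sq.e_def, mul_assoc]
  have h1 : (combS E σ).u * (tens (Ph E) (fun c => (σ c).e) * ev (Ub (bE E))) = tens (Ph E) (fun c => (σ c).e) * ev (Ub (bE E)) := by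
    apply ev_fix
    intro u hu
    have hP : u ∈ Pb (bE E) := by
      intro i j hij
      obtain ⟨c, i, rfl⟩ := E_ind E i
      obtain ⟨c', j, rfl⟩ := E_ind E j
      rw [bE_apply, bE_apply] at hij
      rw [mem_Ub.mp hu, Matrix.one_apply_ne]
      · intro h; have := (Sigma.mk.inj (E.injective h)).1; exact hij.ne' this
      · have h1 := combS_b E σ c i
        have h2 := combS_b E σ c' j
        rw [h1, h2]; exact SL_le_lt hij
    obtain ⟨v, hv, h⟩ := Pb_decomp E hP
    rw [h, dl_mul, tens_ev, mul_assoc, ← mul_assoc (dl v), ev_left hv, ← tens_ev, ← mul_assoc, ← tens_dl, tens_mul]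
    congr 2
    funext c
    apply Sq.dl_e
    intro k l hkl
    change mx u (E ⟨c, k⟩) (E ⟨c, l⟩) = _
    rw [mem_Ub.mp hu, Matrix.one_apply, Matrix.one_apply]
    · simp
    · have h1 := combS_b E σ c k
      have h2 := combS_b E σ c l
      rw [h1, h2]; exact SL_le_same.mpr hkl
  rw [h1, combS_te, ← mul_assoc, tens_mul]
  simp only [Sq.te_e]

end comb

section exh
variable {F : Type} [Field F] [Fintype F] [DecidableEq F]

lemma ep_ideal {G : Type} [Group G] [Fintype G] (j : Irr G) (e : Al G) (h : rk j e ≠ 0) :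
    ∃ x y : Fin (dm j) → Al G, ep j = ∑ k, x k * e * y k := by
  have h1 : rp j e ≠ 0 := fun h2 => h ((rk_eq_zero _ _).mpr h2)
  obtain ⟨a, b, hab⟩ : ∃ a b, (rp j e : Mt j) a b ≠ 0 := by
    by_contra hc
    push Not at hc
    exact h1 (Matrix.ext hc)
  refine ⟨fun k => bl j (Matrix.single k a ((rp j e : Mt j) a b)⁻¹), fun k => bl j (Matrix.single b k 1), ?_⟩
  apply rp_ext
  intro i
  by_cases hi : i = j
  · subst hi
    rw [rp_ep_same, map_sum]
    simp only [map_mul, rp_bl_same]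
    ext k l
    rw [Matrix.sum_apply, Finset.sum_eq_single k]
    · rw [Matrix.mul_assoc]
      simp only [Matrix.single_mul_apply_same, Matrix.one_apply]
      rw [Matrix.mul_apply]
      simp [Matrix.single_apply]
      by_cases hkl : k = l
      · simp [hkl, hab]
      · simp [hkl]
    · intro m _ hm
      rw [Matrix.mul_assoc, Matrix.single_mul_apply_of_ne]; exact hm.symm
    · simp
  · rw [rp_ep_ne hi, map_sum]
    simp [rp_bl_ne hi]

lemma exhaust (n : ℕ) (hn : 0 < n) (i : Irr (GL (Fin n) F)) :
    ∃ (Λ : Type) (_ : LinearOrder Λ) (_ : Fintype Λ) (σ : Sq F Λ (Fin n)), rk i σ.e ≠ 0 := by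
  induction n using Nat.strong_induction_on with
  | _ n ih =>
  by_cases hi : IsCusp i
  · let ρ : Cusp F := ⟨n, hn, i, hi⟩
    let σ : Sq F Unit (Fin n) := ⟨fun _ => ρ, Equiv.uniqueSigma _⟩
    refine ⟨Unit, inferInstance, inferInstance, σ, ?_⟩
    intro h
    have h0 := (rp_eq_zero_iff _ _).mp ((rk_eq_zero _ _).mp h)
    apply σ.e_ne
    have hu : σ.u = 1 := by
      have : σ.u * 1 = 1 := ev_fix fun k hk => by
        have : k = 1 := gl_ext fun a b => by
          rw [mem_Ub.mp hk, mx_one]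
          exact le_of_eq (Subsingleton.elim _ _)
        rw [this, dl_one, one_mul]
      simpa using this
    have ht : σ.te = pe ρ := by
      have h1 : σ.te = ∑ h : Unit → GL (Fin n) F, (cf (h ()) (pe ρ)) • dl (Ph σ.E h) := by
        rw [Sq.te, tens]; simp; rfl
      rw [h1, al_sum (pe ρ)]
      refine Fintype.sum_equiv (Equiv.funUnique Unit _) _ _ fun h => ?_
      have hh : Ph σ.E h = h () := gl_ext fun a b => Ph_same σ.E h () a b
      rw [hh, ← al_sum]; rfl
    have h3 : ep i * pe ρ = pe ρ := by rw [ep_comm]; exact pe_ep ρ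
    rw [Sq.e_def, hu, ht, mul_one] at h0 ⊢
    rw [← h3]; exact h0
  · rw [IsCusp] at hi
    push Not at hi
    obtain ⟨β, ⟨k0, k1, hk⟩, hβ⟩ := hi
    let d : Bool → ℕ := fun c => Fintype.card {k // β k = c}
    let E : (Σ c, Fin (d c)) ≃ Fin n :=
      (Equiv.sigmaCongrRight fun c => (Fintype.equivFin {k // β k = c}).symm).trans (Equiv.sigmaFiberEquiv β)
    have hE : bE E = β := by
      funext k
      obtain ⟨c, m, rfl⟩ := E_ind E k
      rw [bE_apply]
      exact ((Fintype.equivFin {k // β k = c}).symm m).2.symm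
    have hne : ∀ c, ∃ k, β k = c := by
      intro c
      rcases Bool.eq_or_eq_not (β k0) c with h | h
      · exact ⟨k0, h⟩
      · refine ⟨k1, ?_⟩
        cases h0 : β k0 <;> cases h1 : β k1 <;> cases c <;> simp_all
    have hd0 : ∀ c, 0 < d c := fun c => Fintype.card_pos_iff.mpr ⟨⟨(hne c).choose, (hne c).choose_spec⟩⟩
    have hdn : ∀ c, d c < n := by
      intro c
      have := Fintype.card_subtype_lt (p := fun k => β k = c) (x := (hne (!c)).choose)
        (by rw [(hne (!c)).choose_spec]; cases c <;> simp)
      simpa using this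
    have step1 : ∃ f : Π c, Irr (GL (Fin (d c)) F), tens (Ph E) (fun c => ep (f c)) * ev (Ub β) * ep i ≠ 0 := by
      by_contra hc
      push Not at hc
      apply hβ
      have h1 : (1 : Al (GL (Fin n) F)) = ∑ f : Π c, Irr (GL (Fin (d c)) F), tens (Ph E) (fun c => ep (f c)) := by
        rw [← tens_sum, ← tens_one (Ph E)]
        congr 1; funext c; exact sum_ep.symm
      rw [← one_mul (ev _ * _), h1, Finset.sum_mul]
      exact Finset.sum_eq_zero fun f _ => by rw [← mul_assoc]; exact hc f
    obtain ⟨f, hf⟩ := step1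
    have ih' := fun c => ih (d c) (hdn c) (hd0 c) (f c)
    choose Λ lo ft σ hσ using ih'
    have hx := fun c => ep_ideal (f c) (σ c).e (hσ c)
    choose x y hxy using hx
    refine ⟨SL Λ, inferInstance, inferInstance, combS E σ, ?_⟩
    intro h0
    have h0 := (rp_eq_zero_iff _ _).mp ((rk_eq_zero _ _).mp h0)
    apply hf
    have h2 : tens (Ph E) (fun c => (σ c).e) * ev (Ub β) * ep i = 0 := by
      have := combS_fix E σ
      rw [hE] at this
      rw [← this, ← ep_comm, ← mul_assoc, h0, zero_mul]
    have h3 : (fun c => ep (f c)) = fun c => ∑ k, x c k * (σ c).e * y c k := funext hxy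
    rw [h3, tens_sum, Finset.sum_mul, Finset.sum_mul]
    refine Finset.sum_eq_zero fun k _ => ?_
    rw [← tens_mul, ← tens_mul, mul_assoc, mul_assoc, mul_assoc, ← mul_assoc _ (ev _)]
    have h4 := tens_ev E (fun c => y c (k c))
    rw [hE] at h4
    rw [h4, mul_assoc (ev _), ← ep_comm, ← mul_assoc (ev _), ← mul_assoc (tens _ fun c => (σ c).e), ← mul_assoc (tens _ fun c => (σ c).e), h2]
    simp
end exh
end
end HRV
end modH8

section modH9
set_option autoImplicit false
open scoped MatrixGroups
open Finset

namespace HRV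
noncomputable section

section hecke
variable {F : Type} [Field F] [Fintype F] [DecidableEq F]
variable {ι : Type} [Fintype ι] [DecidableEq ι]
variable {Λ : Type} [LinearOrder Λ] [Fintype Λ]

/-- adjacent equal blocks -/
structure Adj (σ : Sq F Λ ι) where
  a : Λ
  b : Λ
  lt : a < b
  adj : ∀ c, c ≤ a ∨ b ≤ c
  eq : σ.ρ a = σ.ρ b

variable {σ : Sq F Λ ι} (A : Adj σ)

abbrev Adj.dd : ℕ := (σ.ρ A.a).d

lemma Adj.hd : (σ.ρ A.a).d = (σ.ρ A.b).d := congrArg Cusp.d A.eq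

def Adj.th0 : (Fin A.dd ⊕ Fin A.dd) ⊕ {i : ι // σ.b i ≠ A.a ∧ σ.b i ≠ A.b} → ι
  | Sum.inl (Sum.inl k) => σ.E ⟨A.a, k⟩
  | Sum.inl (Sum.inr k) => σ.E ⟨A.b, Fin.cast A.hd k⟩
  | Sum.inr i => i.1

lemma Adj.th0_bij : Function.Bijective A.th0 := by
  have hlt := A.lt.ne
  constructor
  · rintro ((k | k) | i) ((l | l) | j) h <;> simp only [Adj.th0] at h
    · have := σ.E.injective h; simp at this; rw [this]
    · have := σ.E.injective h; simp at this; exact absurd this.1 hlt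
    · exact absurd (by rw [← h]; simp) j.2.1
    · have := σ.E.injective h; simp at this; exact absurd this.1.symm hlt
    · have := σ.E.injective h; simp at this; rw [this]
    · exact absurd (by rw [← h]; simp) j.2.2
    · exact absurd (by rw [h]; simp) i.2.1
    · exact absurd (by rw [h]; simp) i.2.2
    · rw [Subtype.ext h]
  · intro i
    by_cases h1 : σ.b i = A.a
    · obtain ⟨k, rfl⟩ := bE_eq _ h1
      exact ⟨Sum.inl (Sum.inl k), rfl⟩
    by_cases h2 : σ.b i = A.b
    · obtain ⟨k, rfl⟩ := bE_eq _ h2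
      exact ⟨Sum.inl (Sum.inr (Fin.cast A.hd.symm k)), rfl⟩
    exact ⟨Sum.inr ⟨i, h1, h2⟩, rfl⟩

def Adj.th : (Fin A.dd ⊕ Fin A.dd) ⊕ {i : ι // σ.b i ≠ A.a ∧ σ.b i ≠ A.b} ≃ ι := Equiv.ofBijective _ A.th0_bij

@[simp] lemma Adj.b_th1 (k) : bE σ.E (A.th (Sum.inl (Sum.inl k))) = A.a := by
  change bE σ.E (σ.E ⟨A.a, k⟩) = _; simp
@[simp] lemma Adj.b_th2 (k) : bE σ.E (A.th (Sum.inl (Sum.inr k))) = A.b := by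
  change bE σ.E (σ.E ⟨A.b, Fin.cast A.hd k⟩) = _; simp
lemma Adj.b_th3 (i) : bE σ.E (A.th (Sum.inr i)) ≠ A.a ∧ bE σ.E (A.th (Sum.inr i)) ≠ A.b := i.2

/-- embedding of the 2 by 2 block group -/
def Adj.J : GL (Fin A.dd ⊕ Fin A.dd) F →* GL ι F :=
  Units.map
    { toFun := fun M => (Matrix.fromBlocks M 0 0 1).submatrix A.th.symm A.th.symm
      map_one' := by
        rw [Matrix.fromBlocks_one, Matrix.submatrix_one_equiv]
      map_mul' := fun M N => by
        rw [Matrix.submatrix_mul_equiv, Matrix.fromBlocks_multiply]; simp }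

lemma Adj.J_apply (g : GL (Fin A.dd ⊕ Fin A.dd) F) (x y) :
    mx (A.J g) (A.th x) (A.th y) = Matrix.fromBlocks (mx g) 0 0 1 x y := by
  change (Matrix.fromBlocks (mx g) 0 0 1 : Matrix _ _ F) (A.th.symm _) (A.th.symm _) = _
  simp

lemma Adj.one_th (x y) : (1 : Matrix ι ι F) (A.th x) (A.th y) = (1 : Matrix _ _ F) x y := by
  rw [Matrix.one_apply, Matrix.one_apply]; simp

def up {m : ℕ} (X : Matrix (Fin m) (Fin m) F) : GL (Fin m ⊕ Fin m) F where
  val := Matrix.fromBlocks 1 X 0 1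
  inv := Matrix.fromBlocks 1 (-X) 0 1
  val_inv := by rw [Matrix.fromBlocks_multiply]; simp [Matrix.fromBlocks_one]
  inv_val := by rw [Matrix.fromBlocks_multiply]; simp [Matrix.fromBlocks_one]

lemma up_add {m : ℕ} (X Y : Matrix (Fin m) (Fin m) F) : up (X + Y) = up X * up Y := by
  apply Units.ext
  change Matrix.fromBlocks 1 (X+Y) 0 1 = Matrix.fromBlocks 1 X 0 1 * Matrix.fromBlocks 1 Y 0 1
  rw [Matrix.fromBlocks_multiply]; simp [add_comm]

lemma up_zero {m : ℕ} : up (0 : Matrix (Fin m) (Fin m) F) = 1 := by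
  apply Units.ext
  change Matrix.fromBlocks 1 0 0 1 = (1 : Matrix _ _ F)
  exact Matrix.fromBlocks_one

def sw (m : ℕ) : GL (Fin m ⊕ Fin m) F where
  val := Matrix.fromBlocks 0 1 1 0
  inv := Matrix.fromBlocks 0 1 1 0
  val_inv := by rw [Matrix.fromBlocks_multiply]; simp [Matrix.fromBlocks_one]
  inv_val := by rw [Matrix.fromBlocks_multiply]; simp [Matrix.fromBlocks_one]

/-- collapse of the two blocks -/
def Adj.f (c : Λ) : Λ := if c = A.b then A.a else c

lemma Adj.f_le {c c' : Λ} (h : c ≤ c') : A.f c ≤ A.f c' := by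
  have := A.lt
  unfold Adj.f
  rcases A.adj c with h1 | h1 <;> rcases A.adj c' with h2 | h2 <;> split_ifs <;> order

lemma Adj.le_of_f {c c' : Λ} (h : A.f c ≤ A.f c') : c ≤ c' ∨ (c = A.b ∧ c' = A.a) := by
  have := A.lt
  unfold Adj.f at h
  by_cases h3 : c = A.b
  · rcases A.adj c' with h2 | h2
    · right; refine ⟨h3, ?_⟩
      rw [if_pos h3, if_neg (by order)] at h
      order
    · left; order
  · left
    rw [if_neg h3] at h
    split_ifs at h <;> order

abbrev Adj.bb (i : ι) : Λ := A.f (σ.b i)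

lemma Adj.Ub_le : (Ub A.bb : Subgroup (GL ι F)) ≤ Ub σ.b := by
  intro u hu i j hij
  exact hu i j (A.f_le hij)

lemma Adj.Pb_le : (Pb σ.b : Subgroup (GL ι F)) ≤ Pb A.bb := by
  intro u hu i j hij
  apply hu i j
  by_contra h
  exact absurd hij (not_lt.mpr (A.f_le (not_lt.mp h)))

lemma Adj.f1 : A.f A.a = A.a := by simp [Adj.f]
lemma Adj.f2 : A.f A.b = A.a := by simp [Adj.f]

lemma Adj.f_ne {c : Λ} (h : c ≠ A.a ∧ c ≠ A.b) : A.f c = c := by simp [Adj.f, h.2]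

lemma Adj.J_Lb (g) : A.J g ∈ Lb A.bb := by
  intro i j hij
  obtain ⟨x, rfl⟩ := A.th.surjective i
  obtain ⟨y, rfl⟩ := A.th.surjective j
  rw [A.J_apply]
  rcases x with ((k | k) | i) <;> rcases y with ((l | l) | j)
  · simp [Adj.bb] at hij
  · simp [Adj.bb, A.f1, A.f2] at hij
  · simp
  · simp [Adj.bb, A.f1, A.f2] at hij
  · simp [Adj.bb, A.f1, A.f2] at hij
  · simp
  · simp
  · simp
  · simp only [Matrix.fromBlocks_apply₂₂]
    rw [Matrix.one_apply_ne]; rintro rfl; exact hij rfl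

lemma Adj.J_up (X) : A.J (up X) ∈ Ub σ.b := by
  intro i j hij
  obtain ⟨x, rfl⟩ := A.th.surjective i
  obtain ⟨y, rfl⟩ := A.th.surjective j
  rw [A.J_apply, A.one_th]
  change Matrix.fromBlocks (Matrix.fromBlocks 1 X 0 1) 0 0 1 x y = _
  have := A.lt
  rw [← Matrix.fromBlocks_one, ← Matrix.fromBlocks_one]
  rcases x with ((k | k) | i) <;> rcases y with ((l | l) | j) <;> try rfl
  simp only [Sq.b, Adj.b_th1, Adj.b_th2] at hij
  order

/-- entry of conjugated upper elements -/
lemma Adj.J_up_ne (X) (i j : ι) (h : ¬ (σ.b i = A.a ∧ σ.b j = A.b)) : mx (A.J (up X)) i j = (1 : Matrix ι ι F) i j := by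
  obtain ⟨x, rfl⟩ := A.th.surjective i
  obtain ⟨y, rfl⟩ := A.th.surjective j
  rw [A.J_apply, A.one_th]
  change Matrix.fromBlocks (Matrix.fromBlocks 1 X 0 1) 0 0 1 x y = _
  rw [← Matrix.fromBlocks_one, ← Matrix.fromBlocks_one]
  rcases x with ((k | k) | i) <;> rcases y with ((l | l) | j) <;> try rfl
  simp only [Sq.b, Adj.b_th1, Adj.b_th2] at h
  exact absurd ⟨trivial, trivial⟩ h

lemma Adj.Ub_split {u : GL ι F} (hu : u ∈ Ub σ.b) : ∃ X, u * A.J (up X) ∈ Ub A.bb := by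
  refine ⟨-(Matrix.of fun k l => mx u (A.th (Sum.inl (Sum.inl k))) (A.th (Sum.inl (Sum.inr l)))), ?_⟩
  set X : Matrix (Fin A.dd) (Fin A.dd) F := (Matrix.of fun k l => mx u (A.th (Sum.inl (Sum.inl k))) (A.th (Sum.inl (Sum.inr l)))) with hX
  have hlt := A.lt
  intro i j hij
  obtain ⟨x, rfl⟩ := A.th.surjective i
  obtain ⟨y, rfl⟩ := A.th.surjective j
  have key : mx (u * A.J (up (-X))) (A.th x) (A.th y) =
      ∑ z, mx u (A.th x) (A.th z) * Matrix.fromBlocks (Matrix.fromBlocks 1 (-X) 0 1) 0 0 1 z y := by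
    rw [mx_mul, ← A.th.sum_comp]
    refine Finset.sum_congr rfl fun z _ => ?_
    rw [A.J_apply]; rfl
  rw [key, Fintype.sum_sum_type, Fintype.sum_sum_type]
  rw [A.one_th]
  have hu' : ∀ x y, bE σ.E (A.th y) ≤ bE σ.E (A.th x) → mx u (A.th x) (A.th y) = (1 : Matrix _ _ F) x y := by
    intro x y h
    rw [← A.one_th]; exact hu _ _ h
  rcases y with ((l | l) | j)
  · simp only [Matrix.fromBlocks_apply₁₁, Matrix.fromBlocks_apply₂₁, Matrix.zero_apply, mul_zero, sum_const_zero, add_zero, Matrix.one_apply, mul_ite, mul_one, Finset.sum_ite_eq', Finset.mem_univ, if_true]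
    rw [hu', Matrix.one_apply]
    rcases A.le_of_f hij with h | h
    · exact h
    · simp at h; order
  · simp only [Matrix.fromBlocks_apply₁₁, Matrix.fromBlocks_apply₂₁,  Matrix.fromBlocks_apply₁₂,  Matrix.fromBlocks_apply₂₂, Matrix.zero_apply, mul_zero, sum_const_zero, add_zero]
    have e2 : ∑ k, mx u (A.th x) (A.th (Sum.inl (Sum.inr k))) * (1 : Matrix (Fin A.dd) (Fin A.dd) F) k l = mx u (A.th x) (A.th (Sum.inl (Sum.inr l))) := by
      simp [Matrix.one_apply]
    rw [e2]
    have hx : A.a ≤ bE σ.E (A.th x) := by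
      have h3 : A.a ≤ A.f (bE σ.E (A.th x)) := by simpa [Adj.bb, A.f2] using hij
      refine h3.trans ?_
      unfold Adj.f; split_ifs with h
      · rw [h]; exact hlt.le
      · exact le_rfl
    have e1 : ∑ k, mx u (A.th x) (A.th (Sum.inl (Sum.inl k))) * (-X) k l = ∑ k, (1 : Matrix ((Fin A.dd ⊕ Fin A.dd) ⊕ {i : ι // σ.b i ≠ A.a ∧ σ.b i ≠ A.b}) ((Fin A.dd ⊕ Fin A.dd) ⊕ {i : ι // σ.b i ≠ A.a ∧ σ.b i ≠ A.b}) F) x (Sum.inl (Sum.inl k)) * (-X) k l := by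
      refine Finset.sum_congr rfl fun k _ => ?_
      rw [hu']; simpa using hx
    rw [e1]
    by_cases hx1 : ∃ k, x = Sum.inl (Sum.inl k)
    · obtain ⟨k, rfl⟩ := hx1
      simp [Matrix.one_apply, hX]
    · have hxb : bE σ.E (A.th x) ≠ A.a := by
        rcases x with ((k | k) | i)
        · exact absurd ⟨k, rfl⟩ hx1
        · simp; exact hlt.ne'
        · exact (A.b_th3 i).1
      rw [hu' x (Sum.inl (Sum.inr l)), Finset.sum_eq_zero, zero_add]
      · intro k _
        rw [Matrix.one_apply_ne, zero_mul]; rintro rfl; exact hx1 ⟨k, rfl⟩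
      · rw [A.b_th2]
        rcases A.adj (bE σ.E (A.th x)) with h | h
        · exact absurd (le_antisymm h hx) hxb
        · exact h
  · simp only [Matrix.fromBlocks_apply₁₂, Matrix.fromBlocks_apply₂₂, Matrix.zero_apply, mul_zero, sum_const_zero, zero_add, Matrix.one_apply, mul_ite, mul_one, Finset.sum_ite_eq', Finset.mem_univ, if_true]
    rw [hu', Matrix.one_apply]
    rcases A.le_of_f hij with h | h
    · exact h
    · exact absurd h.1 (A.b_th3 j).2

/-- average over the one-block unipotent group -/
def Adj.eab : Al (GL ι F) := (Fintype.card (Matrix (Fin A.dd) (Fin A.dd) F) : ℂ)⁻¹ • ∑ X, dl (A.J (up X))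

abbrev Adj.Q : ℂ := (Fintype.card (Matrix (Fin A.dd) (Fin A.dd) F) : ℂ)
lemma Adj.Q_ne : A.Q ≠ 0 := Nat.cast_ne_zero.mpr Fintype.card_ne_zero

lemma Adj.eab_fix {x : Al (GL ι F)} (h : ∀ X, dl (A.J (up X)) * x = x) : A.eab * x = x := by
  rw [Adj.eab, smul_mul_assoc, Finset.sum_mul, Finset.sum_congr rfl fun X _ => h X, Finset.sum_const, Finset.card_univ,
    ← Nat.cast_smul_eq_nsmul ℂ, smul_smul, inv_mul_cancel₀ A.Q_ne, one_smul]

lemma Adj.eab_fix' {x : Al (GL ι F)} (h : ∀ X, x * dl (A.J (up X)) = x) : x * A.eab = x := by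
  rw [Adj.eab, mul_smul_comm, Finset.mul_sum, Finset.sum_congr rfl fun X _ => h X, Finset.sum_const, Finset.card_univ,
    ← Nat.cast_smul_eq_nsmul ℂ, smul_smul, inv_mul_cancel₀ A.Q_ne, one_smul]

lemma Adj.eab_shift (Y) : A.eab * dl (A.J (up Y)) = A.eab := by
  rw [Adj.eab, smul_mul_assoc, Finset.sum_mul]
  congr 1
  refine Fintype.sum_equiv (Equiv.addRight Y) _ _ fun X => ?_
  rw [← dl_mul, ← map_mul, ← up_add]; rfl

lemma Adj.eab_comm : A.eab * ev (Ub A.bb) = ev (Ub A.bb) * A.eab := by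
  rw [Adj.eab, smul_mul_assoc, mul_smul_comm, Finset.sum_mul, Finset.mul_sum]
  congr 1
  exact Finset.sum_congr rfl fun X _ => ev_Lb (A.J_Lb _)

lemma Adj.u_eq : ev (Ub A.bb) * A.eab = σ.u := by
  have h1 : ∀ u ∈ (Ub σ.b : Subgroup (GL ι F)), (ev (Ub A.bb) * A.eab) * dl u = ev (Ub A.bb) * A.eab := by
    intro u hu
    obtain ⟨X, hX⟩ := A.Ub_split hu
    have e : u = (u * A.J (up X)) * A.J (up (-X)) := by
      rw [mul_assoc, ← map_mul, ← up_add]; simp [up_zero]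
    rw [e, dl_mul, ← A.eab_comm, ← mul_assoc, mul_assoc A.eab, ev_right hX, A.eab_comm, mul_assoc, A.eab_shift]
  have h2 := ev_fix' h1
  rw [← h2, mul_assoc, A.eab_fix fun X => ev_left (A.J_up X), ev_sub A.Ub_le]

lemma Adj.u_eq' : A.eab * ev (Ub A.bb) = σ.u := by rw [A.eab_comm, A.u_eq]

end hecke
end
end HRV
end modH9

section modH10
set_option autoImplicit false
open scoped MatrixGroups
open Finset

namespace HRV
noncomputable section

section hecke
variable {F : Type} [Field F] [Fintype F] [DecidableEq F]
variable {ι : Type} [Fintype ι] [DecidableEq ι]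
variable {Λ : Type} [LinearOrder Λ] [Fintype Λ]
variable {σ : Sq F Λ ι} (A : Adj σ)

/-- the swap -/
def Adj.s : Mtch σ σ := ⟨Equiv.swap A.a A.b, fun c => by
  by_cases h1 : c = A.a
  · subst h1; rw [Equiv.swap_apply_left, A.eq]
  by_cases h2 : c = A.b
  · subst h2; rw [Equiv.swap_apply_right, A.eq]
  rw [Equiv.swap_apply_of_ne_of_ne h1 h2]⟩

/-- product of matchings -/
def mmul (v w : Mtch σ σ) : Mtch σ σ := ⟨v.1 * w.1, fun c => (v.2 (w.1 c)).trans (w.2 c)⟩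
def mone : Mtch σ σ := ⟨1, fun c => rfl⟩

lemma wh_mul (v w : Mtch σ σ) : wh σ σ (mmul v w) = wh σ σ v * wh σ σ w := by
  ext i
  obtain ⟨a, k, rfl⟩ := E_ind σ.E i
  rw [Equiv.Perm.mul_apply, wh, hat_apply, wh, wh, hat_apply, hat_apply]
  rfl

lemma wh_one : wh σ σ mone = 1 := by
  ext i
  obtain ⟨a, k, rfl⟩ := E_ind σ.E i
  rw [wh, hat_apply]; rfl

lemma Adj.s_s : mmul A.s A.s = mone := Subtype.ext (Equiv.swap_mul_self _ _)

lemma hat_aux {σ : Sq F Λ ι} {a b : Λ} (h : a = b) (k : ℕ) (hk : k < (σ.ρ a).d) (hk' : k < (σ.ρ b).d) :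
    σ.E ⟨a, ⟨k, hk⟩⟩ = σ.E ⟨b, ⟨k, hk'⟩⟩ := by subst h; rfl

lemma Adj.wh1 (k) : wh σ σ A.s (A.th (Sum.inl (Sum.inl k))) = A.th (Sum.inl (Sum.inr k)) := by
  change hat σ.E σ.E _ _ (σ.E ⟨A.a, k⟩) = σ.E ⟨A.b, Fin.cast A.hd k⟩
  rw [hat_apply]
  exact hat_aux (Equiv.swap_apply_left _ _) k.1 _ _
lemma Adj.wh2 (k) : wh σ σ A.s (A.th (Sum.inl (Sum.inr k))) = A.th (Sum.inl (Sum.inl k)) := by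
  change hat σ.E σ.E _ _ (σ.E ⟨A.b, Fin.cast A.hd k⟩) = σ.E ⟨A.a, k⟩
  rw [hat_apply]
  exact hat_aux (Equiv.swap_apply_right _ _) k.1 _ _
lemma Adj.wh3 (i) : wh σ σ A.s (A.th (Sum.inr i)) = A.th (Sum.inr i) := by
  obtain ⟨i, hi⟩ := i
  obtain ⟨c, k, rfl⟩ := E_ind σ.E i
  change hat σ.E σ.E _ _ (σ.E ⟨c, k⟩) = σ.E ⟨c, k⟩
  rw [hat_apply]
  simp only [Sq.b, bE_apply] at hi
  exact hat_aux (Equiv.swap_apply_of_ne_of_ne hi.1 hi.2) k.1 _ _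

lemma Adj.J_sw : A.J (sw _) = pm (wh σ σ A.s) := by
  apply gl_ext; intro i j
  obtain ⟨x, rfl⟩ := A.th.surjective i
  obtain ⟨y, rfl⟩ := A.th.surjective j
  rw [A.J_apply, mx_pm]
  change Matrix.fromBlocks (Matrix.fromBlocks 0 1 1 0) 0 0 1 x y = _
  rcases y with ((l | l) | j)
  · rw [A.wh1]; rcases x with ((k | k) | i) <;> simp [Matrix.one_apply]
  · rw [A.wh2]; rcases x with ((k | k) | i) <;> simp [Matrix.one_apply]
  · rw [A.wh3]; rcases x with ((k | k) | i) <;> simp [Matrix.one_apply]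

abbrev nn (w : Mtch σ σ) : GL ι F := pm (wh σ σ w)
abbrev tt (w : Mtch σ σ) : Al (GL ι F) := tB σ σ w

lemma nn_mul (v w : Mtch σ σ) : nn (mmul v w) = nn v * nn w := by rw [nn, wh_mul, pm_mul]
lemma tt_def (w : Mtch σ σ) : tt w = σ.e * dl (nn w) * σ.e := rfl
lemma tt_one : tt (mone : Mtch σ σ) = σ.e := by
  rw [tt_def, nn, wh_one, pm_one, dl_one, mul_one, σ.e_idem]

lemma Adj.s_bb : dl (nn A.s) * ev (Ub A.bb) = ev (Ub A.bb) * dl (nn A.s) := by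
  rw [nn, ← A.J_sw]; exact ev_Lb (A.J_Lb _)

lemma Adj.e_bb : σ.e * ev (Ub A.bb) = σ.e := by
  rw [Sq.e_def, mul_assoc, ev_sub' A.Ub_le]
lemma Adj.bb_e : ev (Ub A.bb) * σ.e = σ.e := by
  rw [Sq.e_eq, ← mul_assoc, ev_sub A.Ub_le]

lemma Adj.ts1 : tt A.s = σ.e * dl (nn A.s) * A.eab := by
  calc tt A.s = σ.e * (dl (nn A.s) * σ.te) * σ.u := by rw [tt_def, Sq.e_def]; simp only [mul_assoc]
    _ = σ.e * dl (nn A.s) * σ.u := by rw [← te_wh, ← mul_assoc, σ.e_te]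
    _ = σ.e * (dl (nn A.s) * ev (Ub A.bb)) * A.eab := by rw [← A.u_eq]; simp only [mul_assoc]
    _ = σ.e * dl (nn A.s) * A.eab := by rw [A.s_bb, ← mul_assoc, A.e_bb]

lemma Adj.ts2 : tt A.s = A.eab * dl (nn A.s) * σ.e := by
  calc tt A.s = σ.u * (σ.te * dl (nn A.s)) * σ.e := by rw [tt_def]; nth_rewrite 1 [Sq.e_eq]; simp only [mul_assoc]
    _ = σ.u * dl (nn A.s) * σ.e := by rw [te_wh, mul_assoc, mul_assoc, σ.te_e, mul_assoc]
    _ = A.eab * (ev (Ub A.bb) * dl (nn A.s)) * σ.e := by rw [← A.u_eq']; simp only [mul_assoc]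
    _ = A.eab * dl (nn A.s) * σ.e := by rw [← A.s_bb, mul_assoc, mul_assoc, A.bb_e, mul_assoc]

lemma mx_conj (v : Equiv.Perm ι) (g : GL ι F) (i j : ι) : mx ((pm v)⁻¹ * g * pm v) i j = mx g (v i) (v j) := by
  rw [mono_mul_right (pm_mono v), mx_pm, if_pos rfl, mul_one, ← pm_inv]
  obtain ⟨k, rfl⟩ := v⁻¹.surjective i
  have h1 := mono_mul_left (pm_mono v⁻¹) (g := g) (i := k) (j := v j)
  have h2 : v (v⁻¹ k) = k := v.apply_symm_apply k
  rw [mx_pm, if_pos rfl, one_mul] at h1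
  rw [h2]
  exact h1

lemma bE_nn (w : Mtch σ σ) (i) : bE σ.E (wh σ σ w i) = w.1 (bE σ.E i) := bE_wh σ σ w i

/-- left ascent relation -/
lemma Adj.R1 (w : Mtch σ σ) (h : w.1.symm A.a < w.1.symm A.b) : tt A.s * tt w = tt (mmul A.s w) := by
  have h1 : ∀ X, dl (A.J (up X)) * (dl (nn w) * σ.e) = dl (nn w) * σ.e := by
    intro X
    have h2 : (nn w)⁻¹ * A.J (up X) * nn w ∈ Ub σ.b := by
      intro i j hij
      rw [mx_conj, A.J_up_ne, Matrix.one_apply, Matrix.one_apply]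
      · simp
      · rintro ⟨h3, h4⟩
        rw [Sq.b, bE_nn] at h3 h4
        rw [← h3, ← h4, Equiv.symm_apply_apply, Equiv.symm_apply_apply] at h
        exact absurd h (not_lt.mpr hij)
    have h3 : A.J (up X) * nn w = nn w * ((nn w)⁻¹ * A.J (up X) * nn w) := by group
    rw [← mul_assoc, ← dl_mul, h3, dl_mul, mul_assoc, σ.dl_e h2]
  have h2 := A.eab_fix h1
  calc tt A.s * tt w = (σ.e * dl (nn A.s) * σ.e) * (σ.e * dl (nn w) * σ.e) := rfl
    _ = (σ.e * dl (nn A.s) * σ.e) * (dl (nn w) * σ.e) := by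
      rw [mul_assoc σ.e (dl (nn w)) σ.e, ← mul_assoc _ σ.e, mul_assoc _ σ.e σ.e, σ.e_idem]
    _ = tt A.s * (dl (nn w) * σ.e) := rfl
    _ = σ.e * dl (nn A.s) * (A.eab * (dl (nn w) * σ.e)) := by rw [A.ts1]; simp only [mul_assoc]
    _ = tt (mmul A.s w) := by rw [h2, tt_def, nn_mul, dl_mul]; simp only [mul_assoc]

/-- right ascent relation -/
lemma Adj.R1' (w : Mtch σ σ) (h : w.1 A.a < w.1 A.b) : tt w * tt A.s = tt (mmul w A.s) := by
  have h1 : ∀ X, (σ.e * dl (nn w)) * dl (A.J (up X)) = σ.e * dl (nn w) := by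
    intro X
    have h2 : nn w * A.J (up X) * (nn w)⁻¹ ∈ Ub σ.b := by
      intro i j hij
      have := mx_conj (wh σ σ w)⁻¹ (A.J (up X)) i j
      rw [pm_inv, inv_inv] at this
      rw [this, A.J_up_ne, Matrix.one_apply, Matrix.one_apply]
      · simp
      · rintro ⟨h3, h4⟩
        have e3 := bE_nn w ((wh σ σ w)⁻¹ i)
        have e4 := bE_nn w ((wh σ σ w)⁻¹ j)
        rw [show ∀ i, wh σ σ w ((wh σ σ w)⁻¹ i) = i from fun i => (wh σ σ w).apply_symm_apply i] at e3 e4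
        rw [show bE σ.E _ = _ from h3] at e3
        rw [show bE σ.E _ = _ from h4] at e4
        rw [← e3, ← e4] at h
        exact absurd h (not_lt.mpr hij)
    have h3 : nn w * A.J (up X) = (nn w * A.J (up X) * (nn w)⁻¹) * nn w := by group
    rw [mul_assoc, ← dl_mul, h3, dl_mul, ← mul_assoc, σ.e_dl h2]
  have h2 := A.eab_fix' h1
  calc tt w * tt A.s = (σ.e * dl (nn w) * σ.e) * (σ.e * dl (nn A.s) * σ.e) := rfl
    _ = (σ.e * dl (nn w)) * (σ.e * dl (nn A.s) * σ.e) := by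
      simp only [← mul_assoc]; rw [mul_assoc _ σ.e σ.e, σ.e_idem]
    _ = σ.e * dl (nn w) * tt A.s := rfl
    _ = σ.e * dl (nn w) * A.eab * (dl (nn A.s) * σ.e) := by rw [A.ts2]; simp only [mul_assoc]
    _ = tt (mmul w A.s) := by rw [h2, tt_def, nn_mul, dl_mul]; simp only [mul_assoc]

/-! the quadratic relation -/

lemma tau_e_g (g : GL ι F) (h : g ∉ Pb σ.b) : tau (σ.e * dl g) = 0 := by
  rw [tau_mul_dl]
  exact σ.sup_e _ fun h' => h (by simpa using (Pb σ.b).inv_mem h')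

lemma tau_e_p {g : GL ι F} (h : g ∈ Pb σ.b) : tau (σ.e * dl g) = (∏ c, lam (σ.ρ c) (dl (blkP σ.E g h c))) * tau σ.e := by
  obtain ⟨u, hu, hg⟩ := Pb_decomp σ.E h
  have e1 : σ.e * dl g = σ.e * dl (Ph σ.E (blkP σ.E g h)) := by
    conv_lhs => rw [hg]
    rw [dl_mul, ← mul_assoc, Sq.e_def, mul_assoc σ.te, ← σ.dl_Ph_u, mul_assoc, mul_assoc, ev_right hu]
  have e2 := σ.e_tens_e (fun c => dl (blkP σ.E g h c))
  rw [tens_dl] at e2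
  rw [e1]
  have e3 : tau (σ.e * dl (Ph σ.E (blkP σ.E g h))) = tau (σ.e * dl (Ph σ.E (blkP σ.E g h)) * σ.e) := by
    rw [tau_mul_comm (σ.e * _), ← mul_assoc, σ.e_idem]
  rw [e3, e2, map_smul, smul_eq_mul]

lemma nn_inv_s : (nn A.s)⁻¹ = nn A.s := by
  rw [inv_eq_iff_mul_eq_one, ← nn_mul, A.s_s, nn, wh_one, pm_one]

/-- lower element -/
def Adj.lo (X : Matrix (Fin A.dd) (Fin A.dd) F) : GL ι F := A.J (sw _ * up X * sw _)

lemma Adj.lo_in {X} (h : A.lo X ∈ Pb σ.b) : X = 0 := by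
  ext k l
  have h1 := h (A.th (Sum.inl (Sum.inr k))) (A.th (Sum.inl (Sum.inl l))) (by simpa using A.lt)
  rw [Adj.lo, A.J_apply] at h1
  have h2 : mx (sw A.dd * up X * sw A.dd : GL _ F) = Matrix.fromBlocks 1 0 X 1 := by
    change Matrix.fromBlocks 0 1 1 0 * Matrix.fromBlocks 1 X 0 1 * Matrix.fromBlocks 0 1 1 0 = _
    rw [Matrix.fromBlocks_multiply, Matrix.fromBlocks_multiply]; simp
  simpa [h2] using h1

lemma Adj.lo_zero : A.lo 0 = 1 := by
  rw [Adj.lo, up_zero, mul_one]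
  have : (sw A.dd * sw A.dd : GL _ F) = 1 := by
    apply Units.ext
    exact (sw A.dd : GL _ F).val_inv
  rw [this, map_one]

lemma Adj.eab_mid (x y : Al (GL ι F)) : x * A.eab * y = A.Q⁻¹ • ∑ X, x * dl (A.J (up X)) * y := by
  rw [Adj.eab, mul_smul_comm, smul_mul_assoc, Finset.mul_sum, Finset.sum_mul]

lemma Adj.sq_eq : tt A.s * tt A.s = A.Q⁻¹ • ∑ X, σ.e * dl (A.lo X) * σ.e := by
  calc tt A.s * tt A.s = (σ.e * dl (nn A.s) * σ.e) * (σ.e * dl (nn A.s) * σ.e) := rfl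
    _ = (σ.e * dl (nn A.s) * σ.e) * (dl (nn A.s) * σ.e) := by
      simp only [← mul_assoc]; rw [mul_assoc _ σ.e σ.e, σ.e_idem]
    _ = tt A.s * (dl (nn A.s) * σ.e) := rfl
    _ = σ.e * dl (nn A.s) * A.eab * (dl (nn A.s) * σ.e) := by rw [A.ts1]
    _ = _ := by
      refine (A.eab_mid _ _).trans (congrArg _ (Finset.sum_congr rfl fun X _ => ?_))
      rw [Adj.lo, map_mul, map_mul, A.J_sw, dl_mul, dl_mul]; simp only [mul_assoc]

lemma tau_eye (y : Al (GL ι F)) : tau (σ.e * y * σ.e) = tau (σ.e * y) := by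
  rw [tau_mul_comm (σ.e * y), ← mul_assoc, σ.e_idem]

lemma Adj.tau_sq : tau (tt A.s * tt A.s) = A.Q⁻¹ * tau σ.e := by
  rw [A.sq_eq, map_smul, map_sum, smul_eq_mul, Finset.sum_eq_single 0]
  · rw [A.lo_zero, dl_one, mul_one, σ.e_idem]
  · intro X _ hX
    rw [tau_eye, tau_e_g]
    exact fun h => hX (A.lo_in h)
  · simp

lemma grv_s : grv σ σ A.s = A.Q⁻¹ * tau σ.e := by
  rw [← A.tau_sq, grv, nn_inv_s]; rfl

lemma grv_one : grv σ σ mone = tau σ.e := by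
  have : tB σ σ mone = σ.e := tt_one
  rw [grv, this, wh_one, pm_one, inv_one, dl_one, mul_one, σ.e_idem, σ.e_idem]

lemma Adj.pm_bb (w : Mtch σ σ) (h : nn w ∈ Pb A.bb) : w = mone ∨ w = A.s := by
  have hle : ∀ c, A.f (w.1 c) ≤ A.f c := by
    intro c
    obtain ⟨i, hi⟩ := b_surj σ c
    by_contra hc
    have := h (wh σ σ w i) i (by
      change A.f (bE σ.E i) < A.f (bE σ.E (wh σ σ w i))
      rw [bE_nn, show bE σ.E i = c from hi]; exact not_le.mp hc)
    rw [mx_pm, if_pos rfl] at this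
    exact one_ne_zero this
  by_cases hab : w.1 A.a = A.b
  · right
    have : (Equiv.swap A.a A.b) * w.1 = 1 := by
      apply equiv_le_eq
      intro c
      have h1 : A.f ((Equiv.swap A.a A.b) (w.1 c)) = A.f (w.1 c) := by
        by_cases h1 : w.1 c = A.a
        · rw [h1, Equiv.swap_apply_left, A.f1, A.f2]
        by_cases h2 : w.1 c = A.b
        · rw [h2, Equiv.swap_apply_right, A.f1, A.f2]
        rw [Equiv.swap_apply_of_ne_of_ne h1 h2]
      rcases A.le_of_f (h1.le.trans (hle c)) with h2 | ⟨h2, h3⟩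
      · exact h2
      · rw [h3, hab, Equiv.swap_apply_right] at h2
        exact absurd h2 A.lt.ne
    apply Subtype.ext
    have h2 : Equiv.swap A.a A.b * (Equiv.swap A.a A.b * w.1) = Equiv.swap A.a A.b := by rw [this, mul_one]
    rw [← mul_assoc, Equiv.swap_mul_self, one_mul] at h2
    exact h2
  · left
    apply Subtype.ext
    apply equiv_le_eq
    intro c
    rcases A.le_of_f (hle c) with h2 | ⟨h2, h3⟩
    · exact h2
    · rw [h3] at h2; exact absurd h2 hab

lemma Sup_mono {G : Type} [Group G] [Fintype G] {P P' : Subgroup G} (h : P ≤ P') {x : Al G} (hx : Sup P x) : Sup P' x :=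
  fun g hg => hx g fun h' => hg (h h')

lemma Adj.coef_zero (w : Mtch σ σ) (h1 : w ≠ mone) (h2 : w ≠ A.s) :
    tau ((mackey σ σ).S w * (tt A.s * tt A.s)) = 0 := by
  change tau (((grv σ σ w)⁻¹ • (σ.e * dl (pm (wh σ σ w))⁻¹ * σ.e)) * (tt A.s * tt A.s)) = 0
  rw [smul_mul_assoc, map_smul, A.sq_eq, mul_smul_comm, map_smul, Finset.mul_sum, map_sum, Finset.sum_eq_zero]
  · simp
  intro X _
  have e1 : σ.e * dl (pm (wh σ σ w))⁻¹ * σ.e * (σ.e * dl (A.lo X) * σ.e) =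
    σ.e * dl (pm (wh σ σ w))⁻¹ * σ.e * dl (A.lo X) * σ.e := by
    simp only [← mul_assoc]; rw [mul_assoc _ σ.e σ.e, σ.e_idem]
  rw [e1, tau_mul_comm, ← mul_assoc, ← mul_assoc, ← mul_assoc, σ.e_idem]
  apply tau_Sup σ.sup_e σ.sup_e
  intro p hp p' hp' h
  have hp2 := A.Pb_le hp
  have hp2' := A.Pb_le hp'
  have hl : A.lo X ∈ Pb A.bb := Lb_le_Pb _ (A.J_Lb _)
  have : nn w = p' * A.lo X * p := by
    rw [mul_assoc, mul_assoc] at h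
    have h3 := eq_inv_of_mul_eq_one_right h
    have h4 := congrArg (fun z => nn w * z * p) h3
    simp only [mul_inv_cancel_left] at h4
    rw [mul_assoc (nn w), inv_mul_cancel, mul_one] at h4
    rw [← h4, mul_assoc]
  rcases A.pm_bb w (this ▸ (Pb _).mul_mem ((Pb _).mul_mem hp2' hl) hp2) with h | h
  · exact h1 h
  · exact h2 h

lemma lam_cast {ρ ρ' : Cusp F} (h : ρ = ρ') (g : GL (Fin ρ.d) F) (g' : GL (Fin ρ'.d) F)
    (hg : ∀ k l, mx g' (Fin.cast (congrArg Cusp.d h) k) (Fin.cast (congrArg Cusp.d h) l) = mx g k l) :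
    lam ρ' (dl g') = lam ρ (dl g) := by
  subst h
  have : g' = g := gl_ext hg
  rw [this]

/-- the product appearing in the cube -/
def Adj.cu (X Y : Matrix (Fin A.dd) (Fin A.dd) F) : GL ι F := A.J (sw _ * up X * sw _ * up Y * sw _)

lemma Adj.cu_mx (X Y) : mx (sw A.dd * up X * sw A.dd * up Y * sw A.dd : GL _ F) = Matrix.fromBlocks Y 1 (X * Y + 1) X := by
  change Matrix.fromBlocks 0 1 1 0 * Matrix.fromBlocks 1 X 0 1 * Matrix.fromBlocks 0 1 1 0 * Matrix.fromBlocks 1 Y 0 1 * Matrix.fromBlocks 0 1 1 0 = _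
  simp only [Matrix.fromBlocks_multiply]; simp

lemma Adj.cu_in {X Y} (h : A.cu X Y ∈ Pb σ.b) : X * Y = -1 := by
  rw [eq_neg_iff_add_eq_zero]
  ext k l
  have h1 := h (A.th (Sum.inl (Sum.inr k))) (A.th (Sum.inl (Sum.inl l))) (by simpa using A.lt)
  rw [Adj.cu, A.J_apply, A.cu_mx] at h1
  simpa using h1

lemma Adj.cu_mem {X Y} (h : X * Y = -1) : A.cu X Y ∈ Pb σ.b := by
  intro i j hij
  obtain ⟨x, rfl⟩ := A.th.surjective i
  obtain ⟨y, rfl⟩ := A.th.surjective j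
  have hlt := A.lt
  rw [Adj.cu, A.J_apply, A.cu_mx]
  rcases x with ((k | k) | i) <;> rcases y with ((l | l) | j)
  · simp at hij
  · simp [Sq.b] at hij; order
  · simp
  · simp [h]
  · simp at hij
  · simp
  · simp
  · simp
  · simp only [Matrix.fromBlocks_apply₂₂]
    rw [Matrix.one_apply_ne]; rintro rfl; exact absurd hij (lt_irrefl _)

lemma Adj.cu_tau (g : GL (Fin A.dd) F) : tau (σ.e * dl (A.cu (-(mx g⁻¹)) (mx g))) =
    omC (σ.ρ A.a) (-1) * (lam (σ.ρ A.a) (dl g) * lam (σ.ρ A.a) (dl g⁻¹)) * tau σ.e := by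
  have hm : A.cu (-(mx g⁻¹)) (mx g) ∈ Pb σ.b := A.cu_mem (by
    rw [neg_mul]; congr 1; exact g.inv_val)
  rw [tau_e_p hm]
  congr 1
  have hE : ∀ c k l, mx (blkP σ.E (A.cu (-(mx g⁻¹)) (mx g)) hm c) k l = mx (A.cu (-(mx g⁻¹)) (mx g)) (σ.E ⟨c, k⟩) (σ.E ⟨c, l⟩) :=
    fun c k l => rfl
  have ha : lam (σ.ρ A.a) (dl (blkP σ.E _ hm A.a)) = lam (σ.ρ A.a) (dl g) := by
    refine lam_cast rfl _ _ fun k l => ?_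
    rw [hE]
    change mx (A.cu (-(mx g⁻¹)) (mx g)) (A.th (Sum.inl (Sum.inl k))) (A.th (Sum.inl (Sum.inl l))) = _
    rw [Adj.cu, A.J_apply, A.cu_mx]; simp
  have hb : lam (σ.ρ A.b) (dl (blkP σ.E _ hm A.b)) = lam (σ.ρ A.a) (dl (scal (-1) * g⁻¹)) := by
    refine lam_cast A.eq _ _ fun k l => ?_
    rw [hE]
    change mx (A.cu (-(mx g⁻¹)) (mx g)) (A.th (Sum.inl (Sum.inr k))) (A.th (Sum.inl (Sum.inr l))) = _
    rw [Adj.cu, A.J_apply, A.cu_mx]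
    change - (mx g⁻¹) k l = ((algebraMap F (Matrix (Fin A.dd) (Fin A.dd) F) (-1)) * mx g⁻¹ : Matrix (Fin A.dd) (Fin A.dd) F) k l
    rw [map_neg, map_one, neg_one_mul]; rfl
  have hc : ∀ c, c ≠ A.a → c ≠ A.b → lam (σ.ρ c) (dl (blkP σ.E _ hm c)) = 1 := by
    intro c h1 h2
    have : blkP σ.E _ hm c = 1 := by
      apply gl_ext; intro k l
      rw [hE]
      have hh : ∀ k, σ.E ⟨c, k⟩ = A.th (Sum.inr ⟨σ.E ⟨c, k⟩, by simpa using ⟨h1, h2⟩⟩) := fun k => rfl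
      rw [hh k, hh l, Adj.cu, A.J_apply, Matrix.fromBlocks_apply₂₂, mx_one, Matrix.one_apply, Matrix.one_apply]
      simp
    rw [this, dl_one, lam_one]
  rw [← Finset.mul_prod_erase _ _ (Finset.mem_univ A.a), ha, ← Finset.mul_prod_erase _ _ (Finset.mem_erase.mpr ⟨A.lt.ne', Finset.mem_univ A.b⟩), hb,
    Finset.prod_eq_one, mul_one, dl_mul, lam_scal]
  · ring
  · intro c hc'
    simp only [Finset.mem_erase] at hc'
    exact hc c hc'.2.1 hc'.1

lemma Adj.cube_eq : σ.e * dl (nn A.s) * A.eab * dl (nn A.s) * A.eab * dl (nn A.s) * σ.e =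
      (A.Q⁻¹ * A.Q⁻¹) • ∑ X, ∑ Y, σ.e * dl (A.cu X Y) * σ.e := by
  have h3 : ∀ Y, σ.e * dl (nn A.s) * A.eab * dl (nn A.s) * dl (A.J (up Y)) * (dl (nn A.s) * σ.e) =
      A.Q⁻¹ • ∑ X, σ.e * dl (nn A.s) * dl (A.J (up X)) * (dl (nn A.s) * dl (A.J (up Y)) * (dl (nn A.s) * σ.e)) := by
    intro Y
    refine Eq.trans ?_ (A.eab_mid _ _); simp only [mul_assoc]
  have h4 : ∀ X Y, σ.e * dl (nn A.s) * dl (A.J (up X)) * (dl (nn A.s) * dl (A.J (up Y)) * (dl (nn A.s) * σ.e)) = σ.e * dl (A.cu X Y) * σ.e := by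
    intro X Y
    rw [Adj.cu, map_mul, map_mul, map_mul, map_mul, A.J_sw, dl_mul, dl_mul, dl_mul, dl_mul]; simp only [mul_assoc]
  rw [mul_assoc (σ.e * dl (nn A.s) * A.eab * dl (nn A.s) * A.eab), mul_smul]
  refine (A.eab_mid _ _).trans (congrArg _ ?_)
  refine (Finset.sum_congr rfl fun Y _ => h3 Y).trans ?_
  rw [← Finset.smul_sum]
  refine congrArg _ ?_
  refine Finset.sum_comm.trans ?_
  exact Finset.sum_congr rfl fun X _ => Finset.sum_congr rfl fun Y _ => h4 X Y

lemma Adj.tau_cu : tau (tt A.s * (tt A.s * tt A.s)) = A.Q⁻¹ * A.Q⁻¹ * (omC (σ.ρ A.a) (-1) * hC (σ.ρ A.a) * tau σ.e) := by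
  have e1 : tt A.s * (tt A.s * tt A.s) = σ.e * dl (nn A.s) * A.eab * dl (nn A.s) * A.eab * dl (nn A.s) * σ.e := by
    have h1 : tt A.s * (tt A.s * tt A.s) = (tt A.s * dl (nn A.s)) * tt A.s := by
      calc _ = (σ.e * dl (nn A.s) * σ.e) * ((σ.e * dl (nn A.s) * σ.e) * (σ.e * dl (nn A.s) * σ.e)) := rfl
        _ = (σ.e * dl (nn A.s) * σ.e) * dl (nn A.s) * (σ.e * dl (nn A.s) * σ.e) := by
          simp only [← mul_assoc]
          rw [mul_assoc _ σ.e σ.e, σ.e_idem, mul_assoc _ σ.e σ.e, σ.e_idem]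
    rw [h1]; nth_rewrite 1 [A.ts1]; rw [A.ts2]; simp only [mul_assoc]
  rw [e1, A.cube_eq, map_smul, smul_eq_mul, map_sum]
  congr 1
  simp only [map_sum, tau_eye]
  rw [Finset.sum_comm, ← sum_lam, Finset.mul_sum, Finset.sum_mul]
  symm
  refine Finset.sum_of_injOn (fun g : GL (Fin A.dd) F => mx g) (fun g _ g' _ h => Units.ext h) (fun _ _ => by simp) ?_ ?_
  · intro Y _ hY
    refine Finset.sum_eq_zero fun X _ => tau_e_g _ fun h => hY ?_
    have h1 := A.cu_in h
    have h2 : (-X) * Y = 1 := by rw [neg_mul, h1, neg_neg]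
    exact ⟨⟨Y, -X, mul_eq_one_comm.mp h2, h2⟩, by simp, rfl⟩
  · intro g _
    rw [Finset.sum_eq_single (-(mx g⁻¹)), A.cu_tau]
    · intro X _ hX
      refine tau_e_g _ fun h => hX ?_
      have h1 := A.cu_in h
      have h2 : X * (mx g * mx g⁻¹) = - mx g⁻¹ := by rw [← mul_assoc, h1, neg_one_mul]
      have h3 : mx g * mx g⁻¹ = 1 := g.val_inv
      rw [h3, mul_one] at h2; exact h2
    · simp

lemma Adj.s_ne : A.s ≠ mone := fun h => by
  have := congrArg (fun w : Mtch σ σ => w.1 A.a) h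
  simp [Adj.s, mone] at this
  exact A.lt.ne' this

lemma tau_e_ne : tau σ.e ≠ 0 := by rw [← grv_one]; exact grv_ne _ _ _

/-- the quadratic relation -/
lemma Adj.R2 : tt A.s * tt A.s = A.Q⁻¹ • (σ.e + (omC (σ.ρ A.a) (-1) * hC (σ.ρ A.a)) • tt A.s) := by
  have h := (mackey σ σ).expand (tt A.s * tt A.s)
  have h0 : σ.e * (tt A.s * tt A.s) * σ.e = tt A.s * tt A.s := by
    have e1 : tt A.s = σ.e * tt A.s := by rw [tt_def, ← mul_assoc, ← mul_assoc, σ.e_idem]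
    have e2 : tt A.s = tt A.s * σ.e := by rw [tt_def, mul_assoc (σ.e * dl (nn A.s)), σ.e_idem]
    rw [← mul_assoc, ← e1, mul_assoc, ← e2]
  rw [h0, show (mackey σ σ).t = 1 from rfl, one_smul] at h
  rw [← h, ← Finset.add_sum_erase _ _ (Finset.mem_univ (mone : Mtch σ σ)),
    ← Finset.add_sum_erase _ _ (Finset.mem_erase.mpr ⟨A.s_ne, Finset.mem_univ A.s⟩), Finset.sum_eq_zero, add_zero, smul_add, smul_smul]
  · have c1 : tau ((mackey σ σ).S mone * (tt A.s * tt A.s)) = A.Q⁻¹ := by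
      change tau (((grv σ σ mone)⁻¹ • (σ.e * dl (pm (wh σ σ mone))⁻¹ * σ.e)) * (tt A.s * tt A.s)) = _
      rw [wh_one, pm_one, inv_one, dl_one, mul_one, σ.e_idem, smul_mul_assoc, map_smul, grv_one, smul_eq_mul]
      have : tau (σ.e * (tt A.s * tt A.s)) = tau (tt A.s * tt A.s) := by rw [← tau_eye, h0]
      rw [this, A.tau_sq, mul_comm, mul_assoc, mul_inv_cancel₀ tau_e_ne, mul_one]
    have c2 : tau ((mackey σ σ).S A.s * (tt A.s * tt A.s)) = A.Q⁻¹ * (omC (σ.ρ A.a) (-1) * hC (σ.ρ A.a)) := by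
      change tau (((grv σ σ A.s)⁻¹ • (σ.e * dl (nn A.s)⁻¹ * σ.e)) * (tt A.s * tt A.s)) = _
      rw [nn_inv_s, smul_mul_assoc, map_smul, ← tt_def, A.tau_cu, grv_s, smul_eq_mul]
      have := A.Q_ne
      have := tau_e_ne (σ := σ)
      field_simp
    rw [c1, c2]
    exact congrArg₂ _ (congrArg _ tt_one) rfl
  · intro w hw
    simp only [Finset.mem_erase] at hw
    exact (congrArg (fun z => z • (mackey σ σ).T w) (A.coef_zero w hw.2.1 hw.1)).trans (zero_smul _ _)

end hecke
end
end HRV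
end modH10

section modH11
set_option autoImplicit false
open scoped MatrixGroups
open Finset

namespace HRV
noncomputable section

section perms
variable {m : ℕ}

/-- adjacent pairs -/
structure SR (m : ℕ) where
  a : Fin m
  b : Fin m
  h : b.1 = a.1 + 1

abbrev SR.s (r : SR m) : Equiv.Perm (Fin m) := Equiv.swap r.a r.b

lemma SR.ss (r : SR m) : r.s * r.s = 1 := Equiv.swap_mul_self _ _
lemma SR.ss' (r : SR m) (w : Equiv.Perm (Fin m)) : r.s * (r.s * w) = w := by rw [← mul_assoc, r.ss, one_mul]

lemma SR.ne (r : SR m) : r.a ≠ r.b := fun h => by have := r.h; rw [h] at this; omega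

def SR.asc (r : SR m) (w : Equiv.Perm (Fin m)) : Prop := w.symm r.a < w.symm r.b

lemma SR.symm_mul (r : SR m) (w : Equiv.Perm (Fin m)) (x) : (r.s * w).symm x = w.symm (r.s x) := by
  rw [Equiv.symm_apply_eq, Equiv.Perm.mul_apply, Equiv.apply_symm_apply, Equiv.swap_apply_self]

lemma SR.asc_mul (r : SR m) (w : Equiv.Perm (Fin m)) : r.asc (r.s * w) ↔ ¬ r.asc w := by
  unfold SR.asc
  rw [r.symm_mul, r.symm_mul, Equiv.swap_apply_left, Equiv.swap_apply_right, not_lt]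
  have : w.symm r.b ≠ w.symm r.a := fun h => r.ne (w.symm.injective h).symm
  exact ⟨fun h => h.le, fun h => lt_of_le_of_ne h this⟩

def invs (w : Equiv.Perm (Fin m)) : Finset (Fin m × Fin m) :=
  univ.filter fun p => p.1 < p.2 ∧ w.symm p.2 < w.symm p.1

def inv (w : Equiv.Perm (Fin m)) : ℕ := (invs w).card

lemma SR.lt_swap (r : SR m) {x y : Fin m} (h : x < y) (hne : ¬ (x = r.a ∧ y = r.b)) : r.s x < r.s y := by
  have hr := r.h
  rw [Equiv.swap_apply_def, Equiv.swap_apply_def]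
  simp only [Fin.ext_iff, Fin.lt_def] at *
  split_ifs <;> (try simp only [Fin.ext_iff, Fin.lt_def] at *) <;> omega

lemma SR.inv_mul (r : SR m) {w : Equiv.Perm (Fin m)} (h : r.asc w) : inv (r.s * w) = inv w + 1 := by
  have hmem : (r.a, r.b) ∈ invs (r.s * w) := by
    simp only [invs, mem_filter, mem_univ, true_and]
    rw [r.symm_mul, r.symm_mul, Equiv.swap_apply_left, Equiv.swap_apply_right]
    exact ⟨by rw [Fin.lt_def, r.h]; omega, h⟩
  rw [inv, ← Finset.card_erase_add_one hmem, inv]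
  congr 1
  refine Finset.card_nbij' (fun p => (r.s p.1, r.s p.2)) (fun p => (r.s p.1, r.s p.2)) ?_ ?_ ?_ ?_
  · rintro ⟨x, y⟩ hp
    simp only [invs, Finset.coe_erase, Finset.coe_filter, mem_univ, true_and, Set.mem_diff, Set.mem_setOf_eq, Set.mem_singleton_iff, Prod.mk.injEq, r.symm_mul] at hp ⊢
    exact ⟨r.lt_swap hp.1.1 hp.2, hp.1.2⟩
  · rintro ⟨x, y⟩ hp
    simp only [invs, Finset.coe_erase, Finset.coe_filter, mem_univ, true_and, Set.mem_diff, Set.mem_setOf_eq, Set.mem_singleton_iff, Prod.mk.injEq, r.symm_mul, Equiv.swap_apply_self] at hp ⊢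
    refine ⟨⟨r.lt_swap hp.1 ?_, hp.2⟩, ?_⟩
    · rintro ⟨rfl, rfl⟩; exact absurd hp.2 (not_lt.mpr h.le)
    · rintro ⟨h1, h2⟩
      rw [Equiv.swap_apply_eq_iff, Equiv.swap_apply_left] at h1
      rw [Equiv.swap_apply_eq_iff, Equiv.swap_apply_right] at h2
      rw [h1, h2, Fin.lt_def, r.h] at hp; omega
  · rintro ⟨x, y⟩ _; simp
  · rintro ⟨x, y⟩ _; simp

lemma inv_one : inv (1 : Equiv.Perm (Fin m)) = 0 := by
  rw [inv, Finset.card_eq_zero, invs, Finset.filter_eq_empty_iff]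
  rintro ⟨x, y⟩ _ ⟨h1, h2⟩
  exact absurd h1 (not_lt.mpr (le_of_lt h2))

lemma exists_desc (w : Equiv.Perm (Fin m)) (h : w ≠ 1) : ∃ r : SR m, ¬ r.asc w := by
  by_contra hcon
  push Not at hcon
  apply h
  have hmono : StrictMono w.symm := by
    cases m with
    | zero => intro x; exact x.elim0
    | succ m =>
      rw [Fin.strictMono_iff_lt_succ]
      intro i
      exact hcon ⟨i.castSucc, i.succ, by simp⟩
  have hid : ∀ x, x ≤ w.symm x := hmono.id_le
  have := equiv_le_eq (1 : Equiv.Perm (Fin m)) w.symm hid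
  refine Equiv.ext fun x => ?_
  have h2 := Equiv.congr_fun this (w x)
  rw [Equiv.symm_apply_apply] at h2
  exact h2

open Classical in
/-- chosen descent -/
def rr (w : Equiv.Perm (Fin m)) (h : w ≠ 1) : SR m := (exists_desc w h).choose
lemma rr_spec (w : Equiv.Perm (Fin m)) (h : w ≠ 1) : ¬ (rr w h).asc w := (exists_desc w h).choose_spec

lemma SR.asc_of (r : SR m) {w : Equiv.Perm (Fin m)} (h : ¬ r.asc w) : r.asc (r.s * w) := (r.asc_mul w).mpr h
lemma SR.inv_desc (r : SR m) {w : Equiv.Perm (Fin m)} (h : ¬ r.asc w) : inv w = inv (r.s * w) + 1 := by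
  rw [← r.inv_mul (r.asc_of h), r.ss']

abbrev PM (m : ℕ) := Matrix (Equiv.Perm (Fin m)) (Equiv.Perm (Fin m)) ℂ

open Classical in
/-- simple generator matrix -/
def Ms (κ : ℂ) (r : SR m) : PM m := Matrix.of fun x y =>
  (if x = r.s * y then 1 else 0) + (if x = y ∧ ¬ r.asc y then κ else 0)

open Classical in
def Mf (κ : ℂ) : ℕ → Equiv.Perm (Fin m) → PM m
  | 0, _ => 1
  | n+1, w => if h : w ≠ 1 then Ms κ (rr w h) * Mf κ n ((rr w h).s * w) else 1

def Mw (κ : ℂ) (w : Equiv.Perm (Fin m)) : PM m := Mf κ (inv w) w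

lemma Mw_one (κ : ℂ) : Mw κ (1 : Equiv.Perm (Fin m)) = 1 := by
  rw [Mw, inv_one, Mf]

lemma Mw_rec (κ : ℂ) (w : Equiv.Perm (Fin m)) (h : w ≠ 1) : Mw κ w = Ms κ (rr w h) * Mw κ ((rr w h).s * w) := by
  rw [Mw, (rr w h).inv_desc (rr_spec w h), Mf, dif_pos h, Mw]

lemma perm_ind {p : Equiv.Perm (Fin m) → Prop} (h1 : p 1)
    (h2 : ∀ w (h : w ≠ 1), p ((rr w h).s * w) → p w) (w) : p w := by
  induction hk : inv w using Nat.strong_induction_on generalizing w with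
  | _ k ih =>
    by_cases h : w = 1
    · rw [h]; exact h1
    · refine h2 w h (ih _ ?_ _ rfl)
      rw [← hk, (rr w h).inv_desc (rr_spec w h)]; omega

def sgn (w : Equiv.Perm (Fin m)) : ℂ := ((Equiv.Perm.sign w : ℤ) : ℂ)
lemma sgn_sq (w : Equiv.Perm (Fin m)) : sgn w * sgn w = 1 := by
  unfold sgn; rcases Int.units_eq_one_or (Equiv.Perm.sign w) with h | h <;> simp [h]
lemma sgn_s (r : SR m) (w : Equiv.Perm (Fin m)) : sgn (r.s * w) = - sgn w := by
  unfold sgn; rw [Equiv.Perm.sign_mul, Equiv.Perm.sign_swap r.ne]; simp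

def Dg (m : ℕ) : PM m := Matrix.diagonal sgn
lemma Dg_sq : Dg m * Dg m = 1 := by
  rw [Dg, Matrix.diagonal_mul_diagonal]; simp only [sgn_sq]; exact Matrix.diagonal_one

lemma Ms_neg (κ : ℂ) (r : SR m) : Ms (-κ) r = - (Dg m * Ms κ r * Dg m) := by
  ext x y
  rw [Matrix.neg_apply, Dg, Matrix.mul_diagonal, Matrix.diagonal_mul, Ms, Ms, Matrix.of_apply, Matrix.of_apply]
  by_cases h1 : x = r.s * y
  · have h2 : x ≠ y := by
      rintro rfl
      have := sgn_s r x
      rw [← h1] at this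
      have h3 := sgn_sq x
      have : sgn x = 0 := by linear_combination this / 2
      rw [this] at h3; simp at h3
    simp only [if_pos h1, if_neg (fun h : x = y ∧ ¬ r.asc y => h2 h.1)]
    rw [h1, sgn_s]
    have := sgn_sq y
    linear_combination -this
  · simp only [if_neg h1]
    by_cases h2 : x = y ∧ ¬ r.asc y
    · simp only [if_pos h2]; rw [h2.1]
      have := sgn_sq y
      linear_combination κ * this
    · simp only [if_neg h2]; simp

lemma Mw_neg (κ : ℂ) (w : Equiv.Perm (Fin m)) : Mw (-κ) w = sgn w • (Dg m * Mw κ w * Dg m) := by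
  induction w using perm_ind with
  | h1 => rw [Mw_one, Mw_one, mul_one, Dg_sq]; simp [sgn]
  | h2 w h ih =>
    have e : sgn w = - sgn ((rr w h).s * w) := by rw [sgn_s, neg_neg]
    rw [Mw_rec _ w h, ih, Ms_neg, Mw_rec κ w h, e, mul_smul_comm, neg_smul, neg_mul, smul_neg]
    congr 2
    simp only [mul_assoc]
    rw [← mul_assoc (Dg m) (Dg m), Dg_sq, one_mul]

def C1m (m : ℕ) (κ : ℂ) : PM m := ∑ w, Mw κ w * (Mw κ w).transpose
def Cm (m : ℕ) (κ : ℂ) : PM m := ∑ x, ∑ y, Mw κ x * Mw κ y * (Mw κ x).transpose * (Mw κ y).transpose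

/-- generic trace function -/
def Fg (g m : ℕ) (κ : ℂ) : ℂ := (Cm m κ ^ g * (C1m m κ)⁻¹ * (C1m m κ)⁻¹).trace

lemma Dg_t : (Dg m).transpose = Dg m := Matrix.diagonal_transpose _

lemma Mw_neg_t (κ : ℂ) (w : Equiv.Perm (Fin m)) : (Mw (-κ) w).transpose = sgn w • (Dg m * (Mw κ w).transpose * Dg m) := by
  rw [Mw_neg, Matrix.transpose_smul, Matrix.transpose_mul, Matrix.transpose_mul, Dg_t, mul_assoc]

lemma C1m_neg (κ : ℂ) : C1m m (-κ) = Dg m * C1m m κ * Dg m := by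
  rw [C1m, C1m, Finset.mul_sum, Finset.sum_mul]
  refine Finset.sum_congr rfl fun w _ => ?_
  rw [Mw_neg_t, Mw_neg, smul_mul_smul_comm, sgn_sq, one_smul]
  simp only [mul_assoc]
  rw [← mul_assoc (Dg m) (Dg m), Dg_sq, one_mul]

lemma Cm_neg (κ : ℂ) : Cm m (-κ) = Dg m * Cm m κ * Dg m := by
  rw [Cm, Cm, Finset.mul_sum, Finset.sum_mul]
  refine Finset.sum_congr rfl fun x _ => ?_
  rw [Finset.mul_sum, Finset.sum_mul]
  refine Finset.sum_congr rfl fun y _ => ?_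
  rw [Mw_neg_t, Mw_neg_t, Mw_neg, Mw_neg, smul_mul_smul_comm, smul_mul_smul_comm, smul_mul_smul_comm,
    show sgn x * sgn y * sgn x * sgn y = 1 by linear_combination (sgn y * sgn y) * sgn_sq x + sgn_sq y, one_smul]
  simp only [mul_assoc]
  simp only [← mul_assoc (Dg m) (Dg m), Dg_sq, one_mul]

lemma Fg_neg (g : ℕ) (κ : ℂ) : Fg g m (-κ) = Fg g m κ := by
  have hD : (Dg m)⁻¹ = Dg m := Matrix.inv_eq_left_inv Dg_sq
  have hp : ∀ k : ℕ, (Dg m * Cm m κ * Dg m) ^ k = Dg m * Cm m κ ^ k * Dg m := by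
    intro k
    induction k with
    | zero => rw [pow_zero, pow_zero, mul_one, Dg_sq]
    | succ k ih =>
      rw [pow_succ, ih, pow_succ]; simp only [mul_assoc]
      simp only [← mul_assoc (Dg m) (Dg m), Dg_sq, one_mul]
  rw [Fg, C1m_neg, Cm_neg, hp, Matrix.mul_inv_rev, Matrix.mul_inv_rev, hD]
  have : Dg m * Cm m κ ^ g * Dg m * (Dg m * ((C1m m κ)⁻¹ * Dg m)) * (Dg m * ((C1m m κ)⁻¹ * Dg m)) =
    Dg m * (Cm m κ ^ g * (C1m m κ)⁻¹ * (C1m m κ)⁻¹ * Dg m) := by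
    simp only [mul_assoc]
    simp only [← mul_assoc (Dg m) (Dg m), Dg_sq, one_mul]
  rw [this, Matrix.trace_mul_comm, mul_assoc, Dg_sq, mul_one, Fg]

lemma Mw_real {κ : ℂ} (hκ : star κ = κ) (w : Equiv.Perm (Fin m)) : (Mw κ w).transpose = (Mw κ w).conjTranspose := by
  induction w using perm_ind with
  | h1 => rw [Mw_one]; simp
  | h2 w h ih =>
    rw [Mw_rec _ w h, Matrix.transpose_mul, Matrix.conjTranspose_mul, ih]
    congr 1
    ext x y
    rw [Matrix.transpose_apply, Matrix.conjTranspose_apply, Ms, Matrix.of_apply]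
    split_ifs <;> simp [hκ] <;> exact hκ.symm

open scoped ComplexOrder in
lemma C1m_unit {κ : ℂ} (hκ : star κ = κ) : IsUnit (C1m m κ) := by
  have : (C1m m κ).PosDef := by
    rw [C1m, ← Finset.add_sum_erase _ _ (Finset.mem_univ (1 : Equiv.Perm (Fin m)))]
    apply Matrix.PosDef.add_posSemidef
    · rw [Mw_one]; simpa using Matrix.PosDef.one
    · apply Matrix.posSemidef_sum
      intro w _
      rw [Mw_real hκ]
      exact Matrix.posSemidef_self_mul_conjTranspose _
  exact this.isUnit

end perms

section kron
variable {C : Type} [Fintype C] [DecidableEq C] {X : C → Type} [∀ c, Fintype (X c)] [∀ c, DecidableEq (X c)]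

/-- Kronecker product over a finite family -/
def kr (A : Π c, Matrix (X c) (X c) ℂ) : Matrix (Π c, X c) (Π c, X c) ℂ := Matrix.of fun x y => ∏ c, A c (x c) (y c)

lemma kr_mul (A B : Π c, Matrix (X c) (X c) ℂ) : kr A * kr B = kr (fun c => A c * B c) := by
  ext x y
  simp only [kr, Matrix.mul_apply, Matrix.of_apply, Finset.prod_univ_sum, Fintype.piFinset_univ, Finset.prod_mul_distrib]

lemma kr_one : kr (fun c => (1 : Matrix (X c) (X c) ℂ)) = 1 := by
  ext x y
  rw [kr, Matrix.of_apply, Matrix.one_apply]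
  split_ifs with h
  · subst h; simp
  · obtain ⟨c, hc⟩ := Function.ne_iff.mp h
    exact Finset.prod_eq_zero (Finset.mem_univ c) (Matrix.one_apply_ne hc)

lemma kr_trace (A : Π c, Matrix (X c) (X c) ℂ) : (kr A).trace = ∏ c, (A c).trace := by
  simp only [Matrix.trace, kr, Matrix.diag_apply, Matrix.of_apply, Finset.prod_univ_sum, Fintype.piFinset_univ]

lemma kr_sum {Y : C → Type} [∀ c, Fintype (Y c)] (A : Π c, Y c → Matrix (X c) (X c) ℂ) :
    ∑ y : Π c, Y c, kr (fun c => A c (y c)) = kr (fun c => ∑ y, A c y) := by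
  ext x z
  simp only [Matrix.sum_apply, kr, Matrix.of_apply, Finset.prod_univ_sum, Fintype.piFinset_univ]

lemma kr_pow (A : Π c, Matrix (X c) (X c) ℂ) (k : ℕ) : kr A ^ k = kr (fun c => A c ^ k) := by
  induction k with
  | zero => simp only [pow_zero, kr_one]
  | succ k ih => simp only [pow_succ, ih, kr_mul]

lemma kr_inv (A : Π c, Matrix (X c) (X c) ℂ) (h : ∀ c, IsUnit (A c)) : (kr A)⁻¹ = kr (fun c => (A c)⁻¹) := by
  apply Matrix.inv_eq_right_inv
  rw [kr_mul, ← kr_one]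
  congr 1; funext c
  exact Matrix.mul_nonsing_inv _ ((Matrix.isUnit_iff_isUnit_det _).mp (h c))

end kron
end
end HRV
end modH11

section modH12
set_option autoImplicit false
open scoped MatrixGroups
open Finset

namespace HRV
noncomputable section

section abs
variable {G : Type} [Group G] [Fintype G] {C : Type} [Fintype C] [DecidableEq C] {m : C → ℕ}

abbrev WW (m : C → ℕ) := Π c, Equiv.Perm (Fin (m c))

/-- left multiplication by a simple reflection -/
def sl (w : WW m) (c : C) (R : SR (m c)) : WW m := Function.update w c (R.s * w c)

lemma sl_same (w : WW m) (c : C) (R : SR (m c)) : sl w c R c = R.s * w c := Function.update_self _ _ _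
lemma sl_ne (w : WW m) (c : C) (R : SR (m c)) {c' : C} (h : c' ≠ c) : sl w c R c' = w c' := Function.update_of_ne h _ _
lemma sl_sl (w : WW m) (c : C) (R : SR (m c)) : sl (sl w c R) c R = w := by
  funext c'
  by_cases h : c' = c
  · subst h; rw [sl_same, sl_same, R.ss']
  · rw [sl_ne _ _ _ h, sl_ne _ _ _ h]

def linv (w : WW m) : ℕ := ∑ c, inv (w c)

lemma linv_sl (w : WW m) (c : C) (R : SR (m c)) (h : R.asc (w c)) : linv (sl w c R) = linv w + 1 := by
  rw [linv, linv, ← Finset.add_sum_erase _ _ (mem_univ c), ← Finset.add_sum_erase _ (fun c => inv (w c)) (mem_univ c), sl_same, R.inv_mul h]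
  have : ∑ x ∈ univ.erase c, inv (sl w c R x) = ∑ x ∈ univ.erase c, inv (w x) :=
    Finset.sum_congr rfl fun x hx => by rw [sl_ne _ _ _ (Finset.ne_of_mem_erase hx)]
  rw [this]; ring

lemma WW_ind {p : WW m → Prop} (h1 : p 1)
    (h2 : ∀ w c (h : w c ≠ 1), p (sl w c (rr (w c) h)) → p w) (w) : p w := by
  induction hk : linv w using Nat.strong_induction_on generalizing w with
  | _ k ih =>
    by_cases h : w = 1
    · rw [h]; exact h1
    · obtain ⟨c, hc⟩ := Function.ne_iff.mp h
      refine h2 w c hc (ih _ ?_ _ rfl)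
      have := linv_sl (sl w c (rr (w c) hc)) c (rr (w c) hc) (by rw [sl_same]; exact SR.asc_of _ (rr_spec _ hc))
      rw [sl_sl] at this
      omega

structure HD {e : Al G} (D : DB e e (WW m)) (κ : C → ℂ) (ts : Π c, SR (m c) → Al G) : Prop where
  T1 : D.T 1 = e
  S1 : D.S 1 = e
  ets : ∀ c R, e * ts c R = ts c R
  hT : ∀ c (R : SR (m c)) w, R.asc (w c) → ts c R * D.T w = D.T (sl w c R)
  hS : ∀ c (R : SR (m c)) w, R.asc (w c) → D.S w * ts c R = D.S (sl w c R)
  h2 : ∀ c R, ts c R * ts c R = e + κ c • ts c R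

variable {e : Al G} {D : DB e e (WW m)} {κ : C → ℂ} {ts : Π c, SR (m c) → Al G} (H : HD D κ ts)

lemma eTl (w) : e * D.T w = D.T w := by
  rw [← D.eT w, ← mul_assoc, ← mul_assoc, D.he]
lemma eSl (w) : e * D.S w = D.S w := by
  rw [← D.eS w, ← mul_assoc, ← mul_assoc, D.he]

open Classical in
lemma tST (x y : WW m) : D.t⁻¹ * tau (D.S x * D.T y) = if x = y then 1 else 0 := by
  split_ifs with h
  · rw [h, D.gram_self, inv_mul_cancel₀ D.ht]
  · rw [D.gram_ne _ _ h, mul_zero]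

lemma HD.tsT (H : HD D κ ts) (c) (R : SR (m c)) (w) (h : ¬ R.asc (w c)) :
    ts c R * D.T w = D.T (sl w c R) + κ c • D.T w := by
  have h1 := H.hT c R (sl w c R) (by rw [sl_same]; exact R.asc_of h)
  rw [sl_sl] at h1
  rw [← h1, ← mul_assoc, H.h2, add_mul, smul_mul_assoc, eTl]

lemma kr_entry (A : Π c, PM (m c)) (x y : WW m) : kr A x y = ∏ c, A c (x c) (y c) := rfl

lemma kr_update (c : C) (M : PM (m c)) (x y : WW m) :
    kr (Function.update (fun c => (1 : PM (m c))) c M) x y = M (x c) (y c) * ∏ c' ∈ univ.erase c, (1 : PM (m c')) (x c') (y c') := by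
  rw [kr_entry, ← Finset.mul_prod_erase _ _ (mem_univ c), Function.update_self]
  congr 1
  exact Finset.prod_congr rfl fun x hx => by rw [Function.update_of_ne (Finset.ne_of_mem_erase hx)]

lemma HD.Lts (H : HD D κ ts) (c) (R : SR (m c)) :
    D.L (ts c R) = kr (Function.update (fun c => (1 : PM (m c))) c (Ms (κ c) R)) := by
  classical
  ext x y
  rw [kr_update]
  have e1 : D.L (ts c R) x y = (if x = sl y c R then 1 else 0) + if ¬ R.asc (y c) then κ c * (if x = y then 1 else 0) else 0 := by
    rw [DB.L, Matrix.of_apply, mul_assoc]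
    by_cases h : R.asc (y c)
    · rw [H.hT c R y h, tST, if_neg (not_not.mpr h), add_zero]
    · rw [H.tsT c R y h, mul_add, map_add, mul_add, tST, if_pos h, mul_smul_comm, map_smul, smul_eq_mul, mul_left_comm, tST]
  rw [e1]
  by_cases h : ∀ c', c' ≠ c → x c' = y c'
  · have e2 : ∏ c' ∈ univ.erase c, (1 : PM (m c')) (x c') (y c') = 1 :=
      Finset.prod_eq_one fun c' hc' => by rw [h c' (Finset.ne_of_mem_erase hc'), Matrix.one_apply_eq]
    have i1 : x = sl y c R ↔ x c = R.s * y c := by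
      constructor
      · intro hh; rw [hh, sl_same]
      · intro hh; funext c'
        by_cases hc : c' = c
        · subst hc; rw [hh, sl_same]
        · rw [h c' hc, sl_ne _ _ _ hc]
    have i2 : x = y ↔ x c = y c := by
      constructor
      · intro hh; rw [hh]
      · intro hh; funext c'
        by_cases hc : c' = c
        · subst hc; exact hh
        · exact h c' hc
    rw [e2, mul_one, Ms, Matrix.of_apply]
    simp only [i1, i2]
    by_cases h3 : x c = y c <;> by_cases h4 : R.asc (y c) <;> simp [h3, h4]
  · push Not at h
    obtain ⟨c', hc', hne⟩ := h
    have e2 : ∏ c' ∈ univ.erase c, (1 : PM (m c')) (x c') (y c') = 0 :=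
      Finset.prod_eq_zero (Finset.mem_erase.mpr ⟨hc', mem_univ _⟩) (Matrix.one_apply_ne hne)
    have i1 : x ≠ sl y c R := fun hh => hne (by rw [hh, sl_ne _ _ _ hc'])
    have i2 : x ≠ y := fun hh => hne (by rw [hh])
    rw [e2, if_neg i1, if_neg i2]; simp

lemma Ms_t {m : ℕ} (κ : ℂ) (R : SR m) : (Ms κ R).transpose = Ms κ R := by
  ext x y
  rw [Matrix.transpose_apply, Ms, Matrix.of_apply, Matrix.of_apply]
  have i1 : y = R.s * x ↔ x = R.s * y := ⟨fun h => by rw [h, R.ss'], fun h => by rw [h, R.ss']⟩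
  have i2 : (y = x ∧ ¬ R.asc x) ↔ (x = y ∧ ¬ R.asc y) :=
    ⟨fun h => ⟨h.1.symm, h.1 ▸ h.2⟩, fun h => ⟨h.1.symm, h.1 ▸ h.2⟩⟩
  classical
  refine congrArg₂ (· + ·) (if_congr i1 rfl rfl) ?_
  by_cases h : x = y ∧ ¬ R.asc y
  · rw [if_pos h, if_pos (i2.mpr h)]
  · rw [if_neg h, if_neg (fun h' => h (i2.mp h'))]

lemma HD.LT (H : HD D κ ts) (w : WW m) : D.L (D.T w) = kr (fun c => Mw (κ c) (w c)) := by
  induction w using WW_ind with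
  | h1 =>
    rw [H.T1, D.L_e, ← kr_one]
    congr 1; funext c; exact (Mw_one _).symm
  | h2 w c h ih =>
    have h1 := H.hT c (rr (w c) h) (sl w c (rr (w c) h)) (by rw [sl_same]; exact SR.asc_of _ (rr_spec _ h))
    rw [sl_sl] at h1
    rw [← h1, D.L_mul _ _ (eTl _), ih, H.Lts, kr_mul]
    congr 1; funext c'
    by_cases hc : c' = c
    · subst hc; rw [Function.update_self, sl_same, ← Mw_rec]
    · rw [Function.update_of_ne hc, sl_ne _ _ _ hc, one_mul]

lemma HD.LS (H : HD D κ ts) (w : WW m) : D.L (D.S w) = kr (fun c => (Mw (κ c) (w c)).transpose) := by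
  induction w using WW_ind with
  | h1 =>
    rw [H.S1, D.L_e, ← kr_one]
    congr 1; funext c; rw [Pi.one_apply, Mw_one, Matrix.transpose_one]
  | h2 w c h ih =>
    have h1 := H.hS c (rr (w c) h) (sl w c (rr (w c) h)) (by rw [sl_same]; exact SR.asc_of _ (rr_spec _ h))
    rw [sl_sl] at h1
    rw [← h1, D.L_mul _ _ (H.ets _ _), ih, H.Lts, kr_mul]
    congr 1; funext c'
    by_cases hc : c' = c
    · subst hc; rw [Function.update_self, sl_same, Mw_rec _ _ h, Matrix.transpose_mul, Ms_t]
    · rw [Function.update_of_ne hc, sl_ne _ _ _ hc, mul_one]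

theorem HD.main (H : HD D κ ts) (hκ : ∀ c, star (κ c) = κ c) (g : ℕ) :
    (∑ i : Irr G, if rk i e = 0 then 0 else (D.t * hk i) ^ (2 * g) * ((D.t * hk i) ^ 2)⁻¹) = ∏ c, Fg g (m c) (κ c) := by
  have h1 : kr (fun c => C1m (m c) (κ c)) = ∑ x, D.L (D.T x) * D.L (D.S x) := by
    simp only [H.LT, H.LS, kr_mul]
    exact (kr_sum (fun c (w : Equiv.Perm (Fin (m c))) => Mw (κ c) w * (Mw (κ c) w).transpose)).symm
  have h2 : kr (fun c => Cm (m c) (κ c)) = ∑ x, ∑ y, D.L (D.T x) * D.L (D.T y) * D.L (D.S x) * D.L (D.S y) := by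
    simp only [H.LT, H.LS, kr_mul]
    have : ∀ x : WW m, ∑ y : WW m, kr (fun c => Mw (κ c) (x c) * Mw (κ c) (y c) * (Mw (κ c) (x c)).transpose * (Mw (κ c) (y c)).transpose) =
        kr (fun c => ∑ y, Mw (κ c) (x c) * Mw (κ c) y * (Mw (κ c) (x c)).transpose * (Mw (κ c) y).transpose) :=
      fun x => kr_sum (fun c (w : Equiv.Perm (Fin (m c))) => Mw (κ c) (x c) * Mw (κ c) w * (Mw (κ c) (x c)).transpose * (Mw (κ c) w).transpose)
    simp only [this]
    exact (kr_sum (fun c (x : Equiv.Perm (Fin (m c))) => ∑ y, Mw (κ c) x * Mw (κ c) y * (Mw (κ c) x).transpose * (Mw (κ c) y).transpose)).symm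
  rw [← (D.main g _ _ h1 h2).2, kr_inv _ fun c => C1m_unit (hκ c), kr_pow, kr_mul, kr_mul, kr_trace]
  rfl

end abs
end
end HRV
end modH12

section modH13
set_option autoImplicit false
open scoped MatrixGroups
open Finset

namespace HRV
noncomputable section

section conc
variable {F : Type} [Field F] [Fintype F] [DecidableEq F]
variable {ι : Type} [Fintype ι] [DecidableEq ι]
variable {C : Type} [LinearOrder C] [Fintype C] {m : C → ℕ}

abbrev LL (m : C → ℕ) := SL fun c => Fin (m c)

/-- canonical sequence data -/
structure CS (F : Type) [Field F] [Fintype F] [DecidableEq F] (ι : Type) [Fintype ι] [DecidableEq ι]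
   {C : Type} [LinearOrder C] [Fintype C] (m : C → ℕ) (r : C → Cusp F) where
  σ : Sq F (LL m) ι
  hσ : ∀ x, σ.ρ x = r x.1
  hr : Function.Injective r

/-- block permutation -/
def bp (w : WW m) : Equiv.Perm (LL m) where
  toFun x := SL.mk x.1 (w x.1 x.2)
  invFun x := SL.mk x.1 ((w x.1).symm x.2)
  left_inv x := by
    change SL.mk x.1 ((w x.1).symm (w x.1 x.2)) = x
    rw [Equiv.symm_apply_apply]; rfl
  right_inv x := by
    change SL.mk x.1 ((w x.1) ((w x.1).symm x.2)) = x
    rw [Equiv.apply_symm_apply]; rfl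

lemma bp_apply (w : WW m) (c : C) (k : Fin (m c)) : bp w (SL.mk c k) = SL.mk c (w c k) := rfl
lemma bp_symm (w : WW m) (c : C) (k : Fin (m c)) : (bp w).symm (SL.mk c k) = SL.mk c ((w c).symm k) := rfl

lemma LL_ext {p q : Equiv.Perm (LL m)} (h : ∀ c k, p (SL.mk c k) = q (SL.mk c k)) : p = q :=
  Equiv.ext fun x => h x.1 x.2

lemma bp_mul (v w : WW m) : bp (v * w) = bp v * bp w := LL_ext fun c k => rfl
lemma bp_one : bp (1 : WW m) = 1 := LL_ext fun c k => rfl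
lemma bp_inv (w : WW m) : bp w⁻¹ = (bp w)⁻¹ := LL_ext fun c k => rfl
lemma bp_inj : Function.Injective (bp (m := m)) := by
  intro v w h
  funext c
  refine Equiv.ext fun k => ?_
  exact SL.mk_inj (Λ := fun c => Fin (m c)) (congrArg (fun p : Equiv.Perm (LL m) => p (SL.mk c k)) h)

lemma bp_sl (w : WW m) (c : C) (R : SR (m c)) : bp (sl w c R) = Equiv.swap (SL.mk c R.a : LL m) (SL.mk c R.b) * bp w := by
  apply LL_ext
  intro c' k
  rw [Equiv.Perm.mul_apply, bp_apply, bp_apply]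
  by_cases h : c' = c
  · subst h
    rw [sl_same, Equiv.Perm.mul_apply]
    by_cases h1 : w c' k = R.a
    · rw [h1, Equiv.swap_apply_left, Equiv.swap_apply_left]
    by_cases h2 : w c' k = R.b
    · rw [h2, Equiv.swap_apply_right, Equiv.swap_apply_right]
    rw [Equiv.swap_apply_of_ne_of_ne h1 h2, Equiv.swap_apply_of_ne_of_ne (fun h => h1 (SL.mk_inj (Λ := fun c => Fin (m c)) h)) (fun h => h2 (SL.mk_inj (Λ := fun c => Fin (m c)) h))]
  · rw [sl_ne _ _ _ h, Equiv.swap_apply_of_ne_of_ne (fun h' => h (SL.mk_fst h')) (fun h' => h (SL.mk_fst h'))]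

variable {r : C → Cusp F} (K : CS F ι m r)

def CS.pw (w : WW m) : Mtch K.σ K.σ := ⟨bp w, fun x => by rw [K.hσ, K.hσ]; rfl⟩

lemma CS.pw_bij : Function.Bijective K.pw := by
  constructor
  · intro v w h; exact bp_inj (congrArg Subtype.val h)
  · rintro ⟨π, hπ⟩
    have h1 : ∀ c (k : Fin (m c)), ∃ l, π (SL.mk c k) = SL.mk c l := by
      intro c k
      have h2 := hπ (SL.mk c k)
      rw [K.hσ, K.hσ] at h2
      have h3 : (π (SL.mk c k)).1 = c := K.hr h2
      generalize π (SL.mk c k) = z at h3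
      obtain ⟨c', l⟩ := z
      change c' = c at h3
      subst h3
      exact ⟨l, rfl⟩
    choose f hf using h1
    have hinj : ∀ c, Function.Injective (f c) := by
      intro c k l h
      have : π (SL.mk c k) = π (SL.mk c l) := by rw [hf, hf, h]
      exact SL.mk_inj (Λ := fun c => Fin (m c)) (π.injective this)
    refine ⟨fun c => Equiv.ofBijective (f c) (Finite.injective_iff_bijective.mp (hinj c)), Subtype.ext (LL_ext fun c k => ?_)⟩
    exact (hf c k).symm

lemma SL_lt_same {c : C} {a b : Fin (m c)} : ((SL.mk c a : LL m) < SL.mk c b) ↔ a < b := by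
  rw [lt_iff_le_not_ge, lt_iff_le_not_ge, SL_le_same, SL_le_same]

def CS.ad (c : C) (R : SR (m c)) : Adj K.σ where
  a := SL.mk c R.a
  b := SL.mk c R.b
  lt := SL_lt_same.mpr (by rw [Fin.lt_def, R.h]; omega)
  adj := by
    rintro ⟨c', k⟩
    rcases lt_trichotomy c' c with h | h | h
    · exact Or.inl (SL_le_lt h)
    · subst h
      rcases le_or_gt k R.a with h1 | h1
      · exact Or.inl (SL_le_same.mpr h1)
      · refine Or.inr (SL_le_same.mpr ?_)
        rw [Fin.le_def, R.h]; exact h1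
    · exact Or.inr (SL_le_lt h)
  eq := by rw [K.hσ, K.hσ]; rfl

lemma CS.pw_sl (w : WW m) (c : C) (R : SR (m c)) : K.pw (sl w c R) = mmul (K.ad c R).s (K.pw w) :=
  Subtype.ext (bp_sl w c R)
lemma CS.pw_one : K.pw 1 = mone := Subtype.ext bp_one
lemma CS.pw_sl_inv (w : WW m) (c : C) (R : SR (m c)) : K.pw (sl w c R)⁻¹ = mmul (K.pw w⁻¹) (K.ad c R).s :=
  Subtype.ext (by
    change bp (sl w c R)⁻¹ = bp w⁻¹ * Equiv.swap _ _
    rw [bp_inv, bp_inv, bp_sl, mul_inv_rev, Equiv.swap_inv]; rfl)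
lemma CS.nn_inv (w : WW m) : nn (K.pw w⁻¹) = (nn (K.pw w))⁻¹ := by
  rw [eq_inv_iff_mul_eq_one, ← nn_mul]
  have : mmul (K.pw w⁻¹) (K.pw w) = mone := Subtype.ext (by
    change bp w⁻¹ * bp w = 1
    rw [← bp_mul, inv_mul_cancel, bp_one])
  rw [this, nn, wh_one, pm_one]

lemma CS.asc (w : WW m) (c : C) (R : SR (m c)) (h : R.asc (w c)) :
    (K.pw w).1.symm (K.ad c R).a < (K.pw w).1.symm (K.ad c R).b := SL_lt_same.mpr h

lemma CS.gram_ne (x y : WW m) (h : x ≠ y) : tau (tt (K.pw x⁻¹) * tt (K.pw y)) = 0 := by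
  rw [tt_def (K.pw x⁻¹), K.nn_inv]
  exact HRV.gram_ne K.σ K.σ (K.pw x) (K.pw y) fun h' => h (K.pw_bij.1 h')

lemma CS.R1 (w : WW m) (c : C) (R : SR (m c)) (h : R.asc (w c)) :
    tt (K.ad c R).s * tt (K.pw w) = tt (K.pw (sl w c R)) := by
  rw [K.pw_sl]; exact (K.ad c R).R1 _ (K.asc w c R h)
lemma CS.R1' (w : WW m) (c : C) (R : SR (m c)) (h : R.asc (w c)) :
    tt (K.pw w⁻¹) * tt (K.ad c R).s = tt (K.pw (sl w c R)⁻¹) := by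
  rw [K.pw_sl_inv]; exact (K.ad c R).R1' _ (K.asc w c R h)

lemma CS.rho_a (c : C) (R : SR (m c)) : K.σ.ρ (K.ad c R).a = r c := K.hσ _

lemma CS.Q_eq (c : C) (R : SR (m c)) : (K.ad c R).Q = (Fintype.card F : ℂ) ^ ((r c).d ^ 2) := by
  have h : (K.ad c R).dd = (r c).d := congrArg Cusp.d (K.rho_a c R)
  have h2 : Fintype.card (Matrix (Fin (K.ad c R).dd) (Fin (K.ad c R).dd) F) = Fintype.card F ^ ((r c).d ^ 2) := by
    rw [← Nat.card_eq_fintype_card]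
    change Nat.card (Fin (K.ad c R).dd → Fin (K.ad c R).dd → F) = _
    rw [Nat.card_eq_fintype_card, Fintype.card_fun, Fintype.card_fun, Fintype.card_fin, h, ← pow_mul, sq]
  rw [Adj.Q, h2]; push_cast; rfl

lemma CS.R2 (c : C) (R : SR (m c)) : tt (K.ad c R).s * tt (K.ad c R).s =
    ((Fintype.card F : ℂ) ^ ((r c).d ^ 2))⁻¹ • (K.σ.e + (omC (r c) (-1) * hC (r c)) • tt (K.ad c R).s) := by
  rw [(K.ad c R).R2, K.Q_eq, K.rho_a]

lemma CS.grec (w : WW m) (c : C) (R : SR (m c)) (h : R.asc (w c)) :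
    tau (tt (K.pw (sl w c R)⁻¹) * tt (K.pw (sl w c R))) =
      ((Fintype.card F : ℂ) ^ ((r c).d ^ 2))⁻¹ * tau (tt (K.pw w⁻¹) * tt (K.pw w)) := by
  have h1 : tt (K.pw (sl w c R)⁻¹) * tt (K.pw (sl w c R)) =
      tt (K.pw w⁻¹) * (tt (K.ad c R).s * tt (K.ad c R).s) * tt (K.pw w) := by
    rw [← K.R1 w c R h, ← K.R1' w c R h]; simp only [mul_assoc]
  have h2 : K.σ.e * tt (K.pw w) = tt (K.pw w) := by
    rw [tt_def]; simp only [← mul_assoc]; rw [K.σ.e_idem]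
  have hne : w ≠ sl w c R := fun h' => by
    have := linv_sl w c R h; rw [← h'] at this; omega
  rw [h1, K.R2, mul_smul_comm, smul_mul_assoc, map_smul, mul_add, add_mul, mul_assoc, h2, mul_smul_comm,
    smul_mul_assoc, mul_assoc, K.R1 w c R h, map_add, map_smul, K.gram_ne _ _ hne, smul_zero, add_zero, smul_eq_mul]

def sc (Y : C → ℂ) (w : WW m) : ℂ := ∏ c, Y c ^ inv (w c)

lemma sc_one (Y : C → ℂ) : sc Y (1 : WW m) = 1 := by
  rw [sc]; exact Finset.prod_eq_one fun c _ => by rw [Pi.one_apply, inv_one, pow_zero]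

lemma sc_sl (Y : C → ℂ) (w : WW m) (c : C) (R : SR (m c)) (h : R.asc (w c)) : sc Y (sl w c R) = Y c * sc Y w := by
  rw [sc, sc, ← Finset.mul_prod_erase _ _ (mem_univ c), ← Finset.mul_prod_erase _ (fun c => Y c ^ inv (w c)) (mem_univ c), sl_same, R.inv_mul h]
  have : ∏ x ∈ univ.erase c, Y x ^ inv (sl w c R x) = ∏ x ∈ univ.erase c, Y x ^ inv (w x) :=
    Finset.prod_congr rfl fun x hx => by rw [sl_ne _ _ _ (Finset.ne_of_mem_erase hx)]
  rw [this]; ring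

lemma CS.gself (Y : C → ℂ) (hY : ∀ c, Y c ^ 2 = (Fintype.card F : ℂ) ^ ((r c).d ^ 2)) (w : WW m) :
    sc Y w * (sc Y w * tau (tt (K.pw w⁻¹) * tt (K.pw w))) = tau K.σ.e := by
  induction w using WW_ind with
  | h1 => rw [sc_one, one_mul, one_mul, _root_.inv_one, K.pw_one, tt_one, K.σ.e_idem]
  | h2 w c h ih =>
    have ha : (rr (w c) h).asc (sl w c (rr (w c) h) c) := by rw [sl_same]; exact SR.asc_of _ (rr_spec _ h)
    have h1 := K.grec _ c (rr (w c) h) ha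
    have h2 := sc_sl Y _ c (rr (w c) h) ha
    rw [sl_sl] at h1 h2
    rw [h1, h2, ← ih]
    have hq : (Fintype.card F : ℂ) ^ ((r c).d ^ 2) ≠ 0 := pow_ne_zero _ (Nat.cast_ne_zero.mpr Fintype.card_ne_zero)
    rw [← hY] at hq ⊢
    have hy : Y c ≠ 0 := fun h => hq (by rw [h]; simp)
    field_simp

lemma card_ne' : (Fintype.card F : ℂ) ≠ 0 := Nat.cast_ne_zero.mpr Fintype.card_ne_zero

lemma Y_ne {Y : C → ℂ} (hY : ∀ c, Y c ^ 2 = (Fintype.card F : ℂ) ^ ((r c).d ^ 2)) (c) : Y c ≠ 0 := fun h => by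
  have := hY c; rw [h] at this
  exact pow_ne_zero ((r c).d ^ 2) (card_ne' (F := F)) (by rw [← this]; simp)

lemma al_ss {G : Type} [Group G] [Fintype G] (a b : ℂ) (x y : Al G) : a • x * b • y = (a * b) • (x * y) :=
  smul_mul_smul_comm a x b y
lemma al_es {G : Type} [Group G] [Fintype G] (e : Al G) (a : ℂ) (x : Al G) (h : e * x = x) : e * (a • x) = a • x := by
  rw [mul_smul_comm, h]
lemma al_ese {G : Type} [Group G] [Fintype G] (e : Al G) (a : ℂ) (x : Al G) (h : e * x * e = x) : e * (a • x) * e = a • x := by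
  rw [mul_smul_comm, smul_mul_assoc, h]
lemma al_quad {G : Type} [Group G] [Fintype G] (e x : Al G) (y k : ℂ) (hy : y ≠ 0) (h : x * x = (y ^ 2)⁻¹ • (e + k • x)) :
    y • x * y • x = e + (k * y⁻¹) • (y • x) := by
  rw [al_ss, h, smul_smul, smul_add, smul_smul, smul_smul]
  rw [show y * y * (y ^ 2)⁻¹ = 1 by field_simp, one_smul, one_mul, show k * y⁻¹ * y = k by field_simp]
lemma CS.ete (w : Mtch K.σ K.σ) : K.σ.e * tt w * K.σ.e = tt w := by
  rw [tt_def]; simp only [← mul_assoc]; rw [mul_assoc _ K.σ.e K.σ.e, K.σ.e_idem]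
lemma CS.et (w : Mtch K.σ K.σ) : K.σ.e * tt w = tt w := by
  rw [tt_def]; simp only [← mul_assoc]; rw [K.σ.e_idem]

def CS.db (Y : C → ℂ) (hY : ∀ c, Y c ^ 2 = (Fintype.card F : ℂ) ^ ((r c).d ^ 2)) : DB K.σ.e K.σ.e (WW m) where
  T := fun w => sc Y w • tt (K.pw w)
  S := fun w => sc Y w • tt (K.pw w⁻¹)
  t := tau K.σ.e
  he := K.σ.e_idem
  hf := K.σ.e_idem
  ht := tau_e_ne
  eT := fun w => al_ese _ _ _ (K.ete _)
  eS := fun w => al_ese _ _ _ (K.ete _)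
  gram_self := fun w => by
    rw [al_ss, map_smul, smul_eq_mul, mul_assoc, K.gself Y hY]
  gram_ne := fun x y h => by
    rw [al_ss, map_smul, K.gram_ne x y h, smul_zero]
  span := fun g => by
    refine Submodule.span_le.mpr ?_ ((mackey K.σ K.σ).span g)
    rintro _ ⟨π, rfl⟩
    obtain ⟨w, rfl⟩ := K.pw_bij.2 π
    have : sc Y w ≠ 0 := Finset.prod_ne_zero_iff.mpr fun c _ => pow_ne_zero _ (Y_ne hY c)
    have h2 : (mackey K.σ K.σ).T (K.pw w) = (sc Y w)⁻¹ • (sc Y w • tt (K.pw w)) := by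
      rw [smul_smul, inv_mul_cancel₀ this, one_smul]; rfl
    rw [h2]
    exact Submodule.smul_mem _ _ (Submodule.subset_span ⟨w, rfl⟩)

lemma CS.hd (Y : C → ℂ) (hY : ∀ c, Y c ^ 2 = (Fintype.card F : ℂ) ^ ((r c).d ^ 2)) :
    HD (K.db Y hY) (fun c => omC (r c) (-1) * hC (r c) * (Y c)⁻¹) (fun c R => Y c • tt (K.ad c R).s) where
  T1 := by change sc Y 1 • tt (K.pw 1) = _; rw [sc_one, one_smul, K.pw_one, tt_one]
  S1 := by change sc Y 1 • tt (K.pw 1⁻¹) = _; rw [sc_one, one_smul, _root_.inv_one, K.pw_one, tt_one]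
  ets := fun c R => al_es _ _ _ (K.et _)
  hT := fun c R w h => by
    change Y c • _ * sc Y w • tt (K.pw w) = sc Y (sl w c R) • tt (K.pw (sl w c R))
    rw [al_ss, K.R1 w c R h, sc_sl Y w c R h]
  hS := fun c R w h => by
    change sc Y w • tt (K.pw w⁻¹) * Y c • _  = sc Y (sl w c R) • tt (K.pw (sl w c R)⁻¹)
    rw [al_ss, K.R1' w c R h, sc_sl Y w c R h, mul_comm (sc Y w)]
  h2 := fun c R => al_quad _ _ _ _ (Y_ne hY c) (by rw [hY]; exact K.R2 c R)

/-- Main spectral identity for the block of a cuspidal support -/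
theorem CS.main (Y : C → ℂ) (hY : ∀ c, Y c ^ 2 = (Fintype.card F : ℂ) ^ ((r c).d ^ 2))
    (hκ : ∀ c, star (omC (r c) (-1) * hC (r c) * (Y c)⁻¹) = omC (r c) (-1) * hC (r c) * (Y c)⁻¹) (g : ℕ) :
    (∑ i : Irr (GL ι F), if rk i K.σ.e = 0 then 0 else (tau K.σ.e * hk i) ^ (2 * g) * ((tau K.σ.e * hk i) ^ 2)⁻¹)
      = ∏ c, Fg g (m c) (omC (r c) (-1) * hC (r c) * (Y c)⁻¹) :=
  (K.hd Y hY).main hκ g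

end conc
end
end HRV
end modH13

section modH14
set_option autoImplicit false
open scoped MatrixGroups
open Finset

namespace HRV
noncomputable section

section int
variable {G : Type} [Group G] [Fintype G]

lemma hk_integral (i : Irr G) : IsIntegral ℤ (hk i) := by
  have h0 : IsIntegral ℤ (∑ a : G, ∑ b : G, MonoidAlgebra.single (a * b * a⁻¹ * b⁻¹) (1 : ℤ) : MonoidAlgebra ℤ G) := by
    haveI : Module.Finite ℤ (MonoidAlgebra ℤ G) := inferInstance
    exact IsIntegral.of_finite ℤ _
  let f : MonoidAlgebra ℤ G →ₐ[ℤ] Al G := MonoidAlgebra.lift ℤ (Al G) G (MonoidAlgebra.of ℂ G)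
  have h1 := (h0.map f).map ((rp i).toRingHom.toIntAlgHom)
  have h2 : f (∑ a : G, ∑ b : G, MonoidAlgebra.single (a * b * a⁻¹ * b⁻¹) (1 : ℤ)) = ∑ a : G, ∑ b : G, dl (a * b * a⁻¹ * b⁻¹) := by
    simp only [map_sum]
    refine Finset.sum_congr rfl fun a _ => Finset.sum_congr rfl fun b _ => ?_
    rw [MonoidAlgebra.lift_single, one_smul]; rfl
  rw [h2] at h1
  have h3 : IsIntegral ℤ (algebraMap ℂ (Mt i) ((hk i) ^ 2)) := by
    rw [Algebra.algebraMap_eq_smul_one, ← comm_sum_el i]; exact h1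
  haveI : Nonempty (Fin (dm i)) := ⟨⟨0, Nat.pos_of_ne_zero (by exact_mod_cast dm_ne i)⟩⟩
  haveI : Nontrivial (Mt i) := inferInstanceAs (Nontrivial (Matrix (Fin (dm i)) (Fin (dm i)) ℂ))
  have h4 : IsIntegral ℤ ((hk i) ^ 2) := (isIntegral_algebraMap_iff (algebraMap ℂ (Mt i)).injective).mp h3
  exact h4.of_pow (by norm_num)

lemma hk_int (i : Irr G) : ∃ k : ℕ, 0 < k ∧ hk i = k ∧ k * dm i = Fintype.card G := by
  have h1 := hk_integral i
  have h2 : hk i = algebraMap ℚ ℂ ((Fintype.card G : ℚ) / dm i) := by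
    rw [hk]; simp
  rw [h2, isIntegral_algebraMap_iff (algebraMap ℚ ℂ).injective, IsIntegrallyClosed.isIntegral_iff] at h1
  obtain ⟨y, hy⟩ := h1
  have hd : (dm i : ℚ) ≠ 0 := by have := dm_ne i; exact_mod_cast this
  have hy2 : (y : ℚ) * dm i = Fintype.card G := by
    rw [eq_div_iff hd] at hy; simpa using hy
  have hpos : 0 < y := by
    have h3 : (0 : ℚ) < (y : ℚ) * dm i := by rw [hy2]; exact_mod_cast Fintype.card_pos
    have h4 : (0 : ℚ) < dm i := by positivity
    have := (mul_pos_iff_of_pos_right h4).mp h3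
    exact_mod_cast this
  lift y to ℕ using hpos.le
  refine ⟨y, by exact_mod_cast hpos, ?_, by exact_mod_cast hy2⟩
  rw [h2, ← hy]; simp

lemma exists_rk {e : Al G} (he : e ≠ 0) : ∃ i : Irr G, rk i e ≠ 0 := by
  by_contra h
  push Not at h
  exact he (rp_ext fun i => by rw [(rk_eq_zero _ _).mp (h i), map_zero])

end int

section om
variable {F : Type} [Field F] [Fintype F] [DecidableEq F]

lemma scal_mul {ι : Type} [Fintype ι] [DecidableEq ι] (z z' : Fˣ) : (scal (z * z') : GL ι F) = scal z * scal z' := map_mul _ _ _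
lemma scal_one {ι : Type} [Fintype ι] [DecidableEq ι] : (scal 1 : GL ι F) = 1 := map_one _

lemma om_mul {n : ℕ} (i : Irr (GL (Fin n) F)) (z z' : Fˣ) : om i (scal (z * z')) = om i (scal z) * om i (scal z') := by
  have h := rp_om i (scal_comm (z * z'))
  rw [scal_mul, dl_mul, map_mul, rp_om i (scal_comm z), rp_om i (scal_comm z'), smul_mul_smul_comm, mul_one] at h
  have h2 : (1 : Mt i) ≠ 0 := by
    haveI : Nonempty (Fin (dm i)) := ⟨⟨0, Nat.pos_of_ne_zero (by exact_mod_cast dm_ne i)⟩⟩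
    haveI : Nontrivial (Mt i) := inferInstanceAs (Nontrivial (Matrix (Fin (dm i)) (Fin (dm i)) ℂ))
    exact one_ne_zero
  rw [scal_mul]
  exact (smul_left_injective ℂ h2 h).symm

lemma om_one {n : ℕ} (i : Irr (GL (Fin n) F)) : om i (scal 1) = 1 := by
  rw [scal_one, om, dl_one, ch_one, div_self (dm_ne i)]

lemma omC_mul (ρ : Cusp F) (z z' : Fˣ) : omC ρ (z * z') = omC ρ z * omC ρ z' := om_mul _ _ _
lemma omC_one (ρ : Cusp F) : omC ρ 1 = 1 := om_one _
lemma omC_sq (ρ : Cusp F) : omC ρ (-1) * omC ρ (-1) = 1 := by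
  rw [← omC_mul, neg_mul_neg, one_mul, omC_one]
lemma omC_pm (ρ : Cusp F) : omC ρ (-1) = 1 ∨ omC ρ (-1) = -1 := by
  have := omC_sq ρ
  have : (omC ρ (-1) - 1) * (omC ρ (-1) + 1) = 0 := by linear_combination this
  rcases mul_eq_zero.mp this with h | h
  · left; linear_combination h
  · right; linear_combination h
end om

section nt

lemma not_dvd (d m : ℕ) (h : d < m) : ∃ B : ℕ, ∀ p : ℕ, B ≤ p → 2 ≤ p → ¬ ((p : ℤ) ^ m - 1 ∣ ∏ j ∈ range d, ((p : ℤ) ^ (j + 1) - 1)) := by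
  let f : Polynomial ℤ := ∏ j ∈ range d, (Polynomial.X ^ (j + 1) - 1)
  let g : Polynomial ℤ := Polynomial.X ^ m - 1
  have hg : g.Monic := Polynomial.monic_X_pow_sub_C 1 (by omega)
  have hgd : g.natDegree = m := by
    have := Polynomial.natDegree_X_pow_sub_C (n := m) (r := (1 : ℤ)); simpa [g] using this
  let R := f %ₘ g
  have hR : R ≠ 0 := by
    intro hR
    have hdv : g ∣ f := (Polynomial.modByMonic_eq_zero_iff_dvd hg).mp hR
    obtain ⟨k, hk⟩ := hdv
    have hz := Complex.isPrimitiveRoot_exp m (by omega)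
    set z := Complex.exp (2 * Real.pi * Complex.I / m)
    have h1 := congrArg (Polynomial.aeval z) hk
    simp only [f, g, map_mul, map_prod, map_sub, map_pow, Polynomial.aeval_X, map_one, hz.pow_eq_one, sub_self, zero_mul] at h1
    rw [Finset.prod_eq_zero_iff] at h1
    obtain ⟨j, hj, h2⟩ := h1
    have := hz.dvd_of_pow_eq_one (j + 1) (by linear_combination h2)
    have := Nat.le_of_dvd (by omega) this
    rw [Finset.mem_range] at hj; omega
  have hdeg : R.degree < g.degree := Polynomial.degree_modByMonic_lt _ hg
  let φ := Int.castRingHom ℝ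
  have ht := Polynomial.div_tendsto_zero_of_degree_lt (R.map φ) (g.map φ) (by
    rw [Polynomial.degree_map_eq_of_injective Int.cast_injective, Polynomial.degree_map_eq_of_injective Int.cast_injective]; exact hdeg)
  have ht2 := ht.comp (tendsto_natCast_atTop_atTop (R := ℝ))
  have h3 := (ht2.eventually (Metric.ball_mem_nhds 0 one_pos))
  have h4 : ∀ᶠ p : ℕ in Filter.atTop, R.eval (p : ℤ) ≠ 0 := by
    have hfin : (R.roots.toFinset : Set ℤ).Finite := Finset.finite_toSet _
    have : {p : ℕ | R.eval (p : ℤ) = 0}.Finite := by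
      refine (hfin.preimage (Nat.cast_injective (R := ℤ)).injOn).subset ?_
      intro p hp
      simp only [Set.mem_preimage, Finset.mem_coe, Multiset.mem_toFinset]
      exact (Polynomial.mem_roots hR).mpr hp
    have h5 := this.compl_mem_cofinite
    rw [Nat.cofinite_eq_atTop] at h5
    exact h5
  obtain ⟨B, hB⟩ := Filter.eventually_atTop.mp (h3.and h4)
  refine ⟨B, fun p hp hp2 hdv => ?_⟩
  obtain ⟨h6, h7⟩ := hB p hp
  have hg1 : g.eval (p : ℤ) = (p : ℤ) ^ m - 1 := by simp [g]
  have hf1 : f.eval (p : ℤ) = ∏ j ∈ range d, ((p : ℤ) ^ (j + 1) - 1) := by simp [f, Polynomial.eval_prod]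
  rw [← hg1, ← hf1] at hdv
  have h8 : f.eval (p : ℤ) = R.eval (p : ℤ) + g.eval (p : ℤ) * (f /ₘ g).eval (p : ℤ) := by
    conv_lhs => rw [← Polynomial.modByMonic_add_div f g]
    rw [Polynomial.eval_add, Polynomial.eval_mul]
  rw [h8, Int.dvd_add_left (Dvd.intro _ rfl)] at hdv
  have h9 := Int.le_of_dvd (abs_pos.mpr h7) ((dvd_abs _ _).mpr hdv)
  have hgp : 0 < g.eval (p : ℤ) := by
    rw [hg1]
    have : (1 : ℤ) < (p : ℤ) ^ m := one_lt_pow₀ (by exact_mod_cast hp2) (by omega)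
    omega
  simp only [Function.comp, Metric.mem_ball, dist_zero_right, norm_div] at h6
  have e1 : (Polynomial.eval (p : ℝ) (R.map φ)) = ((R.eval (p : ℤ) : ℤ) : ℝ) := by
    rw [Polynomial.eval_map, show (p : ℝ) = φ (p : ℤ) by simp [φ], Polynomial.eval₂_at_apply]; rfl
  have e2 : (Polynomial.eval (p : ℝ) (g.map φ)) = ((g.eval (p : ℤ) : ℤ) : ℝ) := by
    rw [Polynomial.eval_map, show (p : ℝ) = φ (p : ℤ) by simp [φ], Polynomial.eval₂_at_apply]; rfl
  rw [e1, e2, Real.norm_eq_abs, Real.norm_eq_abs, ← Int.cast_abs, ← Int.cast_abs, abs_of_pos hgp, div_lt_one (by exact_mod_cast hgp)] at h6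
  have : |R.eval (p : ℤ)| < g.eval (p : ℤ) := by exact_mod_cast h6
  omega

end nt
end
end HRV
end modH14

section modH15
set_option autoImplicit false
open scoped MatrixGroups
open Finset

namespace HRV
noncomputable section

section nt

lemma cop (p : ℤ) (k : ℕ) (hk : 0 < k) : IsCoprime p (p ^ k - 1) := by
  refine ⟨p ^ (k - 1), -1, ?_⟩
  have : p ^ (k - 1) * p = p ^ k := by rw [← pow_succ]; congr 1; omega
  rw [this]; ring

lemma gl_prod (p : ℤ) (d : ℕ) : ∏ i ∈ range d, (p ^ d - p ^ i) = p ^ (d * (d - 1) / 2) * ∏ j ∈ range d, (p ^ (j + 1) - 1) := by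
  rw [← Finset.prod_range_reflect (fun j => p ^ (j + 1) - 1), ← Finset.sum_range_id, ← Finset.prod_pow_eq_pow_sum, ← Finset.prod_mul_distrib]
  refine Finset.prod_congr rfl fun i hi => ?_
  rw [Finset.mem_range] at hi
  rw [mul_sub, mul_one, ← pow_add]; congr 2; omega

lemma ht_form (p d h D s : ℕ) (hp : p.Prime) (hh : 0 < h)
    (hs : s ^ 2 = h ^ 2 + 4 * p ^ (d ^ 2)) (hD : (D : ℤ) * h = ∏ i ∈ range d, ((p : ℤ) ^ d - p ^ i))
    (hnd : ∀ m, d < m → m ≤ d ^ 2 → ¬ ((p : ℤ) ^ m - 1 ∣ ∏ j ∈ range d, ((p : ℤ) ^ (j + 1) - 1))) :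
    (h : ℤ) = p ^ (d * (d - 1) / 2) * (p ^ d - 1) := by
  have h1 : h < s := by
    have : 0 < 4 * p ^ (d ^ 2) := by have := hp.pos; positivity
    nlinarith
  have hpar : (s + h) % 2 = 0 := by
    have h2 : s ^ 2 % 2 = h ^ 2 % 2 := by omega
    rcases Nat.mod_two_eq_zero_or_one s with a | a <;> rcases Nat.mod_two_eq_zero_or_one h with b | b <;>
      simp [Nat.pow_mod, a, b] at h2 <;> omega
  obtain ⟨A, hA⟩ : ∃ A, s = h + 2 * A := ⟨(s - h) / 2, by omega⟩
  have hAB : A * (A + h) = p ^ (d ^ 2) := by rw [hA] at hs; nlinarith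
  obtain ⟨a, ha, hAa⟩ := (Nat.dvd_prime_pow hp).mp (Dvd.intro _ hAB)
  obtain ⟨b, hb, hBb⟩ := (Nat.dvd_prime_pow hp).mp (Dvd.intro_left _ hAB)
  have hab : a < b := by
    rw [← Nat.pow_lt_pow_iff_right hp.one_lt, ← hAa, ← hBb]; omega
  have hsum : a + b = d ^ 2 := by
    rw [hBb, hAa, ← pow_add] at hAB
    exact Nat.pow_right_injective hp.two_le hAB
  obtain ⟨m, rfl⟩ : ∃ m, b = a + m := ⟨b - a, by omega⟩
  have hm : 0 < m := by omega
  have hh2 : (h : ℤ) = p ^ a * (p ^ m - 1) := by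
    have : (h : ℤ) = p ^ (a + m) - p ^ a := by
      have e : ((A + h : ℕ) : ℤ) = ((p ^ (a + m) : ℕ) : ℤ) := by rw [hBb]
      rw [hAa] at e; push_cast at e; linarith
    rw [this]; ring
  set N := ∏ j ∈ range d, ((p : ℤ) ^ (j + 1) - 1) with hN
  rw [gl_prod, hh2] at hD
  have hcN : IsCoprime (p : ℤ) N := IsCoprime.prod_right fun j _ => cop _ _ (by omega)
  have hT : 2 * (d * (d - 1) / 2) = d ^ 2 - d := by
    have : 2 ∣ d * (d - 1) := (Nat.even_mul_pred_self d).two_dvd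
    rw [Nat.mul_div_cancel' this, Nat.mul_sub, mul_one, sq]
  have haT : a ≤ d * (d - 1) / 2 := by
    have h3 : (p : ℤ) ^ a ∣ p ^ (d * (d - 1) / 2) * N := ⟨D * (p ^ m - 1), by rw [← hD]; ring⟩
    have h4 : (p : ℤ) ^ a ∣ p ^ (d * (d - 1) / 2) := (hcN.pow_left).dvd_of_dvd_mul_right h3
    have h5 : p ^ a ∣ p ^ (d * (d - 1) / 2) := by exact_mod_cast h4
    exact (Nat.pow_dvd_pow_iff_le_right hp.one_lt).mp h5
  have hdd : d ≤ d ^ 2 := by nlinarith [Nat.zero_le d, sq_nonneg d, Nat.le_mul_self d]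
  have hdm : d ≤ m := by omega
  have hdv : (p : ℤ) ^ m - 1 ∣ N := by
    have h3 : (p : ℤ) ^ m - 1 ∣ p ^ (d * (d - 1) / 2) * N := ⟨D * p ^ a, by rw [← hD]; ring⟩
    exact ((cop (p : ℤ) m hm).symm.pow_right).dvd_of_dvd_mul_left h3
  have hmd : m = d := by
    by_contra hne
    exact hnd m (by omega) (by omega) hdv
  rw [hh2, hmd]; congr 2; omega

lemma sq_int (N : ℕ) (x : ℚ) (h : x ^ 2 = N) : ∃ s : ℕ, s ^ 2 = N := by
  have h1 : IsSquare ((N : ℕ) : ℚ) := ⟨x, by rw [← h, sq]⟩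
  rw [Rat.isSquare_natCast_iff] at h1
  obtain ⟨s, hs⟩ := h1
  exact ⟨s, by rw [hs, sq]⟩

end nt

section heart
variable {F : Type} [Field F] [Fintype F] [DecidableEq F]

/-- the sequence `ρ × ρ` -/
def pp (ρ : Cusp F) : CS F (Σ _ : LL (fun _ : Unit => 2), Fin ρ.d) (fun _ : Unit => 2) (fun _ => ρ) where
  σ := ⟨fun _ => ρ, Equiv.refl _⟩
  hσ := fun _ => rfl
  hr := fun _ _ _ => rfl

def R2' : SR 2 := ⟨0, 1, rfl⟩

lemma sum_W2 {M : Type} [AddCommMonoid M] (inst : Fintype (WW (fun _ : Unit => 2))) (dec : DecidableEq Unit)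
    (f : WW (fun _ : Unit => 2) → M) : (@Finset.sum _ _ _ (@Finset.univ _ inst) f) = f 1 + f (@sl _ dec _ 1 () R2') := by
  have h : (univ : Finset (Equiv.Perm (Fin 2))) = {1, R2'.s} := by decide
  letI := inst
  refine (Fintype.sum_equiv (Equiv.funUnique Unit (Equiv.Perm (Fin 2))) f (fun v => f ((Equiv.funUnique Unit (Equiv.Perm (Fin 2))).symm v)) ?_).trans ?_
  · intro x; rw [Equiv.symm_apply_apply]
  rw [h, Finset.sum_pair (by decide)]
  congr 2
  funext c
  exact (@sl_same _ _ dec (fun _ : Unit => 2) 1 () R2').symm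

lemma quad_abs {G : Type} [Group G] [Fintype G] [dec : DecidableEq Unit] {e : Al G} {D : DB e e (WW (fun _ : Unit => 2))}
    {κ : Unit → ℂ} {ts : Unit → SR 2 → Al G} (H : HD D κ ts) (hts : ts () R2' * e = ts () R2') (i : Irr G) (hi : rk i e ≠ 0) :
    (D.t * hk i * rk i e - 2) ^ 2 = κ () ^ 2 * (1 + (D.t * hk i * rk i e - 2)) := by
  have hi2 : rp i e ≠ 0 := fun h => hi ((rk_eq_zero _ _).mpr h)
  have hasc : R2'.asc ((1 : WW (fun _ : Unit => 2)) ()) := by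
    change (1 : Equiv.Perm (Fin 2)).symm 0 < (1 : Equiv.Perm (Fin 2)).symm 1
    decide
  have hT : D.T (sl 1 () R2') = ts () R2' := by rw [← H.hT () R2' 1 hasc, H.T1, hts]
  have hS : D.S (sl 1 () R2') = ts () R2' := by rw [← H.hS () R2' 1 hasc, H.S1, H.ets]
  have h2 := H.h2 () R2'
  have hcas := D.casimir_rp 1 i
  rw [sum_W2 _ dec, hT, hS, H.T1, H.S1, mul_one, mul_one, D.he, h2, ch_idem _ D.he] at hcas
  set x := D.t * hk i * rk i e - 2 with hxd
  have hx : rp i (κ () • ts () R2') = x • rp i e := by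
    rw [map_add, map_add] at hcas
    have h9 : rp i (κ () • ts () R2') = (D.t * hk i * rk i e) • rp i e - rp i e - rp i e := by rw [← hcas]; abel
    rw [h9, hxd]; module
  have h3 : (κ () • ts () R2') * (κ () • ts () R2') = κ () ^ 2 • (e + κ () • ts () R2') := by rw [al_ss, h2, sq]
  have h4 := congrArg (rp i) h3
  rw [map_mul, hx, map_smul, map_add, hx, smul_mul_smul_comm, ← map_mul, D.he] at h4
  have h5 : (x * x - κ () ^ 2 * (1 + x)) • rp i e = 0 := by
    rw [sub_smul, h4]; module
  have h6 := (smul_eq_zero.mp h5).resolve_right hi2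
  linear_combination h6

lemma tau_e_rat {ι : Type} [Fintype ι] [DecidableEq ι] {Λ : Type} [LinearOrder Λ] [Fintype Λ] (σ : Sq F Λ ι) : ∃ x : ℚ, tau σ.e = x := by
  rw [σ.tau_e]
  choose k hk0 hk1 hk2 using fun a => hk_int (σ.ρ a).i
  refine ⟨(∏ a, (k a : ℚ)⁻¹) * (Nat.card (Ub (F := F) σ.b) : ℚ)⁻¹, ?_⟩
  push_cast
  congr 1
  · exact Finset.prod_congr rfl fun a _ => by rw [hC, hk1]

lemma quad_rat (ρ : Cusp F) : ∃ x : ℚ, (x : ℂ) ^ 2 = hC ρ ^ 2 * ((Fintype.card F : ℂ) ^ (ρ.d ^ 2))⁻¹ * (1 + x) := by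
  let Y0 : ℂ := ((Fintype.card F : ℂ) ^ (ρ.d ^ 2)) ^ ((1 : ℂ) / 2)
  have hY0 : Y0 ^ 2 = (Fintype.card F : ℂ) ^ (ρ.d ^ 2) := by
    have := Complex.cpow_nat_inv_pow ((Fintype.card F : ℂ) ^ (ρ.d ^ 2)) (n := 2) (by norm_num)
    simpa [Y0] using this
  have hY : ∀ c : Unit, (fun _ : Unit => Y0) c ^ 2 = (Fintype.card F : ℂ) ^ (((fun _ : Unit => ρ) c).d ^ 2) := fun _ => hY0
  have H := (pp ρ).hd (fun _ => Y0) hY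
  obtain ⟨i, hi⟩ := exists_rk ((pp ρ).σ.e_ne)
  have h1 := quad_abs H (by
    rw [smul_mul_assoc]
    refine congrArg _ ?_
    rw [tt_def, mul_assoc, (pp ρ).σ.e_idem]) i hi
  obtain ⟨t, ht⟩ := tau_e_rat (pp ρ).σ
  have ht' : ((pp ρ).db (fun _ => Y0) hY).t = t := ht
  obtain ⟨k, _, hk1, _⟩ := hk_int i
  rw [hk1, ht'] at h1
  refine ⟨t * k * rk i (pp ρ).σ.e - 2, ?_⟩
  push_cast
  rw [h1, ← hY0]
  refine congrArg (· * _) ?_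
  have := omC_sq ρ
  linear_combination (hC ρ ^ 2 * (Y0⁻¹) ^ 2) * this

lemma quad_sq (ρ : Cusp F) (h : ℕ) (hh : 0 < h) (hC1 : hC ρ = h) : ∃ s : ℕ, s ^ 2 = h ^ 2 + 4 * Fintype.card F ^ (ρ.d ^ 2) := by
  obtain ⟨x, hx⟩ := quad_rat ρ
  rw [hC1] at hx
  set Q : ℕ := Fintype.card F ^ (ρ.d ^ 2) with hQ
  have hQ0 : (Q : ℚ) ≠ 0 := by rw [hQ]; exact_mod_cast pow_ne_zero _ Fintype.card_ne_zero
  have hx' : x ^ 2 = (h : ℚ) ^ 2 * (Q : ℚ)⁻¹ * (1 + x) := by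
    have : ((x ^ 2 : ℚ) : ℂ) = (((h : ℚ) ^ 2 * (Q : ℚ)⁻¹ * (1 + x) : ℚ) : ℂ) := by
      push_cast; rw [hx, hQ]; push_cast; rfl
    exact_mod_cast this
  refine sq_int _ ((2 * x * Q - h ^ 2) / h) ?_
  have hh0 : (h : ℚ) ≠ 0 := by exact_mod_cast hh.ne'
  field_simp at hx' ⊢
  push_cast
  linear_combination 4 * (Q : ℚ) * hx'

/-- hook values of cuspidals for large primes -/
theorem hC_val (n : ℕ) : ∃ B : ℕ, ∀ (F : Type) [Field F] [Fintype F] [DecidableEq F], (Fintype.card F).Prime → B ≤ Fintype.card F →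
    ∀ ρ : Cusp F, ρ.d ≤ n → hC ρ = (Fintype.card F : ℂ) ^ (ρ.d * (ρ.d - 1) / 2) * ((Fintype.card F : ℂ) ^ ρ.d - 1) := by
  have h1 : ∀ d m : ℕ, ∃ B : ℕ, d < m → ∀ p : ℕ, B ≤ p → 2 ≤ p → ¬ ((p : ℤ) ^ m - 1 ∣ ∏ j ∈ range d, ((p : ℤ) ^ (j + 1) - 1)) := by
    intro d m
    by_cases h : d < m
    · obtain ⟨B, hB⟩ := not_dvd d m h; exact ⟨B, fun _ => hB⟩
    · exact ⟨0, fun h' => absurd h' h⟩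
  choose b hb using h1
  refine ⟨∑ d ∈ range (n + 1), ∑ m ∈ range (d ^ 2 + 1), b d m, ?_⟩
  intro F _ _ _ hp hB ρ hρ
  obtain ⟨k, hk0, hk1, hk2⟩ := hk_int ρ.i
  obtain ⟨s, hs⟩ := quad_sq ρ k hk0 hk1
  have hcard : Fintype.card (GL (Fin ρ.d) F) = ∏ i : Fin ρ.d, (Fintype.card F ^ ρ.d - Fintype.card F ^ (i : ℕ)) := by
    rw [← Nat.card_eq_fintype_card, Matrix.card_GL_field]
  have h2 := ht_form (Fintype.card F) ρ.d k (dm ρ.i) s hp hk0 hs (by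
    have : ((k * dm ρ.i : ℕ) : ℤ) = ((∏ i : Fin ρ.d, (Fintype.card F ^ ρ.d - Fintype.card F ^ (i : ℕ)) : ℕ) : ℤ) := by rw [hk2, hcard]
    rw [Finset.prod_range, mul_comm]
    push_cast at this
    rw [this]
    refine Finset.prod_congr rfl fun i _ => ?_
    rw [Nat.cast_sub (Nat.pow_le_pow_right hp.pos i.2.le)]; push_cast; rfl) (by
    intro m hm1 hm2
    refine hb _ _ hm1 _ (le_trans ?_ hB) hp.two_le
    calc b ρ.d m ≤ ∑ m ∈ range (ρ.d ^ 2 + 1), b ρ.d m :=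
          Finset.single_le_sum (f := fun m => b ρ.d m) (fun _ _ => Nat.zero_le _) (Finset.mem_range.mpr (by omega))
      _ ≤ _ := Finset.single_le_sum (f := fun d => ∑ m ∈ range (d ^ 2 + 1), b d m) (fun _ _ => Nat.zero_le _) (Finset.mem_range.mpr (by omega)))
  rw [hC, hk1]
  exact_mod_cast congrArg (Int.cast : ℤ → ℂ) h2

end heart
end
end HRV
end modH15

section modH16
set_option autoImplicit false
open scoped MatrixGroups
open Finset

namespace HRV
noncomputable section

/-- square root of the cardinality -/
def yF (F : Type) [Fintype F] : ℂ := (Real.sqrt (Fintype.card F) : ℂ)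

def kap (y : ℂ) (d : ℕ) : ℂ := y ^ d - (y ^ d)⁻¹

def Vg (g m : ℕ) (κ : ℂ) : ℂ := (κ ^ m) ^ (2 * g) * ((κ ^ m) ^ 2)⁻¹ * Fg g m κ

section bas
variable {F : Type} [Field F] [Fintype F] [DecidableEq F]

variable (F) in
lemma yF_sq : yF F ^ 2 = (Fintype.card F : ℂ) := by
  rw [yF]; norm_cast; exact_mod_cast Real.sq_sqrt (Nat.cast_nonneg _)

variable (F) in
lemma yF_ne : yF F ≠ 0 := fun h => by
  have := yF_sq F; rw [h] at this
  have h2 : (Fintype.card F : ℂ) ≠ 0 := by exact_mod_cast Fintype.card_ne_zero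
  exact h2 (by rw [← this]; simp)

variable (F) in
lemma yF_star : star (yF F) = yF F := Complex.conj_ofReal _

variable (F) in
lemma kap_star (d : ℕ) : star (kap (yF F) d) = kap (yF F) d := by
  rw [kap, star_sub, star_inv₀, star_pow, yF_star]

/-- good value of hooks of cuspidals -/
def Gd (F : Type) [Field F] [Fintype F] [DecidableEq F] (n : ℕ) : Prop :=
  ∀ ρ : Cusp F, ρ.d ≤ n → hC ρ = (Fintype.card F : ℂ) ^ (ρ.d * (ρ.d - 1) / 2) * ((Fintype.card F : ℂ) ^ ρ.d - 1)

lemma Gd.kap {n : ℕ} (h : Gd F n) (ρ : Cusp F) (hρ : ρ.d ≤ n) : hC ρ = kap (yF F) ρ.d * yF F ^ (ρ.d ^ 2) := by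
  have hT : 2 * (ρ.d * (ρ.d - 1) / 2) = ρ.d ^ 2 - ρ.d := by
    have : 2 ∣ ρ.d * (ρ.d - 1) := (Nat.even_mul_pred_self ρ.d).two_dvd
    rw [Nat.mul_div_cancel' this, Nat.mul_sub, mul_one, sq]
  have hdd : ρ.d ≤ ρ.d ^ 2 := by rw [sq]; exact Nat.le_mul_self _
  rw [h ρ hρ, ← yF_sq F, ← pow_mul, hT, HRV.kap]
  have h1 : yF F ^ (ρ.d ^ 2) = yF F ^ (ρ.d ^ 2 - ρ.d) * yF F ^ ρ.d := by rw [← pow_add]; congr 1; omega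
  have h2 : yF F ^ ρ.d ≠ 0 := pow_ne_zero _ (yF_ne F)
  rw [h1]; field_simp
  ring

lemma count_lt {ι Λ : Type} [Fintype ι] [Fintype Λ] [LinearOrder Λ] (b : ι → Λ) :
    2 * (univ.filter fun p : ι × ι => b p.1 < b p.2).card + ∑ x, (univ.filter fun i => b i = x).card ^ 2 = Fintype.card ι ^ 2 := by
  classical
  have h1 : (univ.filter fun p : ι × ι => b p.2 < b p.1).card = (univ.filter fun p : ι × ι => b p.1 < b p.2).card :=
    Finset.card_equiv (Equiv.prodComm ι ι) (by simp)
  have h2 : (univ.filter fun p : ι × ι => b p.1 = b p.2).card = ∑ x, (univ.filter fun i => b i = x).card ^ 2 := by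
    rw [Finset.card_eq_sum_card_fiberwise (f := fun p : ι × ι => b p.1) (t := univ) (fun _ _ => by simp)]
    refine Finset.sum_congr rfl fun x _ => ?_
    rw [sq, ← Finset.card_product]
    congr 1
    ext p; simp only [mem_filter, mem_univ, true_and, mem_product]
    constructor
    · rintro ⟨h, rfl⟩; exact ⟨rfl, h.symm⟩
    · rintro ⟨rfl, h⟩; exact ⟨h.symm, rfl⟩
  have h3 : Fintype.card ι ^ 2 = (univ : Finset (ι × ι)).card := by rw [Finset.card_univ, Fintype.card_prod, sq]
  rw [h3, ← h2]
  have h4 := Finset.card_filter_add_card_filter_not (s := (univ : Finset (ι × ι))) (fun p => b p.1 = b p.2)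
  have h5 : (univ.filter fun p : ι × ι => ¬ b p.1 = b p.2) = (univ.filter fun p : ι × ι => b p.1 < b p.2) ∪ (univ.filter fun p : ι × ι => b p.2 < b p.1) := by
    ext p; simp [lt_or_lt_iff_ne]
  rw [h5, Finset.card_union_of_disjoint (Finset.disjoint_filter.mpr fun p _ h => not_lt_of_gt h), h1] at h4
  omega

variable {ι : Type} [Fintype ι] [DecidableEq ι] {Λ : Type} [LinearOrder Λ] [Fintype Λ]

lemma Sq.card_b (σ : Sq F Λ ι) (x : Λ) : (univ.filter fun i => σ.b i = x).card = (σ.ρ x).d := by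
  rw [← Fintype.card_fin (σ.ρ x).d, ← Finset.card_univ]
  symm
  refine Finset.card_bij (fun k _ => σ.E ⟨x, k⟩) ?_ ?_ ?_
  · intro k _; simp [Sq.b, bE_apply]
  · intro k _ l _ h
    have := σ.E.injective h
    simpa using this
  · intro i hi
    obtain ⟨⟨a, k⟩, rfl⟩ := σ.E.surjective i
    simp only [mem_filter, mem_univ, true_and, Sq.b, bE_apply] at hi
    subst hi
    exact ⟨k, mem_univ _, rfl⟩

lemma Sq.card_d (σ : Sq F Λ ι) : ∑ x, (σ.ρ x).d = Fintype.card ι := by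
  rw [← Fintype.card_congr σ.E, Fintype.card_sigma]; simp

lemma Sq.tau_y {n : ℕ} (hG : Gd F n) (σ : Sq F Λ ι) (hσ : ∀ x, (σ.ρ x).d ≤ n) :
    tau σ.e * ((∏ x, kap (yF F) (σ.ρ x).d) * yF F ^ (Fintype.card ι ^ 2)) = 1 := by
  rw [σ.tau_e, card_Ub]
  have h1 := count_lt σ.b
  simp only [σ.card_b] at h1
  have h2 : ∏ a, (hC (σ.ρ a))⁻¹ = ((∏ x, kap (yF F) (σ.ρ x).d) * yF F ^ (∑ x, (σ.ρ x).d ^ 2))⁻¹ := by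
    rw [Finset.prod_inv_distrib, ← Finset.prod_pow_eq_pow_sum, ← Finset.prod_mul_distrib]
    refine congrArg _ (Finset.prod_congr rfl fun x _ => hG.kap _ (hσ x))
  have h3 : ∏ a, (hC (σ.ρ a))⁻¹ ≠ 0 := Finset.prod_ne_zero_iff.mpr fun a _ => inv_ne_zero (hC_ne _)
  have h4 := yF_ne F
  rw [h2] at h3 ⊢
  rw [← h1]
  push_cast
  rw [← yF_sq F]
  have h5 := inv_ne_zero h3
  rw [inv_inv] at h5
  have h6 := (mul_ne_zero_iff.mp h5).1
  rw [pow_add, pow_mul]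
  field_simp

lemma LL_prod {C : Type} [LinearOrder C] [Fintype C] {m : C → ℕ} (f : C → ℂ) : ∏ x : LL m, f x.1 = ∏ c, f c ^ m c := by
  have : ∏ x : LL m, f x.1 = ∏ x : (Σ c, Fin (m c)), f x.1 := Fintype.prod_equiv (Equiv.refl _) _ _ (fun _ => rfl)
  rw [this, Fintype.prod_sigma]
  simp

lemma LL_sum {C : Type} [LinearOrder C] [Fintype C] {m : C → ℕ} (f : C → ℕ) : ∑ x : LL m, f x.1 = ∑ c, m c * f c := by
  have : ∑ x : LL m, f x.1 = ∑ x : (Σ c, Fin (m c)), f x.1 := Fintype.sum_equiv (Equiv.refl _) _ _ (fun _ => rfl)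
  rw [this, Fintype.sum_sigma]
  simp

/-- normalised hook -/
def hn {ι : Type} [Fintype ι] [DecidableEq ι] (i : Irr (GL ι F)) : ℂ := hk i * (yF F ^ (Fintype.card ι ^ 2))⁻¹

lemma CS.blk {C : Type} [LinearOrder C] [Fintype C] {m : C → ℕ} {r : C → Cusp F} (K : CS F ι m r)
    {n : ℕ} (hG : Gd F n) (hr : ∀ c, (r c).d ≤ n) (g : ℕ) (z : Fˣ) :
    (∑ i : Irr (GL ι F), if rk i K.σ.e = 0 then 0 else hn i ^ (2 * g) * (hn i ^ 2)⁻¹ * om i (scal z))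
      = ∏ c, (Vg g (m c) (kap (yF F) (r c).d) * omC (r c) z ^ m c) := by
  have hκ : ∀ c, omC (r c) (-1) * hC (r c) * (omC (r c) (-1) * yF F ^ ((r c).d ^ 2))⁻¹ = kap (yF F) (r c).d := by
    intro c
    have h1 : omC (r c) (-1) ≠ 0 := fun h => by have := omC_sq (r c); rw [h] at this; simp at this
    have h2 : yF F ^ ((r c).d ^ 2) ≠ 0 := pow_ne_zero _ (yF_ne F)
    rw [hG.kap _ (hr c)]; field_simp
  have hm := K.main (fun c => omC (r c) (-1) * yF F ^ ((r c).d ^ 2)) (by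
    intro c
    have := omC_sq (r c)
    rw [mul_pow, ← yF_sq F, ← pow_mul, ← pow_mul, mul_comm _ 2]
    first | rw [this, one_mul] | (rw [sq, this, one_mul])) (by intro c; rw [hκ c, kap_star]) g
  simp only [hκ] at hm
  have hsc := K.σ.tau_y hG (fun x => by rw [K.hσ]; exact hr _)
  have hp : ∏ x, kap (yF F) (K.σ.ρ x).d = ∏ c, kap (yF F) (r c).d ^ m c := by
    rw [← LL_prod]; exact Finset.prod_congr rfl fun x _ => by rw [K.hσ]
  rw [hp] at hsc
  set Q := ∏ c, kap (yF F) (r c).d ^ m c with hQ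
  have hY : yF F ^ (Fintype.card ι ^ 2) ≠ 0 := pow_ne_zero _ (yF_ne F)
  have hhn : ∀ i : Irr (GL ι F), hn i = Q * (tau K.σ.e * hk i) := by
    intro i; rw [hn]; field_simp
    linear_combination (-hk i) * hsc
  have hL : ∀ i : Irr (GL ι F), (if rk i K.σ.e = 0 then 0 else hn i ^ (2 * g) * (hn i ^ 2)⁻¹ * om i (scal z))
     = (Q ^ (2 * g) * (Q ^ 2)⁻¹ * ∏ c, omC (r c) z ^ m c) * (if rk i K.σ.e = 0 then 0 else (tau K.σ.e * hk i) ^ (2 * g) * ((tau K.σ.e * hk i) ^ 2)⁻¹) := by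
    intro i
    by_cases h : rk i K.σ.e = 0
    · rw [if_pos h, if_pos h, mul_zero]
    · rw [if_neg h, if_neg h, om_seq K.σ i h, hhn]
      have : ∏ a, omC (K.σ.ρ a) z = ∏ c, omC (r c) z ^ m c := by
        rw [← LL_prod]; exact Finset.prod_congr rfl fun x _ => by rw [K.hσ]
      rw [this, mul_pow, mul_pow Q _ 2, mul_inv]; ring
  rw [Finset.sum_congr rfl fun i _ => hL i, ← Finset.mul_sum, hm, hQ, ← Finset.prod_pow, ← Finset.prod_pow, ← Finset.prod_inv_distrib,
    ← Finset.prod_mul_distrib, ← Finset.prod_mul_distrib, ← Finset.prod_mul_distrib]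
  refine Finset.prod_congr rfl fun c _ => ?_
  rw [Vg]; ring

end bas
end
end HRV
end modH16

section modH17
set_option autoImplicit false
open scoped MatrixGroups
open Finset

namespace HRV
noncomputable section

section cn
variable (F : Type) [Field F] [Fintype F] [DecidableEq F] (n : ℕ)

/-- cuspidals of degree at most n -/
def CN : Type := {ρ : Cusp F // ρ.d ≤ n}

instance : Finite (CN F n) := by
  let f : CN F n → Σ d : Fin (n + 1), Irr (GL (Fin d) F) := fun ρ => ⟨⟨ρ.1.d, Nat.lt_succ_of_le ρ.2⟩, ρ.1.i⟩
  refine Finite.of_injective f ?_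
  rintro ⟨⟨d, hd, i, hi⟩, h⟩ ⟨⟨d', hd', i', hi'⟩, h'⟩ e
  simp only [f, Sigma.mk.injEq, Fin.mk.injEq] at e
  obtain ⟨rfl, e2⟩ := e
  obtain rfl := eq_of_heq e2
  rfl

instance : Fintype (CN F n) := Fintype.ofFinite _
instance : LinearOrder (CN F n) := LinearOrder.lift' (Fintype.equivFin (CN F n)) (Fintype.equivFin (CN F n)).injective

variable {F n}

/-- local factor -/
def Sf (g : ℕ) (z : Fˣ) (c : CN F n) : PowerSeries ℂ :=
  PowerSeries.expand c.1.d c.1.hd.ne' (PowerSeries.rescale (omC c.1 z) (PowerSeries.mk fun m => Vg g m (kap (yF F) c.1.d)))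

variable (F n) in
/-- generating series -/
def Zs (g : ℕ) (z : Fˣ) : PowerSeries ℂ := ∏ c : CN F n, Sf g z c

variable {ι : Type} [Fintype ι] [DecidableEq ι] {Λ Λ' : Type} [LinearOrder Λ] [Fintype Λ] [LinearOrder Λ'] [Fintype Λ']

lemma mtch_card (σ : Sq F Λ ι) (σ' : Sq F Λ' ι) (π : Mtch σ σ') (ρ : Cusp F) :
    Nat.card {a // σ.ρ a = ρ} = Nat.card {a // σ'.ρ a = ρ} := by
  refine (Nat.card_congr (π.1.subtypeEquiv fun a => ?_)).symm
  rw [π.2]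

lemma mtch_of_card (σ : Sq F Λ ι) (σ' : Sq F Λ' ι) (h : ∀ ρ, Nat.card {a // σ.ρ a = ρ} = Nat.card {a // σ'.ρ a = ρ}) :
    Nonempty (Mtch σ σ') := by
  have e : ∀ ρ, Nonempty ({a // σ'.ρ a = ρ} ≃ {a // σ.ρ a = ρ}) := fun ρ => by
    classical
    refine ⟨Fintype.equivOfCardEq ?_⟩
    rw [← Nat.card_eq_fintype_card, ← Nat.card_eq_fintype_card, h]
  exact ⟨⟨Equiv.ofFiberEquiv fun ρ => (e ρ).some, fun a => Equiv.ofFiberEquiv_map _ a⟩⟩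

lemma CS.fib {C : Type} [LinearOrder C] [Fintype C] {m : C → ℕ} {r : C → Cusp F} (K : CS F ι m r) (c : C) :
    Nat.card {x // K.σ.ρ x = r c} = m c := by
  rw [← Fintype.card_fin (m c), ← Nat.card_eq_fintype_card]
  refine Nat.card_congr (Equiv.ofBijective (fun k : Fin (m c) => (⟨SL.mk c k, K.hσ _⟩ : {x // K.σ.ρ x = r c})) ⟨?_, ?_⟩).symm
  · intro k l h
    exact SL.mk_inj (Λ := fun c => Fin (m c)) (Subtype.ext_iff.mp h)
  · rintro ⟨⟨c', k⟩, h⟩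
    have h1 : c' = c := K.hr ((K.hσ _).symm.trans h)
    subst h1
    exact ⟨k, rfl⟩

lemma CS.fib' {C : Type} [LinearOrder C] [Fintype C] {m : C → ℕ} {r : C → Cusp F} (K : CS F ι m r) (ρ : Cusp F) (hρ : ∀ c, r c ≠ ρ) :
    Nat.card {x // K.σ.ρ x = ρ} = 0 := by
  rw [Nat.card_eq_zero]
  left
  exact ⟨fun x => hρ x.1.1 ((K.hσ _).symm.trans x.2)⟩

lemma CS.exists {C : Type} [LinearOrder C] [Fintype C] (m : C → ℕ) (r : C → Cusp F) (hr : Function.Injective r) (N : ℕ)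
    (hN : ∑ c, m c * (r c).d = N) : Nonempty (CS F (Fin N) m r) := by
  have h : Fintype.card (Σ x : LL m, Fin (r x.1).d) = Fintype.card (Fin N) := by
    rw [Fintype.card_sigma, Fintype.card_fin, ← hN, ← LL_sum]; simp
  exact ⟨⟨⟨fun x => r x.1, Fintype.equivOfCardEq h⟩, fun _ => rfl, hr⟩⟩

lemma val_inj : Function.Injective (fun c : CN F n => c.1) := Subtype.val_injective

open Classical in
/-- idempotent of a support -/
def eL (N : ℕ) (l : CN F n → ℕ) : Al (GL (Fin N) F) :=
  if h : Nonempty (CS F (Fin N) (fun c => l c / c.1.d) (fun c : CN F n => c.1)) ∧ ∀ c, c.1.d ∣ l c then h.1.some.σ.e else 0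

lemma rk_zero {G : Type} [Group G] [Fintype G] (i : Irr G) : rk i (0 : Al G) = 0 := by
  rw [rk_eq_zero, map_zero]

lemma Sf_coeff (g : ℕ) (z : Fˣ) (c : CN F n) (k : ℕ) :
    (Sf g z c).coeff k = if c.1.d ∣ k then Vg g (k / c.1.d) (kap (yF F) c.1.d) * omC c.1 z ^ (k / c.1.d) else 0 := by
  rw [Sf, PowerSeries.coeff_expand]
  split_ifs
  · rw [PowerSeries.coeff_rescale, PowerSeries.coeff_mk, mul_comm]
  · rfl

lemma eL_sum (hG : Gd F n) (g N : ℕ) (z : Fˣ) (l : CN F n → ℕ) (hl : ∑ c, l c = N) :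
    (∑ i : Irr (GL (Fin N) F), if rk i (eL N l) = 0 then 0 else hn i ^ (2 * g) * (hn i ^ 2)⁻¹ * om i (scal z))
      = ∏ c, (Sf g z c).coeff (l c) := by
  by_cases hd : ∀ c : CN F n, c.1.d ∣ l c
  · have h : Nonempty (CS F (Fin N) (fun c => l c / c.1.d) (fun c : CN F n => c.1)) := CS.exists _ _ val_inj N (by
      rw [← hl]; exact Finset.sum_congr rfl fun c _ => Nat.div_mul_cancel (hd c))
    rw [eL, dif_pos ⟨h, hd⟩]
    refine (h.some.blk hG (fun c => c.2) g z).trans ?_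
    refine Finset.prod_congr rfl fun c _ => ?_
    rw [Sf_coeff, if_pos (hd c)]
  · rw [eL, dif_neg (fun h => hd h.2)]
    push Not at hd
    obtain ⟨c, hc⟩ := hd
    rw [Finset.prod_eq_zero (Finset.mem_univ c) (by rw [Sf_coeff, if_neg hc])]
    refine Finset.sum_eq_zero fun i _ => ?_
    rw [if_pos (rk_zero i)]

lemma eL_unique (N : ℕ) (l l' : CN F n → ℕ) (i : Irr (GL (Fin N) F)) (h : rk i (eL N l) ≠ 0) (h' : rk i (eL N l') ≠ 0) : l = l' := by
  rw [eL] at h h'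
  split_ifs at h with h1
  · split_ifs at h' with h2
    · by_cases hm : IsEmpty (Mtch h1.1.some.σ h2.1.some.σ)
      · exact absurd (mackey_disj _ _ hm i h) h'
      · rw [not_isEmpty_iff] at hm
        obtain ⟨π⟩ := hm
        funext c
        have := mtch_card _ _ π c.1
        rw [h1.1.some.fib c, h2.1.some.fib c] at this
        rw [← Nat.div_mul_cancel (h1.2 c), ← Nat.div_mul_cancel (h2.2 c), this]
    · exact absurd (rk_zero i) h'
  · exact absurd (rk_zero i) h

lemma Sq.d_le (σ : Sq F Λ ι) (a : Λ) : (σ.ρ a).d ≤ Fintype.card ι := by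
  rw [← σ.card_d]; exact Finset.single_le_sum (f := fun a => (σ.ρ a).d) (fun _ _ => Nat.zero_le _) (Finset.mem_univ a)

lemma eL_exists (N : ℕ) (hN : 0 < N) (hNn : N ≤ n) (i : Irr (GL (Fin N) F)) : ∃ l : CN F n → ℕ, ∑ c, l c = N ∧ rk i (eL N l) ≠ 0 := by
  classical
  obtain ⟨Λ, _, _, σ, hσ⟩ := exhaust N hN i
  have hle : ∀ a, (σ.ρ a).d ≤ n := fun a => (σ.d_le a).trans (by rw [Fintype.card_fin]; exact hNn)
  let f : Λ → CN F n := fun a => ⟨σ.ρ a, hle a⟩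
  let m : CN F n → ℕ := fun c => Nat.card {a // σ.ρ a = c.1}
  have hs : ∑ c : CN F n, m c * c.1.d = N := by
    have h1 := σ.card_d
    rw [Fintype.card_fin] at h1
    rw [← h1, ← Finset.sum_fiberwise (s := univ) (g := f)]
    refine Finset.sum_congr rfl fun c _ => ?_
    have h2 : ∀ a ∈ univ.filter (fun a => f a = c), (σ.ρ a).d = c.1.d := by
      intro a ha; rw [Finset.mem_filter] at ha; rw [← ha.2]
    rw [Finset.sum_congr rfl h2, Finset.sum_const, smul_eq_mul]
    congr 1
    simp only [m]
    rw [Nat.card_eq_fintype_card, Fintype.card_subtype]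
    congr 1; ext a; simp only [mem_filter, mem_univ, true_and]
    exact ⟨fun h => Subtype.ext h, fun h => congrArg Subtype.val h⟩
  have hdiv : ∀ c : CN F n, m c * c.1.d / c.1.d = m c := fun c => Nat.mul_div_cancel _ c.1.hd
  refine ⟨fun c => m c * c.1.d, hs, ?_⟩
  have h : Nonempty (CS F (Fin N) (fun c => m c * c.1.d / c.1.d) (fun c : CN F n => c.1)) := CS.exists _ _ val_inj N (by
      rw [← hs]; exact Finset.sum_congr rfl fun c _ => by rw [hdiv])
  rw [eL, dif_pos ⟨h, fun c => Dvd.intro_left _ rfl⟩]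
  obtain ⟨π⟩ := mtch_of_card σ h.some.σ (by
    intro ρ
    by_cases hρ : ρ.d ≤ n
    · refine Eq.trans ?_ (h.some.fib (⟨ρ, hρ⟩ : CN F n)).symm
      exact (hdiv (⟨ρ, hρ⟩ : CN F n)).symm
    · rw [h.some.fib' ρ (by rintro c rfl; exact hρ c.2), Nat.card_eq_zero]
      left
      exact ⟨fun a => hρ (by rw [← a.2]; exact hle _)⟩)
  rwa [← mackey_same σ _ π i]

theorem Zs_coeff (hG : Gd F n) (g N : ℕ) (hN : 0 < N) (hNn : N ≤ n) (z : Fˣ) :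
    (Zs F n g z).coeff N = ∑ i : Irr (GL (Fin N) F), hn i ^ (2 * g) * (hn i ^ 2)⁻¹ * om i (scal z) := by
  classical
  rw [Zs, PowerSeries.coeff_prod]
  have h1 : ∀ l ∈ finsuppAntidiag (univ : Finset (CN F n)) N, ∏ c, (Sf g z c).coeff (l c) =
      ∑ i : Irr (GL (Fin N) F), if rk i (eL N l) = 0 then 0 else hn i ^ (2 * g) * (hn i ^ 2)⁻¹ * om i (scal z) := by
    intro l hl
    rw [mem_finsuppAntidiag] at hl
    exact (eL_sum hG g N z l hl.1).symm
  rw [Finset.sum_congr rfl h1, Finset.sum_comm]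
  refine Finset.sum_congr rfl fun i _ => ?_
  obtain ⟨l, hl, hr⟩ := eL_exists N hN hNn i
  rw [Finset.sum_eq_single (Finsupp.equivFunOnFinite.symm l)]
  · have : ((Finsupp.equivFunOnFinite.symm l : CN F n →₀ ℕ) : CN F n → ℕ) = l := rfl
    rw [this, if_neg hr]
  · intro l' _ hne
    refine if_pos ?_
    by_contra hr'
    exact hne (DFunLike.coe_injective (eL_unique N _ _ i hr' hr))
  · intro h
    exfalso; apply h
    rw [mem_finsuppAntidiag]
    exact ⟨hl, fun _ _ => mem_univ _⟩

end cn
end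
end HRV
end modH17

section modH18
set_option autoImplicit false
open scoped MatrixGroups
open Finset

namespace HRV
noncomputable section

section ps
open PowerSeries

/-- Euler operator -/
def Eu (f : PowerSeries ℂ) : PowerSeries ℂ := PowerSeries.mk fun k => (k : ℂ) * f.coeff k

lemma Eu_coeff (f : PowerSeries ℂ) (k : ℕ) : (Eu f).coeff k = (k : ℂ) * f.coeff k := PowerSeries.coeff_mk _ _

lemma Eu_mul (f h : PowerSeries ℂ) : Eu (f * h) = Eu f * h + f * Eu h := by
  ext k
  rw [Eu_coeff, map_add, coeff_mul, coeff_mul, coeff_mul, Finset.mul_sum, ← Finset.sum_add_distrib]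
  refine Finset.sum_congr rfl fun p hp => ?_
  rw [Eu_coeff, Eu_coeff, ← HasAntidiagonal.mem_antidiagonal.mp hp]; push_cast; ring

lemma Eu_expand (d : ℕ) (hd : d ≠ 0) (f : PowerSeries ℂ) : Eu (expand d hd f) = (d : ℂ) • expand d hd (Eu f) := by
  ext k
  rw [Eu_coeff, coeff_smul, coeff_expand, coeff_expand]
  split_ifs with h
  · rw [Eu_coeff, smul_eq_mul, ← mul_assoc]
    congr 1
    rw [← Nat.cast_mul, Nat.mul_div_cancel' h]
  · simp

lemma Eu_rescale (a : ℂ) (f : PowerSeries ℂ) : Eu (rescale a f) = rescale a (Eu f) := by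
  ext k; rw [Eu_coeff, coeff_rescale, coeff_rescale, Eu_coeff]; ring

/-- logarithmic derivative -/
def LD (f : PowerSeries ℂ) : PowerSeries ℂ := Eu f * f⁻¹

lemma LD_spec (f : PowerSeries ℂ) (h : constantCoeff f ≠ 0) : Eu f = f * LD f := by
  rw [LD, mul_left_comm, PowerSeries.mul_inv_cancel _ h, mul_one]

lemma LD_eq {f L : PowerSeries ℂ} (h : constantCoeff f ≠ 0) (hL : Eu f = f * L) : LD f = L := by
  rw [LD, hL, mul_right_comm, PowerSeries.mul_inv_cancel _ h, one_mul]

lemma LD_prod {C : Type} (s : Finset C) (f : C → PowerSeries ℂ) (h : ∀ c, constantCoeff (f c) ≠ 0) :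
    LD (∏ c ∈ s, f c) = ∑ c ∈ s, LD (f c) := by
  classical
  induction s using Finset.induction_on with
  | empty =>
    rw [prod_empty, sum_empty]
    refine LD_eq (by simp) ?_
    rw [mul_zero]; ext k
    rw [Eu_coeff, coeff_one]
    by_cases h : k = 0
    · simp [h]
    · simp [h]
  | insert a s ha ih =>
    rw [prod_insert ha, sum_insert ha, ← ih]
    have h1 : constantCoeff (∏ c ∈ s, f c) ≠ 0 := by
      rw [map_prod]; exact Finset.prod_ne_zero_iff.mpr fun c _ => h c
    refine LD_eq (by rw [map_mul]; exact mul_ne_zero (h a) h1) ?_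
    rw [Eu_mul, LD_spec _ (h a), LD_spec _ h1]; ring

lemma LD_er (d : ℕ) (hd : d ≠ 0) (a : ℂ) (f : PowerSeries ℂ) (h : constantCoeff f ≠ 0) :
    LD (expand d hd (rescale a f)) = (d : ℂ) • expand d hd (rescale a (LD f)) := by
  refine LD_eq ?_ ?_
  · rw [constantCoeff_expand, ← coeff_zero_eq_constantCoeff_apply, coeff_rescale, pow_zero, one_mul, coeff_zero_eq_constantCoeff_apply]; exact h
  · rw [Eu_expand, Eu_rescale, LD_spec f h, map_mul, map_mul, mul_smul_comm]

lemma LD_zero (f : PowerSeries ℂ) : (LD f).coeff 0 = 0 := by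
  rw [LD, coeff_mul]; simp [Eu_coeff]

/-- if the first coefficients vanish then so do those of the log derivative -/
lemma LD_top (f : PowerSeries ℂ) (h : constantCoeff f = 1) (N : ℕ) (hN : 0 < N) (h0 : ∀ k, 0 < k → k < N → f.coeff k = 0) :
    (N : ℂ) * f.coeff N = (LD f).coeff N := by
  have h1 := congrArg (coeff N) (LD_spec f (by rw [h]; exact one_ne_zero))
  rw [Eu_coeff, coeff_mul] at h1
  rw [h1, Finset.sum_eq_single (0, N)]
  · rw [coeff_zero_eq_constantCoeff_apply, h, one_mul]
  · rintro ⟨a, b⟩ hp hne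
    rw [HasAntidiagonal.mem_antidiagonal] at hp
    simp only at hp ⊢
    by_cases ha : a = 0
    · subst ha; exact absurd (by simp at hp; simp [hp]) hne
    · by_cases hb : b = 0
      · subst hb; rw [LD_zero, mul_zero]
      · rw [h0 a (by omega) (by omega), zero_mul]
  · intro h; exact absurd (HasAntidiagonal.mem_antidiagonal.mpr (zero_add N)) h

lemma LD_top' (f : PowerSeries ℂ) (h : constantCoeff f = 1) (N : ℕ) (h0 : ∀ k, 0 < k → k < N → (LD f).coeff k = 0) :
    ∀ k, 0 < k → k < N → f.coeff k = 0 := by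
  intro k
  induction k using Nat.strong_induction_on with
  | _ k ih =>
  intro hk hkN
  have h1 := LD_top f h k hk (fun j hj hjk => ih j hjk hj (by omega))
  rw [h0 k hk hkN] at h1
  exact (mul_eq_zero.mp h1).resolve_left (by exact_mod_cast hk.ne')

end ps

section small

lemma Fg_small (g m : ℕ) (κ : ℂ) (hm : m ≤ 1) : Fg g m κ = 1 := by
  have : Subsingleton (Equiv.Perm (Fin m)) := by
    have : Subsingleton (Fin m) := Fin.subsingleton_iff_le_one.mpr hm
    infer_instance
  have hM : ∀ w : Equiv.Perm (Fin m), Mw κ w = 1 := fun w => by rw [Subsingleton.elim w 1, Mw_one]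
  have hu : (univ : Finset (Equiv.Perm (Fin m))) = {1} := by ext; simp [eq_iff_true_of_subsingleton]
  have h1 : C1m m κ = 1 := by
    rw [C1m, hu, sum_singleton, hM, Matrix.transpose_one, mul_one]
  have h2 : Cm m κ = 1 := by
    rw [Cm, hu, sum_singleton, sum_singleton, hM, Matrix.transpose_one]; simp
  rw [Fg, h1, h2, one_pow, _root_.inv_one, mul_one, mul_one, Matrix.trace_one]
  rw [← Finset.card_univ, hu]; simp

lemma Vg_zero (g : ℕ) (κ : ℂ) : Vg g 0 κ = 1 := by
  rw [Vg, Fg_small _ _ _ (by norm_num)]; simp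

lemma Vg_one (κ : ℂ) : Vg 0 1 κ = (κ ^ 2)⁻¹ := by
  rw [Vg, Fg_small _ _ _ (by norm_num)]; simp

/-- generating series in m -/
def Vs (g : ℕ) (κ : ℂ) : PowerSeries ℂ := PowerSeries.mk fun m => Vg g m κ

lemma Vs_const (g : ℕ) (κ : ℂ) : PowerSeries.constantCoeff (Vs g κ) = 1 := by
  rw [← PowerSeries.coeff_zero_eq_constantCoeff_apply, Vs, PowerSeries.coeff_mk, Vg_zero]

def ell (g m : ℕ) (κ : ℂ) : ℂ := (LD (Vs g κ)).coeff m

lemma ell_one (κ : ℂ) : ell 0 1 κ = (κ ^ 2)⁻¹ := by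
  rw [ell, ← LD_top _ (Vs_const 0 κ) 1 one_pos (fun k h1 h2 => by omega), Vs, PowerSeries.coeff_mk, Vg_one]; simp

lemma ell_rec (g m : ℕ) (κ : ℂ) : (m : ℂ) * Vg g m κ = ∑ p ∈ antidiagonal m, Vg g p.1 κ * ell g p.2 κ := by
  have h1 := congrArg (PowerSeries.coeff m) (LD_spec (Vs g κ) (by rw [Vs_const]; exact one_ne_zero))
  rw [Eu_coeff, PowerSeries.coeff_mul] at h1
  simpa [Vs, ell] using h1

end small

section main
variable {F : Type} [Field F] [Fintype F] [DecidableEq F] {n : ℕ}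

lemma Sf_const (g : ℕ) (z : Fˣ) (c : CN F n) : PowerSeries.constantCoeff (Sf g z c) = 1 := by
  rw [← PowerSeries.coeff_zero_eq_constantCoeff_apply, Sf_coeff, if_pos (dvd_zero _), Nat.zero_div, Vg_zero]; simp

lemma Zs_const (g : ℕ) (z : Fˣ) : PowerSeries.constantCoeff (Zs F n g z) = 1 := by
  rw [Zs, map_prod]; simp [Sf_const]

variable (F n) in
/-- sum of central characters of cuspidals of degree d -/
def Sd (d : ℕ) (z : Fˣ) : ℂ := ∑ c : CN F n, if c.1.d = d then omC c.1 z else 0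

lemma omC_pow (ρ : Cusp F) (z : Fˣ) (k : ℕ) : omC ρ (z ^ k) = omC ρ z ^ k := by
  induction k with
  | zero => rw [pow_zero, pow_zero, omC_one]
  | succ k ih => rw [pow_succ, pow_succ, omC_mul, ih]

lemma LD_Zs (g N : ℕ) (hN : 0 < N) (z : Fˣ) :
    (LD (Zs F n g z)).coeff N = ∑ d ∈ N.divisors, (d : ℂ) * ell g (N / d) (kap (yF F) d) * Sd F n d (z ^ (N / d)) := by
  rw [Zs, LD_prod _ _ (fun c => by rw [Sf_const]; exact one_ne_zero), map_sum]
  simp only [Sd, Finset.mul_sum]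
  rw [Finset.sum_comm]
  refine Finset.sum_congr rfl fun c _ => ?_
  rw [Sf, LD_er _ _ _ _ (by have := Vs_const g (kap (yF F) c.1.d); rw [Vs] at this; rw [this]; exact one_ne_zero),
    PowerSeries.coeff_smul, PowerSeries.coeff_expand]
  by_cases h : c.1.d ∣ N
  · rw [if_pos h, Finset.sum_eq_single c.1.d]
    · rw [if_pos rfl, PowerSeries.coeff_rescale, omC_pow, ell, Vs, smul_eq_mul]; ring
    · intro d _ hd; rw [if_neg (Ne.symm hd), mul_zero]
    · intro h'; exact absurd (Nat.mem_divisors.mpr ⟨h, hN.ne'⟩) h'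
  · rw [if_neg h, smul_zero, Finset.sum_eq_zero]
    intro d hd
    rw [if_neg, mul_zero]
    rintro rfl; exact h (Nat.dvd_of_mem_divisors hd)

/-- genus zero -/
lemma Zs_g0 (hG : Gd F n) (N : ℕ) (hN : 0 < N) (hNn : N ≤ n) (z : Fˣ) :
    (Zs F n 0 z).coeff N = if z = 1 then (yF F ^ (N ^ 2)) ^ 2 * (Fintype.card (GL (Fin N) F) : ℂ)⁻¹ else 0 := by
  rw [Zs_coeff hG 0 N hN hNn]
  have h1 := tau_eq (dl (scal z : GL (Fin N) F))
  have h2 : ∀ i : Irr (GL (Fin N) F), hn i ^ (2 * 0) * (hn i ^ 2)⁻¹ * om i (scal z) =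
      (yF F ^ (N ^ 2)) ^ 2 * (Fintype.card (GL (Fin N) F) : ℂ)⁻¹ * (ch i (dl (scal z)) / hk i) := by
    intro i
    have hy : yF F ≠ 0 := yF_ne F
    have hd : (dm i : ℂ) ≠ 0 := dm_ne i
    have hc : (Fintype.card (GL (Fin N) F) : ℂ) ≠ 0 := card_ne
    rw [hn, Fintype.card_fin, om, hk, mul_zero, pow_zero, one_mul]
    field_simp
  rw [Finset.sum_congr rfl fun i _ => h2 i, ← Finset.mul_sum, ← h1, tau_dl]
  have h3 : (scal z : GL (Fin N) F) = 1 ↔ z = 1 := by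
    constructor
    · intro h
      have h4 := congrArg (fun A : GL (Fin N) F => mx A ⟨0, hN⟩ ⟨0, hN⟩) h
      apply Units.ext
      simpa [mx, scal_apply] using h4
    · rintro rfl; exact scal_one
  by_cases hz : z = 1
  · rw [if_pos hz, if_pos (by first | exact h3.mpr hz | exact (h3.mpr hz).symm), mul_one]
  · rw [if_neg hz, if_neg (by first | exact fun h => hz (h3.mp h) | exact fun h => hz (h3.mp h.symm)), mul_zero]

end main
end
end HRV
end modH18

section modH19
set_option autoImplicit false
open scoped MatrixGroups
open Finset

namespace HRV
noncomputable section

/-- universal cuspidal sums -/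
def sd (y : ℂ) (d : ℕ) : ℂ :=
  if d = 1 then y ^ 2 - 1 else
    - (kap y d) ^ 2 * ∑ d' ∈ d.properDivisors.attach, ell 0 (d / d'.1) (kap y d'.1) * sd y d'.1
termination_by d
decreasing_by exact (Nat.mem_properDivisors.mp d'.2).2

lemma sd_one (y : ℂ) : sd y 1 = y ^ 2 - 1 := by rw [sd, if_pos rfl]

lemma sd_eq (y : ℂ) (d : ℕ) (hd : d ≠ 1) : sd y d = - (kap y d) ^ 2 * ∑ d' ∈ d.properDivisors, ell 0 (d / d') (kap y d') * sd y d' := by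
  rw [sd, if_neg hd, ← Finset.sum_attach d.properDivisors]

section main
variable {F : Type} [Field F] [Fintype F] [DecidableEq F] {n : ℕ}

lemma kap_ne (d : ℕ) (hd : 0 < d) : kap (yF F) d ≠ 0 := by
  have h1 : (1 : ℝ) < Real.sqrt (Fintype.card F) := by
    rw [Real.lt_sqrt zero_le_one, one_pow]; exact_mod_cast Fintype.one_lt_card
  have h2 : (1 : ℝ) < Real.sqrt (Fintype.card F) ^ d := one_lt_pow₀ h1 hd.ne'
  have h3 : (Real.sqrt (Fintype.card F) ^ d)⁻¹ < 1 := inv_lt_one_of_one_lt₀ h2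
  have h4 : Real.sqrt (Fintype.card F) ^ d - (Real.sqrt (Fintype.card F) ^ d)⁻¹ ≠ 0 := by linarith
  rw [kap, yF]
  exact_mod_cast h4

lemma ord_pow (z : Fˣ) (m d : ℕ) (hm : 0 < m) (h : m * d < orderOf z) : d < orderOf (z ^ m) := by
  have h1 : z ^ (m * orderOf (z ^ m)) = 1 := by rw [pow_mul, pow_orderOf_eq_one]
  have h2 := orderOf_dvd_of_pow_eq_one h1
  have h4 : 0 < m * orderOf (z ^ m) := Nat.mul_pos hm (orderOf_pos _)
  have h3 := Nat.le_of_dvd h4 h2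
  exact Nat.lt_of_mul_lt_mul_left (h.trans_le h3)

lemma LD_g0 (hG : Gd F n) (z : Fˣ) (hz : z ≠ 1) (N : ℕ) (hN : 0 < N) (hNn : N ≤ n) : (LD (Zs F n 0 z)).coeff N = 0 := by
  rw [← LD_top _ (Zs_const 0 z) N hN (fun k hk hkN => by rw [Zs_g0 hG k hk (by omega), if_neg hz]), Zs_g0 hG N hN hNn, if_neg hz, mul_zero]

lemma Sd_split (g d : ℕ) (hd : 0 < d) (z : Fˣ) : (LD (Zs F n g z)).coeff d = (d : ℂ) * ell g 1 (kap (yF F) d) * Sd F n d z +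
    ∑ d' ∈ d.properDivisors, (d' : ℂ) * ell g (d / d') (kap (yF F) d') * Sd F n d' (z ^ (d / d')) := by
  rw [LD_Zs _ _ hd, ← Nat.cons_self_properDivisors hd.ne', Finset.sum_cons, Nat.div_self hd, pow_one]

lemma Sd_zero (hG : Gd F n) (d : ℕ) (hd : 0 < d) (hdn : d ≤ n) (z : Fˣ) (hz : d < orderOf z) : Sd F n d z = 0 := by
  induction d using Nat.strong_induction_on generalizing z with
  | _ d ih =>
  have hz1 : z ≠ 1 := by rintro rfl; rw [orderOf_one] at hz; omega
  have h1 := Sd_split (n := n) 0 d hd z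
  rw [LD_g0 hG z hz1 d hd hdn, Finset.sum_eq_zero, add_zero, ell_one] at h1
  · have h2 : (d : ℂ) * (kap (yF F) d ^ 2)⁻¹ ≠ 0 :=
      mul_ne_zero (by exact_mod_cast hd.ne') (inv_ne_zero (pow_ne_zero _ (kap_ne d hd)))
    exact (mul_eq_zero.mp h1.symm).resolve_left h2
  · intro d' hd'
    rw [Nat.mem_properDivisors] at hd'
    have h3 : d / d' * d' = d := Nat.div_mul_cancel hd'.1
    have h4 : 0 < d' := Nat.pos_of_dvd_of_pos hd'.1 hd
    rw [ih d' hd'.2 h4 (by omega) _ (ord_pow z _ _ (Nat.div_pos hd'.2.le h4) (by rw [h3]; exact hz)), mul_zero]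

lemma ord_div (z : Fˣ) (d d' : ℕ) (hd : 0 < d) (hz : orderOf z = d) (h : d' ∣ d) : orderOf (z ^ (d / d')) = d' := by
  have h4 : 0 < d' := Nat.pos_of_dvd_of_pos h hd
  have := orderOf_pow_of_dvd (x := z) (n := d / d') (Nat.div_pos (Nat.le_of_dvd hd h) h4).ne' (by rw [hz]; exact Nat.div_dvd_of_dvd h)
  rw [this, hz, Nat.div_div_self h hd.ne']

lemma Sd_sd (hG : Gd F n) (d : ℕ) (hd : 0 < d) (hdn : d ≤ n) (z : Fˣ) (hz : orderOf z = d) : (d : ℂ) * Sd F n d z = sd (yF F) d := by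
  induction d using Nat.strong_induction_on generalizing z with
  | _ d ih =>
  have h1 := Sd_split (n := n) 0 d hd z
  have hk := kap_ne (F := F) d hd
  by_cases hd1 : d = 1
  · subst hd1
    have hz1 : z = 1 := orderOf_eq_one_iff.mp hz
    have hc : (Fintype.card (GL (Fin 1) F) : ℂ) = yF F ^ 2 - 1 := by
      rw [← Nat.card_eq_fintype_card, Matrix.card_GL_field, yF_sq]
      simp
      rw [Nat.cast_sub (show 1 ≤ Fintype.card F from Fintype.card_pos)]; simp
    rw [← LD_top _ (Zs_const 0 z) 1 one_pos (fun k hk hkN => by omega), Zs_g0 hG 1 one_pos hdn, if_pos hz1, hc, ell_one] at h1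
    simp only [Nat.properDivisors_one, Finset.sum_empty, Nat.cast_one, one_mul, one_pow, pow_one, add_zero] at h1
    rw [sd_one, Nat.cast_one, one_mul]
    have hy := yF_ne F
    have h2 : yF F ^ 2 - 1 ≠ 0 := by
      rw [← hc]; exact card_ne
    have h3 : Sd F n 1 z = kap (yF F) 1 ^ 2 * (yF F ^ 2 * (yF F ^ 2 - 1)⁻¹) := by
      rw [h1]; field_simp
    rw [h3, kap]
    field_simp
  · have hz1 : z ≠ 1 := by rintro rfl; rw [orderOf_one] at hz; omega
    rw [LD_g0 hG z hz1 d hd hdn, ell_one] at h1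
    have h2 : ∑ d' ∈ d.properDivisors, (d' : ℂ) * ell 0 (d / d') (kap (yF F) d') * Sd F n d' (z ^ (d / d'))
       = ∑ d' ∈ d.properDivisors, ell 0 (d / d') (kap (yF F) d') * sd (yF F) d' := by
      refine Finset.sum_congr rfl fun d' hd' => ?_
      rw [Nat.mem_properDivisors] at hd'
      rw [← ih d' hd'.2 (Nat.pos_of_dvd_of_pos hd'.1 hd) (by omega) _ (ord_div z d d' hd hz hd'.1)]
      ring
    rw [h2] at h1
    rw [sd_eq _ _ hd1]
    field_simp at h1
    linear_combination -h1

/-- formula for the top coefficient -/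
theorem Zs_top (hG : Gd F n) (hn : 0 < n) (g : ℕ) (z : Fˣ) (hz : orderOf z = n) :
    (n : ℂ) * (Zs F n g z).coeff n = ∑ d ∈ n.divisors, ell g (n / d) (kap (yF F) d) * sd (yF F) d := by
  have h0 : ∀ k, 0 < k → k < n → (LD (Zs F n g z)).coeff k = 0 := by
    intro k hk hkn
    rw [LD_Zs _ _ hk]
    refine Finset.sum_eq_zero fun d hd => ?_
    have hd1 := Nat.dvd_of_mem_divisors hd
    have hd0 := Nat.pos_of_dvd_of_pos hd1 hk
    have hdk := Nat.le_of_dvd hk hd1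
    rw [Sd_zero hG d hd0 (by omega) _ (ord_pow z _ _ (Nat.div_pos hdk hd0) (by rw [Nat.div_mul_cancel hd1, hz]; exact hkn)), mul_zero]
  rw [LD_top _ (Zs_const g z) n hn (LD_top' _ (Zs_const g z) n h0), LD_Zs _ _ hn]
  refine Finset.sum_congr rfl fun d hd => ?_
  have hd1 := Nat.dvd_of_mem_divisors hd
  rw [← Sd_sd hG d (Nat.pos_of_dvd_of_pos hd1 hn) (Nat.le_of_dvd hn hd1) _ (ord_div z n d hn hz hd1)]
  ring

/-- counting formula -/
theorem cnt (hG : Gd F n) (hn : 0 < n) (g : ℕ) (hg : 1 ≤ g) (z : Fˣ) (hz : orderOf z = n) :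
    (n : ℂ) * (Nat.card {p : (Fin g → GL (Fin n) F) × (Fin g → GL (Fin n) F) //
      (List.ofFn fun i => p.1 i * p.2 i * (p.1 i)⁻¹ * (p.2 i)⁻¹).prod = scal z} : ℂ) =
    Fintype.card (GL (Fin n) F) * (yF F ^ (n ^ 2 * (2 * g - 2)) * ∑ d ∈ n.divisors, ell g (n / d) (kap (yF F) d) * sd (yF F) d) := by
  rw [frobenius g hg (scal_comm z), ← Zs_top hG hn g z⁻¹ (by rw [orderOf_inv, hz]), Zs_coeff hG g n hn le_rfl]
  have h1 : ∀ i : Irr (GL (Fin n) F), yF F ^ (n ^ 2 * (2 * g - 2)) * (HRV.hn i ^ (2 * g) * (HRV.hn i ^ 2)⁻¹ * om i (scal z⁻¹)) = hk i ^ (2 * g - 2) * om i (scal z)⁻¹ := by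
    intro i
    have e : (scal z : GL (Fin n) F)⁻¹ = scal z⁻¹ := (map_inv (Units.map (algebraMap F (Matrix (Fin n) (Fin n) F)).toMonoidHom) z).symm
    have h2 : HRV.hn i ≠ 0 := mul_ne_zero (hk_ne i) (inv_ne_zero (pow_ne_zero _ (yF_ne F)))
    have h3 : HRV.hn i ^ (2 * g) * (HRV.hn i ^ 2)⁻¹ = HRV.hn i ^ (2 * g - 2) := by
      rw [← div_eq_mul_inv, pow_sub₀ _ h2 (by omega), div_eq_mul_inv]
    have h4 : hk i = yF F ^ (n ^ 2) * HRV.hn i := by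
      rw [HRV.hn, Fintype.card_fin, mul_left_comm, mul_inv_cancel₀ (pow_ne_zero _ (yF_ne F)), mul_one]
    rw [e, h3, h4, mul_pow, ← pow_mul, mul_assoc]
  rw [mul_left_comm (yF F ^ _), Finset.mul_sum (a := yF F ^ _), Finset.sum_congr rfl fun i _ => h1 i]
  ring

end main
end
end HRV
end modH19

section modH20
set_option autoImplicit false
open scoped MatrixGroups
open Finset

namespace HRV
noncomputable section

section rs
open Polynomial

/-- rational functions as functions -/
def RS (f : ℂ → ℂ) : Prop := ∃ N D : ℂ[X], D ≠ 0 ∧ ∀ x, f x * D.eval x = N.eval x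

lemma RS.congr {f h : ℂ → ℂ} (hf : RS f) (e : ∀ x, f x = h x) : RS h := by
  have : f = h := funext e
  rwa [← this]

lemma RS.const (c : ℂ) : RS (fun _ => c) := ⟨C c, 1, one_ne_zero, fun x => by simp⟩
lemma RS.id : RS (fun x => x) := ⟨X, 1, one_ne_zero, fun x => by simp⟩
lemma RS.add {f h : ℂ → ℂ} (hf : RS f) (hh : RS h) : RS (fun x => f x + h x) := by
  obtain ⟨N, D, h1, h2⟩ := hf
  obtain ⟨N', D', h1', h2'⟩ := hh
  refine ⟨N * D' + N' * D, D * D', mul_ne_zero h1 h1', fun x => ?_⟩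
  rw [eval_add, eval_mul, eval_mul, eval_mul, ← h2, ← h2']; ring
lemma RS.mul {f h : ℂ → ℂ} (hf : RS f) (hh : RS h) : RS (fun x => f x * h x) := by
  obtain ⟨N, D, h1, h2⟩ := hf
  obtain ⟨N', D', h1', h2'⟩ := hh
  refine ⟨N * N', D * D', mul_ne_zero h1 h1', fun x => ?_⟩
  rw [eval_mul, eval_mul, ← h2, ← h2']; ring
lemma RS.inv {f : ℂ → ℂ} (hf : RS f) : RS (fun x => (f x)⁻¹) := by
  obtain ⟨N, D, h1, h2⟩ := hf
  by_cases hN : N = 0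
  · refine ⟨0, D, h1, fun x => ?_⟩
    have := h2 x
    rw [hN, eval_zero] at this
    rw [eval_zero]
    change (f x)⁻¹ * _ = 0
    rcases mul_eq_zero.mp this with h | h
    · rw [h, inv_zero, zero_mul]
    · rw [h, mul_zero]
  · refine ⟨N * D, N * N, mul_ne_zero hN hN, fun x => ?_⟩
    rw [eval_mul, eval_mul, ← h2]
    by_cases h : f x = 0
    · rw [h]; simp
    · field_simp
lemma RS.neg {f : ℂ → ℂ} (hf : RS f) : RS (fun x => - f x) := ((RS.const (-1)).mul hf).congr fun x => by ring
lemma RS.sub {f h : ℂ → ℂ} (hf : RS f) (hh : RS h) : RS (fun x => f x - h x) := (hf.add hh.neg).congr fun x => by ring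
lemma RS.pow {f : ℂ → ℂ} (hf : RS f) (k : ℕ) : RS (fun x => f x ^ k) := by
  induction k with
  | zero => exact (RS.const 1).congr fun x => (pow_zero _).symm
  | succ k ih => exact (ih.mul hf).congr fun x => (pow_succ _ _).symm
lemma RS.sum {A : Type} (s : Finset A) {f : A → ℂ → ℂ} (hf : ∀ a ∈ s, RS (f a)) : RS (fun x => ∑ a ∈ s, f a x) := by
  classical
  induction s using Finset.induction_on with
  | empty => exact (RS.const 0).congr fun x => sum_empty.symm
  | insert a s ha ih =>
    exact ((hf a (mem_insert_self _ _)).add (ih fun b hb => hf b (mem_insert_of_mem hb))).congr fun x => by rw [sum_insert ha]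
lemma RS.prod {A : Type} (s : Finset A) {f : A → ℂ → ℂ} (hf : ∀ a, RS (f a)) : RS (fun x => ∏ a ∈ s, f a x) := by
  classical
  induction s using Finset.induction_on with
  | empty => exact (RS.const 1).congr fun x => prod_empty.symm
  | insert a s ha ih =>
    exact ((hf a).mul ih).congr fun x => by rw [prod_insert ha]

lemma RS.ite {p : Prop} [Decidable p] {f h : ℂ → ℂ} (hf : RS f) (hh : RS h) : RS (fun x => if p then f x else h x) := by
  by_cases hp : p
  · exact hf.congr fun x => by rw [if_pos hp]
  · exact hh.congr fun x => by rw [if_neg hp]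

/-- if a rational function vanishes infinitely often it vanishes cofinitely -/
lemma RS.zero {f : ℂ → ℂ} (hf : RS f) (h : {x | f x = 0}.Infinite) : {x | f x ≠ 0}.Finite := by
  obtain ⟨N, D, h1, h2⟩ := hf
  have hN : N = 0 := by
    refine Polynomial.eq_zero_of_infinite_isRoot N (h.mono ?_)
    intro x hx
    rw [Set.mem_setOf_eq] at hx
    change N.eval x = 0
    rw [← h2, hx, zero_mul]
  refine (D.rootSet_finite ℂ).subset ?_
  intro x hx
  rw [Polynomial.mem_rootSet]
  refine ⟨h1, ?_⟩
  have := h2 x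
  rw [hN, eval_zero] at this
  rw [Polynomial.coe_aeval_eq_eval]
  exact (mul_eq_zero.mp this).resolve_left hx

variable {A : Type} [Fintype A] [DecidableEq A]

def RM (M : ℂ → Matrix A A ℂ) : Prop := ∀ i j, RS fun x => M x i j

lemma RM.congr {M M' : ℂ → Matrix A A ℂ} (h : RM M) (e : ∀ x, M x = M' x) : RM M' := by
  have : M = M' := funext e
  rwa [← this]

lemma RM.mul {M M' : ℂ → Matrix A A ℂ} (h : RM M) (h' : RM M') : RM fun x => M x * M' x := fun i j =>
  (RS.sum univ fun k _ => (h i k).mul (h' k j)).congr fun x => (Matrix.mul_apply).symm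
lemma RM.one : RM fun _ => (1 : Matrix A A ℂ) := fun i j => RS.const _
lemma RM.tr {M : ℂ → Matrix A A ℂ} (h : RM M) : RM fun x => (M x).transpose := fun i j => h j i
lemma RM.sum {B : Type} (s : Finset B) {M : B → ℂ → Matrix A A ℂ} (h : ∀ b, RM (M b)) : RM fun x => ∑ b ∈ s, M b x := fun i j =>
  (RS.sum s fun b _ => h b i j).congr fun x => (Matrix.sum_apply i j s _).symm
lemma RM.pow {M : ℂ → Matrix A A ℂ} (h : RM M) (k : ℕ) : RM fun x => M x ^ k := by
  induction k with
  | zero => exact RM.one.congr fun x => (pow_zero _).symm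
  | succ k ih => exact (ih.mul h).congr fun x => (pow_succ _ _).symm
lemma RM.det {M : ℂ → Matrix A A ℂ} (h : RM M) : RS fun x => (M x).det :=
  (RS.sum univ fun σ _ => (RS.const ((Equiv.Perm.sign σ : ℤ) : ℂ)).mul (RS.prod univ fun i => h (σ i) i)).congr
    fun x => (Matrix.det_apply' _).symm
lemma RM.inv {M : ℂ → Matrix A A ℂ} (h : RM M) : RM fun x => (M x)⁻¹ := fun i j => by
  have h1 : RM fun x => (M x).updateRow j (Pi.single i 1) := by
    intro a b
    by_cases hab : a = j
    · subst hab
      exact (RS.const ((Pi.single i 1 : A → ℂ) b)).congr fun x => (congrFun Matrix.updateRow_self b).symm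
    · exact (h a b).congr fun x => (congrFun (Matrix.updateRow_ne hab) b).symm
  refine ((h.det.inv).mul h1.det).congr fun x => ?_
  change _ = (M x)⁻¹ i j
  rw [Matrix.inv_def, Matrix.smul_apply, Matrix.adjugate_apply, Ring.inverse_eq_inv', smul_eq_mul]
lemma RM.trace {M : ℂ → Matrix A A ℂ} (h : RM M) : RS fun x => (M x).trace := RS.sum univ fun i _ => h i i

end rs

section fun_
variable {f : ℂ → ℂ} (hf : RS f)

open Classical in
lemma RS_Ms {m : ℕ} {f : ℂ → ℂ} (hf : RS f) (r : SR m) : RM fun x => Ms (f x) r := fun i j => by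
  have : RS fun x => (if i = r.s * j then (1 : ℂ) else 0) + (if i = j ∧ ¬ r.asc j then f x else 0) :=
    (RS.const _).add (RS.ite hf (RS.const 0))
  exact this.congr fun x => rfl

lemma RS_Mw {m : ℕ} {f : ℂ → ℂ} (hf : RS f) (w : Equiv.Perm (Fin m)) : RM fun x => Mw (f x) w := by
  induction w using perm_ind with
  | h1 => exact RM.one.congr fun x => (Mw_one _).symm
  | h2 w h ih => exact ((RS_Ms hf _).mul ih).congr fun x => (Mw_rec _ w h).symm

lemma RS_Fg (g m : ℕ) {f : ℂ → ℂ} (hf : RS f) : RS fun x => Fg g m (f x) := by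
  have h1 : RM fun x => C1m m (f x) := RM.sum univ fun w => (RS_Mw hf w).mul (RS_Mw hf w).tr
  have h2 : RM fun x => Cm m (f x) := RM.sum univ fun w => RM.sum univ fun v =>
    (((RS_Mw hf w).mul (RS_Mw hf v)).mul (RS_Mw hf w).tr).mul (RS_Mw hf v).tr
  exact (((h2.pow g).mul h1.inv).mul h1.inv).trace

lemma RS_Vg (g m : ℕ) {f : ℂ → ℂ} (hf : RS f) : RS fun x => Vg g m (f x) :=
  (((hf.pow m).pow (2 * g)).mul ((hf.pow m).pow 2).inv).mul (RS_Fg g m hf)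

lemma RS_ell (g m : ℕ) {f : ℂ → ℂ} (hf : RS f) : RS fun x => ell g m (f x) := by
  induction m using Nat.strong_induction_on with
  | _ m ih =>
  have h : ∀ x, ell g m (f x) = (m : ℂ) * Vg g m (f x) - ∑ p ∈ (antidiagonal m).erase (0, m), Vg g p.1 (f x) * ell g p.2 (f x) := by
    intro x
    rw [ell_rec, ← Finset.add_sum_erase _ _ (show ((0, m) : ℕ × ℕ) ∈ antidiagonal m from HasAntidiagonal.mem_antidiagonal.mpr (zero_add m)), Vg_zero]; ring
  refine RS.congr ?_ fun x => (h x).symm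
  refine ((RS.const _).mul (RS_Vg g m hf)).sub (RS.sum _ fun p hp => ?_)
  rw [Finset.mem_erase, HasAntidiagonal.mem_antidiagonal] at hp
  refine (RS_Vg g _ hf).mul (ih _ ?_)
  rcases p with ⟨a, b⟩
  simp only at hp ⊢
  by_contra hb
  exact hp.1 (by rw [Prod.mk.injEq]; omega)

lemma RS_kap (d : ℕ) : RS fun x => kap x d := (RS.id.pow d).sub (RS.id.pow d).inv

lemma kap_inv (x : ℂ) (d : ℕ) : kap x⁻¹ d = - kap x d := by rw [kap, kap, inv_pow, inv_inv]; ring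

lemma Vg_neg (g m : ℕ) (κ : ℂ) : Vg g m (-κ) = Vg g m κ := by
  rw [Vg, Vg, Fg_neg, neg_pow, mul_pow, mul_pow]
  have : ∀ k : ℕ, ((-1 : ℂ) ^ m) ^ (2 * k) = 1 := fun k => by rw [← pow_mul, mul_comm m, mul_assoc, pow_mul]; simp
  have h2 := this 1
  rw [mul_one] at h2
  rw [this, h2]; simp

lemma ell_neg (g m : ℕ) (κ : ℂ) : ell g m (-κ) = ell g m κ := by
  have : Vs g (-κ) = Vs g κ := by rw [Vs, Vs]; congr 1; funext m; exact Vg_neg g m κ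
  rw [ell, this, ell]

lemma ell_sym (g m d : ℕ) (x : ℂ) : ell g m (kap x⁻¹ d) = ell g m (kap x d) := by rw [kap_inv, ell_neg]

def st (y : ℂ) (d : ℕ) : ℂ :=
  if d = 1 then 1 else
    - (kap y d) ^ 2 * ∑ d' ∈ d.properDivisors.attach, ell 0 (d / d'.1) (kap y d'.1) * st y d'.1
termination_by d
decreasing_by exact (Nat.mem_properDivisors.mp d'.2).2

lemma st_one (y : ℂ) : st y 1 = 1 := by rw [st, if_pos rfl]

lemma st_eq (y : ℂ) (d : ℕ) (hd : d ≠ 1) : st y d = - (kap y d) ^ 2 * ∑ d' ∈ d.properDivisors, ell 0 (d / d') (kap y d') * st y d' := by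
  rw [st, if_neg hd, ← Finset.sum_attach d.properDivisors]

lemma sd_st (y : ℂ) (d : ℕ) : sd y d = (y ^ 2 - 1) * st y d := by
  induction d using Nat.strong_induction_on with
  | _ d ih =>
  by_cases hd : d = 1
  · rw [hd, sd_one, st_one, mul_one]
  · rw [sd_eq _ _ hd, st_eq _ _ hd, Finset.sum_congr rfl fun d' hd' => by rw [ih d' (Nat.mem_properDivisors.mp hd').2, mul_left_comm], ← Finset.mul_sum]
    ring

lemma st_sym (y : ℂ) (d : ℕ) : st y⁻¹ d = st y d := by
  induction d using Nat.strong_induction_on with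
  | _ d ih =>
  by_cases hd : d = 1
  · rw [hd, st_one, st_one]
  · rw [st_eq _ _ hd, st_eq _ _ hd, Finset.sum_congr rfl fun d' hd' => by rw [ih d' (Nat.mem_properDivisors.mp hd').2, ell_sym], kap_inv, neg_sq]

lemma RS_st (d : ℕ) : RS fun y => st y d := by
  induction d using Nat.strong_induction_on with
  | _ d ih =>
  by_cases hd : d = 1
  · exact (RS.const 1).congr fun y => by rw [hd, st_one]
  · refine RS.congr ?_ fun y => (st_eq y d hd).symm
    exact ((RS_kap d).pow 2).neg.mul (RS.sum _ fun d' hd' => (RS_ell _ _ (RS_kap d')).mul (ih d' (Nat.mem_properDivisors.mp hd').2))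

/-- symmetric rational function -/
def Ps (g n : ℕ) (y : ℂ) : ℂ := ∑ d ∈ n.divisors, ell g (n / d) (kap y d) * st y d

lemma Ps_sym (g n : ℕ) (y : ℂ) : Ps g n y⁻¹ = Ps g n y := Finset.sum_congr rfl fun d _ => by rw [ell_sym, st_sym]
lemma RS_Ps (g n : ℕ) : RS fun y => Ps g n y := RS.sum _ fun d _ => (RS_ell _ _ (RS_kap d)).mul (RS_st d)
lemma Ps_sd (g n : ℕ) (y : ℂ) : ∑ d ∈ n.divisors, ell g (n / d) (kap y d) * sd y d = (y ^ 2 - 1) * Ps g n y := by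
  rw [Ps, Finset.mul_sum]; exact Finset.sum_congr rfl fun d _ => by rw [sd_st]; ring

end fun_

section pal
open Polynomial

lemma pal_poly (P : ℂ[X]) (D : ℕ) (h : {x : ℂ | ¬ (x ≠ 0 → x ^ D * P.eval x⁻¹ = P.eval x)}.Finite) :
    P.natDegree ≤ D ∧ ∀ k ≤ D, P.coeff k = P.coeff (D - k) := by
  set M := P.natDegree with hM
  have h1 : X ^ D * P.reverse = X ^ M * P := by
    refine Polynomial.eq_of_infinite_eval_eq _ _ ?_
    have : ({0} ∪ {x : ℂ | ¬ (x ≠ 0 → x ^ D * P.eval x⁻¹ = P.eval x)} : Set ℂ)ᶜ.Infinite := ((Set.finite_singleton 0).union h).infinite_compl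
    refine this.mono fun x hx => ?_
    rw [Set.mem_compl_iff, Set.mem_union, not_or, Set.mem_singleton_iff, Set.mem_setOf_eq, not_not] at hx
    have h0 := hx.1
    have h2 := hx.2 h0
    letI := invertibleOfNonzero (inv_ne_zero h0)
    have h3 := Polynomial.eval₂_reverse_mul_pow (RingHom.id ℂ) (x⁻¹) P
    rw [invOf_eq_inv, inv_inv] at h3
    change P.reverse.eval x * (x⁻¹) ^ M = P.eval x⁻¹ at h3
    rw [Set.mem_setOf_eq, eval_mul, eval_mul, eval_pow, eval_pow, eval_X, ← h2, ← h3, inv_pow]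
    have : x ^ M ≠ 0 := pow_ne_zero _ h0
    field_simp
  have hk : ∀ k, P.coeff k = if D ≤ M + k then P.reverse.coeff (M + k - D) else 0 := by
    intro k
    have h2 := congrArg (fun Q => Q.coeff (M + k)) h1
    simp only [coeff_X_pow_mul'] at h2
    rw [if_pos (Nat.le_add_right M k), Nat.add_sub_cancel_left] at h2
    exact h2.symm
  constructor
  · rw [Polynomial.natDegree_le_iff_coeff_eq_zero]
    intro k hk1
    rw [hk, if_pos (by omega)]
    refine Polynomial.coeff_eq_zero_of_natDegree_lt ?_
    have := P.reverse_natDegree_le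
    omega
  · intro k hkD
    rw [hk]
    split_ifs with h3
    · rw [Polynomial.coeff_reverse, Polynomial.revAt_le (by omega)]
      congr 1; omega
    · exact (Polynomial.coeff_eq_zero_of_natDegree_lt (by omega)).symm

end pal
end
end HRV
end modH20

section modH21
set_option autoImplicit false
open scoped MatrixGroups
open Finset

namespace HRV
noncomputable section

/-- number of solutions -/
def NS (F : Type) [Field F] [Fintype F] (g n : ℕ) (z : Fˣ) : ℕ :=
  Nat.card {p : (Fin g → GL (Fin n) F) × (Fin g → GL (Fin n) F) //
      (List.ofFn fun i => p.1 i * p.2 i * (p.1 i)⁻¹ * (p.2 i)⁻¹).prod = scal z}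

/-- the hypothesis -/
def Hyp (g n : ℕ) (P : Polynomial ℚ) : Prop :=
  ∀ (F : Type) [Field F] [Fintype F], n ∣ Fintype.card F - 1 →
      ∃ ζ : F, orderOf ζ = n ∧
        (Nat.card {p : (Fin g → GL (Fin n) F) × (Fin g → GL (Fin n) F) //
            (↑((List.ofFn fun i => p.1 i * p.2 i * (p.1 i)⁻¹ * (p.2 i)⁻¹).prod) :
              Matrix (Fin n) (Fin n) F) = ζ • (1 : Matrix (Fin n) (Fin n) F)} : ℚ)
          = (Nat.card (GL (Fin n) F) : ℚ) / ((Fintype.card F : ℚ) - 1)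
              * P.eval (Fintype.card F : ℚ)

lemma Hyp.unit {g n : ℕ} {P : Polynomial ℚ} (h : Hyp g n P) (hn : 0 < n) (F : Type) [Field F] [Fintype F]
    (hF : n ∣ Fintype.card F - 1) : ∃ z : Fˣ, orderOf z = n ∧
      (NS F g n z : ℚ) * ((Fintype.card F : ℚ) - 1) = (Nat.card (GL (Fin n) F) : ℚ) * P.eval (Fintype.card F : ℚ) := by
  obtain ⟨ζ, h1, h2⟩ := h F hF
  have h0 : ζ ≠ 0 := by
    rintro rfl
    have := pow_orderOf_eq_one (0 : F)
    rw [h1, zero_pow hn.ne'] at this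
    exact zero_ne_one this
  have e : ∀ x : GL (Fin n) F, (x : Matrix (Fin n) (Fin n) F) = ζ • (1 : Matrix (Fin n) (Fin n) F) ↔ x = scal (Units.mk0 ζ h0) := by
    intro x
    rw [Units.ext_iff]
    change _ ↔ (x : Matrix (Fin n) (Fin n) F) = algebraMap F (Matrix (Fin n) (Fin n) F) ζ
    rw [Algebra.algebraMap_eq_smul_one]
  refine ⟨Units.mk0 ζ h0, ?_, ?_⟩
  · rw [← h1, ← orderOf_units]; rfl
  · have hc : (Fintype.card F : ℚ) - 1 ≠ 0 := by
      have := Fintype.one_lt_card (α := F)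
      have : (1 : ℚ) < Fintype.card F := by exact_mod_cast this
      exact (sub_pos.mpr this).ne'
    have e2 : NS F g n (Units.mk0 ζ h0) = Nat.card {p : (Fin g → GL (Fin n) F) × (Fin g → GL (Fin n) F) //
            (↑((List.ofFn fun i => p.1 i * p.2 i * (p.1 i)⁻¹ * (p.2 i)⁻¹).prod) :
              Matrix (Fin n) (Fin n) F) = ζ • (1 : Matrix (Fin n) (Fin n) F)} :=
      Nat.card_congr (Equiv.subtypeEquivRight fun p => (e _).symm)
    rw [e2, h2, div_mul_eq_mul_div, div_mul_cancel₀ _ hc]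

/-- infinitely many good primes -/
lemma Hyp.prime {g n : ℕ} {P : Polynomial ℚ} (h : Hyp g n P) (hn : 0 < n) (B : ℕ) :
    ∃ p : ℕ, ∃ _ : Fact p.Prime, B ≤ p ∧ ∃ z : (ZMod p)ˣ, orderOf z = n ∧
      (NS (ZMod p) g n z : ℚ) * ((p : ℚ) - 1) = (Nat.card (GL (Fin n) (ZMod p)) : ℚ) * P.eval (p : ℚ) := by
  obtain ⟨p, hp, hB, hm⟩ := Nat.exists_prime_gt_modEq_one (k := n) B hn.ne'
  haveI : Fact p.Prime := ⟨hp⟩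
  have hd : n ∣ Fintype.card (ZMod p) - 1 := by
    rw [ZMod.card]
    exact (Nat.modEq_iff_dvd' hp.one_lt.le).mp hm.symm
  obtain ⟨z, h1, h2⟩ := h.unit hn (ZMod p) hd
  rw [ZMod.card] at h2
  exact ⟨p, this, hB.le, z, h1, h2⟩

/-- complexification of P -/
abbrev PC (P : Polynomial ℚ) : Polynomial ℂ := P.map (algebraMap ℚ ℂ)

lemma PC_eval (P : Polynomial ℚ) (p : ℕ) : (PC P).eval (p : ℂ) = ((P.eval (p : ℚ) : ℚ) : ℂ) := by
  have := Polynomial.eval_map_apply (f := algebraMap ℚ ℂ) (p := P) (p : ℚ)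
  simpa using this

lemma Hyp.id1 {g n : ℕ} (hg : 1 ≤ g) {P : Polynomial ℚ} (h : Hyp g n P) (hn : 0 < n) (B : ℕ) :
    ∃ p : ℕ, B ≤ p ∧ ∃ y : ℂ, y ^ 2 = p ∧ (n : ℂ) * (PC P).eval (y ^ 2) = (y ^ 2 - 1) ^ 2 * y ^ (n ^ 2 * (2 * g - 2)) * Ps g n y := by
  obtain ⟨B', hB'⟩ := hC_val n
  obtain ⟨p, hp, hB, z, h1, h2⟩ := h.prime hn (B + B')
  have hG : Gd (ZMod p) n := hB' (ZMod p) (by rw [ZMod.card]; exact hp.out) (by rw [ZMod.card]; omega)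
  have hc := cnt hG hn g hg z h1
  have hy : yF (ZMod p) ^ 2 = p := by rw [yF_sq, ZMod.card]
  refine ⟨p, by omega, yF (ZMod p), hy, ?_⟩
  rw [Ps_sd, hy] at hc
  rw [hy, PC_eval]
  have h3 : ((NS (ZMod p) g n z : ℚ) * ((p : ℚ) - 1) : ℂ) = ((Nat.card (GL (Fin n) (ZMod p)) : ℚ) : ℂ) * ((P.eval (p : ℚ) : ℚ) : ℂ) := by
    exact_mod_cast congrArg (fun x : ℚ => (x : ℂ)) h2
  have hc' : (n : ℂ) * (NS (ZMod p) g n z : ℂ) = (Nat.card (GL (Fin n) (ZMod p)) : ℂ) * (yF (ZMod p) ^ (n ^ 2 * (2 * g - 2)) * (((p : ℂ) - 1) * Ps g n (yF (ZMod p)))) := by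
    rw [Nat.card_eq_fintype_card]; exact hc
  have hG0 : (Nat.card (GL (Fin n) (ZMod p)) : ℂ) ≠ 0 := by exact_mod_cast Nat.card_pos.ne'
  apply mul_left_cancel₀ hG0
  push_cast at h3
  linear_combination ((p : ℂ) - 1) * hc' - (n : ℂ) * h3

lemma Hyp.id2 {g n : ℕ} (hg : 1 ≤ g) {P : Polynomial ℚ} (h : Hyp g n P) (hn : 0 < n) :
    {y : ℂ | (n : ℂ) * (PC P).eval (y ^ 2) - (y ^ 2 - 1) ^ 2 * y ^ (n ^ 2 * (2 * g - 2)) * Ps g n y ≠ 0}.Finite := by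
  have hr : RS fun y => (n : ℂ) * (PC P).eval (y ^ 2) - (y ^ 2 - 1) ^ 2 * y ^ (n ^ 2 * (2 * g - 2)) * Ps g n y := by
    refine RS.sub ((RS.const _).mul ?_) (((((RS.id.pow 2).sub (RS.const 1)).pow 2).mul (RS.id.pow _)).mul (RS_Ps g n))
    refine ⟨(PC P).comp (Polynomial.X ^ 2), 1, one_ne_zero, fun x => ?_⟩
    rw [Polynomial.eval_comp]; simp
  refine hr.zero ?_
  intro hfin
  have h2 : (Set.image (fun y : ℂ => y ^ 2) {y : ℂ | (n : ℂ) * (PC P).eval (y ^ 2) - (y ^ 2 - 1) ^ 2 * y ^ (n ^ 2 * (2 * g - 2)) * Ps g n y = 0}).Finite := hfin.image _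
  have h3 : {p : ℕ | (p : ℂ) ∈ (Set.image (fun y : ℂ => y ^ 2) {y : ℂ | (n : ℂ) * (PC P).eval (y ^ 2) - (y ^ 2 - 1) ^ 2 * y ^ (n ^ 2 * (2 * g - 2)) * Ps g n y = 0})}.Finite :=
    h2.preimage (Nat.cast_injective.injOn)
  obtain ⟨B, hB⟩ := h3.bddAbove
  obtain ⟨p, hp, y, hy, hh⟩ := h.id1 hg hn (B + 1)
  have : p ≤ B := @hB p ⟨y, by rw [Set.mem_setOf_eq, hh, sub_self], hy⟩
  omega

lemma Hyp.pal {g n : ℕ} (hg : 1 ≤ g) {P : Polynomial ℚ} (h : Hyp g n P) (hn : 0 < n) :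
    P.natDegree ≤ n ^ 2 * (2 * g - 2) + 2 ∧ ∀ k ≤ n ^ 2 * (2 * g - 2) + 2, P.coeff k = P.coeff (n ^ 2 * (2 * g - 2) + 2 - k) := by
  have hb := h.id2 hg hn
  set S := {y : ℂ | (n : ℂ) * (PC P).eval (y ^ 2) - (y ^ 2 - 1) ^ 2 * y ^ (n ^ 2 * (2 * g - 2)) * Ps g n y ≠ 0} with hS
  have key := pal_poly (PC P) (n ^ 2 * (2 * g - 2) + 2) (by
    refine ((hb.image fun y => y ^ 2).union (hb.image fun y => (y ^ 2)⁻¹)).subset ?_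
    intro x hx
    rw [Set.mem_setOf_eq] at hx
    push Not at hx
    obtain ⟨h0, hx⟩ := hx
    by_contra hc
    rw [Set.mem_union, not_or] at hc
    obtain ⟨y, hy⟩ := IsAlgClosed.exists_pow_nat_eq x (n := 2) (by norm_num)
    have hy0 : y ≠ 0 := by rintro rfl; apply h0; rw [← hy]; simp
    have e1 : y ∉ S := fun hh => hc.1 ⟨y, hh, hy⟩
    have e2 : y⁻¹ ∉ S := fun hh => hc.2 ⟨y⁻¹, hh, by change ((y⁻¹) ^ 2)⁻¹ = x; rw [inv_pow, inv_inv, hy]⟩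
    rw [hS, Set.mem_setOf_eq, not_not, sub_eq_zero] at e1 e2
    rw [Ps_sym, inv_pow, inv_pow, hy] at e2
    rw [hy] at e1
    apply hx
    have hn0 : (n : ℂ) ≠ 0 := by exact_mod_cast hn.ne'
    apply mul_left_cancel₀ hn0
    rw [mul_left_comm, e1, e2, pow_add]
    have e3 : x ^ (n ^ 2 * (2 * g - 2)) = y ^ (n ^ 2 * (2 * g - 2)) * y ^ (n ^ 2 * (2 * g - 2)) := by
      rw [← hy, ← pow_mul, mul_comm, pow_mul, sq]
    rw [e3]
    have := pow_ne_zero (n ^ 2 * (2 * g - 2)) hy0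
    field_simp
    ring)
  rw [Polynomial.natDegree_map] at key
  refine ⟨key.1, fun k hk => ?_⟩
  have := key.2 k hk
  rw [Polynomial.coeff_map, Polynomial.coeff_map] at this
  exact (algebraMap ℚ ℂ).injective this

/-- reduction to the leading coefficient -/
lemma Hyp.fin {g n : ℕ} (hg : 1 ≤ g) {P : Polynomial ℚ} (h : Hyp g n P) (hn : 0 < n)
    (hl : P.coeff (n ^ 2 * (2 * g - 2) + 2) = 1) : P.natDegree = n ^ 2 * (2 * g - 2) + 2 ∧
    P.leadingCoeff = 1 ∧
    P.coeff 0 = 1 ∧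
    ∀ k ≤ n ^ 2 * (2 * g - 2) + 2,
      P.coeff k = P.coeff (n ^ 2 * (2 * g - 2) + 2 - k) := by
  obtain ⟨h1, h2⟩ := h.pal hg hn
  have h3 : P.natDegree = n ^ 2 * (2 * g - 2) + 2 :=
    le_antisymm h1 (Polynomial.le_natDegree_of_ne_zero (by rw [hl]; exact one_ne_zero))
  refine ⟨h3, ?_, ?_, h2⟩
  · rw [Polynomial.leadingCoeff, h3, hl]
  · rw [h2 0 (Nat.zero_le _), Nat.sub_zero, hl]

/-- asymptotic determination of the leading coefficient -/
lemma coeff_lim {P : Polynomial ℚ} {D : ℕ} (hD : P.natDegree ≤ D) (C : ℝ)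
    (h : ∀ B : ℕ, ∃ p : ℕ, B ≤ p ∧ |((P.eval (p : ℚ) : ℚ) : ℝ) - (p : ℝ) ^ D| * (p : ℝ) ≤ C * (p : ℝ) ^ D) : P.coeff D = 1 := by
  set Q : Polynomial ℝ := P.map (algebraMap ℚ ℝ) - Polynomial.X ^ D with hQ
  have hQd : Q.natDegree ≤ D := by
    refine (Polynomial.natDegree_sub_le _ _).trans (max_le ?_ ?_)
    · rwa [Polynomial.natDegree_map]
    · exact Polynomial.natDegree_X_pow_le D
  have hc : Q.coeff D = (P.coeff D : ℝ) - 1 := by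
    rw [hQ, Polynomial.coeff_sub, Polynomial.coeff_map, Polynomial.coeff_X_pow, if_pos rfl]; rfl
  have ev : ∀ p : ℕ, Q.eval (p : ℝ) = ((P.eval (p : ℚ) : ℚ) : ℝ) - (p : ℝ) ^ D := by
    intro p
    rw [hQ, Polynomial.eval_sub, Polynomial.eval_pow, Polynomial.eval_X]
    have := Polynomial.eval_map_apply (f := algebraMap ℚ ℝ) (p := P) (p : ℚ)
    simp only [map_natCast] at this
    rw [this]; rfl
  by_contra hne
  have hQ0 : Q.coeff D ≠ 0 := by
    rw [hc, sub_ne_zero]; exact_mod_cast hne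
  have hdeg : Q.degree = D := by
    refine le_antisymm (Polynomial.natDegree_le_iff_degree_le.mp hQd) (Polynomial.le_degree_of_ne_zero hQ0)
  have hlim : Filter.Tendsto (fun x => |(Q * Polynomial.X).eval x / (Polynomial.X ^ D : Polynomial ℝ).eval x|) Filter.atTop Filter.atTop := by
    refine Polynomial.abs_div_tendsto_atTop_of_degree_gt _ _ ?_ (pow_ne_zero _ Polynomial.X_ne_zero)
    rw [Polynomial.degree_mul, hdeg, Polynomial.degree_X, Polynomial.degree_X_pow]
    exact_mod_cast Nat.lt_succ_self D
  have h2 := (hlim.comp tendsto_natCast_atTop_atTop).eventually_gt_atTop C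
  obtain ⟨B, hB⟩ := Filter.eventually_atTop.mp h2
  obtain ⟨p, hp, hh⟩ := h (B + 1)
  have h3 := hB p (by omega)
  have hp0 : (0 : ℝ) < p := by exact_mod_cast (by omega : 0 < p)
  have hpD : (0 : ℝ) < (p : ℝ) ^ D := pow_pos hp0 D
  simp only [Function.comp] at h3
  rw [Polynomial.eval_mul, Polynomial.eval_pow, Polynomial.eval_X, ev, abs_div, abs_mul, abs_of_pos hp0, abs_of_pos hpD, lt_div_iff₀ hpD] at h3
  exact absurd hh (not_le.mpr h3)

end
end HRV
end modH21

section modH22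
set_option autoImplicit false
open scoped MatrixGroups
open Finset

namespace HRV
noncomputable section

section g1
variable {F : Type} [Field F] {n : ℕ}

lemma eig_zero {V : Type} [AddCommGroup V] [Module F V] (T : Module.End F V) (μ : Fin n → F)
    (hμ : Function.Injective μ) (v : Fin n → V) (hv : ∀ i, T (v i) = μ i • v i) (h0 : ∑ i, v i = 0) (i : Fin n) : v i = 0 := by
  classical
  by_contra hi
  have hl : LinearIndependent F (fun k : {k : Fin n // v k ≠ 0} => v k.1) := by
    refine Module.End.eigenvectors_linearIndependent' T (fun k => μ k.1) (fun a b hab => Subtype.ext (hμ hab)) _ fun k => ?_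
    exact ⟨Module.End.mem_eigenspace_iff.mpr (hv k.1), k.2⟩
  rw [Fintype.linearIndependent_iff] at hl
  refine one_ne_zero (α := F) (hl (fun _ => 1) ?_ ⟨i, hi⟩)
  simp only [one_smul]
  rw [← Finset.sum_subtype (univ.filter fun k => v k ≠ 0) (by simp) v]
  refine Eq.trans ?_ h0
  refine Finset.sum_subset (filter_subset _ _) fun k _ hk => ?_
  by_contra hh
  exact hk (mem_filter.mpr ⟨mem_univ _, hh⟩)

/-- a pair of invertible matrices commuting up to a root of unity -/
structure QP (n : ℕ) (z : Fˣ) where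
  A : (Matrix (Fin n) (Fin n) F)ˣ
  B : (Matrix (Fin n) (Fin n) F)ˣ
  h : (A : Matrix (Fin n) (Fin n) F) * (B : Matrix (Fin n) (Fin n) F) = (z : F) • ((B : Matrix (Fin n) (Fin n) F) * (A : Matrix (Fin n) (Fin n) F))

namespace QP
variable {z : Fˣ} (Q : QP n z)

lemma AjB (j : ℕ) : (Q.A : Matrix (Fin n) (Fin n) F) * (Q.B : Matrix (Fin n) (Fin n) F) ^ j = (z : F) ^ j • ((Q.B : Matrix (Fin n) (Fin n) F) ^ j * (Q.A : Matrix (Fin n) (Fin n) F)) := by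
  induction j with
  | zero => simp
  | succ j ih => rw [pow_succ, ← mul_assoc, ih, smul_mul_assoc, mul_assoc, Q.h, mul_smul_comm, smul_smul, ← mul_assoc, pow_succ]

lemma iAB (i : ℕ) : (Q.A : Matrix (Fin n) (Fin n) F) ^ i * (Q.B : Matrix (Fin n) (Fin n) F) = (z : F) ^ i • ((Q.B : Matrix (Fin n) (Fin n) F) * (Q.A : Matrix (Fin n) (Fin n) F) ^ i) := by
  induction i with
  | zero => simp
  | succ i ih => rw [pow_succ', mul_assoc, ih, mul_smul_comm, ← mul_assoc, Q.h, smul_mul_assoc, smul_smul, mul_assoc, pow_succ]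

lemma zinj (hz : orderOf z = n) : Function.Injective fun i : Fin n => (z : F) ^ (i : ℕ) := by
  intro i j h
  have h2 : z ^ (i : ℕ) = z ^ (j : ℕ) := Units.ext (by simpa using h)
  rw [pow_inj_mod, hz, Nat.mod_eq_of_lt i.2, Nat.mod_eq_of_lt j.2] at h2
  exact Fin.ext h2

lemma indep (hz : orderOf z = n) (c : Fin n → Fin n → F)
    (h : ∑ j : Fin n, ∑ i : Fin n, c i j • ((Q.A : Matrix (Fin n) (Fin n) F) ^ (i : ℕ) * (Q.B : Matrix (Fin n) (Fin n) F) ^ (j : ℕ)) = 0) : ∀ i j, c i j = 0 := by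
  have h1 : ∀ j : Fin n, ∑ i : Fin n, c i j • ((Q.A : Matrix (Fin n) (Fin n) F) ^ (i : ℕ) * (Q.B : Matrix (Fin n) (Fin n) F) ^ (j : ℕ)) = 0 := by
    refine eig_zero (LinearMap.mulLeft F (Q.A : Matrix (Fin n) (Fin n) F) ∘ₗ LinearMap.mulRight F ((Q.A⁻¹ : (Matrix (Fin n) (Fin n) F)ˣ) : Matrix (Fin n) (Fin n) F)) _ (zinj hz) _ (fun j => ?_) h
    rw [map_sum, Finset.smul_sum]
    refine sum_congr rfl fun i _ => ?_
    rw [map_smul, smul_comm]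
    congr 1
    change (Q.A : Matrix (Fin n) (Fin n) F) * (((Q.A : Matrix (Fin n) (Fin n) F) ^ (i : ℕ) * (Q.B : Matrix (Fin n) (Fin n) F) ^ (j : ℕ)) * ((Q.A⁻¹ : (Matrix (Fin n) (Fin n) F)ˣ) : Matrix (Fin n) (Fin n) F)) = _
    rw [← mul_assoc, ← mul_assoc, ← pow_succ', pow_succ, mul_assoc ((Q.A : Matrix (Fin n) (Fin n) F) ^ (i : ℕ)), Q.AjB, mul_smul_comm, smul_mul_assoc, mul_assoc, mul_assoc, Units.mul_inv, mul_one]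
  intro i j
  have h2 : ∑ i : Fin n, c i j • ((Q.A : Matrix (Fin n) (Fin n) F) ^ (i : ℕ)) = 0 := by
    have := congrArg (fun M => M * (((Q.B ^ (j : ℕ))⁻¹ : (Matrix (Fin n) (Fin n) F)ˣ) : Matrix (Fin n) (Fin n) F)) (h1 j)
    simp only [Finset.sum_mul, smul_mul_assoc, zero_mul] at this
    rw [← this]
    refine sum_congr rfl fun i _ => ?_
    rw [mul_assoc, ← Units.val_pow_eq_pow_val, ← Units.val_pow_eq_pow_val, Units.mul_inv, mul_one]
  have h3 := eig_zero (LinearMap.mulLeft F ((Q.B⁻¹ : (Matrix (Fin n) (Fin n) F)ˣ) : Matrix (Fin n) (Fin n) F) ∘ₗ LinearMap.mulRight F (Q.B : Matrix (Fin n) (Fin n) F)) _ (zinj hz) (fun i : Fin n => c i j • ((Q.A : Matrix (Fin n) (Fin n) F) ^ (i : ℕ))) (fun i => by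
    rw [map_smul, smul_comm]
    congr 1
    change ((Q.B⁻¹ : (Matrix (Fin n) (Fin n) F)ˣ) : Matrix (Fin n) (Fin n) F) * ((Q.A : Matrix (Fin n) (Fin n) F) ^ (i : ℕ) * (Q.B : Matrix (Fin n) (Fin n) F)) = _
    rw [Q.iAB, mul_smul_comm, ← mul_assoc, Units.inv_mul, one_mul]) h2 i
  refine (smul_eq_zero.mp h3).resolve_right ?_
  haveI : Nonempty (Fin n) := ⟨i⟩
  rw [← Units.val_pow_eq_pow_val]
  exact Units.ne_zero _

lemma span (hz : orderOf z = n) : Submodule.span F (Set.range fun p : Fin n × Fin n => ((Q.A : Matrix (Fin n) (Fin n) F) ^ (p.1 : ℕ) * (Q.B : Matrix (Fin n) (Fin n) F) ^ (p.2 : ℕ))) = ⊤ := by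
  have hl : LinearIndependent F fun p : Fin n × Fin n => ((Q.A : Matrix (Fin n) (Fin n) F) ^ (p.1 : ℕ) * (Q.B : Matrix (Fin n) (Fin n) F) ^ (p.2 : ℕ)) := by
    rw [Fintype.linearIndependent_iff]
    intro c hc p
    refine Q.indep hz (fun i j => c (i, j)) ?_ p.1 p.2
    rw [← hc, Fintype.sum_prod_type, Finset.sum_comm]
  refine hl.span_eq_top_of_card_eq_finrank' ?_
  rw [Module.finrank_matrix]; simp

lemma ind (hz : orderOf z = n) (p : (Matrix (Fin n) (Fin n) F) → Prop) (hAB : ∀ i j : ℕ, p ((Q.A : Matrix (Fin n) (Fin n) F) ^ i * (Q.B : Matrix (Fin n) (Fin n) F) ^ j)) (h0 : p 0)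
    (ha : ∀ M N, p M → p N → p (M + N)) (hs : ∀ (c : F) M, p M → p (c • M)) (M : Matrix (Fin n) (Fin n) F) : p M := by
  have hM : M ∈ Submodule.span F (Set.range fun p : Fin n × Fin n => ((Q.A : Matrix (Fin n) (Fin n) F) ^ (p.1 : ℕ) * (Q.B : Matrix (Fin n) (Fin n) F) ^ (p.2 : ℕ))) := by
    rw [Q.span hz]; trivial
  induction hM using Submodule.span_induction with
  | mem x h => obtain ⟨q, rfl⟩ := h; exact hAB _ _
  | zero => exact h0
  | add x y _ _ hx hy => exact ha x y hx hy
  | smul c x _ hx => exact hs c x hx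

lemma comm_scal (hz : orderOf z = n) (hn : 0 < n) (U : (Matrix (Fin n) (Fin n) F)ˣ) (hA : (U : Matrix (Fin n) (Fin n) F) * Q.A = Q.A * U) (hB : (U : Matrix (Fin n) (Fin n) F) * Q.B = Q.B * U) :
    ∃ a : Fˣ, U = scal a := by
  have hc : ∀ M : (Matrix (Fin n) (Fin n) F), (U : Matrix (Fin n) (Fin n) F) * M = M * U := by
    refine Q.ind hz _ (fun i j => ?_) (by simp) (fun M N h1 h2 => by rw [mul_add, add_mul, h1, h2]) (fun c M h => by rw [mul_smul_comm, smul_mul_assoc, h])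
    exact ((show Commute (U : Matrix (Fin n) (Fin n) F) Q.A from hA).pow_right i).mul_right ((show Commute (U : Matrix (Fin n) (Fin n) F) Q.B from hB).pow_right j)
  have : (U : Matrix (Fin n) (Fin n) F) ∈ Set.range (Matrix.scalar (Fin n)) := Matrix.mem_range_scalar_of_commute_single fun i j _ => (hc _).symm
  obtain ⟨a, ha⟩ := this
  have ha0 : a ≠ 0 := by
    rintro rfl
    haveI : Nonempty (Fin n) := ⟨⟨0, hn⟩⟩
    rw [map_zero] at ha
    exact Units.ne_zero U ha.symm
  refine ⟨Units.mk0 a ha0, Units.ext ?_⟩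
  rw [← ha]; rfl

lemma zn (hz : orderOf z = n) : (z : F) ^ n = 1 := by
  rw [← Units.val_pow_eq_pow_val, ← hz, pow_orderOf_eq_one, Units.val_one]

lemma powA (hz : orderOf z = n) (hn : 0 < n) : ∃ a : Fˣ, Q.A ^ n = scal a := by
  refine Q.comm_scal hz hn _ ?_ ?_
  · rw [Units.val_pow_eq_pow_val, ← pow_succ, ← pow_succ']
  · rw [Units.val_pow_eq_pow_val, Q.iAB, zn hz, one_smul]

lemma powB (hz : orderOf z = n) (hn : 0 < n) : ∃ a : Fˣ, Q.B ^ n = scal a := by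
  refine Q.comm_scal hz hn _ ?_ ?_
  · rw [Units.val_pow_eq_pow_val, Q.AjB, zn hz, one_smul]
  · rw [Units.val_pow_eq_pow_val, ← pow_succ, ← pow_succ']

/-- inverse pair -/
def op : QP n z⁻¹ where
  A := Q.B⁻¹
  B := Q.A⁻¹
  h := by
    have h1 : (Q.A : Matrix (Fin n) (Fin n) F) * (Q.B : Matrix (Fin n) (Fin n) F) * (((Q.B⁻¹ : (Matrix (Fin n) (Fin n) F)ˣ) : Matrix (Fin n) (Fin n) F) * ((Q.A⁻¹ : (Matrix (Fin n) (Fin n) F)ˣ) : Matrix (Fin n) (Fin n) F)) = 1 := by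
      rw [mul_assoc, ← mul_assoc (Q.B : Matrix (Fin n) (Fin n) F), Units.mul_inv, one_mul, Units.mul_inv]
    have h2 : (Q.B : Matrix (Fin n) (Fin n) F) * (Q.A : Matrix (Fin n) (Fin n) F) * (((Q.A⁻¹ : (Matrix (Fin n) (Fin n) F)ˣ) : Matrix (Fin n) (Fin n) F) * ((Q.B⁻¹ : (Matrix (Fin n) (Fin n) F)ˣ) : Matrix (Fin n) (Fin n) F)) = 1 := by
      rw [mul_assoc, ← mul_assoc (Q.A : Matrix (Fin n) (Fin n) F), Units.mul_inv, one_mul, Units.mul_inv]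
    have h3 : (((Q.A⁻¹ : (Matrix (Fin n) (Fin n) F)ˣ) : Matrix (Fin n) (Fin n) F) * ((Q.B⁻¹ : (Matrix (Fin n) (Fin n) F)ˣ) : Matrix (Fin n) (Fin n) F)) * ((Q.B : Matrix (Fin n) (Fin n) F) * (Q.A : Matrix (Fin n) (Fin n) F)) = 1 := by
      rw [mul_assoc, ← mul_assoc _ (Q.B : Matrix (Fin n) (Fin n) F), Units.inv_mul, one_mul, Units.inv_mul]
    rw [Q.h, smul_mul_assoc] at h1
    have h4 := congrArg (fun M => (z⁻¹ : Fˣ) • ((((Q.A⁻¹ : (Matrix (Fin n) (Fin n) F)ˣ) : Matrix (Fin n) (Fin n) F) * ((Q.B⁻¹ : (Matrix (Fin n) (Fin n) F)ˣ) : Matrix (Fin n) (Fin n) F)) * M)) h1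
    simp only [mul_smul_comm, mul_one] at h4
    rw [← mul_assoc, h3, one_mul] at h4
    rw [Units.smul_def, Units.smul_def, smul_smul, Units.inv_mul, one_smul] at h4
    exact h4

lemma inv_pow_mul (i j : ℕ) : ((Q.B⁻¹ : (Matrix (Fin n) (Fin n) F)ˣ) : Matrix (Fin n) (Fin n) F) ^ j * ((Q.A⁻¹ : (Matrix (Fin n) (Fin n) F)ˣ) : Matrix (Fin n) (Fin n) F) ^ i = (Q.op.A : Matrix (Fin n) (Fin n) F) ^ j * (Q.op.B : Matrix (Fin n) (Fin n) F) ^ i := rfl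

section tw
variable (Q' : QP n z)

def fA : Module.End F (Matrix (Fin n) (Fin n) F) := LinearMap.mulLeft F (Q'.A : Matrix (Fin n) (Fin n) F) ∘ₗ LinearMap.mulRight F ((Q.A⁻¹ : (Matrix (Fin n) (Fin n) F)ˣ) : Matrix (Fin n) (Fin n) F)
def fB : Module.End F (Matrix (Fin n) (Fin n) F) := LinearMap.mulLeft F (Q'.B : Matrix (Fin n) (Fin n) F) ∘ₗ LinearMap.mulRight F ((Q.B⁻¹ : (Matrix (Fin n) (Fin n) F)ˣ) : Matrix (Fin n) (Fin n) F)

lemma fA_pow (k : ℕ) (X : Matrix (Fin n) (Fin n) F) : ((Q.fA Q') ^ k) X = (Q'.A : Matrix (Fin n) (Fin n) F) ^ k * X * ((Q.A⁻¹ : (Matrix (Fin n) (Fin n) F)ˣ) : Matrix (Fin n) (Fin n) F) ^ k := by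
  induction k with
  | zero => simp
  | succ k ih =>
    rw [pow_succ', Module.End.mul_apply, ih]
    change (Q'.A : Matrix (Fin n) (Fin n) F) * (_ * ((Q.A⁻¹ : (Matrix (Fin n) (Fin n) F)ˣ) : Matrix (Fin n) (Fin n) F)) = _
    rw [pow_succ', pow_succ]; simp only [mul_assoc]
lemma fB_pow (k : ℕ) (X : Matrix (Fin n) (Fin n) F) : ((Q.fB Q') ^ k) X = (Q'.B : Matrix (Fin n) (Fin n) F) ^ k * X * ((Q.B⁻¹ : (Matrix (Fin n) (Fin n) F)ˣ) : Matrix (Fin n) (Fin n) F) ^ k := by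
  induction k with
  | zero => simp
  | succ k ih =>
    rw [pow_succ', Module.End.mul_apply, ih]
    change (Q'.B : Matrix (Fin n) (Fin n) F) * (_ * ((Q.B⁻¹ : (Matrix (Fin n) (Fin n) F)ˣ) : Matrix (Fin n) (Fin n) F)) = _
    rw [pow_succ', pow_succ]; simp only [mul_assoc]

lemma fcomm : Commute (Q.fA Q') (Q.fB Q') := by
  refine LinearMap.ext fun X => ?_
  change (Q'.A : Matrix (Fin n) (Fin n) F) * (((Q'.B : Matrix (Fin n) (Fin n) F) * (X * ((Q.B⁻¹ : (Matrix (Fin n) (Fin n) F)ˣ) : Matrix (Fin n) (Fin n) F))) * ((Q.A⁻¹ : (Matrix (Fin n) (Fin n) F)ˣ) : Matrix (Fin n) (Fin n) F)) =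
    (Q'.B : Matrix (Fin n) (Fin n) F) * (((Q'.A : Matrix (Fin n) (Fin n) F) * (X * ((Q.A⁻¹ : (Matrix (Fin n) (Fin n) F)ˣ) : Matrix (Fin n) (Fin n) F))) * ((Q.B⁻¹ : (Matrix (Fin n) (Fin n) F)ˣ) : Matrix (Fin n) (Fin n) F))
  have h1 := Q'.h
  have h2 : ((Q.B⁻¹ : (Matrix (Fin n) (Fin n) F)ˣ) : Matrix (Fin n) (Fin n) F) * ((Q.A⁻¹ : (Matrix (Fin n) (Fin n) F)ˣ) : Matrix (Fin n) (Fin n) F) = ((z⁻¹ : Fˣ) : F) • (((Q.A⁻¹ : (Matrix (Fin n) (Fin n) F)ˣ) : Matrix (Fin n) (Fin n) F) * ((Q.B⁻¹ : (Matrix (Fin n) (Fin n) F)ˣ) : Matrix (Fin n) (Fin n) F)) := Q.op.h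
  calc _ = ((Q'.A : Matrix (Fin n) (Fin n) F) * (Q'.B : Matrix (Fin n) (Fin n) F)) * X * (((Q.B⁻¹ : (Matrix (Fin n) (Fin n) F)ˣ) : Matrix (Fin n) (Fin n) F) * ((Q.A⁻¹ : (Matrix (Fin n) (Fin n) F)ˣ) : Matrix (Fin n) (Fin n) F)) := by simp only [mul_assoc]
    _ = ((Q'.B : Matrix (Fin n) (Fin n) F) * (Q'.A : Matrix (Fin n) (Fin n) F)) * X * (((Q.A⁻¹ : (Matrix (Fin n) (Fin n) F)ˣ) : Matrix (Fin n) (Fin n) F) * ((Q.B⁻¹ : (Matrix (Fin n) (Fin n) F)ˣ) : Matrix (Fin n) (Fin n) F)) := by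
      rw [h1, h2, smul_mul_assoc, smul_mul_assoc, mul_smul_comm, smul_smul, Units.mul_inv, one_smul]
    _ = _ := by simp only [mul_assoc]

lemma pow_one_of (U V : (Matrix (Fin n) (Fin n) F)ˣ) (a : Fˣ) (hU : U ^ n = scal a) (hV : V ^ n = scal a) (X : Matrix (Fin n) (Fin n) F) :
    (V : Matrix (Fin n) (Fin n) F) ^ n * X * ((U⁻¹ : (Matrix (Fin n) (Fin n) F)ˣ) : Matrix (Fin n) (Fin n) F) ^ n = X := by
  rw [← Units.val_pow_eq_pow_val, ← Units.val_pow_eq_pow_val, inv_pow, hU, hV]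
  have : ((scal a : (Matrix (Fin n) (Fin n) F)ˣ) : Matrix (Fin n) (Fin n) F) * X = X * ((scal a : (Matrix (Fin n) (Fin n) F)ˣ) : Matrix (Fin n) (Fin n) F) := Algebra.commutes (a : F) X
  rw [this, mul_assoc, Units.mul_inv, mul_one]

/-- the averaging intertwiner -/
def TT : Module.End F (Matrix (Fin n) (Fin n) F) := (∑ i ∈ range n, (Q.fA Q') ^ i) * (∑ j ∈ range n, (Q.fB Q') ^ j)

lemma TT_A (a : Fˣ) (h : Q.A ^ n = scal a) (h' : Q'.A ^ n = scal a) (X : Matrix (Fin n) (Fin n) F) :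
    (Q'.A : Matrix (Fin n) (Fin n) F) * (Q.TT Q' X) = (Q.TT Q' X) * (Q.A : Matrix (Fin n) (Fin n) F) := by
  have h1 : (Q.fA Q') ^ n = 1 := LinearMap.ext fun X => by rw [fA_pow]; exact pow_one_of _ _ a h h' X
  have h2 : (Q.fA Q' - 1) * Q.TT Q' = 0 := by rw [TT, ← mul_assoc, mul_geom_sum, h1, sub_self, zero_mul]
  rw [sub_mul, one_mul, sub_eq_zero] at h2
  have h3 := LinearMap.congr_fun h2 X
  change (Q'.A : Matrix (Fin n) (Fin n) F) * ((Q.TT Q' X) * ((Q.A⁻¹ : (Matrix (Fin n) (Fin n) F)ˣ) : Matrix (Fin n) (Fin n) F)) = Q.TT Q' X at h3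
  have h4 := congrArg (fun M => M * (Q.A : Matrix (Fin n) (Fin n) F)) h3
  simp only [mul_assoc, Units.inv_mul, mul_one] at h4
  exact h4

lemma TT_B (a : Fˣ) (h : Q.B ^ n = scal a) (h' : Q'.B ^ n = scal a) (X : Matrix (Fin n) (Fin n) F) :
    (Q'.B : Matrix (Fin n) (Fin n) F) * (Q.TT Q' X) = (Q.TT Q' X) * (Q.B : Matrix (Fin n) (Fin n) F) := by
  have h1 : (Q.fB Q') ^ n = 1 := LinearMap.ext fun X => by rw [fB_pow]; exact pow_one_of _ _ a h h' X
  have hc : Commute (Q.fB Q') (∑ i ∈ range n, (Q.fA Q') ^ i) := Commute.sum_right _ _ _ fun i _ => ((Q.fcomm Q').symm.pow_right i)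
  have h2 : (Q.fB Q' - 1) * (∑ j ∈ range n, (Q.fB Q') ^ j) = 0 := by rw [mul_geom_sum, h1, sub_self]
  rw [sub_mul, one_mul, sub_eq_zero] at h2
  have h2' : Q.fB Q' * Q.TT Q' = Q.TT Q' := by rw [TT, ← mul_assoc, hc.eq, mul_assoc, h2]
  have h3 := LinearMap.congr_fun h2' X
  change (Q'.B : Matrix (Fin n) (Fin n) F) * ((Q.TT Q' X) * ((Q.B⁻¹ : (Matrix (Fin n) (Fin n) F)ˣ) : Matrix (Fin n) (Fin n) F)) = Q.TT Q' X at h3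
  have h4 := congrArg (fun M => M * (Q.B : Matrix (Fin n) (Fin n) F)) h3
  simp only [mul_assoc, Units.inv_mul, mul_one] at h4
  exact h4

lemma TT_eq (X : Matrix (Fin n) (Fin n) F) : Q.TT Q' X = ∑ j : Fin n, ∑ i : Fin n, ((Q'.A : Matrix (Fin n) (Fin n) F) ^ (i : ℕ) * (Q'.B : Matrix (Fin n) (Fin n) F) ^ (j : ℕ)) * X * (((Q.B⁻¹ : (Matrix (Fin n) (Fin n) F)ˣ) : Matrix (Fin n) (Fin n) F) ^ (j : ℕ) * ((Q.A⁻¹ : (Matrix (Fin n) (Fin n) F)ˣ) : Matrix (Fin n) (Fin n) F) ^ (i : ℕ)) := by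
  rw [TT, Finset.sum_mul_sum, LinearMap.sum_apply, Finset.sum_range, Finset.sum_comm]
  refine sum_congr rfl fun i _ => ?_
  rw [LinearMap.sum_apply, Finset.sum_range]
  refine sum_congr rfl fun j _ => ?_
  rw [Module.End.mul_apply, fB_pow, fA_pow]
  simp only [mul_assoc]

lemma TT_ne (hz : orderOf z = n) (hn : 0 < n) : ∃ X, Q.TT Q' X ≠ 0 := by
  by_contra! h
  have k0 : Fin n := ⟨0, hn⟩
  have hz' : orderOf z⁻¹ = n := by rw [orderOf_inv, hz]
  have key : ∀ r k : Fin n, ∀ j i : Fin n, ((Q'.A : Matrix (Fin n) (Fin n) F) ^ (i : ℕ) * (Q'.B : Matrix (Fin n) (Fin n) F) ^ (j : ℕ) : Matrix (Fin n) (Fin n) F) r k = 0 := by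
    intro r k
    refine Q.op.indep hz' (fun j i => ((Q'.A : Matrix (Fin n) (Fin n) F) ^ (i : ℕ) * (Q'.B : Matrix (Fin n) (Fin n) F) ^ (j : ℕ) : Matrix (Fin n) (Fin n) F) r k) ?_
    ext l s
    have h1 := congrArg (fun M : (Matrix (Fin n) (Fin n) F) => M r s) (h (Matrix.single k l 1))
    rw [Q.TT_eq] at h1
    rw [Finset.sum_comm]
    simp only [Matrix.sum_apply, Matrix.zero_apply] at h1
    rw [Matrix.sum_apply, Matrix.zero_apply, ← h1]
    refine sum_congr rfl fun j _ => ?_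
    rw [Matrix.sum_apply]
    refine sum_congr rfl fun i _ => ?_
    rw [Matrix.smul_apply, smul_eq_mul, ← inv_pow_mul, Matrix.mul_apply (M := _ * _ * Matrix.single k l 1)]
    rw [Finset.sum_eq_single l]
    · rw [Matrix.mul_single_apply_same, mul_one]
    · intro b _ hb
      rw [Matrix.mul_single_apply_of_ne _ _ _ _ _ hb, zero_mul]
    · simp
  have := key k0 k0 ⟨0, hn⟩ ⟨0, hn⟩
  simp at this

lemma conj_ex (hz : orderOf z = n) (hn : 0 < n) (a b : Fˣ) (h : Q.A ^ n = scal a) (h' : Q'.A ^ n = scal a)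
    (k : Q.B ^ n = scal b) (k' : Q'.B ^ n = scal b) : ∃ U : (Matrix (Fin n) (Fin n) F)ˣ, Q'.A = U * Q.A * U⁻¹ ∧ Q'.B = U * Q.B * U⁻¹ := by
  obtain ⟨X, hX⟩ := Q.TT_ne Q' hz hn
  set T := Q.TT Q' X with hT
  have hA := Q.TT_A Q' a h h' X
  have hB := Q.TT_B Q' b k k' X
  have hAB : ∀ i j : ℕ, T * ((Q.A : Matrix (Fin n) (Fin n) F) ^ i * (Q.B : Matrix (Fin n) (Fin n) F) ^ j) = ((Q'.A : Matrix (Fin n) (Fin n) F) ^ i * (Q'.B : Matrix (Fin n) (Fin n) F) ^ j) * T := by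
    intro i j
    have e1 : SemiconjBy T (Q.A : Matrix (Fin n) (Fin n) F) (Q'.A : Matrix (Fin n) (Fin n) F) := hA.symm
    have e2 : SemiconjBy T (Q.B : Matrix (Fin n) (Fin n) F) (Q'.B : Matrix (Fin n) (Fin n) F) := hB.symm
    exact (e1.pow_right i).mul_right (e2.pow_right j)
  have hdet : T.det ≠ 0 := by
    intro h0
    obtain ⟨v, hv, hv0⟩ := Matrix.exists_mulVec_eq_zero_iff.mpr h0
    have h2 : ∀ M : (Matrix (Fin n) (Fin n) F), T.mulVec (M.mulVec v) = 0 := by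
      refine Q.ind hz _ (fun i j => ?_) (by simp) (fun M N h1 h2 => by rw [Matrix.add_mulVec, Matrix.mulVec_add, h1, h2, add_zero])
        (fun c M h1 => by rw [Matrix.smul_mulVec, Matrix.mulVec_smul, h1, smul_zero])
      rw [Matrix.mulVec_mulVec, hAB, ← Matrix.mulVec_mulVec, hv0, Matrix.mulVec_zero]
    obtain ⟨r, hr⟩ := Function.ne_iff.mp hv
    apply hX
    ext s t
    have h3 := congrFun (h2 (Matrix.single t r 1)) s
    rw [Matrix.single_mulVec_eq, one_mul, Matrix.mulVec_smul, Pi.smul_apply, Matrix.mulVec_single_one] at h3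
    exact (smul_eq_zero.mp h3).resolve_left hr
  refine ⟨Matrix.GeneralLinearGroup.mkOfDetNeZero T hdet, ?_, ?_⟩
  · rw [eq_mul_inv_iff_mul_eq]; exact Units.ext hA
  · rw [eq_mul_inv_iff_mul_eq]; exact Units.ext hB

end tw
end QP
end g1
end
end HRV
end modH22

section modH23
set_option autoImplicit false
open scoped MatrixGroups
open Finset

namespace HRV
noncomputable section

section g1
variable {F : Type} [Field F] [Fintype F] {n : ℕ} {z : Fˣ}

lemma qp_iff (A B : GL (Fin n) F) : A * B * A⁻¹ * B⁻¹ = scal z ↔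
    (A : Matrix (Fin n) (Fin n) F) * (B : Matrix (Fin n) (Fin n) F) = (z : F) • ((B : Matrix (Fin n) (Fin n) F) * (A : Matrix (Fin n) (Fin n) F)) := by
  rw [mul_inv_eq_iff_eq_mul, mul_inv_eq_iff_eq_mul, Units.ext_iff]
  change (A : Matrix (Fin n) (Fin n) F) * (B : Matrix (Fin n) (Fin n) F) = algebraMap F _ (z : F) * (B : Matrix (Fin n) (Fin n) F) * (A : Matrix (Fin n) (Fin n) F) ↔ _
  rw [mul_assoc, ← Algebra.smul_def]

def qpEquiv : {p : (Fin 1 → GL (Fin n) F) × (Fin 1 → GL (Fin n) F) //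
      (List.ofFn fun i => p.1 i * p.2 i * (p.1 i)⁻¹ * (p.2 i)⁻¹).prod = scal z} ≃ QP n z where
  toFun p := ⟨p.1.1 0, p.1.2 0, (qp_iff _ _).mp (by simpa using p.2)⟩
  invFun Q := ⟨(fun _ => Q.A, fun _ => Q.B), by simpa using (qp_iff _ _).mpr Q.h⟩
  left_inv p := by
    apply Subtype.ext
    refine Prod.ext ?_ ?_ <;> funext i <;> rw [Subsingleton.elim i 0]
  right_inv Q := rfl

lemma NS_one : NS F 1 n z = Nat.card (QP n z) := Nat.card_congr qpEquiv

instance : Finite (QP n z) := Finite.of_equiv _ (qpEquiv (F := F) (n := n) (z := z))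

lemma scal_inj (hn : 0 < n) {a b : Fˣ} (h : (scal a : GL (Fin n) F) = scal b) : a = b := by
  classical
  have := congrArg (fun M : GL (Fin n) F => mx M ⟨0, hn⟩ ⟨0, hn⟩) h
  beta_reduce at this
  rw [scal_apply, scal_apply, if_pos rfl, if_pos rfl] at this
  exact Units.ext this

/-- upper bound injection -/
lemma qp_upper (hz : orderOf z = n) (hn : 0 < n) :
    Nat.card (QP n z) * Nat.card Fˣ ≤ Nat.card Fˣ * Nat.card Fˣ * Nat.card (GL (Fin n) F) := by
  classical
  choose a ha using fun Q : QP n z => Q.powA hz hn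
  choose b hb using fun Q : QP n z => Q.powB hz hn
  have hbase : ∃ base : Fˣ × Fˣ → QP n z → QP n z, ∀ Q, a (base (a Q, b Q) Q) = a Q ∧ b (base (a Q, b Q) Q) = b Q ∧
      ∀ Q', (a Q, b Q) = (a Q', b Q') → base (a Q, b Q) Q = base (a Q', b Q') Q' := by
    refine ⟨fun c Q => if h : ∃ R : QP n z, (a R, b R) = c then h.choose else Q, fun Q => ?_⟩
    have h1 : ∃ R : QP n z, (a R, b R) = (a Q, b Q) := ⟨Q, rfl⟩
    have h2 := h1.choose_spec
    beta_reduce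
    refine ⟨?_, ?_, ?_⟩
    · rw [dif_pos h1]; exact congrArg Prod.fst h2
    · rw [dif_pos h1]; exact congrArg Prod.snd h2
    · intro Q' hQ'
      have h3 : ∃ R : QP n z, (a R, b R) = (a Q', b Q') := ⟨Q', rfl⟩
      rw [dif_pos h1, dif_pos h3]
      simp only [hQ']
  obtain ⟨base, hbase⟩ := hbase
  have hU : ∀ Q : QP n z, ∃ U : GL (Fin n) F, Q.A = U * (base (a Q, b Q) Q).A * U⁻¹ ∧ Q.B = U * (base (a Q, b Q) Q).B * U⁻¹ := by
    intro Q
    refine (base (a Q, b Q) Q).conj_ex Q hz hn (a Q) (b Q) ?_ (ha Q) ?_ (hb Q)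
    · rw [ha, (hbase Q).1]
    · rw [hb, (hbase Q).2.1]
  choose U hUA hUB using hU
  rw [← Nat.card_prod, ← Nat.card_prod, ← Nat.card_prod]
  refine Nat.card_le_card_of_injective (fun p : QP n z × Fˣ => ((a p.1, b p.1), U p.1 * scal p.2)) ?_
  rintro ⟨Q, c⟩ ⟨Q', c'⟩ h
  rw [Prod.mk.injEq] at h
  obtain ⟨h1, h2⟩ := h
  simp only at h1 h2
  have h3 := (hbase Q).2.2 Q' h1
  have cj : ∀ (V X : GL (Fin n) F) (c : Fˣ), V * X * V⁻¹ = (V * scal c) * X * (V * scal c)⁻¹ := by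
    intro V X c
    rw [mul_inv_rev, mul_assoc V (scal c), scal_comm]; group
  have e1 : Q.A = Q'.A := by rw [hUA Q, hUA Q', h3, cj (U Q) _ c, h2, ← cj (U Q') _ c']
  have e2 : Q.B = Q'.B := by rw [hUB Q, hUB Q', h3, cj (U Q) _ c, h2, ← cj (U Q') _ c']
  have e3 : Q = Q' := by
    rcases Q with ⟨A, B, _⟩; rcases Q' with ⟨A', B', _⟩
    simp only at e1 e2
    subst e1; subst e2; rfl
  subst e3
  rw [scal_inj hn (mul_left_cancel h2)]

/-- diagonal and weighted shift matrices -/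
lemma shift_ex (hz : orderOf z = n) (hn : 0 < n) : ∃ (D : GL (Fin n) F) (B : Fˣ → GL (Fin n) F),
    (∀ b, D * B b * D⁻¹ * (B b)⁻¹ = scal z) ∧ ∀ b b', (mx (B b)).det = (mx (B b')).det → b = b' := by
  obtain ⟨m, rfl⟩ : ∃ m, n = m + 1 := ⟨n - 1, by omega⟩
  have hD : (Matrix.diagonal fun i : Fin (m + 1) => (z : F) ^ (i : ℕ)).det ≠ 0 := by
    rw [Matrix.det_diagonal]
    exact Finset.prod_ne_zero_iff.mpr fun i _ => pow_ne_zero _ (Units.ne_zero z)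
  have hB : ∀ b : Fˣ, (Matrix.diagonal (Pi.mulSingle (0 : Fin (m + 1)) (b : F)) * ((finRotate (m + 1))⁻¹ : Equiv.Perm _).permMatrix F).det =
      (b : F) * ((Equiv.Perm.sign (finRotate (m + 1))⁻¹ : ℤ) : F) := by
    intro b
    rw [Matrix.det_mul, Matrix.det_diagonal, Matrix.det_permutation, Fintype.prod_eq_single 0 (fun i hi => by rw [Pi.mulSingle_eq_of_ne hi]), Pi.mulSingle_eq_same]
  have hs : ((Equiv.Perm.sign (finRotate (m + 1))⁻¹ : ℤ) : F) ≠ 0 := by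
    rcases Int.units_eq_one_or (Equiv.Perm.sign (finRotate (m + 1))⁻¹) with h | h <;> rw [h] <;> simp
  refine ⟨Matrix.GeneralLinearGroup.mkOfDetNeZero _ hD, fun b => Matrix.GeneralLinearGroup.mkOfDetNeZero _
    (show (Matrix.diagonal (Pi.mulSingle (0 : Fin (m + 1)) (b : F)) * ((finRotate (m + 1))⁻¹ : Equiv.Perm _).permMatrix F).det ≠ 0 by
      rw [hB]; exact mul_ne_zero (Units.ne_zero b) hs), ?_, ?_⟩
  · intro b
    rw [qp_iff]
    change (Matrix.diagonal fun i : Fin (m + 1) => (z : F) ^ (i : ℕ)) * (Matrix.diagonal (Pi.mulSingle (0 : Fin (m + 1)) (b : F)) * ((finRotate (m + 1))⁻¹ : Equiv.Perm _).permMatrix F) =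
      (z : F) • ((Matrix.diagonal (Pi.mulSingle (0 : Fin (m + 1)) (b : F)) * ((finRotate (m + 1))⁻¹ : Equiv.Perm _).permMatrix F) * (Matrix.diagonal fun i : Fin (m + 1) => (z : F) ^ (i : ℕ)))
    ext i j
    rw [Matrix.smul_apply, Matrix.diagonal_mul, Matrix.mul_diagonal, Matrix.diagonal_mul, smul_eq_mul]
    rw [show ((finRotate (m + 1))⁻¹ : Equiv.Perm _).permMatrix F i j = if j = (finRotate (m + 1))⁻¹ i then 1 else 0 by
      simp [PEquiv.toMatrix_apply, Equiv.toPEquiv_apply, eq_comm]]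
    split_ifs with h
    · have h' : i = finRotate (m + 1) j := by rw [h]; simp
      have : (z : F) ^ (i : ℕ) = (z : F) * (z : F) ^ (j : ℕ) := by
        rw [h', ← pow_succ']
        by_cases hj : j = Fin.last m
        · rw [hj, finRotate_last]
          simp only [Fin.val_zero, pow_zero, Fin.val_last]
          exact (QP.zn hz).symm
        · rw [coe_finRotate_of_ne_last hj]
      rw [this]; ring
    · simp
  · intro b b' h
    change (Matrix.diagonal (Pi.mulSingle (0 : Fin (m + 1)) (b : F)) * ((finRotate (m + 1))⁻¹ : Equiv.Perm _).permMatrix F).det =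
      (Matrix.diagonal (Pi.mulSingle (0 : Fin (m + 1)) (b' : F)) * ((finRotate (m + 1))⁻¹ : Equiv.Perm _).permMatrix F).det at h
    rw [hB, hB] at h
    exact Units.ext (mul_right_cancel₀ hs h)

lemma qp_lower (hz : orderOf z = n) (hn : 0 < n) : Nat.card Fˣ * Nat.card (GL (Fin n) F) ≤ Nat.card (QP n z) := by
  classical
  obtain ⟨D, B, hDB, hdet⟩ := shift_ex hz hn
  have hr : ∃ r : Fˣ → GL (Fin n) F → GL (Fin n) F, ∀ b g, r b (g * B b * g⁻¹) * B b * (r b (g * B b * g⁻¹))⁻¹ = g * B b * g⁻¹ := by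
    refine ⟨fun b X => if h : ∃ g, g * B b * g⁻¹ = X then h.choose else 1, fun b g => ?_⟩
    have h1 : ∃ g', g' * B b * g'⁻¹ = g * B b * g⁻¹ := ⟨g, rfl⟩
    beta_reduce; rw [dif_pos h1]; exact h1.choose_spec
  obtain ⟨r, hr⟩ := hr
  have hQ : ∀ p : Fˣ × GL (Fin n) F, ∃ Q : QP n z, Q.B = p.2 * B p.1 * p.2⁻¹ ∧
      Q.A = r p.1 (p.2 * B p.1 * p.2⁻¹) * D * (r p.1 (p.2 * B p.1 * p.2⁻¹))⁻¹ * p.2 * (r p.1 (p.2 * B p.1 * p.2⁻¹))⁻¹ := by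
    rintro ⟨b, g⟩
    simp only
    have h1 := hr b g
    set R := r b (g * B b * g⁻¹) with hR
    refine ⟨⟨R * D * R⁻¹ * g * R⁻¹, g * B b * g⁻¹, (qp_iff _ _).mp ?_⟩, rfl, rfl⟩
    have h2 : R⁻¹ * g * B b = B b * (R⁻¹ * g) := by
      have := congrArg (fun X => R⁻¹ * X * g) h1
      simp only [mul_assoc, inv_mul_cancel_left, inv_mul_cancel, mul_one] at this
      rw [mul_assoc]; exact this.symm
    have h3 : D * B b = scal z * B b * D := by
      have := hDB b
      rwa [mul_inv_eq_iff_eq_mul, mul_inv_eq_iff_eq_mul] at this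
    rw [mul_inv_eq_iff_eq_mul, mul_inv_eq_iff_eq_mul]
    nth_rewrite 1 [← h1]
    rw [← h1]
    calc R * D * R⁻¹ * g * R⁻¹ * (R * B b * R⁻¹) = R * D * (R⁻¹ * g * B b) * R⁻¹ := by group
      _ = R * (D * B b) * R⁻¹ * g * R⁻¹ := by rw [h2]; group
      _ = (R * scal z) * B b * D * R⁻¹ * g * R⁻¹ := by rw [h3]; group
      _ = scal z * (R * B b * R⁻¹) * (R * D * R⁻¹ * g * R⁻¹) := by rw [← scal_comm]; group
  choose Q hQB hQA using hQ
  rw [← Nat.card_prod]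
  refine Nat.card_le_card_of_injective Q ?_
  rintro ⟨b, g⟩ ⟨b', g'⟩ h
  have hB := hQB (b, g)
  have hA := hQA (b, g)
  rw [h, hQB] at hB
  rw [h, hQA] at hA
  simp only at hA hB
  have hb : b = b' := by
    apply hdet
    have : ∀ (b : Fˣ) (g : GL (Fin n) F), (mx (B b)).det = (mx (g * B b * g⁻¹)).det := by
      intro b g
      change _ = ((g : Matrix (Fin n) (Fin n) F) * mx (B b) * ((g⁻¹ : GL (Fin n) F) : Matrix (Fin n) (Fin n) F)).det
      rw [Matrix.det_mul, Matrix.det_mul, mul_right_comm, ← Matrix.det_mul, Units.mul_inv, Matrix.det_one, one_mul]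
    rw [this b g, this b' g', hB]
  subst hb
  rw [hB] at hA
  simp only [mul_assoc, mul_left_cancel_iff, mul_right_cancel_iff] at hA
  rw [← hA]

lemma qp_card (hz : orderOf z = n) (hn : 0 < n) : Nat.card (QP n z) = Nat.card Fˣ * Nat.card (GL (Fin n) F) := by
  refine le_antisymm ?_ (qp_lower hz hn)
  have h := qp_upper hz hn
  have h0 : 0 < Nat.card Fˣ := Nat.card_pos
  refine Nat.le_of_mul_le_mul_right (h.trans (le_of_eq ?_)) h0
  ring

end g1

lemma Hyp.lead_one {n : ℕ} {P : Polynomial ℚ} (h : Hyp 1 n P) (hn : 0 < n) : P.coeff (n ^ 2 * (2 * 1 - 2) + 2) = 1 := by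
  refine coeff_lim (h.pal le_rfl hn).1 2 fun B => ?_
  obtain ⟨p, hp, hB, z, h1, h2⟩ := h.prime hn B
  refine ⟨p, hB, ?_⟩
  rw [NS_one, qp_card h1 hn] at h2
  have hG0 : (Nat.card (GL (Fin n) (ZMod p)) : ℚ) ≠ 0 := by exact_mod_cast Nat.card_pos.ne'
  have hu : (Nat.card (ZMod p)ˣ : ℚ) = (p : ℚ) - 1 := by
    rw [Nat.card_eq_fintype_card, ZMod.card_units, Nat.cast_sub hp.out.one_lt.le, Nat.cast_one]
  have h3 : P.eval (p : ℚ) = ((p : ℚ) - 1) ^ 2 := by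
    apply mul_left_cancel₀ hG0
    rw [← h2]; push_cast; rw [hu]; ring
  rw [h3]
  push_cast
  have hp1 : (1 : ℝ) ≤ p := by exact_mod_cast hp.out.one_lt.le
  simp only [Nat.sub_self, mul_one, mul_zero, zero_add]
  rw [abs_sub_comm, abs_of_nonneg (by nlinarith)]
  nlinarith

end
end HRV
end modH23

section modH24
set_option autoImplicit false
open scoped MatrixGroups
open Finset

namespace HRV
noncomputable section

section lin
variable {F : Type} [Field F] [Fintype F] [DecidableEq F]
variable {ι : Type} [Fintype ι] [DecidableEq ι]

lemma rdl_mul {G : Type} [Group G] [Fintype G] (i : Irr G) (g h : G) : rp i (dl (g * h)) = rp i (dl g) * rp i (dl h) := by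
  rw [dl_mul, map_mul]

lemma rdl_one {G : Type} [Group G] [Fintype G] (i : Irr G) : rp i (dl (1 : G)) = 1 := by
  rw [dl_one, map_one]

/-- kernel of a representation -/
def Kr {G : Type} [Group G] [Fintype G] (i : Irr G) : Subgroup G where
  carrier := {g | rp i (dl g) = 1}
  one_mem' := rdl_one i
  mul_mem' := fun {a b} ha hb => by
    change rp i (dl a) = 1 at ha
    change rp i (dl b) = 1 at hb
    change rp i (dl (a * b)) = 1
    rw [rdl_mul, ha, hb, mul_one]
  inv_mem' := fun {a} ha => by
    change rp i (dl a) = 1 at ha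
    change rp i (dl a⁻¹) = 1
    have := rdl_mul i a a⁻¹
    rw [mul_inv_cancel, rdl_one, ha, one_mul] at this
    exact this.symm

lemma mem_Kr {G : Type} [Group G] [Fintype G] {i : Irr G} {g : G} : g ∈ Kr i ↔ rp i (dl g) = 1 := Iff.rfl

lemma Kr_conj {G : Type} [Group G] [Fintype G] {i : Irr G} {g : G} (x : G) (h : g ∈ Kr i) : x * g * x⁻¹ ∈ Kr i := by
  rw [mem_Kr] at h ⊢
  rw [rdl_mul, rdl_mul, h, mul_one, ← rdl_mul, mul_inv_cancel, rdl_one]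

/-- trivial action of subgroup iff average acts as identity -/
lemma ev_triv {G : Type} [Group G] [Fintype G] {i : Irr G} {H : Subgroup G} (h : H ≤ Kr i) : rp i (ev H) = 1 := by
  classical
  have h1 : ∀ g : G, rp i (if g ∈ H then ((fun _ => 1 : G → ℂ) g⁻¹) • dl g else 0) = (if g ∈ H then (1 : ℂ) else 0) • (1 : Mt i) := by
    intro g
    by_cases hg : g ∈ H
    · rw [if_pos hg, if_pos hg, map_smul, mem_Kr.mp (h hg)]
    · rw [if_neg hg, if_neg hg, map_zero, zero_smul]
  have h2 : rp i (ev H) = (Nat.card H : ℂ)⁻¹ • ∑ g : G, (if g ∈ H then (1 : ℂ) else 0) • (1 : Mt i) := by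
    unfold ev av
    rw [map_smul, map_sum]
    congr 1
    exact Finset.sum_congr rfl fun g _ => h1 g
  rw [h2, ← Finset.sum_smul, Finset.sum_boole, smul_smul]
  have : (((univ : Finset G).filter fun g => g ∈ H).card : ℂ) = Nat.card H := by
    rw [Nat.card_eq_fintype_card, Fintype.card_subtype]
  rw [this, inv_mul_cancel₀ (cardH_ne H), one_smul]

lemma triv_of_ev {G : Type} [Group G] [Fintype G] {i : Irr G} {H : Subgroup G} (h : rp i (ev H) = 1) : H ≤ Kr i := by
  intro g hg
  rw [mem_Kr]
  have := congrArg (rp i) (av_left (isCh_one H) hg)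
  rw [map_mul, map_smul, one_smul] at this
  change _ * rp i (ev H) = rp i (ev H) at this
  rwa [h, mul_one] at this

/-- kernel of det -/
def SLg (ι F : Type) [Field F] [Fintype ι] [DecidableEq ι] : Subgroup (GL ι F) := (Matrix.GeneralLinearGroup.det (n := ι) (R := F)).ker

lemma mem_SLg {g : GL ι F} : g ∈ SLg ι F ↔ (mx g).det = 1 := by
  rw [SLg, MonoidHom.mem_ker, Units.ext_iff]; rfl

lemma ev_SL_comm (g : GL ι F) : dl g * ev (SLg ι F) = ev (SLg ι F) * dl g :=
  av_conj g (fun h => by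
    rw [SLg, MonoidHom.mem_ker, MonoidHom.mem_ker, map_mul, map_mul, map_inv, mul_inv_cancel_comm]) fun _ _ => rfl

lemma SL_dich (i : Irr (GL ι F)) : SLg ι F ≤ Kr i ∨ rp i (ev (SLg ι F)) = 0 := by
  have h := rp_central (i := i) (X := rp i (ev (SLg ι F))) (fun g => by
    rw [← map_mul, ← map_mul, ev_SL_comm])
  have h2 : rp i (ev (SLg ι F)) * rp i (ev (SLg ι F)) = rp i (ev (SLg ι F)) := by rw [← map_mul, ev_idem]
  set c := (rp i (ev (SLg ι F))).trace / dm i with hc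
  have h3 : c = 0 ∨ c = 1 := by
    rw [h, smul_mul_smul_comm, one_mul] at h2
    have h4 := congrFun (congrFun h2 0) 0
    simp only [Matrix.smul_apply, Matrix.one_apply_eq, smul_eq_mul, mul_one] at h4
    have h5 : c * (c - 1) = 0 := by rw [mul_sub, h4]; ring
    rcases mul_eq_zero.mp h5 with h6 | h6
    · exact Or.inl h6
    · exact Or.inr (sub_eq_zero.mp h6)
  rcases h3 with h3 | h3
  · right; rw [h, h3, zero_smul]
  · left; apply triv_of_ev; rw [h, h3, one_smul]

/-- commutative image implies dimension one -/
lemma dm_one {G : Type} [Group G] [Fintype G] {i : Irr G} (h : ∀ a b, rp i (dl a) * rp i (dl b) = rp i (dl b) * rp i (dl a)) :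
    dm i = 1 := by
  have h1 : ∀ x : Al G, ∀ a, rp i (dl a) * rp i x = rp i x * rp i (dl a) := by
    intro x a
    rw [al_sum x, map_sum, Finset.mul_sum, Finset.sum_mul]
    refine Finset.sum_congr rfl fun b _ => ?_
    rw [map_smul, mul_smul_comm, smul_mul_assoc, h]
  obtain ⟨x, hx⟩ := rp_surj i (Matrix.single 0 0 1)
  have h2 := rp_central (h1 x)
  rw [hx, Matrix.trace_single_eq_same] at h2
  have h3 := congrFun (congrFun h2 0) 0
  rw [Matrix.single_apply_same, Matrix.smul_apply, Matrix.one_apply_eq, smul_eq_mul, mul_one] at h3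
  have h4 := dm_ne i
  rw [eq_div_iff h4, one_mul] at h3
  exact_mod_cast h3

lemma dm_lin {i : Irr (GL ι F)} (h : SLg ι F ≤ Kr i) : dm i = 1 := by
  apply dm_one
  intro a b
  have h1 : a * b * (b * a)⁻¹ ∈ SLg ι F := by
    rw [SLg, MonoidHom.mem_ker]
    simp only [map_mul, map_inv]
    rw [mul_comm (Matrix.GeneralLinearGroup.det b), mul_inv_cancel]
  have h2 := rdl_mul i (a * b * (b * a)⁻¹) (b * a)
  rw [inv_mul_cancel_right, mem_Kr.mp (h h1), one_mul, rdl_mul, rdl_mul] at h2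
  exact h2

lemma card_SL [Nonempty ι] : Nat.card (GL ι F) = Nat.card (SLg ι F) * (Fintype.card F - 1) := by
  have h1 : Function.Surjective (Matrix.GeneralLinearGroup.det (n := ι) (R := F)) := by
    intro u
    obtain ⟨k⟩ := ‹Nonempty ι›
    refine ⟨Matrix.GeneralLinearGroup.mkOfDetNeZero (Matrix.diagonal (Function.update (fun _ => 1) k (u : F))) ?_, ?_⟩
    · rw [Matrix.det_diagonal, Finset.prod_update_of_mem (mem_univ k)]; simp
    · apply Units.ext
      change (Matrix.diagonal (Function.update (fun _ => 1) k (u : F))).det = u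
      rw [Matrix.det_diagonal, Finset.prod_update_of_mem (mem_univ k)]; simp
  have h2 := Subgroup.card_mul_index (SLg ι F)
  rw [← h2, SLg, Subgroup.index_ker, MonoidHom.range_eq_top.mpr h1, Subgroup.card_top, Nat.card_eq_fintype_card (α := Fˣ), Fintype.card_units]

open Classical in
lemma card_lin [Nonempty ι] : (univ.filter fun i : Irr (GL ι F) => SLg ι F ≤ Kr i).card = Fintype.card F - 1 := by
  have h1 := tau_eq (ev (SLg ι F))
  rw [tau_av (isCh_one _)] at h1
  have h2 : ∀ i : Irr (GL ι F), ch i (ev (SLg ι F)) / hk i = if SLg ι F ≤ Kr i then (Fintype.card (GL ι F) : ℂ)⁻¹ else 0 := by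
    intro i
    by_cases h : SLg ι F ≤ Kr i
    · rw [if_pos h, ch_apply, ev_triv h, Matrix.trace_one, Fintype.card_fin, hk, dm_lin h]
      simp
    · rw [if_neg h, ch_apply, (SL_dich i).resolve_left h, Matrix.trace_zero, zero_div]
  rw [Finset.sum_congr rfl fun i _ => h2 i, ← Finset.sum_filter, Finset.sum_const, nsmul_eq_mul] at h1
  have h3 : (Fintype.card (GL ι F) : ℂ) = Nat.card (SLg ι F) * ((Fintype.card F - 1 : ℕ) : ℂ) := by
    rw [← Nat.card_eq_fintype_card, card_SL]; push_cast; rfl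
  have h4 : (Fintype.card (GL ι F) : ℂ) ≠ 0 := by exact_mod_cast Fintype.card_ne_zero
  have h5 := cardH_ne (SLg ι F)
  rw [eq_mul_inv_iff_mul_eq₀ h4, h3, inv_mul_cancel_left₀ h5] at h1
  exact_mod_cast h1.symm

lemma scal_SL {n : ℕ} {z : Fˣ} (hz : z ^ n = 1) : (scal z : GL (Fin n) F) ∈ SLg (Fin n) F := by
  rw [mem_SLg]
  change (algebraMap F (Matrix (Fin n) (Fin n) F) (z : F)).det = 1
  rw [Algebra.algebraMap_eq_smul_one, Matrix.det_smul, Matrix.det_one, mul_one, Fintype.card_fin]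
  have := congrArg Units.val hz
  rwa [Units.val_pow_eq_pow_val, Units.val_one] at this

lemma om_lin {n : ℕ} {z : Fˣ} (hz : z ^ n = 1) {i : Irr (GL (Fin n) F)} (h : SLg (Fin n) F ≤ Kr i) : om i (scal z) = 1 := by
  rw [om, ch_apply, mem_Kr.mp (h (scal_SL hz)), Matrix.trace_one, Fintype.card_fin, div_self (dm_ne i)]

lemma om_norm {n : ℕ} {z : Fˣ} {k : ℕ} (hk : k ≠ 0) (hz : z ^ k = 1) (i : Irr (GL (Fin n) F)) : ‖om i (scal z)‖ = 1 := by
  have h : ∀ k : ℕ, om i (scal (z ^ k)) = om i (scal z) ^ k := by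
    intro k
    induction k with
    | zero => rw [pow_zero, pow_zero, om_one]
    | succ k ih => rw [pow_succ, om_mul, ih, pow_succ]
  have h1 := h k
  rw [hz, om_one] at h1
  exact Complex.norm_eq_one_of_pow_eq_one h1.symm hk

end lin
end
end HRV
end modH24

section modH25
set_option autoImplicit false
open scoped MatrixGroups
open Finset

namespace HRV
noncomputable section

section nonlin
variable {F : Type} [Field F] [Fintype F] [DecidableEq F]
variable {ι : Type} [Fintype ι] [DecidableEq ι]

/-- invertible diagonal -/
def dg (D : ι → F) (h : ∀ k, D k ≠ 0) : GL ι F :=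
  Matrix.GeneralLinearGroup.mkOfDetNeZero (Matrix.diagonal D) (by
    rw [Matrix.det_diagonal]; exact Finset.prod_ne_zero_iff.mpr fun k _ => h k)

lemma dg_comm (D D' : ι → F) (h : ∀ k, D k ≠ 0) (h' : ∀ k, D' k ≠ 0) : dg D h * dg D' h' = dg D' h' * dg D h := by
  apply Units.ext
  change Matrix.diagonal D * Matrix.diagonal D' = Matrix.diagonal D' * Matrix.diagonal D
  rw [Matrix.diagonal_mul_diagonal, Matrix.diagonal_mul_diagonal]
  congr 1; funext k; exact mul_comm _ _

/-- transvection -/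
def tv {k l : ι} (h : k ≠ l) (c : F) : GL ι F :=
  Matrix.GeneralLinearGroup.mkOfDetNeZero (Matrix.transvection k l c) (by
    rw [Matrix.det_transvection_of_ne k l h]; exact one_ne_zero)

lemma mx_tv {k l : ι} (h : k ≠ l) (c : F) : mx (tv h c) = Matrix.transvection k l c := rfl

lemma R_diag {i : Irr (GL ι F)} (ht : ∀ (k l : ι) (h : k ≠ l) (c : F), tv h c ∈ Kr i) (D : ι → F) (hD : ∀ k, D k ≠ 0) (g : GL ι F) :
    rp i (dl g) * rp i (dl (dg D hD)) = rp i (dl (dg D hD)) * rp i (dl g) := by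
  have key : ∀ g' : GL ι F, mx g' = mx g → rp i (dl g') * rp i (dl (dg D hD)) = rp i (dl (dg D hD)) * rp i (dl g') := by
    refine Matrix.diagonal_transvection_induction_of_det_ne_zero
      (fun M => ∀ g' : GL ι F, mx g' = M → rp i (dl g') * rp i (dl (dg D hD)) = rp i (dl (dg D hD)) * rp i (dl g')) (mx g) ?_ ?_ ?_ ?_
    · exact ((Matrix.isUnit_iff_isUnit_det _).mp g.isUnit).ne_zero
    · intro D' hD' g' hg'
      rw [Matrix.det_diagonal] at hD'
      have h1 : g' = dg D' (fun k => Finset.prod_ne_zero_iff.mp hD' k (mem_univ k)) := Units.ext hg'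
      rw [h1, ← rdl_mul, dg_comm, rdl_mul]
    · intro t g' hg'
      have h1 : g' = tv t.hij t.c := Units.ext hg'
      rw [h1, mem_Kr.mp (ht _ _ t.hij t.c), one_mul, mul_one]
    · intro A B hA hB h1 h2 g' hg'
      have e : g' = Matrix.GeneralLinearGroup.mkOfDetNeZero A hA * Matrix.GeneralLinearGroup.mkOfDetNeZero B hB := Units.ext hg'
      rw [e, rdl_mul, mul_assoc, h2 _ rfl, ← mul_assoc, h1 _ rfl, mul_assoc]
  exact key g rfl

lemma diag2_Kr {i : Irr (GL ι F)} (ht : ∀ (k l : ι) (h : k ≠ l) (c : F), tv h c ∈ Kr i) {k l : ι} (hkl : k ≠ l) {c : F} (hc : c ≠ 0)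
    (g : GL ι F) (hg : mx g = Matrix.diagonal (fun x => if x = k then c else if x = l then c⁻¹ else 1)) : g ∈ Kr i := by
  have hD : ∀ x, (fun x => if x = k then c else 1 : ι → F) x ≠ 0 := by
    intro x; dsimp only; split_ifs; exacts [hc, one_ne_zero]
  have e : g * (pm (Equiv.swap k l) * dg _ hD) = dg _ hD * pm (Equiv.swap k l) := by
    apply gl_ext
    intro x y
    let W : Matrix ι ι F := mx (pm (Equiv.swap k l))
    have hW : ∀ a b, W a b = if a = Equiv.swap k l b then 1 else 0 := mx_pm _
    change ((mx g * (W * Matrix.diagonal (fun x => if x = k then c else 1)) : Matrix ι ι F) x y) = (Matrix.diagonal (fun x => if x = k then c else 1) * W : Matrix ι ι F) x y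
    rw [hg, Matrix.diagonal_mul, Matrix.diagonal_mul, Matrix.mul_diagonal, hW]
    by_cases h1 : x = Equiv.swap k l y
    · rw [if_pos h1]
      by_cases h2 : y = k
      · subst h2; rw [Equiv.swap_apply_left] at h1; subst h1
        simp [hkl.symm, hc]
      · by_cases h3 : y = l
        · subst h3; rw [Equiv.swap_apply_right] at h1; subst h1
          simp [h2]
        · rw [Equiv.swap_apply_of_ne_of_ne h2 h3] at h1; subst h1
          simp [h2, h3]
    · rw [if_neg h1]; ring
  have h1 := congrArg (fun x => rp i (dl x)) e
  simp only [rdl_mul] at h1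
  rw [R_diag ht] at h1
  rw [← rdl_mul i (dg _ hD), ← rdl_mul] at h1
  rw [mem_Kr]
  have h2 := rdl_mul i (g * (dg _ hD * pm (Equiv.swap k l))) (dg _ hD * pm (Equiv.swap k l))⁻¹
  rw [h1, mul_inv_cancel_right, ← rdl_mul, mul_inv_cancel, rdl_one] at h2
  exact h2

lemma SL_of_tv [Nontrivial ι] {i : Irr (GL ι F)} (ht : ∀ (k l : ι) (h : k ≠ l) (c : F), tv h c ∈ Kr i) : SLg ι F ≤ Kr i := by
  intro g hg
  rw [mem_SLg] at hg
  have key := Matrix.SpecialLinearGroup.diagonal_transvection_induction' (ι := ι) (F := F)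
    (fun A => ∀ g' : GL ι F, mx g' = A.1 → g' ∈ Kr i) ⟨mx g, hg⟩ ?_ ?_ ?_
  · exact key g rfl
  · intro k l hkl c hc g' hg'
    exact diag2_Kr ht hkl hc g' hg'
  · intro k l hkl c g' hg'
    have : g' = tv hkl c := Units.ext hg'
    rw [this]; exact ht _ _ _ _
  · intro A B hA hB g' hg'
    have e : g' = Matrix.GeneralLinearGroup.mkOfDetNeZero A.1 (by rw [A.2]; exact one_ne_zero) * Matrix.GeneralLinearGroup.mkOfDetNeZero B.1 (by rw [B.2]; exact one_ne_zero) := Units.ext hg'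
    rw [e]
    exact (Kr i).mul_mem (hA _ rfl) (hB _ rfl)

end nonlin
end
end HRV
end modH25

section modH26
set_option autoImplicit false
open scoped MatrixGroups
open Finset

namespace HRV
noncomputable section

section nl
variable {F : Type} [Field F] [Fintype F] [DecidableEq F]
variable {ι : Type} [Fintype ι] [DecidableEq ι]

/-- column subgroup -/
def Cc (F : Type) [Field F] [Fintype F] [DecidableEq F] (l : ι) : Subgroup (GL ι F) := Ub (fun x => decide (x = l))

instance (l : ι) : Fintype (Cc F l) := Fintype.ofFinite _

lemma mem_Cc {l : ι} {g : GL ι F} : g ∈ Cc F l ↔ ∀ x y, (y ≠ l ∨ x = l) → mx g x y = (1 : Matrix ι ι F) x y := by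
  rw [Cc, mem_Ub]
  refine forall_congr' fun x => forall_congr' fun y => ?_
  by_cases hx : x = l <;> by_cases hy : y = l <;> simp [hx, hy]

lemma card_Cc (l : ι) : Nat.card (Cc F l) = Fintype.card F ^ (Fintype.card ι - 1) := by
  rw [Cc, card_Ub]
  congr 1
  have : (univ.filter fun p : ι × ι => decide (p.1 = l) < decide (p.2 = l)) = (univ.erase l) ×ˢ {l} := by
    ext ⟨x, y⟩
    by_cases hx : x = l <;> by_cases hy : y = l <;> simp [hx, hy]
    · exact ⟨fun h => absurd h (by decide), fun e => absurd e.symm hy⟩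
    · exact fun e => hy e.symm
  rw [this, Finset.card_product, Finset.card_singleton, mul_one, Finset.card_erase_of_mem (mem_univ l), Finset.card_univ]

lemma tv_Cc {k l : ι} (h : k ≠ l) (c : F) : tv h c ∈ Cc F l := by
  rw [mem_Cc]
  intro x y hxy
  rw [mx_tv, Matrix.transvection, Matrix.add_apply]
  rw [Matrix.single_apply_of_ne, add_zero]
  rintro ⟨rfl, rfl⟩
  rcases hxy with h1 | h1
  · exact h1 rfl
  · exact h h1

lemma conj_tv {k l : ι} (h : k ≠ l) {g : GL ι F} (hg : g ∈ Cc F l) (hk : mx g k l ≠ 0) : ∃ x : GL ι F, x * tv h 1 = g * x := by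
  rw [mem_Cc] at hg
  let v : ι → F := fun x => if x = l then 0 else mx g x l
  let X : Matrix ι ι F := (1 : Matrix ι ι F).updateCol k v
  have hX : X.det ≠ 0 := by
    have h1 : X.det = v k := by
      rw [← Matrix.cramer_apply, Matrix.cramer_one]; rfl
    rw [h1]; simp only [v]; rwa [if_neg h]
  have hv : ∀ x, X x k = v x := fun x => by simp [X]
  have hl : ∀ y, X l y = if y = l then 1 else 0 := by
    intro y
    by_cases hy : y = k
    · subst hy; rw [hv, if_neg h]; simp [v]
    · simp only [X]; rw [Matrix.updateCol_ne hy, Matrix.one_apply]; simp only [eq_comm]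
  have hgv : ∀ x z, mx g x z = (1 : Matrix ι ι F) x z + if z = l then v x else 0 := by
    intro x z
    by_cases hz : z = l
    · subst hz
      by_cases hx : x = z
      · subst hx; rw [hg _ _ (Or.inr rfl)]; simp [v]
      · rw [Matrix.one_apply_ne hx]; simp [v, hx]
    · rw [hg _ _ (Or.inl hz), if_neg hz, add_zero]
  refine ⟨Matrix.GeneralLinearGroup.mkOfDetNeZero X hX, ?_⟩
  apply gl_ext
  intro x y
  change (X * Matrix.transvection k l 1 : Matrix ι ι F) x y = (mx g * X : Matrix ι ι F) x y
  have h1 : (X * Matrix.transvection k l 1 : Matrix ι ι F) x y = X x y + if y = l then v x else 0 := by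
    rw [Matrix.transvection, mul_add, mul_one, Matrix.add_apply]
    congr 1
    by_cases hy : y = l
    · subst hy; rw [if_pos rfl, Matrix.mul_single_apply_same, hv, mul_one]
    · rw [if_neg hy, Matrix.mul_single_apply_of_ne _ _ _ _ _ hy]
  have h2 : (mx g * X : Matrix ι ι F) x y = X x y + if y = l then v x else 0 := by
    rw [Matrix.mul_apply]
    simp only [hgv, add_mul, Finset.sum_add_distrib]
    congr 1
    · rw [← Matrix.mul_apply, one_mul]
    · simp only [ite_mul, zero_mul, Finset.sum_ite_eq', mem_univ, if_true, hl, mul_ite, mul_one, mul_zero]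
  rw [h1, h2]

lemma pm_tv {k l : ι} (h : k ≠ l) (c : F) (w : Equiv.Perm ι) : pm w * tv h c = tv (w.injective.ne h) c * pm w := by
  apply gl_ext
  intro x y
  let W : Matrix ι ι F := mx (pm w)
  have hW : ∀ a b, W a b = if a = w b then 1 else 0 := mx_pm _
  change (W * (1 + Matrix.single k l c) : Matrix ι ι F) x y = ((1 + Matrix.single (w k) (w l) c) * W : Matrix ι ι F) x y
  rw [mul_add, add_mul, one_mul, mul_one, Matrix.add_apply, Matrix.add_apply]
  congr 1
  by_cases hy : y = l
  · subst hy
    rw [Matrix.mul_single_apply_same, hW]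
    by_cases hx : x = w k
    · subst hx; rw [Matrix.single_mul_apply_same, hW, if_pos rfl, if_pos rfl]; ring
    · rw [Matrix.single_mul_apply_of_ne _ _ _ _ _ hx, if_neg hx, zero_mul]
  · rw [Matrix.mul_single_apply_of_ne _ _ _ _ _ hy]
    by_cases hx : x = w k
    · subst hx; rw [Matrix.single_mul_apply_same, hW, if_neg (fun e => hy (w.injective e).symm), mul_zero]
    · rw [Matrix.single_mul_apply_of_ne _ _ _ _ _ hx]

lemma ch_conj {G : Type} [Group G] [Fintype G] (i : Irr G) {x g h : G} (e : x * g = h * x) : ch i (dl g) = ch i (dl h) := by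
  have : g = x⁻¹ * (h * x) := by rw [← e, inv_mul_cancel_left]
  rw [this, dl_mul, ch_mul_comm, ← dl_mul, mul_assoc, mul_inv_cancel, mul_one]

/-- constancy of the character -/
lemma ch_Cc (i : Irr (GL ι F)) {k l : ι} (h : k ≠ l) {g : GL ι F} (hg : g ∈ Cc F l) (h1 : g ≠ 1) : ch i (dl g) = ch i (dl (tv h 1)) := by
  obtain ⟨k', hk', hne⟩ : ∃ k', k' ≠ l ∧ mx g k' l ≠ 0 := by
    by_contra hcon
    push Not at hcon
    apply h1
    apply gl_ext
    intro x y
    rw [mx_one]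
    by_cases hx : x = l
    · exact (mem_Cc.mp hg) x y (Or.inr hx)
    · by_cases hy : y = l
      · subst hy; rw [hcon x hx, Matrix.one_apply_ne hx]
      · exact (mem_Cc.mp hg) x y (Or.inl hy)
  obtain ⟨x, hx⟩ := conj_tv hk' hg hne
  rw [← ch_conj i hx]
  have h2 := pm_tv hk' (1 : F) (Equiv.swap k' k)
  rw [ch_conj i h2]
  congr 2
  apply Units.ext
  change Matrix.transvection _ _ _ = Matrix.transvection _ _ _
  rw [Equiv.swap_apply_left, Equiv.swap_apply_of_ne_of_ne hk'.symm h.symm]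

lemma ch_av (i : Irr (GL ι F)) {k l : ι} (h : k ≠ l) (lam : GL ι F → ℂ) (hl : lam 1 = 1) :
    (Nat.card (Cc F l) : ℂ) * ch i (av (Cc F l) lam) = dm i + ((∑ g : Cc F l, lam (g : GL ι F)⁻¹) - 1) * ch i (dl (tv h 1)) := by
  classical
  rw [av, map_smul, smul_eq_mul, mul_inv_cancel_left₀ (cardH_ne _), map_sum]
  have h1 : ∀ g : GL ι F, ch i (if g ∈ Cc F l then lam g⁻¹ • dl g else 0) =
      if g ∈ Cc F l then (lam g⁻¹ * ch i (dl (tv h 1)) + if g = 1 then (dm i - ch i (dl (tv h 1)) : ℂ) else 0) else 0 := by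
    intro g
    by_cases hg : g ∈ Cc F l
    · rw [if_pos hg, if_pos hg, map_smul, smul_eq_mul]
      by_cases hg1 : g = 1
      · rw [if_pos hg1, hg1, _root_.inv_one, hl, dl_one, ch_one]; ring
      · rw [if_neg hg1, ch_Cc i h hg hg1, add_zero]
    · rw [if_neg hg, if_neg hg, map_zero]
  rw [Finset.sum_congr rfl fun g _ => h1 g, ← Finset.sum_filter, Finset.sum_add_distrib, Finset.sum_ite_eq', if_pos (by simp [(Cc F l).one_mem]),
    ← Finset.sum_mul]
  have h2 : ∑ g ∈ univ.filter (fun g => g ∈ Cc F l), lam g⁻¹ = ∑ g : Cc F l, lam (g : GL ι F)⁻¹ :=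
    Finset.sum_subtype _ (by simp) (fun g => lam g⁻¹)
  rw [h2]; ring

/-- additive character on the column subgroup -/
lemma psi_ch {k l : ι} (h : k ≠ l) (ψ : AddChar F ℂ) : IsCh (Cc F l) (fun g => ψ (mx g k l)) := by
  refine ⟨?_, ?_⟩
  · change ψ (mx (1 : GL ι F) k l) = 1
    rw [mx_one, Matrix.one_apply_ne h, AddChar.map_zero_eq_one]
  · intro g hg g' hg'
    rw [← AddChar.map_add_eq_mul]
    change ψ (mx (g * g') k l) = _
    congr 1
    rw [mx_mul]
    have h1 : ∀ x, mx g k x * mx g' x l = (if x = k then mx g' k l else 0) + if x = l then mx g k l else 0 := by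
      intro x
      by_cases hx : x = l
      · subst hx
        rw [(mem_Cc.mp hg') x x (Or.inr rfl), if_neg h.symm, if_pos rfl, Matrix.one_apply_eq]; ring
      · rw [(mem_Cc.mp hg) k x (Or.inl hx), if_neg hx]
        by_cases hxk : x = k
        · subst hxk; rw [if_pos rfl, Matrix.one_apply_eq]; ring
        · rw [if_neg hxk, Matrix.one_apply_ne (fun e => hxk e.symm)]; ring
    rw [Finset.sum_congr rfl fun x _ => h1 x, Finset.sum_add_distrib, Finset.sum_ite_eq', Finset.sum_ite_eq', if_pos (mem_univ _), if_pos (mem_univ _), add_comm]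

lemma psi_sum {k l : ι} (h : k ≠ l) (ψ : AddChar F ℂ) (hψ : ψ 1 ≠ 1) : ∑ g : Cc F l, ψ (mx (g : GL ι F)⁻¹ k l) = 0 := by
  have hc := psi_ch h ψ
  let t : Cc F l := ⟨tv h 1, tv_Cc h 1⟩
  have h1 : ∑ g : Cc F l, ψ (mx (g : GL ι F)⁻¹ k l) = ∑ g : Cc F l, ψ (mx (g : GL ι F) k l) :=
    Fintype.sum_equiv (Equiv.inv _) _ _ fun g => rfl
  have h2 : ∑ g : Cc F l, ψ (mx (g : GL ι F) k l) = ψ 1 * ∑ g : Cc F l, ψ (mx (g : GL ι F) k l) := by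
    rw [Finset.mul_sum]
    refine (Fintype.sum_equiv (Equiv.mulLeft t) _ _ fun g => ?_).symm
    have h3 := hc.2 t.1 t.2 g.1 g.2
    have h4 : mx t.1 k l = 1 := by
      change (1 + Matrix.single k l 1 : Matrix ι ι F) k l = 1
      rw [Matrix.add_apply, Matrix.one_apply_ne h, Matrix.single_apply_same, zero_add]
    beta_reduce at h3
    rw [h4] at h3
    exact h3.symm
  rw [h1]
  have h3 : (ψ 1 - 1) * ∑ g : Cc F l, ψ (mx (g : GL ι F) k l) = 0 := by rw [sub_mul, ← h2]; ring
  exact (mul_eq_zero.mp h3).resolve_left (sub_ne_zero.mpr hψ)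

lemma dm_nonlin {k l : ι} (h : k ≠ l) (i : Irr (GL ι F)) (hi : ¬ SLg ι F ≤ Kr i) : Fintype.card F ^ (Fintype.card ι - 1) ≤ dm i + 1 := by
  obtain ⟨ψ, hψ⟩ := AddChar.exists_apply_ne_zero.mpr (one_ne_zero (α := F))
  have e1 := ch_av i h (fun _ => 1) rfl
  have e2 := ch_av i h (fun g => ψ (mx g k l)) (psi_ch h ψ).1
  rw [psi_sum h ψ hψ] at e2
  rw [ch_idem i (av_idem (psi_ch h ψ))] at e2
  rw [ch_idem i (av_idem (isCh_one _)), Finset.sum_const, nsmul_eq_mul, mul_one, Finset.card_univ, ← Nat.card_eq_fintype_card] at e1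
  set r := rk i (av (Cc F l) fun _ => 1) with hr
  set s := rk i (av (Cc F l) fun g => ψ (mx g k l)) with hs
  have h0 := cardH_ne (Cc F l)
  have e3 : (dm i : ℂ) = r + ((Nat.card (Cc F l) : ℂ) - 1) * s := by
    apply mul_left_cancel₀ h0
    have : (Nat.card (Cc F l) : ℂ) * (r + ((Nat.card (Cc F l) : ℂ) - 1) * s) = Nat.card (Cc F l) * r + ((Nat.card (Cc F l) : ℂ) - 1) * (Nat.card (Cc F l) * s) := by ring
    rw [this, e1, e2]; ring
  have e4 : dm i + s = r + Nat.card (Cc F l) * s := by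
    have : (dm i : ℂ) + s = r + Nat.card (Cc F l) * s := by rw [e3]; ring
    exact_mod_cast this
  rw [← card_Cc l]
  have hpos : 0 < Nat.card (Cc F l) := Nat.card_pos
  rcases Nat.eq_zero_or_pos s with h1 | h1
  · exfalso
    apply hi
    rw [h1, mul_zero, add_zero, add_zero] at e4
    have h2 : (1 - ev (Cc F l)) * (1 - ev (Cc F l)) = 1 - ev (Cc F l) := by
      rw [sub_mul, mul_sub, mul_sub, ev_idem]; simp
    have h3 := ch_idem i h2
    rw [map_sub, ch_one, ch_idem i (ev_idem _)] at h3
    have h4 : rk i (1 - ev (Cc F l)) = 0 := by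
      rw [e4] at h3
      change (r : ℂ) - r = _ at h3
      rw [sub_self] at h3
      exact_mod_cast h3.symm
    rw [rk_eq_zero, map_sub, map_one, sub_eq_zero] at h4
    have h5 := triv_of_ev h4.symm
    haveI : Nontrivial ι := ⟨⟨k, l, h⟩⟩
    refine SL_of_tv fun a b hab c => ?_
    have h9 : Cc F l = Cc F (Equiv.swap b l b) := by rw [Equiv.swap_apply_left]
    have h6 : tv ((Equiv.swap b l).injective.ne hab) c ∈ Kr i := h5 (by rw [h9]; exact tv_Cc _ c)
    have h7 := pm_tv hab c (Equiv.swap b l)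
    have h8 := Kr_conj (pm (Equiv.swap b l))⁻¹ h6
    rw [inv_inv, mul_assoc, ← h7, inv_mul_cancel_left] at h8
    exact h8
  · obtain ⟨s', hs'⟩ : ∃ s', s = s' + 1 := ⟨s - 1, by omega⟩
    rw [hs'] at e4
    nlinarith

end nl
end
end HRV
end modH26

section modH27
set_option autoImplicit false
open scoped MatrixGroups
open Finset

namespace HRV
noncomputable section

section cntI
variable {F : Type} [Field F] [Fintype F] [DecidableEq F]

lemma GL_le (n : ℕ) : (Nat.card (GL (Fin n) F) : ℝ) ≤ (Fintype.card F : ℝ) ^ (n ^ 2) := by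
  rw [Matrix.card_GL_field]
  have h : ∏ i : Fin n, (Fintype.card F ^ n - Fintype.card F ^ (i : ℕ)) ≤ ∏ i : Fin n, Fintype.card F ^ n :=
    Finset.prod_le_prod' fun i _ => Nat.sub_le _ _
  rw [Finset.prod_const, Finset.card_univ, Fintype.card_fin, ← pow_mul, ← sq] at h
  exact_mod_cast h

lemma GL_ge (n : ℕ) : (Fintype.card F : ℝ) ^ (n ^ 2) * (1 - 1 / (Fintype.card F : ℝ)) ^ n ≤ (Nat.card (GL (Fin n) F) : ℝ) := by
  have hq : (1 : ℝ) < Fintype.card F := by exact_mod_cast Fintype.one_lt_card (α := F)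
  rw [Matrix.card_GL_field, Nat.cast_prod]
  have h : ∏ i : Fin n, ((Fintype.card F : ℝ) ^ n * (1 - 1 / (Fintype.card F : ℝ))) ≤
      ∏ i : Fin n, ((Fintype.card F ^ n - Fintype.card F ^ (i : ℕ) : ℕ) : ℝ) := by
    refine Finset.prod_le_prod (fun i _ => ?_) fun i _ => ?_
    · refine mul_nonneg (by positivity) ?_
      rw [sub_nonneg, div_le_one (by linarith)]; exact hq.le
    · rw [Nat.cast_sub (Nat.pow_le_pow_right Fintype.card_pos i.2.le)]
      push_cast
      obtain ⟨m, hm⟩ : ∃ m, n = m + 1 := ⟨n - 1, by have := i.2; omega⟩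
      have h1 : (Fintype.card F : ℝ) ^ (i : ℕ) ≤ (Fintype.card F : ℝ) ^ m := pow_le_pow_right₀ hq.le (by have := i.2; omega)
      have h2 : (Fintype.card F : ℝ) ^ n * (1 - 1 / (Fintype.card F : ℝ)) = (Fintype.card F : ℝ) ^ n - (Fintype.card F : ℝ) ^ m := by
        rw [hm, pow_succ]; field_simp
      rw [h2]; linarith
  rw [Finset.prod_const, Finset.card_univ, Fintype.card_fin, mul_pow, ← pow_mul, ← sq] at h
  exact h

lemma GL_ge2 (n : ℕ) : (Fintype.card F : ℝ) ^ (n ^ 2) ≤ 2 ^ n * (Nat.card (GL (Fin n) F) : ℝ) := by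
  have hq : (2 : ℝ) ≤ Fintype.card F := by exact_mod_cast Fintype.one_lt_card (α := F)
  have h1 : (1 / 2 : ℝ) ≤ 1 - 1 / (Fintype.card F : ℝ) := by
    have : 1 / (Fintype.card F : ℝ) ≤ 1 / 2 := one_div_le_one_div_of_le (by norm_num) hq
    linarith
  have h2 : (1 / 2 : ℝ) ^ n ≤ (1 - 1 / (Fintype.card F : ℝ)) ^ n := pow_le_pow_left₀ (by norm_num) h1 n
  have h3 := GL_ge (F := F) n
  have h4 : (Fintype.card F : ℝ) ^ (n ^ 2) * (1 / 2) ^ n ≤ Nat.card (GL (Fin n) F) := le_trans (by gcongr) h3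
  calc (Fintype.card F : ℝ) ^ (n ^ 2) = 2 ^ n * ((Fintype.card F : ℝ) ^ (n ^ 2) * (1 / 2) ^ n) := by
        rw [one_div, inv_pow]; field_simp
    _ ≤ _ := by gcongr

lemma sum_dm {G : Type} [Group G] [Fintype G] : ∑ i : Irr G, (dm i : ℝ) ^ 2 = Fintype.card G := by
  have h := tau_eq (1 : Al G)
  rw [← dl_one, tau_dl, if_pos rfl] at h
  have h2 : ∀ i : Irr G, ch i (dl 1) / hk i = (dm i : ℂ) ^ 2 / Fintype.card G := by
    intro i
    rw [dl_one, ch_one, hk, div_div_eq_mul_div, sq]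
  rw [Finset.sum_congr rfl fun i _ => h2 i, ← Finset.sum_div, eq_div_iff (card_ne (G := G)), one_mul] at h
  exact_mod_cast h.symm

/-- weights of cuspidals -/
lemma cusp_w {n : ℕ} (hG : Gd F n) (c : CN F n) :
    ((Fintype.card F : ℝ) ^ c.1.d)⁻¹ ≤ 2 ^ n * ((dm c.1.i : ℝ) ^ 2 / Fintype.card (GL (Fin c.1.d) F)) := by
  obtain ⟨k, hk0, hk1, hk2⟩ := hk_int c.1.i
  have h1 := hG c.1 c.2
  rw [hC, hk1] at h1
  set d := c.1.d with hd
  set q := Fintype.card F with hq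
  have hq1 : 1 ≤ q := Fintype.card_pos
  have h2 : (k : ℝ) = (q : ℝ) ^ (d * (d - 1) / 2) * ((q : ℝ) ^ d - 1) := by
    have h3 : ((k : ℝ) : ℂ) = (((q : ℝ) ^ (d * (d - 1) / 2) * ((q : ℝ) ^ d - 1) : ℝ) : ℂ) := by
      push_cast; exact h1
    exact_mod_cast h3
  have hT : 2 * (d * (d - 1) / 2) + 2 * d = d ^ 2 + d := by
    have : 2 ∣ d * (d - 1) := (Nat.even_mul_pred_self d).two_dvd
    rw [Nat.mul_div_cancel' this]
    have : 0 < d := c.1.hd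
    obtain ⟨e, he⟩ : ∃ e, d = e + 1 := ⟨d - 1, by omega⟩
    rw [he]
    simp only [Nat.add_sub_cancel]; ring
  have hk' : (k : ℝ) ≤ (q : ℝ) ^ (d * (d - 1) / 2) * (q : ℝ) ^ d := by
    rw [h2]; gcongr; linarith
  have hq0 : (0 : ℝ) < q := by exact_mod_cast hq1
  have hk3 : (k : ℝ) ^ 2 ≤ (q : ℝ) ^ (d ^ 2) * (q : ℝ) ^ d := by
    calc (k : ℝ) ^ 2 ≤ ((q : ℝ) ^ (d * (d - 1) / 2) * (q : ℝ) ^ d) ^ 2 := by gcongr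
      _ = (q : ℝ) ^ (2 * (d * (d - 1) / 2) + 2 * d) := by rw [← pow_add, ← pow_mul]; congr 1; ring
      _ = _ := by rw [hT, pow_add]
  have hg : (q : ℝ) ^ (d ^ 2) ≤ 2 ^ n * (Fintype.card (GL (Fin d) F) : ℝ) := by
    have := GL_ge2 (F := F) d
    rw [Nat.card_eq_fintype_card] at this
    refine this.trans ?_
    have h5 : (2 : ℝ) ^ d ≤ 2 ^ n := pow_le_pow_right₀ (by norm_num) c.2
    gcongr
  have hN : (0 : ℝ) < Fintype.card (GL (Fin d) F) := by exact_mod_cast Fintype.card_pos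
  have hkR : (0 : ℝ) < k := by exact_mod_cast hk0
  have hdm : (dm c.1.i : ℝ) = Fintype.card (GL (Fin d) F) / k := by
    rw [eq_div_iff hkR.ne', mul_comm]; exact_mod_cast hk2
  have : (dm c.1.i : ℝ) ^ 2 / Fintype.card (GL (Fin d) F) = Fintype.card (GL (Fin d) F) / (k : ℝ) ^ 2 := by
    rw [hdm]; field_simp
  rw [this, ← one_div, ← mul_div_assoc, div_le_div_iff₀ (by positivity) (by positivity), one_mul]
  calc (k : ℝ) ^ 2 ≤ (q : ℝ) ^ (d ^ 2) * (q : ℝ) ^ d := hk3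
    _ ≤ _ := by gcongr

lemma cusp_sum {n : ℕ} (hG : Gd F n) : ∑ c : CN F n, ((Fintype.card F : ℝ) ^ c.1.d)⁻¹ ≤ 2 ^ n * (n + 1) := by
  let f : CN F n → Σ d : Fin (n + 1), Irr (GL (Fin d) F) := fun ρ => ⟨⟨ρ.1.d, Nat.lt_succ_of_le ρ.2⟩, ρ.1.i⟩
  have hf : Function.Injective f := by
    rintro ⟨⟨d, hd, i, hi⟩, h⟩ ⟨⟨d', hd', i', hi'⟩, h'⟩ e
    simp only [f, Sigma.mk.injEq, Fin.mk.injEq] at e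
    obtain ⟨rfl, e2⟩ := e
    obtain rfl := eq_of_heq e2
    rfl
  let w : (Σ d : Fin (n + 1), Irr (GL (Fin d) F)) → ℝ := fun x => 2 ^ n * ((dm x.2 : ℝ) ^ 2 / Fintype.card (GL (Fin x.1) F))
  calc ∑ c : CN F n, ((Fintype.card F : ℝ) ^ c.1.d)⁻¹ ≤ ∑ c : CN F n, w (f c) := Finset.sum_le_sum fun c _ => cusp_w hG c
    _ = ∑ x ∈ univ.map ⟨f, hf⟩, w x := by rw [Finset.sum_map]; rfl
    _ ≤ ∑ x, w x := Finset.sum_le_sum_of_subset_of_nonneg (Finset.subset_univ _) fun x _ _ => by positivity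
    _ = ∑ d : Fin (n + 1), 2 ^ n := by
      rw [Fintype.sum_sigma]
      refine Finset.sum_congr rfl fun d _ => ?_
      change ∑ i : Irr (GL (Fin d) F), 2 ^ n * ((dm i : ℝ) ^ 2 / Fintype.card (GL (Fin d) F)) = _
      have hN : (Fintype.card (GL (Fin d) F) : ℝ) ≠ 0 := by exact_mod_cast Fintype.card_ne_zero
      rw [← Finset.mul_sum, ← Finset.sum_div, sum_dm, div_self hN, mul_one]
    _ = 2 ^ n * (n + 1) := by
      rw [Finset.sum_const, Finset.card_univ, Fintype.card_fin, nsmul_eq_mul]; push_cast; ring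

lemma fib_le {ι Λ : Type} [Fintype ι] [DecidableEq ι] [LinearOrder Λ] [Fintype Λ] (σ : Sq F Λ ι) :
    (univ.filter fun i : Irr (GL ι F) => rk i σ.e ≠ 0).card ≤ (Fintype.card ι).factorial := by
  classical
  have h1 : Fintype.card (Mtch σ σ) ≤ (Fintype.card Λ).factorial := by
    rw [← Fintype.card_perm]
    exact Fintype.card_le_of_injective (fun π => π.1) Subtype.val_injective
  have h2 : Fintype.card Λ ≤ Fintype.card ι := by
    rw [← σ.card_d, Fintype.card_eq_sum_ones]
    exact Finset.sum_le_sum fun x _ => (σ.ρ x).hd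
  refine le_trans ?_ (h1.trans (Nat.factorial_le h2))
  rw [← mackey_count, Finset.card_eq_sum_ones, Finset.sum_filter]
  refine Finset.sum_le_sum fun i _ => ?_
  split_ifs with h
  · exact Nat.mul_pos (Nat.pos_of_ne_zero h) (Nat.pos_of_ne_zero h)
  · exact Nat.zero_le _

lemma irr_card {n : ℕ} (hn : 0 < n) (hG : Gd F n) :
    (Fintype.card (Irr (GL (Fin n) F)) : ℝ) ≤ n.factorial * Real.exp (n * (2 ^ n * (n + 1))) * (Fintype.card F : ℝ) ^ n := by
  classical
  have hq : (1 : ℝ) < Fintype.card F := by exact_mod_cast Fintype.one_lt_card (α := F)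
  set q : ℝ := ((Fintype.card F : ℕ) : ℝ) with hqd
  choose L hL1 hL2 using fun i => eL_exists (F := F) n hn le_rfl i
  let T : Finset (CN F n → ℕ) := Fintype.piFinset fun _ => range (n + 1)
  let w : CN F n → ℕ → ℝ := fun c k => if k = 0 then 1 else (q ^ c.1.d)⁻¹
  have hw : ∀ c k, 0 ≤ w c k := fun c k => by
    simp only [w]; split_ifs
    · exact zero_le_one
    · positivity
  have hLT : ∀ i ∈ (univ : Finset (Irr (GL (Fin n) F))), L i ∈ T := by
    intro i _
    rw [Fintype.mem_piFinset]
    intro c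
    rw [Finset.mem_range, Nat.lt_succ_iff, ← hL1 i]
    exact Finset.single_le_sum (f := L i) (fun _ _ => Nat.zero_le _) (mem_univ c)
  have hfib : ∀ l ∈ T, ((univ.filter fun i : Irr (GL (Fin n) F) => L i = l).card : ℝ) ≤ n.factorial * q ^ n * ∏ c, w c (l c) := by
    intro l _
    have hnn : 0 ≤ (n.factorial : ℝ) * q ^ n * ∏ c, w c (l c) :=
      mul_nonneg (by positivity) (Finset.prod_nonneg fun c _ => hw c _)
    rcases Finset.eq_empty_or_nonempty (univ.filter fun i : Irr (GL (Fin n) F) => L i = l) with h0 | ⟨i0, hi0⟩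
    · rw [h0, Finset.card_empty, Nat.cast_zero]; exact hnn
    · rw [Finset.mem_filter] at hi0
      have hl1 := hL1 i0
      have hl2 := hL2 i0
      rw [hi0.2] at hl1 hl2
      have hcond : Nonempty (CS F (Fin n) (fun c => l c / c.1.d) (fun c : CN F n => c.1)) ∧ ∀ c, c.1.d ∣ l c := by
        by_contra hc
        rw [eL, dif_neg hc] at hl2
        exact hl2 (rk_zero _)
      have he : eL n l = hcond.1.some.σ.e := by rw [eL, dif_pos hcond]
      have h1 : (univ.filter fun i : Irr (GL (Fin n) F) => L i = l).card ≤ n.factorial := by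
        have h2 := fib_le hcond.1.some.σ
        rw [← he, Fintype.card_fin] at h2
        refine le_trans (Finset.card_le_card fun i hi => ?_) h2
        rw [Finset.mem_filter] at hi ⊢
        refine ⟨mem_univ _, ?_⟩
        rw [← hi.2]; exact hL2 i
      have h3 : (1 : ℝ) ≤ q ^ n * ∏ c, w c (l c) := by
        have h4 : (q ^ n)⁻¹ ≤ ∏ c, w c (l c) := by
          have e1 : q ^ n = ∏ c, q ^ l c := by rw [Finset.prod_pow_eq_pow_sum, hl1]
          rw [e1, ← Finset.prod_inv_distrib]
          refine Finset.prod_le_prod (fun c _ => by positivity) fun c _ => ?_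
          simp only [w]
          split_ifs with h5
          · rw [h5, pow_zero, _root_.inv_one]
          · exact inv_anti₀ (by positivity) (pow_le_pow_right₀ hq.le (Nat.le_of_dvd (Nat.pos_of_ne_zero h5) (hcond.2 c)))
        have hqn : (0 : ℝ) < q ^ n := by positivity
        calc (1 : ℝ) = q ^ n * (q ^ n)⁻¹ := (mul_inv_cancel₀ hqn.ne').symm
          _ ≤ _ := by gcongr
      calc ((univ.filter fun i : Irr (GL (Fin n) F) => L i = l).card : ℝ) ≤ n.factorial * 1 := by
            rw [mul_one]; exact_mod_cast h1
        _ ≤ n.factorial * (q ^ n * ∏ c, w c (l c)) := by gcongr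
        _ = _ := by ring
  have h1 := Finset.card_eq_sum_card_fiberwise hLT
  rw [Finset.card_univ] at h1
  have h2 : (Fintype.card (Irr (GL (Fin n) F)) : ℝ) = ∑ l ∈ T, ((univ.filter fun i : Irr (GL (Fin n) F) => L i = l).card : ℝ) := by
    rw [h1]; push_cast; rfl
  have h3 : ∑ l ∈ T, ∏ c, w c (l c) ≤ Real.exp (n * (2 ^ n * (n + 1))) := by
    have h4 : ∏ c, ∑ k ∈ range (n + 1), w c k = ∑ l ∈ T, ∏ c, w c (l c) := Finset.prod_univ_sum _ _
    rw [← h4]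
    have h5 : ∀ c : CN F n, ∑ k ∈ range (n + 1), w c k ≤ Real.exp (n * (q ^ c.1.d)⁻¹) := by
      intro c
      rw [Finset.sum_range_succ']
      have : ∀ k ∈ range n, w c (k + 1) = (q ^ c.1.d)⁻¹ := fun k _ => by simp only [w]; rw [if_neg (Nat.succ_ne_zero k)]
      rw [Finset.sum_congr rfl this, Finset.sum_const, Finset.card_range, nsmul_eq_mul]
      have h6 : w c 0 = 1 := by simp only [w]; rw [if_pos trivial]
      rw [h6]
      exact Real.add_one_le_exp _
    refine (Finset.prod_le_prod (fun c _ => Finset.sum_nonneg fun k _ => hw c k) fun c _ => h5 c).trans ?_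
    rw [← Real.exp_sum, ← Finset.mul_sum]
    apply Real.exp_le_exp.mpr
    have := cusp_sum hG
    gcongr
  calc (Fintype.card (Irr (GL (Fin n) F)) : ℝ) ≤ ∑ l ∈ T, n.factorial * q ^ n * ∏ c, w c (l c) := by
        rw [h2]; exact Finset.sum_le_sum hfib
    _ = n.factorial * q ^ n * ∑ l ∈ T, ∏ c, w c (l c) := by rw [Finset.mul_sum]
    _ ≤ n.factorial * q ^ n * Real.exp (n * (2 ^ n * (n + 1))) := by gcongr
    _ = _ := by ring

end cntI
end
end HRV
end modH27

section modH28
set_option autoImplicit false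
open scoped MatrixGroups
open Finset

namespace HRV
noncomputable section

section combine
variable {F : Type} [Field F] [Fintype F] [DecidableEq F]

lemma nl_bound {n e : ℕ} (he : 2 ≤ e) (i : Irr (GL (Fin n) F)) (hi : ¬ SLg (Fin n) F ≤ Kr i) :
    ‖hk i‖ ^ e * (Fintype.card F : ℝ) ^ n ≤ 2 ^ e * ((Fintype.card F : ℝ) ^ (n ^ 2)) ^ e := by
  classical
  have hq : (1 : ℝ) < Fintype.card F := by exact_mod_cast Fintype.one_lt_card (α := F)
  obtain ⟨k, hk0, hk1, hk2⟩ := hk_int i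
  have hn : 2 ≤ n := by
    by_contra h
    refine hi fun x hx => ?_
    have hx1 : x = 1 := by
      rw [SLg, MonoidHom.mem_ker] at hx
      have hx2 : (x : Matrix (Fin n) (Fin n) F).det = 1 := congrArg Units.val hx
      have hn' : n = 0 ∨ n = 1 := by omega
      rcases hn' with rfl | rfl
      · exact Subsingleton.elim _ _
      · rw [Matrix.det_fin_one] at hx2
        ext a b
        rw [Subsingleton.elim a 0, Subsingleton.elim b 0, hx2]; simp
    rw [hx1]; exact one_mem _
  have hd : Fintype.card F ^ (n - 1) ≤ dm i + 1 := by
    have := dm_nonlin (F := F) (ι := Fin n) (k := ⟨0, by omega⟩) (l := ⟨1, by omega⟩) (by simp) i hi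
    rwa [Fintype.card_fin] at this
  have hd1 : 1 ≤ dm i := Nat.pos_of_ne_zero (by
    rintro h
    rw [h, Nat.mul_zero] at hk2
    exact Fintype.card_ne_zero hk2.symm)
  have hN := GL_le (F := F) n
  rw [Nat.card_eq_fintype_card, ← hk2] at hN
  push_cast at hN
  have hn1 : ‖hk i‖ = k := by rw [hk1]; simp
  rw [hn1]
  have h1 : (k : ℝ) * (Fintype.card F : ℝ) ^ (n - 1) ≤ 2 * (Fintype.card F : ℝ) ^ (n ^ 2) := by
    have h2 : (Fintype.card F : ℝ) ^ (n - 1) ≤ 2 * dm i := by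
      have : Fintype.card F ^ (n - 1) ≤ 2 * dm i := by omega
      exact_mod_cast this
    have hk' : (0 : ℝ) ≤ k := Nat.cast_nonneg k
    nlinarith [mul_le_mul_of_nonneg_left h2 hk']
  have h3 : n ≤ (n - 1) * e := by
    have : (n - 1) * 2 ≤ (n - 1) * e := Nat.mul_le_mul_left _ he
    omega
  calc (k : ℝ) ^ e * (Fintype.card F : ℝ) ^ n ≤ (k : ℝ) ^ e * (Fintype.card F : ℝ) ^ ((n - 1) * e) := by
        gcongr
        exact hq.le
    _ = ((k : ℝ) * (Fintype.card F : ℝ) ^ (n - 1)) ^ e := by rw [mul_pow, pow_mul]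
    _ ≤ (2 * (Fintype.card F : ℝ) ^ (n ^ 2)) ^ e := by gcongr
    _ = _ := mul_pow _ _ _

/-- the constant -/
def KK (n e : ℕ) : ℝ := n.factorial * Real.exp (n * (2 ^ n * (n + 1))) * 2 ^ e

lemma nl_sum {n e : ℕ} (hn : 0 < n) (hG : Gd F n) (he : 2 ≤ e) {z : Fˣ} (hz : z ^ n = 1) :
    ‖(∑ i : Irr (GL (Fin n) F), hk i ^ e * om i (scal z))
      - ((Fintype.card F : ℂ) - 1) * (Nat.card (GL (Fin n) F) : ℂ) ^ e‖ ≤ KK n e * ((Fintype.card F : ℝ) ^ (n ^ 2)) ^ e := by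
  classical
  haveI : Nonempty (Fin n) := ⟨⟨0, hn⟩⟩
  have hq : (1 : ℝ) < Fintype.card F := by exact_mod_cast Fintype.one_lt_card (α := F)
  have h1 : ∑ i ∈ univ.filter (fun i : Irr (GL (Fin n) F) => SLg (Fin n) F ≤ Kr i), hk i ^ e * om i (scal z)
      = ((Fintype.card F : ℂ) - 1) * (Nat.card (GL (Fin n) F) : ℂ) ^ e := by
    have h2 : ∀ i ∈ univ.filter (fun i : Irr (GL (Fin n) F) => SLg (Fin n) F ≤ Kr i), hk i ^ e * om i (scal z)
        = (Nat.card (GL (Fin n) F) : ℂ) ^ e := by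
      intro i hi
      have hi' := (Finset.mem_filter.mp hi).2
      obtain ⟨k, hk0, hk1, hk2⟩ := hk_int i
      rw [dm_lin hi', mul_one] at hk2
      rw [om_lin hz hi', mul_one, hk1, hk2, Nat.card_eq_fintype_card]
    rw [Finset.sum_congr rfl h2, Finset.sum_const, nsmul_eq_mul]
    congr 1
    have h3 := card_lin (F := F) (ι := Fin n)
    have h4 : (univ.filter (fun i : Irr (GL (Fin n) F) => SLg (Fin n) F ≤ Kr i)).card = Fintype.card F - 1 := by
      rw [← h3]
    rw [h4, Nat.cast_sub Fintype.card_pos, Nat.cast_one]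
  rw [← Finset.sum_filter_add_sum_filter_not univ (fun i : Irr (GL (Fin n) F) => SLg (Fin n) F ≤ Kr i), h1, add_sub_cancel_left]
  set q : ℝ := ((Fintype.card F : ℕ) : ℝ) with hqd
  have hqn : (0 : ℝ) < q ^ n := by positivity
  have h5 : ∀ i ∈ univ.filter (fun i : Irr (GL (Fin n) F) => ¬ SLg (Fin n) F ≤ Kr i),
      ‖hk i ^ e * om i (scal z)‖ ≤ 2 ^ e * (q ^ (n ^ 2)) ^ e / q ^ n := by
    intro i hi
    rw [norm_mul, om_norm hn.ne' hz, mul_one, norm_pow, le_div_iff₀ hqn]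
    exact nl_bound he i (Finset.mem_filter.mp hi).2
  refine (norm_sum_le_of_le _ h5).trans ?_
  rw [Finset.sum_const, nsmul_eq_mul]
  have h6 : ((univ.filter (fun i : Irr (GL (Fin n) F) => ¬ SLg (Fin n) F ≤ Kr i)).card : ℝ) ≤ n.factorial * Real.exp (n * (2 ^ n * (n + 1))) * q ^ n := by
    refine le_trans ?_ (irr_card hn hG)
    rw [Nat.cast_le, ← Finset.card_univ]
    exact Finset.card_le_card (Finset.filter_subset _ _)
  calc _ ≤ n.factorial * Real.exp (n * (2 ^ n * (n + 1))) * q ^ n * (2 ^ e * (q ^ (n ^ 2)) ^ e / q ^ n) := by gcongr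
    _ = _ := by rw [KK]; field_simp

lemma main_bound (n e : ℕ) {q N : ℝ} (hq : 2 ≤ q) (h1 : N ≤ q ^ (n ^ 2)) (h2 : q ^ (n ^ 2) * (1 - 1 / q) ^ n ≤ N) :
    |(q - 1) ^ 2 * N ^ e - q ^ (n ^ 2 * e + 2)| * q ≤ (2 + n * e) * q ^ (n ^ 2 * e + 2) := by
  have hq0 : 0 < q := by linarith
  have hi : 0 < 1 / q := by positivity
  have hi1 : 1 / q ≤ 1 / 2 := one_div_le_one_div_of_le (by norm_num) hq
  have hx : 0 ≤ 1 - 1 / q := by linarith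
  have hN : 0 ≤ N := le_trans (by positivity) h2
  have hup : (q - 1) ^ 2 * N ^ e ≤ q ^ (n ^ 2 * e + 2) := by
    calc (q - 1) ^ 2 * N ^ e ≤ q ^ 2 * (q ^ (n ^ 2)) ^ e := by
          gcongr <;> linarith
      _ = _ := by rw [← pow_mul]; ring
  have hlo : q ^ (n ^ 2 * e + 2) * (1 - (2 + n * e) * (1 / q)) ≤ (q - 1) ^ 2 * N ^ e := by
    have hb := one_add_mul_le_pow (a := -(1 / q)) (by linarith) (2 + n * e)
    push_cast at hb
    calc q ^ (n ^ 2 * e + 2) * (1 - (2 + n * e) * (1 / q)) ≤ q ^ (n ^ 2 * e + 2) * (1 + -(1 / q)) ^ (2 + n * e) := by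
          gcongr; linarith
      _ = (q * (1 - 1 / q)) ^ 2 * (q ^ (n ^ 2) * (1 - 1 / q) ^ n) ^ e := by
          rw [← sub_eq_add_neg, mul_pow, mul_pow, ← pow_mul, ← pow_mul, pow_add, pow_add]; ring
      _ = (q - 1) ^ 2 * (q ^ (n ^ 2) * (1 - 1 / q) ^ n) ^ e := by
          congr 2; field_simp
      _ ≤ _ := by gcongr
  rw [abs_of_nonpos (by linarith)]
  have h3 : -((q - 1) ^ 2 * N ^ e - q ^ (n ^ 2 * e + 2)) ≤ q ^ (n ^ 2 * e + 2) * ((2 + n * e) * (1 / q)) := by linarith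
  calc _ ≤ q ^ (n ^ 2 * e + 2) * ((2 + n * e) * (1 / q)) * q := by gcongr
    _ = _ := by field_simp

end combine

lemma Hyp.lead_big {g n : ℕ} (hg : 2 ≤ g) {P : Polynomial ℚ} (h : Hyp g n P) (hn : 0 < n) :
    P.coeff (n ^ 2 * (2 * g - 2) + 2) = 1 := by
  classical
  refine coeff_lim (h.pal (by omega) hn).1 ((2 + n * (2 * g - 2 : ℕ)) + KK n (2 * g - 2)) fun B => ?_
  obtain ⟨B', hB'⟩ := hC_val n
  obtain ⟨p, hp, hB, z, h1, h2⟩ := h.prime hn (B + B')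
  have hG : Gd (ZMod p) n := hB' (ZMod p) (by rw [ZMod.card]; exact hp.out) (by rw [ZMod.card]; omega)
  refine ⟨p, by omega, ?_⟩
  have hp2 : (2 : ℝ) ≤ p := by exact_mod_cast hp.out.two_le
  set e := 2 * g - 2 with hee
  have he : 2 ≤ e := by omega
  have hz : (z⁻¹) ^ n = 1 := by rw [inv_pow, ← h1, pow_orderOf_eq_one, _root_.inv_one]
  have hf := frobenius (G := GL (Fin n) (ZMod p)) g (by omega) (scal_comm z)
  have hs : (scal z : GL (Fin n) (ZMod p))⁻¹ = scal z⁻¹ := by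
    rw [inv_eq_iff_mul_eq_one, ← scal_mul, mul_inv_cancel, scal_one]
  rw [hs, ← hee] at hf
  have hb := nl_sum hn hG he hz
  set S : ℂ := ∑ i : Irr (GL (Fin n) (ZMod p)), hk i ^ e * om i (scal z⁻¹) with hS
  set N := Nat.card (GL (Fin n) (ZMod p)) with hNd
  have hN0 : (N : ℂ) ≠ 0 := by rw [hNd]; exact_mod_cast Nat.card_pos.ne'
  have hPS : ((P.eval (p : ℚ) : ℚ) : ℂ) = ((p : ℂ) - 1) * S := by
    have h3 : (NS (ZMod p) g n z : ℂ) = N * S := by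
      rw [hNd, Nat.card_eq_fintype_card]; exact hf
    have h4 : (NS (ZMod p) g n z : ℂ) * ((p : ℂ) - 1) = (N : ℂ) * ((P.eval (p : ℚ) : ℚ) : ℂ) := by
      have := congrArg (fun x : ℚ => (x : ℂ)) h2
      push_cast at this
      exact this
    rw [h3] at h4
    apply mul_left_cancel₀ hN0
    rw [← h4]; ring
  rw [ZMod.card] at hb
  have hN1 : (N : ℝ) ≤ (p : ℝ) ^ (n ^ 2) := by
    have := GL_le (F := ZMod p) n
    rw [ZMod.card] at this
    exact this
  have hN2 : (p : ℝ) ^ (n ^ 2) * (1 - 1 / (p : ℝ)) ^ n ≤ N := by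
    have := GL_ge (F := ZMod p) n
    rw [ZMod.card] at this
    exact this
  have hm := main_bound n e hp2 hN1 hN2
  have h5 : |((P.eval (p : ℚ) : ℚ) : ℝ) - ((p : ℝ) - 1) ^ 2 * (N : ℝ) ^ e| ≤ p * (KK n e * ((p : ℝ) ^ (n ^ 2)) ^ e) := by
    have h6 : |((P.eval (p : ℚ) : ℚ) : ℝ) - ((p : ℝ) - 1) ^ 2 * (N : ℝ) ^ e|
        = ‖((p : ℂ) - 1) * (S - ((p : ℂ) - 1) * (N : ℂ) ^ e)‖ := by
      rw [← Real.norm_eq_abs, ← Complex.norm_real]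
      congr 1
      push_cast
      rw [hPS]; ring
    rw [h6, norm_mul]
    have h7 : ‖(p : ℂ) - 1‖ ≤ p := by
      have : (p : ℂ) - 1 = (((p : ℝ) - 1 : ℝ) : ℂ) := by push_cast; rfl
      rw [this, Complex.norm_real, Real.norm_eq_abs, abs_of_nonneg (by linarith)]; linarith
    gcongr
  have h8 : |((P.eval (p : ℚ) : ℚ) : ℝ) - (p : ℝ) ^ (n ^ 2 * e + 2)|
      ≤ |((P.eval (p : ℚ) : ℚ) : ℝ) - ((p : ℝ) - 1) ^ 2 * (N : ℝ) ^ e| + |((p : ℝ) - 1) ^ 2 * (N : ℝ) ^ e - (p : ℝ) ^ (n ^ 2 * e + 2)| :=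
    abs_sub_le _ _ _
  have hp0 : (0 : ℝ) ≤ p := by linarith
  calc _ ≤ (p * (KK n e * ((p : ℝ) ^ (n ^ 2)) ^ e) + |((p : ℝ) - 1) ^ 2 * (N : ℝ) ^ e - (p : ℝ) ^ (n ^ 2 * e + 2)|) * p := by
        gcongr; linarith
    _ = KK n e * (p : ℝ) ^ (n ^ 2 * e + 2) + |((p : ℝ) - 1) ^ 2 * (N : ℝ) ^ e - (p : ℝ) ^ (n ^ 2 * e + 2)| * p := by
        rw [← pow_mul]; ring
    _ ≤ KK n e * (p : ℝ) ^ (n ^ 2 * e + 2) + (2 + n * e) * (p : ℝ) ^ (n ^ 2 * e + 2) := by linarith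
    _ = _ := by ring

lemma Hyp.final {g n : ℕ} (hg : 1 ≤ g) {P : Polynomial ℚ} (h : Hyp g n P) (hn : 0 < n) :
    P.coeff (n ^ 2 * (2 * g - 2) + 2) = 1 := by
  rcases Nat.lt_or_ge 1 g with h1 | h1
  · exact h.lead_big h1 hn
  · obtain rfl : g = 1 := by omega
    exact h.lead_one hn

end
end HRV
end modH28


open scoped MatrixGroups

/-- Let `g ≥ 1`, `n ≥ 1` and `d_n = n²(2g−2)+2`.  If a polynomial
`P ∈ ℚ[X]` counts the `2g`-tuples in `GL(n,F_q)^{2g}` with `[A₁,B₁]⋯[A_g,B_g] = ζ·Iₙ`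
(for some `ζ` of order `n`) as `(|GL(n,F_q)|/(q−1))·P(q)`, for every finite field `F_q`
with `n ∣ q−1`, then `P` has degree `d_n`, leading coefficient `1`, constant coefficient
`1`, and palindromic coefficients: `X^{d_n}·P(1/X) = P(X)`. -/
theorem statement12 (g n : ℕ) (hg : 1 ≤ g) (hn : 1 ≤ n) (P : Polynomial ℚ)
    (hP : ∀ (F : Type) [Field F] [Fintype F], n ∣ Fintype.card F - 1 →
      ∃ ζ : F, orderOf ζ = n ∧
        (Nat.card {p : (Fin g → GL (Fin n) F) × (Fin g → GL (Fin n) F) //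
            (↑((List.ofFn fun i => p.1 i * p.2 i * (p.1 i)⁻¹ * (p.2 i)⁻¹).prod) :
              Matrix (Fin n) (Fin n) F) = ζ • (1 : Matrix (Fin n) (Fin n) F)} : ℚ)
          = (Nat.card (GL (Fin n) F) : ℚ) / ((Fintype.card F : ℚ) - 1)
              * P.eval (Fintype.card F : ℚ)) :
    P.natDegree = n ^ 2 * (2 * g - 2) + 2 ∧
    P.leadingCoeff = 1 ∧
    P.coeff 0 = 1 ∧
    ∀ k ≤ n ^ 2 * (2 * g - 2) + 2,
      P.coeff k = P.coeff (n ^ 2 * (2 * g - 2) + 2 - k) := by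
  exact HRV.Hyp.fin hg (show HRV.Hyp g n P from hP) hn (HRV.Hyp.final hg (show HRV.Hyp g n P from hP) hn)
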